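/- Let p > 2 and α > 0, and let Q(x) = ((p+1)/(2·cosh²(((p−1)/2)·x)))^(1/(p−1)), c_Q = (2p+2)^(1/(p−1)), c₁ = ∫_ℝ (Q')², κ = (c_Q/c₁)·∫_ℝ Q(x)^p·e^(−x) dx. Let u : ℝ × ℝ → ℝ be twice continuously differentiable on [0,∞) × ℝ and satisfy ∂ₜ²u + 2α·∂ₜu − ∂ₓ²u + u − |u|^(p−1)·u = 0 on [0,∞) × ℝ; assume for every t ≥ 0 that x ↦ u(t,x) and all partial derivatives of u of order at most 2 at time t are square-integrable on ℝ, with L² norms bounded on compact time intervals, and that for each fixed t the functions u(t,x), ∂ₜu(t,x), ∂ₓu(t,x) tend to 0 as |x| → ∞. Then exactly one of the following three scenarios occurs. (Vanishing) There exist C, γ > 0 such that for all t ≥ 0, ∫_ℝ ((∂ₓu)² + u² + (∂ₜu)²)(t,x) dx ≤ C·e^(−γt). (Single soliton) There exist σ ∈ {−1,1}, ℓ ∈ ℝ and C, γ > 0 such that for all t ≥ 0, ∫_ℝ ((∂ₓ(u(t,·) − σ·Q(·−ℓ)))² + (u(t,·) − σ·Q(·−ℓ))² + (∂ₜu(t,·))²)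 dx ≤ C·e^(−γt). (Multi-soliton) There exist an integer K ≥ 2, σ ∈ {−1,1}, ℓ ∈ ℝ, functions z₁, …, z_K : [0,∞) → ℝ, and C > 0 such that for all t > 0: ∫_ℝ ((∂ₓ(u(t,·) − σ·Σ_{k=1}^K (−1)^k·Q(·−z_k(t))))² + (u(t,·) − σ·Σ_{k=1}^K (−1)^k·Q(·−z_k(t)))² ) dx + ∫_ℝ (∂ₜu(t,x))² dx ≤ C²·t^(−2); and for every θ with 1 < θ < min(p−1, 5/4) there exists C_θ such that for all k = 1, …, K and all t ≥ 1: |z_k(t) − (k − (K+1)/2)·log t − τ_k − ℓ| ≤ C_θ·t^(−θ+1), where τ₁, …, τ_K are the unique real numbers with Σ_{k=1}^K τ_k = 0 and e^(−(τ_{k+1}−τ_k)) = (2α/κ)·γ_k, γ_k = k·(K−k)/2. -/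

import Mathlib

open MeasureTheory Filter

/-- The ground state of the one-dimensional nonlinear Klein-Gordon equation. -/
noncomputable def Q (p : ℝ) (x : ℝ) : ℝ :=
  ((p + 1) / (2 * Real.cosh ((p - 1) / 2 * x) ^ 2)) ^ (1 / (p - 1))

/-- The constant `c_Q = (2p+2)^(1/(p-1))`. -/
noncomputable def cQ (p : ℝ) : ℝ := (2 * p + 2) ^ (1 / (p - 1))

/-- The constant `c₁ = ∫ (Q')²`. -/
noncomputable def c₁ (p : ℝ) : ℝ := ∫ x : ℝ, deriv (Q p) x ^ 2

/-- The interaction constant `κ = (c_Q/c₁) ∫ Q^p e^{-x}`. -/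
noncomputable def κ (p : ℝ) : ℝ := cQ p / c₁ p * ∫ x : ℝ, Q p x ^ p * Real.exp (-x)

/-- Time derivative `∂ₜ u`. -/
noncomputable def ut (u : ℝ × ℝ → ℝ) (t x : ℝ) : ℝ := deriv (fun s => u (s, x)) t

/-- Second time derivative `∂ₜ² u`. -/
noncomputable def utt (u : ℝ × ℝ → ℝ) (t x : ℝ) : ℝ := deriv (fun s => ut u s x) t

/-- Space derivative `∂ₓ u`. -/
noncomputable def ux (u : ℝ × ℝ → ℝ) (t x : ℝ) : ℝ := deriv (fun y => u (t, y)) x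

/-- Second space derivative `∂ₓ² u`. -/
noncomputable def uxx (u : ℝ × ℝ → ℝ) (t x : ℝ) : ℝ := deriv (fun y => ux u t y) x

/-- Mixed derivative `∂ₓ ∂ₜ u`. -/
noncomputable def utx (u : ℝ × ℝ → ℝ) (t x : ℝ) : ℝ := deriv (fun y => ut u t y) x

/-- Vanishing scenario: exponential convergence to `0` in the energy space. -/
def Vanishing (u : ℝ × ℝ → ℝ) : Prop :=
  ∃ C > (0 : ℝ), ∃ γ > (0 : ℝ), ∀ t ≥ (0 : ℝ),
    (∫ x : ℝ, (ux u t x ^ 2 + u (t, x) ^ 2 + ut u t x ^ 2)) ≤ C * Real.exp (-γ * t)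

/-- Single soliton scenario: exponential convergence to `(σ Q(· - ℓ), 0)`. -/
def SingleSoliton (p : ℝ) (u : ℝ × ℝ → ℝ) : Prop :=
  ∃ σ : ℝ, (σ = 1 ∨ σ = -1) ∧ ∃ ℓ : ℝ, ∃ C > (0 : ℝ), ∃ γ > (0 : ℝ), ∀ t ≥ (0 : ℝ),
    (∫ x : ℝ, ((deriv (fun y => u (t, y) - σ * Q p (y - ℓ)) x) ^ 2 +
        (u (t, x) - σ * Q p (x - ℓ)) ^ 2 + ut u t x ^ 2)) ≤ C * Real.exp (-γ * t)

/-- Multi-soliton scenario: `K ≥ 2` solitary waves with alternate signs, at mutual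
distances of order `log t`. -/
def MultiSoliton (p α : ℝ) (u : ℝ × ℝ → ℝ) : Prop :=
  ∃ K : ℕ, 2 ≤ K ∧ ∃ σ : ℝ, (σ = 1 ∨ σ = -1) ∧ ∃ ℓ : ℝ, ∃ z : ℕ → ℝ → ℝ,
    ∃ C > (0 : ℝ),
      (∀ t : ℝ, 0 < t →
        (∫ x : ℝ,
            ((deriv (fun y => u (t, y) -
                σ * ∑ k ∈ Finset.range K, (-1 : ℝ) ^ (k + 1) * Q p (y - z k t)) x) ^ 2 +
              (u (t, x) -
                σ * ∑ k ∈ Finset.range K, (-1 : ℝ) ^ (k + 1) * Q p (x - z k t)) ^ 2)) +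
          (∫ x : ℝ, ut u t x ^ 2) ≤ C ^ 2 / t ^ 2) ∧
      ∃ τ : Fin K → ℝ,
        (∑ k, τ k = 0) ∧
        (∀ j : ℕ, ∀ h : j + 1 < K,
          Real.exp (-(τ ⟨j + 1, h⟩ - τ ⟨j, by omega⟩)) =
            (2 * α / κ p) * (((j : ℝ) + 1) * ((K : ℝ) - ((j : ℝ) + 1)) / 2)) ∧
        ∀ θ : ℝ, 1 < θ → θ < min (p - 1) (5 / 4) →
          ∃ Cθ : ℝ, ∀ k : ℕ, ∀ h : k < K, ∀ t : ℝ, 1 ≤ t →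
            |z k t - ((k : ℝ) + 1 - ((K : ℝ) + 1) / 2) * Real.log t - τ ⟨k, h⟩ - ℓ|
              ≤ Cθ * t ^ (-θ + 1)

namespace NLKG

open Topology Real Finset

/-- The power nonlinearity `|s|^(p-1) s`. -/
noncomputable def nl (p s : ℝ) : ℝ := |s| ^ (p - 1) * s

/-- The derivative of the nonlinearity. -/
noncomputable def dnl (p s : ℝ) : ℝ := p * |s| ^ (p - 1)

/-- The primitive of the nonlinearity. -/
noncomputable def Fp (p s : ℝ) : ℝ := |s| ^ (p + 1) / (p + 1)

section

variable {p : ℝ}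

lemma hasDerivAt_Fp (hp : 2 < p) (s : ℝ) : HasDerivAt (Fp p) (nl p s) s := by
  have h := (hasDerivAt_abs_rpow s (p := p + 1) (by linarith)).div_const (p + 1)
  refine HasDerivAt.congr_deriv h ?_
  have : p + 1 ≠ 0 := by linarith
  unfold nl
  rw [show p + 1 - 2 = p - 1 by ring]
  field_simp

lemma hasDerivAt_nl (hp : 2 < p) (s : ℝ) : HasDerivAt (nl p) (dnl p s) s := by
  have h := (hasDerivAt_abs_rpow s (p := p - 1) (by linarith)).mul (hasDerivAt_id s)
  refine HasDerivAt.congr_deriv h ?_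
  unfold dnl
  by_cases hs : s = 0
  · subst hs
    simp [zero_rpow (show p - 1 ≠ 0 by linarith)]
  · have h1 : |s| ^ (p - 1) = |s| ^ (p - 1 - 2) * s ^ 2 := by
      rw [← sq_abs s, ← rpow_natCast, ← rpow_add (abs_pos.mpr hs)]
      congr 1; norm_num
    simp only [id]
    rw [h1]; ring

lemma hasDerivAt_dnl (hp : 2 < p) (s : ℝ) :
    HasDerivAt (dnl p) (p * ((p - 1) * |s| ^ (p - 1 - 2) * s)) s :=
  (hasDerivAt_abs_rpow s (p := p - 1) (by linarith)).const_mul p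

lemma continuous_nl (hp : 2 < p) : Continuous (nl p) :=
  continuous_iff_continuousAt.2 fun s => (hasDerivAt_nl hp s).continuousAt

lemma continuous_dnl (hp : 2 < p) : Continuous (dnl p) :=
  continuous_iff_continuousAt.2 fun s => (hasDerivAt_dnl hp s).continuousAt

lemma continuous_Fp (hp : 2 < p) : Continuous (Fp p) :=
  continuous_iff_continuousAt.2 fun s => (hasDerivAt_Fp hp s).continuousAt

lemma dnl_nonneg (hp : 2 < p) (s : ℝ) : 0 ≤ dnl p s := by unfold dnl; positivity

lemma nl_neg (s : ℝ) : nl p (-s) = -nl p s := by simp [nl]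
lemma nl_zero : nl p 0 = 0 := by simp [nl]
lemma dnl_mono (hp : 2 < p) {s M : ℝ} (h : |s| ≤ M) : dnl p s ≤ p * M ^ (p - 1) := by
  unfold dnl
  have := rpow_le_rpow (abs_nonneg s) h (show 0 ≤ p - 1 by linarith)
  nlinarith

lemma dnl_le_lin (hp : 2 < p) {s M : ℝ} (h : |s| ≤ M) : dnl p s ≤ p * M ^ (p - 2) * |s| := by
  unfold dnl
  have := rpow_le_rpow (abs_nonneg s) h (show 0 ≤ p - 2 by linarith)
  have h2 : |s| ^ (p - 1) = |s| ^ (p - 2) * |s| := by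
    rw [← rpow_add_one' (abs_nonneg s) (by linarith)]; congr 1; ring
  rw [h2, ← mul_assoc]
  gcongr

lemma mvt_abs {g g' : ℝ → ℝ} (hg : ∀ s, HasDerivAt g (g' s) s) {a b C : ℝ} {M : ℝ}
    (hC : ∀ s, |s| ≤ M → |g' s| ≤ C) (ha : |a| ≤ M) (hb : |b| ≤ M) :
    |g b - g a| ≤ C * |b - a| := by
  have := (convex_Icc (-M) M).norm_image_sub_le_of_norm_hasDerivWithin_le
    (f := g) (f' := g') (C := C) (fun x _ => (hg x).hasDerivWithinAt)
    (fun x hx => hC x (abs_le.2 hx)) (abs_le.1 ha) (abs_le.1 hb)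
  simpa [norm_eq_abs] using this

lemma dnl_lip (hp : 2 < p) {a b M : ℝ} (ha : |a| ≤ M) (hb : |b| ≤ M) :
    |dnl p b - dnl p a| ≤ p * (p - 1) * M ^ (p - 2) * |b - a| := by
  refine mvt_abs (hasDerivAt_dnl hp) (fun s hs => ?_) ha hb
  have h2 : |s| ^ (p - 2) = |s| ^ (p - 1 - 2) * |s| := by
    rw [← rpow_add_one' (abs_nonneg s) (by linarith)]; congr 1; ring
  have := rpow_le_rpow (abs_nonneg s) hs (show 0 ≤ p - 2 by linarith)
  rw [abs_mul, abs_mul, abs_mul, abs_of_pos (show 0 < p by linarith),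
    abs_of_pos (show 0 < p - 1 by linarith), abs_of_nonneg (by positivity), mul_assoc (p - 1), ← h2,
    ← mul_assoc]
  have : 0 ≤ p * (p - 1) := by nlinarith
  gcongr

lemma nl_lip (hp : 2 < p) {a b M : ℝ} (ha : |a| ≤ M) (hb : |b| ≤ M) :
    |nl p b - nl p a| ≤ p * M ^ (p - 1) * |b - a| :=
  mvt_abs (hasDerivAt_nl hp)
    (fun s hs => by rw [abs_of_nonneg (dnl_nonneg hp s)]; exact dnl_mono hp hs) ha hb

/-- Second-order Taylor bound from a Lipschitz bound on the derivative. -/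
lemma taylor_quad {g g' : ℝ → ℝ} (hg : ∀ s, HasDerivAt g (g' s) s) {a b C M : ℝ}
    (hC : ∀ s r, |s| ≤ M → |r| ≤ M → |g' s - g' r| ≤ C * |s - r|) (hC0 : 0 ≤ C)
    (ha : |a| ≤ M) (hb : |a + b| ≤ M) : |g (a + b) - g a - g' a * b| ≤ C * b ^ 2 := by
  have key := (convex_uIcc a (a + b)).norm_image_sub_le_of_norm_hasDerivWithin_le
    (f := fun s => g s - g' a * s) (f' := fun s => g' s - g' a) (C := C * |b|)
    (fun x _ => by
      have := ((hg x).sub ((hasDerivAt_id x).const_mul (g' a))).hasDerivWithinAt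
        (s := Set.uIcc a (a + b))
      rw [mul_one] at this
      exact this)
    (fun x hx => by
      have hx2 : |x| ≤ M := by
        rw [abs_le] at *
        rcases Set.mem_uIcc.1 hx with h | h <;> constructor <;> linarith
      refine (hC x a hx2 ha).trans ?_
      have : |x - a| ≤ |b| := by
        have := Set.abs_sub_left_of_mem_uIcc hx
        simpa using this
      gcongr)
    (Set.left_mem_uIcc) (Set.right_mem_uIcc)
  simp only [norm_eq_abs] at key
  calc |g (a + b) - g a - g' a * b| = |g (a + b) - g' a * (a + b) - (g a - g' a * a)| := by
        congr 1; ring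
    _ ≤ C * |b| * |a + b - a| := key
    _ = C * b ^ 2 := by rw [add_sub_cancel_left, mul_assoc, ← sq, sq_abs]

lemma nl_quad (hp : 2 < p) {a b M : ℝ} (ha : |a| ≤ M) (hb : |a + b| ≤ M) :
    |nl p (a + b) - nl p a - dnl p a * b| ≤ p * (p - 1) * M ^ (p - 2) * b ^ 2 :=
  taylor_quad (hasDerivAt_nl hp) (fun _ _ hs hr => dnl_lip hp hr hs)
    (by have : 0 ≤ M := (abs_nonneg a).trans ha
        have : 0 ≤ p * (p - 1) := by nlinarith
        positivity) ha hb

lemma Fp_quad (hp : 2 < p) {a b M : ℝ} (ha : |a| ≤ M) (hb : |a + b| ≤ M) :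
    |Fp p (a + b) - Fp p a - nl p a * b| ≤ p * M ^ (p - 1) * b ^ 2 :=
  taylor_quad (hasDerivAt_Fp hp) (fun _ _ hs hr => nl_lip hp hr hs)
    (by have : 0 ≤ M := (abs_nonneg a).trans ha
        positivity) ha hb

lemma abs_nl (hp : 2 < p) (s : ℝ) : |nl p s| = |s| ^ p := by
  unfold nl
  rw [abs_mul, abs_of_nonneg (by positivity), ← rpow_add_one' (abs_nonneg s) (by linarith)]
  congr 1; ring

lemma abs_nl_le (hp : 2 < p) {s M : ℝ} (h : |s| ≤ M) : |nl p s| ≤ M ^ (p - 1) * |s| := by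
  unfold nl
  rw [abs_mul, abs_of_nonneg (by positivity)]
  have := rpow_le_rpow (abs_nonneg s) h (show 0 ≤ p - 1 by linarith)
  gcongr

lemma abs_nl_le_sq (hp : 2 < p) {s M : ℝ} (h : |s| ≤ M) : |nl p s| ≤ M ^ (p - 2) * s ^ 2 := by
  rw [abs_nl hp]
  have := rpow_le_rpow (abs_nonneg s) h (show 0 ≤ p - 2 by linarith)
  have h2 : |s| ^ p = |s| ^ (p - 2) * |s| ^ 2 := by
    rw [← rpow_natCast, ← rpow_add' (abs_nonneg s) (by norm_num; linarith)]
    congr 1; norm_num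
  rw [h2, sq_abs]
  gcongr

lemma Fp_nonneg (hp : 2 < p) (s : ℝ) : 0 ≤ Fp p s := by
  unfold Fp; have : 0 < p + 1 := by linarith
  positivity

lemma Fp_mul (hp : 2 < p) (s : ℝ) : (p + 1) * Fp p s = nl p s * s := by
  unfold Fp nl
  have : p + 1 ≠ 0 := by linarith
  rw [mul_div_cancel₀ _ this, mul_assoc, ← sq, ← sq_abs s, ← rpow_natCast,
    ← rpow_add' (abs_nonneg s) (by norm_num; linarith)]
  congr 1; norm_num; ring

lemma Fp_le (hp : 2 < p) {s M : ℝ} (h : |s| ≤ M) : Fp p s ≤ M ^ (p - 1) * s ^ 2 := by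
  have h1 := Fp_mul hp s
  have h2 := abs_nl_le hp h
  have h3 : nl p s * s ≤ M ^ (p - 1) * s ^ 2 := by
    calc nl p s * s ≤ |nl p s * s| := le_abs_self _
      _ = |nl p s| * |s| := abs_mul _ _
      _ ≤ M ^ (p - 1) * |s| * |s| := by gcongr
      _ = _ := by rw [mul_assoc, ← sq, sq_abs]
  have := Fp_nonneg hp s
  nlinarith

lemma nl_triple (hp : 2 < p) {M : ℝ} (hM : 0 ≤ M) : ∃ C, 0 ≤ C ∧ ∀ a b, |a| ≤ M → |b| ≤ M →
    |nl p (a + b) - nl p a - nl p b - dnl p a * b| ≤ C * |b| * min |a| |b| := by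
  set c := (2 * M) ^ (p - 2) with hc
  have hc0 : 0 ≤ c := by positivity
  have hpp : 0 < p * (p - 1) := by nlinarith
  refine ⟨4 * (p * (p - 1) * c + p * c + c), by positivity, fun a b ha hb => ?_⟩
  have ha2 : |a| ≤ 2 * M := by linarith
  have hb2 : |b| ≤ 2 * M := by linarith
  have hab : |a + b| ≤ 2 * M := (abs_add_le a b).trans (by linarith)
  have t0 : ∀ x y z w : ℝ, |x - y - z - w| ≤ |x - y - w| + |z| := fun x y z w => by
    rw [show x - y - z - w = (x - y - w) - z by ring]; exact abs_sub _ _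
  have hp0 : 0 < p := by linarith
  rcases le_total |b| |a| with h | h
  · rw [min_eq_right h]
    have h1 := nl_quad hp ha2 hab
    have h2 := abs_nl_le_sq hp hb2
    refine (t0 _ _ _ _).trans ?_
    have h3 : 4 * (p * (p - 1) * c + p * c + c) * |b| * |b|
      = 4 * (p * (p - 1) * c + p * c + c) * b ^ 2 := by rw [mul_assoc, ← sq, sq_abs]
    rw [h3]
    have : 0 ≤ b ^ 2 := sq_nonneg b
    have e1 : 0 ≤ p * (p - 1) * c * b ^ 2 := by positivity
    have e2 : 0 ≤ p * c * b ^ 2 := by positivity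
    have e3 : 0 ≤ c * b ^ 2 := by positivity
    nlinarith
  · rw [min_eq_left h]
    have h1 : |nl p (a + b) - nl p b| ≤ p * c * (2 * |b|) * |a| := by
      have := mvt_abs (hasDerivAt_nl hp) (a := b) (b := a + b) (C := p * c * (2 * |b|))
        (M := 2 * |b|) (fun s hs => by
          rw [abs_of_nonneg (dnl_nonneg hp s)]
          refine (dnl_le_lin hp (hs.trans (show 2 * |b| ≤ 2 * M by linarith))).trans ?_
          gcongr) (by linarith [abs_nonneg b]) ((abs_add_le a b).trans (by linarith))
      simpa using this
    have h2 : |nl p a| ≤ c * |a| * |b| := by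
      refine (abs_nl_le_sq hp ha2).trans ?_
      rw [← sq_abs, sq, mul_assoc]; gcongr
    have h3 : |dnl p a * b| ≤ p * c * |a| * |b| := by
      rw [abs_mul, abs_of_nonneg (dnl_nonneg hp a)]
      gcongr; exact dnl_le_lin hp ha2
    have h4 : |nl p (a + b) - nl p a - nl p b - dnl p a * b|
        ≤ |nl p (a + b) - nl p b| + |nl p a| + |dnl p a * b| := by
      rw [show nl p (a + b) - nl p a - nl p b - dnl p a * b
        = (nl p (a + b) - nl p b) - nl p a - dnl p a * b by ring]
      exact (abs_sub _ _).trans (by gcongr; exact abs_sub _ _)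
    have e0 : 0 ≤ |a| * |b| := by positivity
    have e1 : 0 ≤ p * (p - 1) * c * (|a| * |b|) := by positivity
    have e2 : 0 ≤ p * c * (|a| * |b|) := by positivity
    have e3 : 0 ≤ c * (|a| * |b|) := by positivity
    nlinarith

end

/-- Continuous square-integrable functions on the line. -/
structure L2c (a : ℝ → ℝ) : Prop where
  cont : Continuous a
  int : Integrable (fun x => a x ^ 2)

section

variable {a b a' b' : ℝ → ℝ}

lemma integral_sq_nonneg (a : ℝ → ℝ) : 0 ≤ ∫ x, a x ^ 2 := integral_nonneg fun x => sq_nonneg (a x)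

namespace L2c

lemma of_bound (ha : L2c a) (hb : Continuous b) {C : ℝ} (h : ∀ x, |b x| ≤ C * |a x|) : L2c b := by
  refine ⟨hb, (ha.int.const_mul (C ^ 2)).mono' (hb.pow 2).aestronglyMeasurable ?_⟩
  refine Eventually.of_forall fun x => ?_
  rw [norm_eq_abs, abs_of_nonneg (sq_nonneg _), ← sq_abs, ← sq_abs (a x), ← mul_pow]
  exact pow_le_pow_left₀ (abs_nonneg _) (h x) 2

lemma integral_le_of_bound (ha : L2c a) (hb : Continuous b) {C : ℝ} (h : ∀ x, |b x| ≤ C * |a x|) :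
    ∫ x, b x ^ 2 ≤ C ^ 2 * ∫ x, a x ^ 2 := by
  rw [← integral_const_mul]
  refine integral_mono (ha.of_bound hb h).int (ha.int.const_mul _) fun x => ?_
  simp only
  rw [← sq_abs, ← sq_abs (a x), ← mul_pow]
  exact pow_le_pow_left₀ (abs_nonneg _) (h x) 2

lemma mul_int (ha : L2c a) (hb : L2c b) : Integrable (fun x => a x * b x) := by
  refine (ha.int.add hb.int).mono' (ha.cont.mul hb.cont).aestronglyMeasurable ?_
  refine Eventually.of_forall fun x => ?_
  simp only [Pi.add_apply, norm_eq_abs, abs_mul]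
  nlinarith [sq_nonneg (|a x| - |b x|), sq_abs (a x), sq_abs (b x), sq_nonneg (a x), sq_nonneg (b x)]

lemma add (ha : L2c a) (hb : L2c b) : L2c (fun x => a x + b x) := by
  refine ⟨ha.cont.add hb.cont, ?_⟩
  have := (ha.int.add hb.int).add ((ha.mul_int hb).const_mul 2)
  refine this.congr (Eventually.of_forall fun x => ?_)
  simp only [Pi.add_apply]; ring

lemma const_mul (ha : L2c a) (c : ℝ) : L2c (fun x => c * a x) :=
  ha.of_bound (ha.cont.const_mul c) (C := |c|) fun x => by rw [abs_mul]

lemma neg (ha : L2c a) : L2c (fun x => -a x) := ha.of_bound ha.cont.neg (C := 1) fun x => by simp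

lemma sub (ha : L2c a) (hb : L2c b) : L2c (fun x => a x - b x) := by
  simpa [sub_eq_add_neg] using ha.add hb.neg

lemma zero : L2c (fun _ => (0 : ℝ)) := ⟨continuous_const, by simp⟩

lemma sum {ι : Type*} (s : Finset ι) {f : ι → ℝ → ℝ} (h : ∀ i ∈ s, L2c (f i)) :
    L2c (fun x => ∑ i ∈ s, f i x) := by
  classical
  induction s using Finset.induction_on with
  | empty => simpa using zero
  | insert i s hi ih =>
    simp only [sum_insert hi]
    exact (h i (by simp)).add (ih fun j hj => h j (by simp [hj]))

lemma bdd_mul (ha : L2c a) (hb : Continuous b) {C : ℝ} (h : ∀ x, |b x| ≤ C) :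
    L2c (fun x => b x * a x) :=
  ha.of_bound (hb.mul ha.cont) (C := C) fun x => by rw [abs_mul]; gcongr; exact h x

lemma abs (ha : L2c a) : L2c (fun x => |a x|) := ha.of_bound ha.cont.abs (C := 1) fun x => by simp

lemma comp_sub (ha : L2c a) (z : ℝ) : L2c (fun x => a (x - z)) :=
  ⟨ha.cont.comp (continuous_id.sub continuous_const), ha.int.comp_sub_right z⟩

lemma young (ha : L2c a) (hb : L2c b) {r : ℝ} (hr : 0 < r) :
    2 * |∫ x, a x * b x| ≤ r * (∫ x, a x ^ 2) + r⁻¹ * ∫ x, b x ^ 2 := by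
  have h1 : |∫ x, a x * b x| ≤ ∫ x, |a x * b x| := abs_integral_le_integral_abs
  have h2 : 2 * ∫ x, |a x * b x| ≤ r * (∫ x, a x ^ 2) + r⁻¹ * ∫ x, b x ^ 2 := by
    rw [← integral_const_mul, ← integral_const_mul, ← integral_const_mul, ← integral_add
      (ha.int.const_mul _) (hb.int.const_mul _)]
    refine integral_mono ((ha.mul_int hb).abs.const_mul _)
      ((ha.int.const_mul _).add (hb.int.const_mul _)) fun x => ?_
    simp only
    rw [abs_mul, ← sq_abs (a x), ← sq_abs (b x)]
    have : 0 ≤ r⁻¹ * (r * |a x| - |b x|) ^ 2 := by positivity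
    have e : r⁻¹ * (r * |a x| - |b x|) ^ 2
        = r * |a x| ^ 2 + r⁻¹ * |b x| ^ 2 - 2 * (|a x| * |b x|) := by
      field_simp
      ring
    linarith
  linarith

lemma cs (ha : L2c a) (hb : L2c b) : (∫ x, a x * b x) ^ 2 ≤ (∫ x, a x ^ 2) * ∫ x, b x ^ 2 := by
  have h : ∀ r : ℝ, 0 ≤ (∫ x, a x ^ 2) * (r * r) + (2 * ∫ x, a x * b x) * r + ∫ x, b x ^ 2 := by
    intro r
    have := integral_sq_nonneg (fun x => r * a x + b x)
    have e : ∫ x, (r * a x + b x) ^ 2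
        = (∫ x, a x ^ 2) * (r * r) + (2 * ∫ x, a x * b x) * r + ∫ x, b x ^ 2 := by
      have : ∀ x, (r * a x + b x) ^ 2 = (r * r) * a x ^ 2 + (2 * r) * (a x * b x) + b x ^ 2 :=
        fun x => by ring
      simp_rw [this]
      rw [integral_add (by exact (ha.int.const_mul _).add ((ha.mul_int hb).const_mul _)) hb.int,
        integral_add (ha.int.const_mul _) ((ha.mul_int hb).const_mul _), integral_const_mul,
        integral_const_mul]
      ring
    linarith
  have := discrim_le_zero h
  unfold discrim at this
  nlinarith

lemma abs_integral_mul_le (ha : L2c a) (hb : L2c b) :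
    |∫ x, a x * b x| ≤ √(∫ x, a x ^ 2) * √(∫ x, b x ^ 2) := by
  rw [← sqrt_mul (integral_sq_nonneg a), ← sqrt_sq_eq_abs]
  exact sqrt_le_sqrt (ha.cs hb)

lemma integral_abs_mul_le (ha : L2c a) (hb : L2c b) :
    ∫ x, |a x * b x| ≤ √(∫ x, a x ^ 2) * √(∫ x, b x ^ 2) := by
  have := ha.abs.abs_integral_mul_le hb.abs
  simp only [sq_abs] at this
  simp_rw [abs_mul]
  exact (le_abs_self _).trans this

lemma integral_add_sq_le (ha : L2c a) (hb : L2c b) :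
    ∫ x, (a x + b x) ^ 2 ≤ 2 * (∫ x, a x ^ 2) + 2 * ∫ x, b x ^ 2 := by
  rw [← integral_const_mul, ← integral_const_mul, ← integral_add (ha.int.const_mul _)
    (hb.int.const_mul _)]
  refine integral_mono (ha.add hb).int ((ha.int.const_mul _).add (hb.int.const_mul _)) fun x => ?_
  simp only
  nlinarith [sq_nonneg (a x - b x)]

lemma integral_sub_sq_le (ha : L2c a) (hb : L2c b) :
    ∫ x, (a x - b x) ^ 2 ≤ 2 * (∫ x, a x ^ 2) + 2 * ∫ x, b x ^ 2 := by
  simpa [sub_eq_add_neg] using ha.integral_add_sq_le hb.neg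

lemma integral_sum_sq_le {ι : Type*} (s : Finset ι) {f : ι → ℝ → ℝ} (h : ∀ i ∈ s, L2c (f i)) :
    ∫ x, (∑ i ∈ s, f i x) ^ 2 ≤ s.card * ∑ i ∈ s, ∫ x, f i x ^ 2 := by
  rw [← integral_finsetSum _ (fun i hi => (h i hi).int), ← integral_const_mul]
  refine integral_mono (L2c.sum s h).int
    ((integrable_finsetSum _ fun i hi => (h i hi).int).const_mul _) fun x => ?_
  exact sq_sum_le_card_mul_sum_sq

/-- Integration by parts on the line. -/
lemma ibp (ha : L2c a) (ha' : L2c a') (hb : L2c b) (hb' : L2c b')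
    (hda : ∀ x, HasDerivAt a (a' x) x) (hdb : ∀ x, HasDerivAt b (b' x) x) :
    ∫ x, a x * b' x = -∫ x, a' x * b x :=
  integral_mul_deriv_eq_deriv_mul_of_integrable (fun x _ => hda x) (fun x _ => hdb x) (ha.mul_int hb') (ha'.mul_int hb)
    (ha.mul_int hb)

end L2c

lemma integral_comp_sub (a : ℝ → ℝ) (z : ℝ) : ∫ x, a (x - z) = ∫ x, a x :=
  integral_sub_right_eq_self a z

/-- An integrable function with integrable derivative is bounded by half the integral of its
derivative. -/
lemma two_mul_abs_le_integral {g g' : ℝ → ℝ} (hd : ∀ x, HasDerivAt g (g' x) x)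
    (hg : Integrable g) (hg' : Integrable g') (x : ℝ) : 2 * |g x| ≤ ∫ y, |g' y| := by
  have t1 : Tendsto g atTop (nhds 0) := tendsto_zero_of_hasDerivAt_of_integrableOn_Ioi (a := x)
    (fun y _ => hd y) hg'.integrableOn hg.integrableOn
  have t2 : Tendsto g atBot (nhds 0) := tendsto_zero_of_hasDerivAt_of_integrableOn_Iic (a := x)
    (fun y _ => hd y) hg'.integrableOn hg.integrableOn
  have e1 := integral_Ioi_of_hasDerivAt_of_tendsto' (a := x) (fun y _ => hd y) hg'.integrableOn t1
  have e2 := integral_Iic_of_hasDerivAt_of_tendsto' (a := x) (fun y _ => hd y) hg'.integrableOn t2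
  have e3 := intervalIntegral.integral_Iic_add_Ioi (b := x) hg'.abs.integrableOn
    hg'.abs.integrableOn
  have b1 : |∫ y in Set.Ioi x, g' y| ≤ ∫ y in Set.Ioi x, |g' y| := abs_integral_le_integral_abs
  have b2 : |∫ y in Set.Iic x, g' y| ≤ ∫ y in Set.Iic x, |g' y| := abs_integral_le_integral_abs
  rw [e1] at b1; rw [e2] at b2
  simp only [zero_sub, sub_zero, abs_neg] at b1 b2
  linarith

namespace L2c

lemma sq_le_integral_abs (ha : L2c a) (ha' : L2c a') (hd : ∀ x, HasDerivAt a (a' x) x) (x : ℝ) :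
    a x ^ 2 ≤ ∫ y, |a y * a' y| := by
  have h2 : ∀ x, HasDerivAt (fun x => a x ^ 2) (2 * (a x * a' x)) x := fun x => by
    refine ((hd x).pow 2).congr_deriv ?_
    norm_num; ring
  have := two_mul_abs_le_integral h2 ha.int ((ha.mul_int ha').const_mul 2) x
  simp_rw [abs_mul (2:ℝ), abs_two] at this
  rw [integral_const_mul, abs_of_nonneg (sq_nonneg _)] at this
  linarith

/-- One-dimensional Sobolev inequality. -/
lemma sq_le (ha : L2c a) (ha' : L2c a') (hd : ∀ x, HasDerivAt a (a' x) x) (x : ℝ) :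
    a x ^ 2 ≤ (∫ y, a y ^ 2) + ∫ y, a' y ^ 2 := by
  have h1 := ha.sq_le_integral_abs ha' hd x
  have h2 : ∫ y, |a y * a' y| ≤ (∫ y, a y ^ 2) + ∫ y, a' y ^ 2 := by
    have := ha.abs.young ha'.abs one_pos
    simp only [sq_abs, inv_one, one_mul] at this
    simp_rw [abs_mul]
    have h0 := le_abs_self (∫ y, |a y| * |a' y|)
    have := integral_sq_nonneg a
    have := integral_sq_nonneg a'
    linarith
  linarith

end L2c

end

/-- Time-dependent functions on the line, defined for times larger than `τ`, which are `C¹` in time,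
bounded and square-integrable together with their time derivative, locally uniformly in time. -/
structure TF (τ : ℝ) (a a' : ℝ → ℝ → ℝ) : Prop where
  cont : ContinuousOn (fun q : ℝ × ℝ => a q.1 q.2) (Set.Ioi τ ×ˢ Set.univ)
  cont' : ContinuousOn (fun q : ℝ × ℝ => a' q.1 q.2) (Set.Ioi τ ×ˢ Set.univ)
  deriv : ∀ t, τ < t → ∀ x, HasDerivAt (fun s => a s x) (a' t x) t
  int : ∀ t, τ < t → Integrable (fun x => a t x ^ 2)
  int' : ∀ t, τ < t → Integrable (fun x => a' t x ^ 2)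
  bd : ∀ s T, τ < s → ∃ B, ∀ t, s ≤ t → t ≤ T → (∀ x, |a t x| ≤ B) ∧
    (∫ x, a t x ^ 2) ≤ B ∧ (∫ x, a' t x ^ 2) ≤ B

lemma continuous_slice {τ : ℝ} {a : ℝ → ℝ → ℝ}
    (h : ContinuousOn (fun q : ℝ × ℝ => a q.1 q.2) (Set.Ioi τ ×ˢ Set.univ)) {t : ℝ} (ht : τ < t) :
    Continuous (a t) := by
  have : ContinuousOn (fun x : ℝ => a t x) Set.univ :=
    h.comp (f := fun x : ℝ => (t, x)) (by fun_prop) fun x _ => ⟨ht, trivial⟩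
  exact continuousOn_univ.1 this

lemma continuousOn_time_slice {τ : ℝ} {a : ℝ → ℝ → ℝ}
    (h : ContinuousOn (fun q : ℝ × ℝ => a q.1 q.2) (Set.Ioi τ ×ˢ Set.univ)) (x : ℝ) :
    ContinuousOn (fun t => a t x) (Set.Ioi τ) :=
  h.comp (f := fun t : ℝ => (t, x)) (by fun_prop) fun t ht => ⟨ht, trivial⟩

/-- Integrated Leibniz rule. -/
lemma integral_sub_eq {τ : ℝ} {g g' : ℝ → ℝ → ℝ}
    (hd : ∀ t, τ < t → ∀ x, HasDerivAt (fun s => g s x) (g' t x) t)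
    (hc' : ContinuousOn (fun q : ℝ × ℝ => g' q.1 q.2) (Set.Ioi τ ×ˢ Set.univ))
    (hi : ∀ t, τ < t → Integrable (g t)) (hi' : ∀ t, τ < t → Integrable (g' t))
    {s t B : ℝ} (hs : τ < s) (hst : s ≤ t)
    (hB : ∀ r, s ≤ r → r ≤ t → ∫ x, |g' r x| ≤ B) :
    IntervalIntegrable (fun r => ∫ x, g' r x) volume s t ∧
    (∫ x, g t x) - ∫ x, g s x = ∫ r in s..t, ∫ x, g' r x := by
  have hm : AEStronglyMeasurable (fun q : ℝ × ℝ => g' q.1 q.2)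
      ((volume.restrict (Set.Ioc s t)).prod volume) := by
    have : ((volume : Measure ℝ).restrict (Set.Ioc s t)).prod (volume : Measure ℝ)
        = (volume.prod volume).restrict (Set.Ioc s t ×ˢ Set.univ) := by
      rw [← Measure.prod_restrict, Measure.restrict_univ]
    rw [this]
    refine ContinuousOn.aestronglyMeasurable (hc'.mono ?_)
      (measurableSet_Ioc.prod MeasurableSet.univ)
    rintro ⟨r, x⟩ ⟨hr, _⟩
    exact ⟨lt_trans hs hr.1, trivial⟩
  have hae : ∀ᵐ r ∂((volume : Measure ℝ).restrict (Set.Ioc s t)), r ∈ Set.Ioc s t :=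
    ae_restrict_mem measurableSet_Ioc
  have hint : Integrable (fun q : ℝ × ℝ => g' q.1 q.2)
      ((volume.restrict (Set.Ioc s t)).prod volume) := by
    rw [integrable_prod_iff hm]
    refine ⟨hae.mono fun r hr => hi' r (lt_trans hs hr.1), ?_⟩
    refine Integrable.mono' (g := fun _ => B) (integrable_const B) hm.norm.integral_prod_right' ?_
    refine hae.mono fun r hr => ?_
    rw [norm_eq_abs, abs_of_nonneg (integral_nonneg fun x => norm_nonneg _)]
    exact hB r hr.1.le hr.2
  have h1 : Integrable (fun r => ∫ x, g' r x) (volume.restrict (Set.Ioc s t)) :=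
    hint.integral_prod_left
  refine ⟨(intervalIntegrable_iff_integrableOn_Ioc_of_le hst).2 h1, ?_⟩
  rw [← integral_sub (hi t (lt_of_lt_of_le hs hst)) (hi s hs),
    intervalIntegral.integral_of_le hst, integral_integral_swap hint]
  refine integral_congr_ae (Eventually.of_forall fun x => ?_)
  simp only
  rw [← intervalIntegral.integral_of_le hst]
  refine (intervalIntegral.integral_eq_sub_of_hasDerivAt (f := fun r => g r x)
    (f' := fun r => g' r x) ?_ ?_).symm
  · intro r hr
    rw [Set.uIcc_of_le hst] at hr
    exact hd r (lt_of_lt_of_le hs hr.1) x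
  · refine ContinuousOn.intervalIntegrable ?_
    refine (continuousOn_time_slice hc' x).mono fun r hr => ?_
    rw [Set.uIcc_of_le hst] at hr
    exact lt_of_lt_of_le hs hr.1

namespace TF

variable {τ : ℝ} {a a' b b' : ℝ → ℝ → ℝ}

lemma l2 (ha : TF τ a a') {t : ℝ} (ht : τ < t) : L2c (a t) :=
  ⟨continuous_slice ha.cont ht, ha.int t ht⟩

lemma l2' (ha : TF τ a a') {t : ℝ} (ht : τ < t) : L2c (a' t) :=
  ⟨continuous_slice ha.cont' ht, ha.int' t ht⟩

lemma congr {a₁ a₁' : ℝ → ℝ → ℝ} (ha : TF τ a a') (h : ∀ t, τ < t → ∀ x, a₁ t x = a t x)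
    (h' : ∀ t, τ < t → ∀ x, a₁' t x = a' t x) : TF τ a₁ a₁' where
  cont := ha.cont.congr fun q hq => h q.1 hq.1 q.2
  cont' := ha.cont'.congr fun q hq => h' q.1 hq.1 q.2
  deriv t ht x := by
    rw [h' t ht]
    refine (ha.deriv t ht x).congr_of_eventuallyEq ?_
    filter_upwards [lt_mem_nhds ht] with s hs using h s hs x
  int t ht := by simpa only [h t ht] using ha.int t ht
  int' t ht := by simpa only [h' t ht] using ha.int' t ht
  bd s T hs := by
    obtain ⟨B, hB⟩ := ha.bd s T hs
    refine ⟨B, fun t h1 h2 => ?_⟩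
    simpa only [h t (hs.trans_le h1), h' t (hs.trans_le h1)] using hB t h1 h2

lemma mono (ha : TF τ a a') {τ' : ℝ} (h : τ ≤ τ') : TF τ' a a' where
  cont := ha.cont.mono (Set.prod_mono (Set.Ioi_subset_Ioi h) le_rfl)
  cont' := ha.cont'.mono (Set.prod_mono (Set.Ioi_subset_Ioi h) le_rfl)
  deriv t ht := ha.deriv t (h.trans_lt ht)
  int t ht := ha.int t (h.trans_lt ht)
  int' t ht := ha.int' t (h.trans_lt ht)
  bd s T hs := ha.bd s T (h.trans_lt hs)

lemma add (ha : TF τ a a') (hb : TF τ b b') :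
    TF τ (fun t x => a t x + b t x) (fun t x => a' t x + b' t x) where
  cont := ha.cont.add hb.cont
  cont' := ha.cont'.add hb.cont'
  deriv t ht x := (ha.deriv t ht x).add (hb.deriv t ht x)
  int t ht := ((ha.l2 ht).add (hb.l2 ht)).int
  int' t ht := ((ha.l2' ht).add (hb.l2' ht)).int
  bd s T hs := by
    obtain ⟨A, hA⟩ := ha.bd s T hs
    obtain ⟨B, hB⟩ := hb.bd s T hs
    refine ⟨A + B + 2 * |A| + 2 * |B|, fun t h1 h2 => ?_⟩
    have ht := hs.trans_le h1
    obtain ⟨a1, a2, a3⟩ := hA t h1 h2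
    obtain ⟨b1, b2, b3⟩ := hB t h1 h2
    have k1 := (ha.l2 ht).integral_add_sq_le (hb.l2 ht)
    have k2 := (ha.l2' ht).integral_add_sq_le (hb.l2' ht)
    have := le_abs_self A
    have := le_abs_self B
    have := (abs_nonneg _).trans (a1 0)
    have := (abs_nonneg _).trans (b1 0)
    refine ⟨fun x => ?_, by linarith, by linarith⟩
    have := abs_add_le (a t x) (b t x)
    have := a1 x
    have := b1 x
    linarith

lemma const_mul (ha : TF τ a a') (c : ℝ) : TF τ (fun t x => c * a t x) (fun t x => c * a' t x) where
  cont := ha.cont.const_mul c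
  cont' := ha.cont'.const_mul c
  deriv t ht x := (ha.deriv t ht x).const_mul c
  int t ht := ((ha.l2 ht).const_mul c).int
  int' t ht := ((ha.l2' ht).const_mul c).int
  bd s T hs := by
    obtain ⟨A, hA⟩ := ha.bd s T hs
    refine ⟨|c| * A + c ^ 2 * A, fun t h1 h2 => ?_⟩
    obtain ⟨a1, a2, a3⟩ := hA t h1 h2
    have h0 := (abs_nonneg _).trans (a1 0)
    have : 0 ≤ |c| * A := by positivity
    have : 0 ≤ c ^ 2 * A := by positivity
    refine ⟨fun x => ?_, ?_, ?_⟩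
    · rw [abs_mul]
      have := mul_le_mul_of_nonneg_left (a1 x) (abs_nonneg c)
      linarith
    · simp_rw [mul_pow]
      rw [integral_const_mul]
      have := mul_le_mul_of_nonneg_left a2 (sq_nonneg c)
      linarith
    · simp_rw [mul_pow]
      rw [integral_const_mul]
      have := mul_le_mul_of_nonneg_left a3 (sq_nonneg c)
      linarith

lemma neg (ha : TF τ a a') : TF τ (fun t x => -a t x) (fun t x => -a' t x) :=
  (ha.const_mul (-1)).congr (fun t _ x => by ring) (fun t _ x => by ring)

lemma sub (ha : TF τ a a') (hb : TF τ b b') :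
    TF τ (fun t x => a t x - b t x) (fun t x => a' t x - b' t x) :=
  (ha.add hb.neg).congr (fun t _ x => by ring) (fun t _ x => by ring)

lemma mul (ha : TF τ a a') (hb : TF τ b b') :
    TF τ (fun t x => a t x * b t x) (fun t x => a' t x * b t x + a t x * b' t x) := by
  have key : ∀ s T, τ < s → ∃ B, ∀ t, s ≤ t → t ≤ T → (∀ x, |a t x| ≤ B) ∧ (∀ x, |b t x| ≤ B) ∧
      (∫ x, b t x ^ 2) ≤ B ∧ (∫ x, a' t x ^ 2) ≤ B ∧ (∫ x, b' t x ^ 2) ≤ B := by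
    intro s T hs
    obtain ⟨A, hA⟩ := ha.bd s T hs
    obtain ⟨B, hB⟩ := hb.bd s T hs
    refine ⟨max A B, fun t h1 h2 => ?_⟩
    obtain ⟨a1, a2, a3⟩ := hA t h1 h2
    obtain ⟨b1, b2, b3⟩ := hB t h1 h2
    exact ⟨fun x => (a1 x).trans (le_max_left _ _), fun x => (b1 x).trans (le_max_right _ _),
      b2.trans (le_max_right _ _), a3.trans (le_max_left _ _), b3.trans (le_max_right _ _)⟩
  have l1 : ∀ t, τ < t → L2c (fun x => a t x * b t x) := fun t ht => by
    obtain ⟨B, hB⟩ := key t t ht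
    exact (hb.l2 ht).bdd_mul (ha.l2 ht).cont (hB t le_rfl le_rfl).1
  have l2 : ∀ t, τ < t → L2c (fun x => a' t x * b t x) := fun t ht => by
    obtain ⟨B, hB⟩ := key t t ht
    have := (ha.l2' ht).bdd_mul (hb.l2 ht).cont (hB t le_rfl le_rfl).2.1
    simpa only [mul_comm] using this
  have l3 : ∀ t, τ < t → L2c (fun x => a t x * b' t x) := fun t ht => by
    obtain ⟨B, hB⟩ := key t t ht
    exact (hb.l2' ht).bdd_mul (ha.l2 ht).cont (hB t le_rfl le_rfl).1
  refine ⟨ha.cont.mul hb.cont, (ha.cont'.mul hb.cont).add (ha.cont.mul hb.cont'),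
    fun t ht x => (ha.deriv t ht x).mul (hb.deriv t ht x), fun t ht => (l1 t ht).int,
    fun t ht => ((l2 t ht).add (l3 t ht)).int, fun s T hs => ?_⟩
  obtain ⟨B, hB⟩ := key s T hs
  refine ⟨B * B + B ^ 2 * B + 4 * (B ^ 2 * B), fun t h1 h2 => ?_⟩
  have ht := hs.trans_le h1
  obtain ⟨a1, b1, b2, a3, b3⟩ := hB t h1 h2
  have h0 := (abs_nonneg _).trans (a1 0)
  have p1 : 0 ≤ B * B := by positivity
  have p2 : 0 ≤ B ^ 2 * B := by positivity
  refine ⟨fun x => ?_, ?_, ?_⟩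
  · rw [abs_mul]
    have := mul_le_mul (a1 x) (b1 x) (abs_nonneg _) h0
    linarith
  · have := (hb.l2 ht).integral_le_of_bound (l1 t ht).cont (C := B) fun x => by
      rw [abs_mul]; gcongr; exact a1 x
    have := mul_le_mul_of_nonneg_left b2 (sq_nonneg B)
    linarith
  · have e1 := (ha.l2' ht).integral_le_of_bound (l2 t ht).cont (C := B) fun x => by
      rw [abs_mul, mul_comm]; gcongr; exact b1 x
    have e2 := (hb.l2' ht).integral_le_of_bound (l3 t ht).cont (C := B) fun x => by
      rw [abs_mul]; gcongr; exact a1 x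
    have := mul_le_mul_of_nonneg_left a3 (sq_nonneg B)
    have := mul_le_mul_of_nonneg_left b3 (sq_nonneg B)
    have := (l2 t ht).integral_add_sq_le (l3 t ht)
    linarith

/-- Composition with a `C¹` function vanishing at the origin. -/
lemma comp (ha : TF τ a a') {φ φ' : ℝ → ℝ} (hφ : ∀ s, HasDerivAt φ (φ' s) s)
    (hφ' : Continuous φ') (h0 : φ 0 = 0) :
    TF τ (fun t x => φ (a t x)) (fun t x => φ' (a t x) * a' t x) := by
  have hφc : Continuous φ := continuous_iff_continuousAt.2 fun s => (hφ s).continuousAt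
  have key : ∀ B : ℝ, ∃ C, 0 ≤ C ∧ ∀ s, |s| ≤ B → |φ' s| ≤ C ∧ |φ s| ≤ C * |s| := by
    intro B
    obtain ⟨C, hC⟩ := (isCompact_Icc (a := -B) (b := B)).exists_bound_of_continuousOn
      hφ'.continuousOn
    refine ⟨|C|, abs_nonneg C, fun s hs => ?_⟩
    have hC' : ∀ r, |r| ≤ B → |φ' r| ≤ |C| := fun r hr =>
      (hC r (Set.mem_Icc.2 (abs_le.1 hr))).trans (le_abs_self C)
    refine ⟨hC' s hs, ?_⟩
    have := Convex.norm_image_sub_le_of_norm_hasDerivWithin_le (f := φ) (f' := φ') (C := |C|)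
      (s := Set.Icc (-B) B) (x := 0) (y := s) (fun r _ => (hφ r).hasDerivWithinAt)
      (fun r hr => hC' r (abs_le.2 (Set.mem_Icc.1 hr))) (convex_Icc _ _)
      (by have := (abs_nonneg s).trans hs; simpa using this) (Set.mem_Icc.2 (abs_le.1 hs))
    simpa [h0] using this
  have c1 : ContinuousOn (fun q : ℝ × ℝ => φ (a q.1 q.2)) (Set.Ioi τ ×ˢ Set.univ) :=
    hφc.comp_continuousOn ha.cont
  have c2 : ContinuousOn (fun q : ℝ × ℝ => φ' (a q.1 q.2) * a' q.1 q.2) (Set.Ioi τ ×ˢ Set.univ) :=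
    (hφ'.comp_continuousOn ha.cont).mul ha.cont'
  have bd : ∀ s T, τ < s → ∃ B C, 0 ≤ B ∧ 0 ≤ C ∧ ∀ t, s ≤ t → t ≤ T →
      (∀ x, |a t x| ≤ B) ∧ (∫ x, a t x ^ 2) ≤ B ∧ (∫ x, a' t x ^ 2) ≤ B ∧
      (∀ x, |φ (a t x)| ≤ C * |a t x|) ∧ (∀ x, |φ' (a t x) * a' t x| ≤ C * |a' t x|) := by
    intro s T hs
    obtain ⟨B, hB⟩ := ha.bd s T hs
    obtain ⟨C, hC0, hC⟩ := key B
    refine ⟨|B|, C, abs_nonneg B, hC0, fun t h1 h2 => ?_⟩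
    obtain ⟨a1, a2, a3⟩ := hB t h1 h2
    refine ⟨fun x => (a1 x).trans (le_abs_self B), a2.trans (le_abs_self B),
      a3.trans (le_abs_self B), fun x => (hC _ (a1 x)).2, fun x => ?_⟩
    rw [abs_mul]
    exact mul_le_mul_of_nonneg_right (hC _ (a1 x)).1 (abs_nonneg _)
  refine ⟨c1, c2, fun t ht x => (hφ _).comp t (ha.deriv t ht x), fun t ht => ?_, fun t ht => ?_,
    fun s T hs => ?_⟩
  · obtain ⟨B, C, -, -, h⟩ := bd t t ht
    exact ((ha.l2 ht).of_bound (continuous_slice (a := fun t x => φ (a t x)) c1 ht)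
      (h t le_rfl le_rfl).2.2.2.1).int
  · obtain ⟨B, C, -, -, h⟩ := bd t t ht
    exact ((ha.l2' ht).of_bound (continuous_slice (a := fun t x => φ' (a t x) * a' t x) c2 ht)
      (h t le_rfl le_rfl).2.2.2.2).int
  · obtain ⟨B, C, hB, hC, h⟩ := bd s T hs
    refine ⟨C * B + C ^ 2 * B, fun t h1 h2 => ?_⟩
    have ht := hs.trans_le h1
    obtain ⟨a1, a2, a3, a4, a5⟩ := h t h1 h2
    have p1 : 0 ≤ C * B := by positivity
    have p2 : 0 ≤ C ^ 2 * B := by positivity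
    refine ⟨fun x => ?_, ?_, ?_⟩
    · have := mul_le_mul_of_nonneg_left (a1 x) hC
      linarith [a4 x]
    · have := (ha.l2 ht).integral_le_of_bound
        (continuous_slice (a := fun t x => φ (a t x)) c1 ht) a4
      have := mul_le_mul_of_nonneg_left a2 (sq_nonneg C)
      linarith
    · have := (ha.l2' ht).integral_le_of_bound
        (continuous_slice (a := fun t x => φ' (a t x) * a' t x) c2 ht) a5
      have := mul_le_mul_of_nonneg_left a3 (sq_nonneg C)
      linarith

/-- Integrated Leibniz rule for products. -/
lemma integral_mul_sub (ha : TF τ a a') (hb : TF τ b b') {s t : ℝ} (hs : τ < s) (hst : s ≤ t) :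
    IntervalIntegrable (fun r => ∫ x, (a' r x * b r x + a r x * b' r x)) volume s t ∧
    (∫ x, a t x * b t x) - ∫ x, a s x * b s x
      = ∫ r in s..t, ∫ x, (a' r x * b r x + a r x * b' r x) := by
  obtain ⟨A, hA⟩ := ha.bd s t hs
  obtain ⟨B, hB⟩ := hb.bd s t hs
  refine integral_sub_eq (g := fun t x => a t x * b t x)
    (g' := fun t x => a' t x * b t x + a t x * b' t x) (B := A + B)
    (fun t ht x => (ha.deriv t ht x).mul (hb.deriv t ht x))
    ((ha.cont'.mul hb.cont).add (ha.cont.mul hb.cont'))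
    (fun t ht => (ha.l2 ht).mul_int (hb.l2 ht))
    (fun t ht => ((ha.l2' ht).mul_int (hb.l2 ht)).add ((ha.l2 ht).mul_int (hb.l2' ht)))
    hs hst fun r h1 h2 => ?_
  have hr := hs.trans_le h1
  obtain ⟨a1, a2, a3⟩ := hA r h1 h2
  obtain ⟨b1, b2, b3⟩ := hB r h1 h2
  have i1 := (ha.l2' hr).mul_int (hb.l2 hr)
  have i2 := (ha.l2 hr).mul_int (hb.l2' hr)
  have e1 : ∫ x, |a' r x * b r x + a r x * b' r x|
      ≤ (∫ x, |a' r x * b r x|) + ∫ x, |a r x * b' r x| := by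
    rw [← integral_add i1.abs i2.abs]
    exact integral_mono (i1.add i2).abs (i1.abs.add i2.abs) fun x => abs_add_le _ _
  have e2 := (ha.l2' hr).abs.young (hb.l2 hr).abs one_pos
  have e3 := (ha.l2 hr).abs.young (hb.l2' hr).abs one_pos
  simp only [sq_abs, ← abs_mul, inv_one, one_mul] at e2 e3
  have := le_abs_self (∫ x, |a' r x * b r x|)
  have := le_abs_self (∫ x, |a r x * b' r x|)
  linarith

lemma exists_abs_integral_le (ha : TF τ a a') (hb : TF τ b b') {s T : ℝ} (hs : τ < s) :
    ∃ C, ∀ t, s ≤ t → t ≤ T → |∫ x, (a' t x * b t x + a t x * b' t x)| ≤ C := by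
  obtain ⟨A, hA⟩ := ha.bd s T hs
  obtain ⟨B, hB⟩ := hb.bd s T hs
  refine ⟨A + B, fun r h1 h2 => ?_⟩
  have hr := hs.trans_le h1
  obtain ⟨a1, a2, a3⟩ := hA r h1 h2
  obtain ⟨b1, b2, b3⟩ := hB r h1 h2
  rw [integral_add ((ha.l2' hr).mul_int (hb.l2 hr)) ((ha.l2 hr).mul_int (hb.l2' hr))]
  have e2 := (ha.l2' hr).young (hb.l2 hr) one_pos
  have e3 := (ha.l2 hr).young (hb.l2' hr) one_pos
  simp only [inv_one, one_mul] at e2 e3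
  have := abs_add_le (∫ x, a' r x * b r x) (∫ x, a r x * b' r x)
  linarith

lemma continuousOn_integral_mul (ha : TF τ a a') (hb : TF τ b b') :
    ContinuousOn (fun t => ∫ x, a t x * b t x) (Set.Ioi τ) := by
  intro t₀ (h0 : τ < t₀)
  obtain ⟨s, hs1, hs2⟩ := exists_between h0
  obtain ⟨C, hC⟩ := ha.exists_abs_integral_le hb (T := t₀ + 1) hs1
  have hlip : ∀ r t, s ≤ r → r ≤ t → t ≤ t₀ + 1 →
      |(∫ x, a t x * b t x) - ∫ x, a r x * b r x| ≤ C * |t - r| := by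
    intro r t h1 h2 h3
    rw [(ha.integral_mul_sub hb (hs1.trans_le h1) h2).2]
    rw [← norm_eq_abs]
    refine intervalIntegral.norm_integral_le_of_norm_le_const fun y hy => ?_
    rw [Set.uIoc_of_le h2] at hy
    exact hC y (h1.trans hy.1.le) (hy.2.trans h3)
  have hlip' : ∀ t, s ≤ t → t ≤ t₀ + 1 →
      |(∫ x, a t x * b t x) - ∫ x, a t₀ x * b t₀ x| ≤ C * |t - t₀| := by
    intro t h1 h3
    rcases le_total t₀ t with h | h
    · exact hlip t₀ t hs2.le h h3
    · rw [abs_sub_comm, abs_sub_comm t]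
      exact hlip t t₀ h1 h (by linarith)
  refine ContinuousAt.continuousWithinAt ?_
  rw [ContinuousAt, tendsto_iff_dist_tendsto_zero]
  have hz : Tendsto (fun t => C * |t - t₀|) (nhds t₀) (nhds 0) := by
    have : Continuous (fun t => C * |t - t₀|) := by fun_prop
    simpa using this.tendsto t₀
  refine squeeze_zero' (Eventually.of_forall fun _ => dist_nonneg) ?_ hz
  filter_upwards [lt_mem_nhds hs2, gt_mem_nhds (lt_add_one t₀)] with t h1 h2
  exact hlip' t h1.le h2.le

/-- Leibniz rule for products. -/
lemma hasDerivAt_integral_mul (ha : TF τ a a') (hb : TF τ b b') {φ : ℝ → ℝ}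
    (hφ : ContinuousOn φ (Set.Ioi τ))
    (h : ∀ t, τ < t → (∫ x, a' t x * b t x) + (∫ x, a t x * b' t x) = φ t) {t : ℝ} (ht : τ < t) :
    HasDerivAt (fun t => ∫ x, a t x * b t x) (φ t) t := by
  obtain ⟨s, hs1, hs2⟩ := exists_between ht
  have h' : ∀ r, s < r → ∫ x, a r x * b r x = (∫ x, a s x * b s x) + ∫ y in s..r, φ y := by
    intro r hr
    have := (ha.integral_mul_sub hb hs1 hr.le).2
    rw [sub_eq_iff_eq_add'] at this
    rw [this]
    congr 1
    refine intervalIntegral.integral_congr fun y hy => ?_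
    rw [Set.uIcc_of_le hr.le] at hy
    have hy' := hs1.trans_le hy.1
    rw [integral_add ((ha.l2' hy').mul_int (hb.l2 hy')) ((ha.l2 hy').mul_int (hb.l2' hy')), h y hy']
  have hd : HasDerivAt (fun r => (∫ x, a s x * b s x) + ∫ y in s..r, φ y) (φ t) t := by
    refine HasDerivAt.const_add _ ?_
    refine intervalIntegral.integral_hasDerivAt_right ?_ ?_ (hφ.continuousAt (lt_mem_nhds ht))
    · refine ContinuousOn.intervalIntegrable (hφ.mono fun y hy => ?_)
      rw [Set.uIcc_of_le hs2.le] at hy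
      exact hs1.trans_le hy.1
    · exact hφ.stronglyMeasurableAtFilter isOpen_Ioi _ ht
  refine hd.congr_of_eventuallyEq ?_
  filter_upwards [lt_mem_nhds hs2] with r hr using h' r hr

end TF

/-- The one-sided exponential kernel. -/
noncomputable def ker : ℝ → ℝ := Set.indicator (Set.Ioi 0) fun y => exp (-y)

lemma ker_nonneg (y : ℝ) : 0 ≤ ker y := Set.indicator_nonneg (fun _ _ => (exp_pos _).le) y

lemma integrable_ker : Integrable ker := by
  unfold ker
  rw [integrable_indicator_iff measurableSet_Ioi]
  exact integrableOn_exp_neg_Ioi 0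

lemma integral_ker : ∫ y, ker y = 1 := by
  unfold ker
  rw [integral_indicator measurableSet_Ioi, integral_exp_neg_Ioi_zero]

/-- The operator `(1 + d/dx)⁻¹`. -/
noncomputable def avg (φ : ℝ → ℝ) (x : ℝ) : ℝ := ∫ y, ker y * φ (x - y)

section

variable {φ : ℝ → ℝ} {M : ℝ}

lemma avg_integrable (hc : Continuous φ) (hM : ∀ x, |φ x| ≤ M) (x : ℝ) :
    Integrable (fun y => ker y * φ (x - y)) :=
  integrable_ker.mul_bdd (c := M) (by fun_prop) (Eventually.of_forall fun y => hM _)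

lemma abs_avg_le (hM : ∀ x, |φ x| ≤ M) (x : ℝ) : |avg φ x| ≤ M := by
  have : ‖∫ y, ker y * φ (x - y)‖ ≤ ∫ y, ker y * M := by
    refine norm_integral_le_of_norm_le (integrable_ker.mul_const M)
      (Eventually.of_forall fun y => ?_)
    rw [norm_mul, norm_eq_abs, abs_of_nonneg (ker_nonneg y)]
    exact mul_le_mul_of_nonneg_left (hM _) (ker_nonneg y)
  rwa [integral_mul_const, integral_ker, one_mul] at this

lemma avg_eq (x : ℝ) : avg φ x = exp (-x) * ∫ y in Set.Iic x, exp y * φ y := by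
  have e1 : avg φ x = ∫ y, ker (x - y) * φ y := by
    unfold avg
    rw [← integral_sub_left_eq_self (fun y => ker y * φ (x - y)) volume x]
    simp
  rw [e1, integral_Iic_eq_integral_Iio, ← integral_const_mul,
    ← integral_indicator measurableSet_Iio]
  refine integral_congr_ae (Eventually.of_forall fun y => ?_)
  simp only [ker, Set.indicator, Set.mem_Ioi, Set.mem_Iio, sub_pos]
  split_ifs
  · rw [neg_sub, ← mul_assoc, ← exp_add]; ring_nf
  · simp

lemma hasDerivAt_avg (hc : Continuous φ) (hM : ∀ x, |φ x| ≤ M) (x : ℝ) :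
    HasDerivAt (avg φ) (φ x - avg φ x) x := by
  have hint : ∀ x, IntegrableOn (fun y => exp y * φ y) (Set.Iic x) := fun x =>
    (integrableOn_exp_Iic x).mul_bdd (c := M) (by fun_prop) (Eventually.of_forall fun y => hM _)
  have e : avg φ = fun x => exp (-x) *
      ((∫ y in Set.Iic 0, exp y * φ y) + ∫ y in (0:ℝ)..x, exp y * φ y) := by
    funext x
    rw [avg_eq, ← intervalIntegral.integral_Iic_sub_Iic (hint 0) (hint x)]
    ring_nf
  have h1 : HasDerivAt (fun x => exp (-x)) (-exp (-x)) x := by simpa using (hasDerivAt_neg x).exp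
  have h2 : HasDerivAt (fun x => ∫ y in (0:ℝ)..x, exp y * φ y) (exp x * φ x) x := by
    have hcc : Continuous fun y => exp y * φ y := by fun_prop
    exact intervalIntegral.integral_hasDerivAt_right (hcc.intervalIntegrable _ _)
      (hcc.stronglyMeasurableAtFilter _ _) hcc.continuousAt
  have h3 := h1.mul (h2.const_add (∫ y in Set.Iic 0, exp y * φ y))
  have e' := congrFun e x
  rw [e']
  rw [e]
  refine h3.congr_deriv ?_
  have : exp (-x) * (exp x * φ x) = φ x := by rw [← mul_assoc, ← exp_add]; simp
  rw [this]; ring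

lemma sq_avg_le (hc : Continuous φ) (hM : ∀ x, |φ x| ≤ M) (x : ℝ) :
    avg φ x ^ 2 ≤ avg (fun y => φ y ^ 2) x := by
  have i1 := avg_integrable hc hM x
  have i2 := avg_integrable (φ := fun y => φ y ^ 2) (M := M ^ 2) (hc.pow 2) (fun y => by
    rw [abs_pow]; exact pow_le_pow_left₀ (abs_nonneg _) (hM y) 2) x
  have h : 0 ≤ ∫ y, ker y * (φ (x - y) - avg φ x) ^ 2 :=
    integral_nonneg fun y => mul_nonneg (ker_nonneg y) (sq_nonneg _)
  have e : ∀ y, ker y * (φ (x - y) - avg φ x) ^ 2 = ker y * φ (x - y) ^ 2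
      - (2 * avg φ x) * (ker y * φ (x - y)) + avg φ x ^ 2 * ker y := fun y => by ring
  simp_rw [e] at h
  rw [integral_add (by exact i2.sub (i1.const_mul _)) (integrable_ker.const_mul _),
    integral_sub i2 (i1.const_mul _), integral_const_mul, integral_const_mul, integral_ker] at h
  have e1 : ∫ y, ker y * φ (x - y) = avg φ x := rfl
  have e2 : ∫ y, ker y * φ (x - y) ^ 2 = avg (fun y => φ y ^ 2) x := rfl
  rw [e1, e2] at h
  nlinarith

lemma l2c_avg (ha : L2c φ) (hM : ∀ x, |φ x| ≤ M) :
    L2c (avg φ) ∧ ∫ x, avg φ x ^ 2 ≤ ∫ x, φ x ^ 2 := by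
  have hcont : Continuous (avg φ) :=
    continuous_iff_continuousAt.2 fun x => (hasDerivAt_avg ha.cont hM x).continuousAt
  have e : avg (fun y => φ y ^ 2)
      = MeasureTheory.convolution ker (fun y => φ y ^ 2) (ContinuousLinearMap.mul ℝ ℝ) volume := by
    funext x; simp [avg, MeasureTheory.convolution]
  have i1 : Integrable (avg (fun y => φ y ^ 2)) := by
    rw [e]; exact integrable_ker.integrable_convolution _ ha.int
  have i2 : ∫ x, avg (fun y => φ y ^ 2) x = ∫ x, φ x ^ 2 := by
    rw [e, integral_convolution _ integrable_ker ha.int]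
    simp [integral_ker]
  have h : L2c (avg φ) := by
    refine ⟨hcont, i1.mono' (hcont.pow 2).aestronglyMeasurable (Eventually.of_forall fun x => ?_)⟩
    rw [norm_eq_abs, abs_of_nonneg (sq_nonneg _)]
    exact sq_avg_le ha.cont hM x
  refine ⟨h, ?_⟩
  rw [← i2]
  exact integral_mono h.int i1 fun x => sq_avg_le ha.cont hM x

end

lemma TF.avg {τ : ℝ} {a a' : ℝ → ℝ → ℝ} (ha : TF τ a a')
    (hb : ∀ s T, τ < s → ∃ B, ∀ t, s ≤ t → t ≤ T → ∀ x, |a' t x| ≤ B) :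
    TF τ (fun t => avg (a t)) (fun t => avg (a' t)) := by
  have key : ∀ t₀, τ < t₀ → ∃ s B, τ < s ∧ s < t₀ ∧ ∀ t ∈ Set.Ioo s (t₀ + 1), ∀ x,
      |a t x| ≤ B ∧ |a' t x| ≤ B := by
    intro t₀ h0
    obtain ⟨s, hs1, hs2⟩ := exists_between h0
    obtain ⟨A, hA⟩ := ha.bd s (t₀ + 1) hs1
    obtain ⟨B, hB⟩ := hb s (t₀ + 1) hs1
    exact ⟨s, max A B, hs1, hs2, fun t ht x =>
      ⟨((hA t ht.1.le ht.2.le).1 x).trans (le_max_left _ _),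
        (hB t ht.1.le ht.2.le x).trans (le_max_right _ _)⟩⟩
  have hcont : ∀ c : ℝ → ℝ → ℝ, ContinuousOn (fun q : ℝ × ℝ => c q.1 q.2) (Set.Ioi τ ×ˢ Set.univ) →
      (∀ t₀, τ < t₀ → ∃ s B, τ < s ∧ s < t₀ ∧ ∀ t ∈ Set.Ioo s (t₀ + 1), ∀ x, |c t x| ≤ B) →
      ContinuousOn (fun q : ℝ × ℝ => NLKG.avg (c q.1) q.2) (Set.Ioi τ ×ˢ Set.univ) := by
    rintro c hc hcb ⟨t₀, x₀⟩ ⟨h0 : τ < t₀, -⟩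
    obtain ⟨s, B, hs1, hs2, h⟩ := hcb t₀ h0
    have hU : Set.Ioo s (t₀ + 1) ×ˢ (Set.univ : Set ℝ) ∈ nhds (t₀, x₀) :=
      (isOpen_Ioo.prod isOpen_univ).mem_nhds ⟨⟨hs2, lt_add_one _⟩, trivial⟩
    refine ContinuousAt.continuousWithinAt ?_
    refine continuousAt_of_dominated (F := fun (q : ℝ × ℝ) y => ker y * c q.1 (q.2 - y))
      (bound := fun y => ker y * B) ?_ ?_ (integrable_ker.mul_const B) ?_
    · filter_upwards [hU] with q hq
      have := continuous_slice hc (hs1.trans hq.1.1)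
      exact integrable_ker.aestronglyMeasurable.mul (by fun_prop)
    · filter_upwards [hU] with q hq
      refine Eventually.of_forall fun y => ?_
      rw [norm_mul, norm_eq_abs, abs_of_nonneg (ker_nonneg y)]
      exact mul_le_mul_of_nonneg_left (h q.1 hq.1 _) (ker_nonneg y)
    · refine Eventually.of_forall fun y => ?_
      refine continuousAt_const.mul ?_
      have h1 : ContinuousAt (fun q : ℝ × ℝ => c q.1 q.2) (t₀, x₀ - y) :=
        hc.continuousAt ((isOpen_Ioi.prod isOpen_univ).mem_nhds ⟨h0, trivial⟩)
      exact ContinuousAt.comp (f := fun q : ℝ × ℝ => (q.1, q.2 - y)) (x := (t₀, x₀)) h1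
        (by fun_prop)
  have bda : ∀ t, τ < t → ∃ B, ∀ x, |a t x| ≤ B := fun t ht => by
    obtain ⟨B, hB⟩ := ha.bd t t ht
    exact ⟨B, (hB t le_rfl le_rfl).1⟩
  have bda' : ∀ t, τ < t → ∃ B, ∀ x, |a' t x| ≤ B := fun t ht => by
    obtain ⟨B, hB⟩ := hb t t ht
    exact ⟨B, (hB t le_rfl le_rfl)⟩
  refine ⟨hcont a ha.cont ?_, hcont a' ha.cont' ?_, ?_, fun t ht => ?_, fun t ht => ?_,
    fun s T hs => ?_⟩
  · intro t₀ h0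
    obtain ⟨s, B, h1, h2, h3⟩ := key t₀ h0
    exact ⟨s, B, h1, h2, fun t ht x => (h3 t ht x).1⟩
  · intro t₀ h0
    obtain ⟨s, B, h1, h2, h3⟩ := key t₀ h0
    exact ⟨s, B, h1, h2, fun t ht x => (h3 t ht x).2⟩
  · intro t₀ h0 x
    obtain ⟨s, B, hs1, hs2, h⟩ := key t₀ h0
    refine (hasDerivAt_integral_of_dominated_loc_of_deriv_le (F := fun t y => ker y * a t (x - y))
      (F' := fun t y => ker y * a' t (x - y)) (bound := fun y => ker y * B)
      (s := Set.Ioo s (t₀ + 1)) (Ioo_mem_nhds hs2 (lt_add_one _)) ?_ ?_ ?_ ?_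
      (integrable_ker.mul_const B) ?_).2
    · filter_upwards [Ioo_mem_nhds hs2 (lt_add_one _)] with t ht
      have := continuous_slice ha.cont (hs1.trans ht.1)
      exact integrable_ker.aestronglyMeasurable.mul (by fun_prop)
    · obtain ⟨B, hB⟩ := bda t₀ h0
      exact avg_integrable (ha.l2 h0).cont hB x
    · have := continuous_slice ha.cont' h0
      exact integrable_ker.aestronglyMeasurable.mul (by fun_prop)
    · refine Eventually.of_forall fun y t ht => ?_
      rw [norm_mul, norm_eq_abs, abs_of_nonneg (ker_nonneg y)]
      exact mul_le_mul_of_nonneg_left (h t ht _).2 (ker_nonneg y)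
    · exact Eventually.of_forall fun y t ht => (ha.deriv t (hs1.trans ht.1) _).const_mul _
  · obtain ⟨B, hB⟩ := bda t ht
    exact (l2c_avg (ha.l2 ht) hB).1.int
  · obtain ⟨B, hB⟩ := bda' t ht
    exact (l2c_avg (ha.l2' ht) hB).1.int
  · obtain ⟨A, hA⟩ := ha.bd s T hs
    refine ⟨A, fun t h1 h2 => ?_⟩
    have ht := hs.trans_le h1
    obtain ⟨a1, a2, a3⟩ := hA t h1 h2
    obtain ⟨B, hB⟩ := bda' t ht
    exact ⟨abs_avg_le a1, (l2c_avg (ha.l2 ht) a1).2.trans a2, (l2c_avg (ha.l2' ht) hB).2.trans a3⟩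

lemma TF.reflect {τ : ℝ} {a a' : ℝ → ℝ → ℝ} (ha : TF τ a a') :
    TF τ (fun t x => a t (-x)) (fun t x => a' t (-x)) where
  cont := ha.cont.comp (f := fun q : ℝ × ℝ => (q.1, -q.2)) (by fun_prop) fun q hq => ⟨hq.1, trivial⟩
  cont' := ha.cont'.comp (f := fun q : ℝ × ℝ => (q.1, -q.2)) (by fun_prop)
    fun q hq => ⟨hq.1, trivial⟩
  deriv t ht x := ha.deriv t ht (-x)
  int t ht := (ha.int t ht).comp_neg
  int' t ht := (ha.int' t ht).comp_neg
  bd s T hs := by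
    obtain ⟨A, hA⟩ := ha.bd s T hs
    refine ⟨A, fun t h1 h2 => ?_⟩
    obtain ⟨a1, a2, a3⟩ := hA t h1 h2
    refine ⟨fun x => a1 _, ?_, ?_⟩
    · rwa [integral_neg_eq_self (fun x => a t x ^ 2)]
    · rwa [integral_neg_eq_self (fun x => a' t x ^ 2)]

lemma L2c.reflect {a : ℝ → ℝ} (ha : L2c a) : L2c (fun x => a (-x)) :=
  ⟨ha.cont.comp continuous_neg, ha.int.comp_neg⟩

/-- The operator `(1 - d²/dx²)⁻¹`. -/
noncomputable def res (φ : ℝ → ℝ) (x : ℝ) : ℝ := 2⁻¹ * (avg φ x + avg (fun y => φ (-y)) (-x))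

/-- The operator `d/dx (1 - d²/dx²)⁻¹`. -/
noncomputable def resx (φ : ℝ → ℝ) (x : ℝ) : ℝ := 2⁻¹ * (avg (fun y => φ (-y)) (-x) - avg φ x)

section

variable {φ : ℝ → ℝ} {M : ℝ}

lemma hasDerivAt_avg_reflect (hc : Continuous φ) (hM : ∀ x, |φ x| ≤ M) (x : ℝ) :
    HasDerivAt (fun x => avg (fun y => φ (-y)) (-x)) (avg (fun y => φ (-y)) (-x) - φ x) x := by
  have := (hasDerivAt_avg (φ := fun y => φ (-y)) (by fun_prop) (fun x => hM (-x)) (-x)).comp x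
    (hasDerivAt_neg x)
  refine this.congr_deriv ?_
  simp

lemma hasDerivAt_res (hc : Continuous φ) (hM : ∀ x, |φ x| ≤ M) (x : ℝ) :
    HasDerivAt (res φ) (resx φ x) x := by
  refine (((hasDerivAt_avg hc hM x).add (hasDerivAt_avg_reflect hc hM x)).const_mul
    (2⁻¹:ℝ)).congr_deriv ?_
  unfold resx; ring

lemma hasDerivAt_resx (hc : Continuous φ) (hM : ∀ x, |φ x| ≤ M) (x : ℝ) :
    HasDerivAt (resx φ) (res φ x - φ x) x := by
  refine (((hasDerivAt_avg_reflect hc hM x).sub (hasDerivAt_avg hc hM x)).const_mul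
    (2⁻¹:ℝ)).congr_deriv ?_
  unfold res; ring

lemma l2c_res (ha : L2c φ) (hM : ∀ x, |φ x| ≤ M) :
    L2c (res φ) ∧ L2c (resx φ) ∧ ∫ x, res φ x ^ 2 ≤ ∫ x, φ x ^ 2 := by
  obtain ⟨h1, h2⟩ := l2c_avg ha hM
  obtain ⟨h3, h4⟩ := l2c_avg (φ := fun y => φ (-y)) ha.reflect (fun x => hM (-x))
  rw [integral_neg_eq_self (fun x => φ x ^ 2)] at h4
  have e : ∫ x, avg (fun y => φ (-y)) (-x) ^ 2 = ∫ x, avg (fun y => φ (-y)) x ^ 2 :=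
    integral_neg_eq_self (fun x => avg (fun y => φ (-y)) x ^ 2) volume
  have h5 := h3.reflect
  refine ⟨(h1.add h5).const_mul _, (h5.sub h1).const_mul _, ?_⟩
  have := h1.integral_add_sq_le h5
  unfold res
  simp_rw [mul_pow]
  rw [integral_const_mul]
  linarith

end

lemma TF.res {τ : ℝ} {a a' : ℝ → ℝ → ℝ} (ha : TF τ a a')
    (hb : ∀ s T, τ < s → ∃ B, ∀ t, s ≤ t → t ≤ T → ∀ x, |a' t x| ≤ B) :
    TF τ (fun t => res (a t)) (fun t => res (a' t)) ∧
    TF τ (fun t => resx (a t)) (fun t => resx (a' t)) := by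
  have h1 := ha.avg hb
  have h2 := (ha.reflect.avg (fun s T hs => by
    obtain ⟨B, hB⟩ := hb s T hs
    exact ⟨B, fun t h1 h2 x => hB t h1 h2 _⟩)).reflect
  exact ⟨(h1.add h2).const_mul _, (h2.sub h1).const_mul _⟩

/-- The curried form of a function on space-time. -/
def U (u : ℝ × ℝ → ℝ) (t x : ℝ) : ℝ := u (t, x)

/-- Solutions of the damped Klein-Gordon equation for positive times. -/
structure Sol (p α : ℝ) (u : ℝ × ℝ → ℝ) : Prop where
  tu : TF 0 (U u) (ut u)
  tut : TF 0 (ut u) (utt u)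
  tux : TF 0 (ux u) (utx u)
  l2uxx : ∀ t, 0 < t → L2c (uxx u t)
  dx : ∀ t, 0 < t → ∀ x, HasDerivAt (U u t) (ux u t x) x
  dtx : ∀ t, 0 < t → ∀ x, HasDerivAt (ut u t) (utx u t x) x
  dxx : ∀ t, 0 < t → ∀ x, HasDerivAt (ux u t) (uxx u t x) x
  eq : ∀ t, 0 < t → ∀ x, utt u t x = uxx u t x - U u t x + nl p (U u t x) - 2 * α * ut u t x

lemma hasDerivAt_fst {g : ℝ × ℝ → ℝ} {t x : ℝ} (h : DifferentiableAt ℝ g (t, x)) :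
    HasDerivAt (fun s => g (s, x)) (fderiv ℝ g (t, x) (1, 0)) t := by
  have h1 : HasDerivAt (fun s : ℝ => (s, x)) ((1 : ℝ), (0 : ℝ)) t :=
    (hasDerivAt_id t).prodMk (hasDerivAt_const t x)
  exact h.hasFDerivAt.comp_hasDerivAt t h1

lemma hasDerivAt_snd {g : ℝ × ℝ → ℝ} {t x : ℝ} (h : DifferentiableAt ℝ g (t, x)) :
    HasDerivAt (fun y => g (t, y)) (fderiv ℝ g (t, x) (0, 1)) x := by
  have h1 : HasDerivAt (fun y : ℝ => (t, y)) ((0 : ℝ), (1 : ℝ)) x :=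
    (hasDerivAt_const x t).prodMk (hasDerivAt_id x)
  exact h.hasFDerivAt.comp_hasDerivAt x h1

lemma continuousOn_fderiv_apply {g : ℝ × ℝ → ℝ} {s : Set (ℝ × ℝ)} (hs : IsOpen s)
    (h : ContDiffOn ℝ 1 g s) (v : ℝ × ℝ) : ContinuousOn (fun q => fderiv ℝ g q v) s :=
  (h.continuousOn_fderiv_of_isOpen hs le_rfl).clm_apply continuousOn_const

lemma L2c.abs_le_one_add {a a' : ℝ → ℝ} (ha : L2c a) (ha' : L2c a')
    (hd : ∀ x, HasDerivAt a (a' x) x) {A B : ℝ} (h1 : ∫ x, a x ^ 2 ≤ A) (h2 : ∫ x, a' x ^ 2 ≤ B)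
    (x : ℝ) : |a x| ≤ 1 + (A + B) := by
  have := ha.sq_le ha' hd x
  nlinarith [sq_nonneg (|a x| - 1), sq_abs (a x)]

theorem sol_of_regular {p α : ℝ} {u : ℝ × ℝ → ℝ}
    (hreg : ContDiffOn ℝ 2 u (Set.Ici (0 : ℝ) ×ˢ Set.univ))
    (hpde : ∀ t ≥ (0 : ℝ), ∀ x : ℝ, utt u t x + 2 * α * ut u t x - uxx u t x + u (t, x)
        - |u (t, x)| ^ (p - 1) * u (t, x) = 0)
    (hint : ∀ t ≥ (0 : ℝ), Integrable (fun x : ℝ => u (t, x) ^ 2) ∧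
      Integrable (fun x : ℝ => ut u t x ^ 2) ∧
      Integrable (fun x : ℝ => ux u t x ^ 2) ∧
      Integrable (fun x : ℝ => utt u t x ^ 2) ∧
      Integrable (fun x : ℝ => utx u t x ^ 2) ∧
      Integrable (fun x : ℝ => uxx u t x ^ 2))
    (hbdd : ∀ T ≥ (0 : ℝ), ∃ B : ℝ, ∀ t : ℝ, 0 ≤ t → t ≤ T → (∫ x : ℝ, u (t, x) ^ 2) ≤ B ∧
      (∫ x : ℝ, ut u t x ^ 2) ≤ B ∧
      (∫ x : ℝ, ux u t x ^ 2) ≤ B ∧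
      (∫ x : ℝ, utt u t x ^ 2) ≤ B ∧
      (∫ x : ℝ, utx u t x ^ 2) ≤ B ∧
      (∫ x : ℝ, uxx u t x ^ 2) ≤ B) : Sol p α u := by
  set Ω : Set (ℝ × ℝ) := Set.Ioi 0 ×ˢ Set.univ with hΩ
  have hΩo : IsOpen Ω := isOpen_Ioi.prod isOpen_univ
  have hu : ContDiffOn ℝ 2 u Ω := hreg.mono (Set.prod_mono Set.Ioi_subset_Ici_self le_rfl)
  have hmem : ∀ {t : ℝ} (_ : 0 < t) (x : ℝ), (t, x) ∈ Ω := fun ht x => ⟨ht, trivial⟩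
  have hn : ∀ {t : ℝ} (_ : 0 < t) (x : ℝ), Ω ∈ nhds (t, x) := fun ht x => hΩo.mem_nhds (hmem ht x)
  have hu1 : ContDiffOn ℝ 1 u Ω := hu.of_le (by norm_num)
  have hfd : ContDiffOn ℝ 1 (fderiv ℝ u) Ω := hu.fderiv_of_isOpen hΩo (by norm_num)
  have hg : ∀ v : ℝ × ℝ, ContDiffOn ℝ 1 (fun q => fderiv ℝ u q v) Ω := fun v =>
    hfd.clm_apply contDiffOn_const
  have du : ∀ {t : ℝ} (_ : 0 < t) (x : ℝ), DifferentiableAt ℝ u (t, x) := fun ht x =>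
    (hu1.contDiffAt (hn ht x)).differentiableAt (by norm_num)
  have dg : ∀ v : ℝ × ℝ, ∀ {t : ℝ} (_ : 0 < t) (x : ℝ),
      DifferentiableAt ℝ (fun q => fderiv ℝ u q v) (t, x) := fun v t ht x =>
    ((hg v).contDiffAt (hn ht x)).differentiableAt (by norm_num)
  have eut : ∀ t, 0 < t → ∀ x, ut u t x = fderiv ℝ u (t, x) (1, 0) := fun t ht x =>
    (hasDerivAt_fst (du ht x)).deriv
  have eux : ∀ t, 0 < t → ∀ x, ux u t x = fderiv ℝ u (t, x) (0, 1) := fun t ht x =>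
    (hasDerivAt_snd (du ht x)).deriv
  have h1 : ∀ t, 0 < t → ∀ x, HasDerivAt (fun s => U u s x) (ut u t x) t := fun t ht x => by
    rw [eut t ht]; exact hasDerivAt_fst (du ht x)
  have h2 : ∀ t, 0 < t → ∀ x, HasDerivAt (U u t) (ux u t x) x := fun t ht x => by
    rw [eux t ht]; exact hasDerivAt_snd (du ht x)
  have t1 : ∀ t, 0 < t → ∀ x, HasDerivAt (fun s => ut u s x)
      (fderiv ℝ (fun q => fderiv ℝ u q (1, 0)) (t, x) (1, 0)) t := fun t ht x => by
    refine (hasDerivAt_fst (dg (1, 0) ht x)).congr_of_eventuallyEq ?_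
    filter_upwards [lt_mem_nhds ht] with s hs using eut s hs x
  have t2 : ∀ t, 0 < t → ∀ x, HasDerivAt (fun s => ux u s x)
      (fderiv ℝ (fun q => fderiv ℝ u q (0, 1)) (t, x) (1, 0)) t := fun t ht x => by
    refine (hasDerivAt_fst (dg (0, 1) ht x)).congr_of_eventuallyEq ?_
    filter_upwards [lt_mem_nhds ht] with s hs using eux s hs x
  have x1 : ∀ t, 0 < t → ∀ x, HasDerivAt (fun y => ut u t y)
      (fderiv ℝ (fun q => fderiv ℝ u q (1, 0)) (t, x) (0, 1)) x := fun t ht x => by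
    refine (hasDerivAt_snd (dg (1, 0) ht x)).congr_of_eventuallyEq ?_
    exact Eventually.of_forall fun y => eut t ht y
  have x2 : ∀ t, 0 < t → ∀ x, HasDerivAt (fun y => ux u t y)
      (fderiv ℝ (fun q => fderiv ℝ u q (0, 1)) (t, x) (0, 1)) x := fun t ht x => by
    refine (hasDerivAt_snd (dg (0, 1) ht x)).congr_of_eventuallyEq ?_
    exact Eventually.of_forall fun y => eux t ht y
  have eutt : ∀ t, 0 < t → ∀ x, utt u t x
      = fderiv ℝ (fun q => fderiv ℝ u q (1, 0)) (t, x) (1, 0) := fun t ht x => (t1 t ht x).deriv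
  have eutx : ∀ t, 0 < t → ∀ x, utx u t x
      = fderiv ℝ (fun q => fderiv ℝ u q (1, 0)) (t, x) (0, 1) := fun t ht x => (x1 t ht x).deriv
  have euxx : ∀ t, 0 < t → ∀ x, uxx u t x
      = fderiv ℝ (fun q => fderiv ℝ u q (0, 1)) (t, x) (0, 1) := fun t ht x => (x2 t ht x).deriv
  have hsymm : ∀ t, 0 < t → ∀ x, fderiv ℝ (fun q => fderiv ℝ u q (0, 1)) (t, x) (1, 0)
      = fderiv ℝ (fun q => fderiv ℝ u q (1, 0)) (t, x) (0, 1) := fun t ht x => by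
    have hs : IsSymmSndFDerivAt ℝ u (t, x) := (hu.contDiffAt (hn ht x)).isSymmSndFDerivAt (by simp)
    have hdd : DifferentiableAt ℝ (fderiv ℝ u) (t, x) :=
      (hfd.contDiffAt (hn ht x)).differentiableAt (by norm_num)
    have e : ∀ v w : ℝ × ℝ, fderiv ℝ (fun q => fderiv ℝ u q v) (t, x) w
        = fderiv ℝ (fderiv ℝ u) (t, x) w v := fun v w => by
      rw [fderiv_clm_apply hdd (differentiableAt_const v)]
      simp
    rw [e, e]
    exact hs _ _
  have cut : ContinuousOn (fun q : ℝ × ℝ => ut u q.1 q.2) Ω :=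
    (continuousOn_fderiv_apply hΩo hu1 (1, 0)).congr fun q hq => eut q.1 hq.1 q.2
  have cux : ContinuousOn (fun q : ℝ × ℝ => ux u q.1 q.2) Ω :=
    (continuousOn_fderiv_apply hΩo hu1 (0, 1)).congr fun q hq => eux q.1 hq.1 q.2
  have cutt : ContinuousOn (fun q : ℝ × ℝ => utt u q.1 q.2) Ω :=
    (continuousOn_fderiv_apply hΩo (hg (1, 0)) (1, 0)).congr fun q hq => eutt q.1 hq.1 q.2
  have cutx : ContinuousOn (fun q : ℝ × ℝ => utx u q.1 q.2) Ω :=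
    (continuousOn_fderiv_apply hΩo (hg (1, 0)) (0, 1)).congr fun q hq => eutx q.1 hq.1 q.2
  have cuxx : ContinuousOn (fun q : ℝ × ℝ => uxx u q.1 q.2) Ω :=
    (continuousOn_fderiv_apply hΩo (hg (0, 1)) (0, 1)).congr fun q hq => euxx q.1 hq.1 q.2
  have cu : ContinuousOn (fun q : ℝ × ℝ => U u q.1 q.2) Ω := hu.continuousOn
  have lu : ∀ t, 0 < t → L2c (U u t) := fun t ht => ⟨continuous_slice cu ht, (hint t ht.le).1⟩
  have lut : ∀ t, 0 < t → L2c (ut u t) := fun t ht => ⟨continuous_slice cut ht, (hint t ht.le).2.1⟩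
  have lux : ∀ t, 0 < t → L2c (ux u t) := fun t ht =>
    ⟨continuous_slice cux ht, (hint t ht.le).2.2.1⟩
  have lutx : ∀ t, 0 < t → L2c (utx u t) := fun t ht =>
    ⟨continuous_slice cutx ht, (hint t ht.le).2.2.2.2.1⟩
  have luxx : ∀ t, 0 < t → L2c (uxx u t) := fun t ht =>
    ⟨continuous_slice cuxx ht, (hint t ht.le).2.2.2.2.2⟩
  have y1 : ∀ t, 0 < t → ∀ x, HasDerivAt (ut u t) (utx u t x) x := fun t ht x => by
    rw [eutx t ht]; exact x1 t ht x
  have y2 : ∀ t, 0 < t → ∀ x, HasDerivAt (ux u t) (uxx u t x) x := fun t ht x => by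
    rw [euxx t ht]; exact x2 t ht x
  have bd : ∀ s T : ℝ, 0 < s → ∃ B, 0 ≤ B ∧ ∀ t, s ≤ t → t ≤ T →
      (∫ x : ℝ, U u t x ^ 2) ≤ B ∧ (∫ x : ℝ, ut u t x ^ 2) ≤ B ∧ (∫ x : ℝ, ux u t x ^ 2) ≤ B ∧
      (∫ x : ℝ, utt u t x ^ 2) ≤ B ∧ (∫ x : ℝ, utx u t x ^ 2) ≤ B ∧
      (∫ x : ℝ, uxx u t x ^ 2) ≤ B := fun s T hs => by
    obtain ⟨B, hB⟩ := hbdd (max T 0) (le_max_right _ _)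
    refine ⟨B, ?_, fun t h1 h2 => hB t (hs.le.trans h1) (h2.trans (le_max_left _ _))⟩
    exact (integral_sq_nonneg _).trans (hB 0 le_rfl (le_max_right _ _)).1
  refine ⟨⟨cu, cut, h1, fun t ht => (lu t ht).int, fun t ht => (lut t ht).int, fun s T hs => ?_⟩,
    ⟨cut, cutt, fun t ht x => ?_, fun t ht => (lut t ht).int, fun t ht => (hint t ht.le).2.2.2.1,
      fun s T hs => ?_⟩,
    ⟨cux, cutx, fun t ht x => ?_, fun t ht => (lux t ht).int, fun t ht => (lutx t ht).int,
      fun s T hs => ?_⟩, luxx, h2, y1, y2, fun t ht x => ?_⟩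
  · obtain ⟨B, h0, hB⟩ := bd s T hs
    refine ⟨1 + (B + B), fun t e1 e2 => ?_⟩
    have ht := hs.trans_le e1
    obtain ⟨b1, b2, b3, b4, b5, b6⟩ := hB t e1 e2
    exact ⟨(lu t ht).abs_le_one_add (lux t ht) (h2 t ht) b1 b3, by linarith, by linarith⟩
  · rw [eutt t ht]; exact t1 t ht x
  · obtain ⟨B, h0, hB⟩ := bd s T hs
    refine ⟨1 + (B + B), fun t e1 e2 => ?_⟩
    have ht := hs.trans_le e1
    obtain ⟨b1, b2, b3, b4, b5, b6⟩ := hB t e1 e2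
    exact ⟨(lut t ht).abs_le_one_add (lutx t ht) (y1 t ht) b2 b5, by linarith, by linarith⟩
  · rw [eutx t ht, ← hsymm t ht]; exact t2 t ht x
  · obtain ⟨B, h0, hB⟩ := bd s T hs
    refine ⟨1 + (B + B), fun t e1 e2 => ?_⟩
    have ht := hs.trans_le e1
    obtain ⟨b1, b2, b3, b4, b5, b6⟩ := hB t e1 e2
    exact ⟨(lux t ht).abs_le_one_add (luxx t ht) (y2 t ht) b3 b6, by linarith, by linarith⟩
  · have := hpde t ht.le x
    unfold U nl
    linarith

/-- `g` is a primitive of `g'` on `(τ, ∞)`. -/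
structure AC (τ : ℝ) (g g' : ℝ → ℝ) : Prop where
  int : ∀ s t, τ < s → s ≤ t → IntervalIntegrable g' volume s t
  eq : ∀ s t, τ < s → s ≤ t → g t - g s = ∫ r in s..t, g' r

namespace AC

variable {τ : ℝ} {g g' k k' : ℝ → ℝ}

lemma add (hg : AC τ g g') (hk : AC τ k k') : AC τ (fun t => g t + k t) (fun t => g' t + k' t) where
  int s t hs h := (hg.int s t hs h).add (hk.int s t hs h)
  eq s t hs h := by
    rw [intervalIntegral.integral_add (hg.int s t hs h) (hk.int s t hs h), ← hg.eq s t hs h,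
      ← hk.eq s t hs h]
    ring

lemma const_mul (hg : AC τ g g') (c : ℝ) : AC τ (fun t => c * g t) (fun t => c * g' t) where
  int s t hs h := (hg.int s t hs h).const_mul c
  eq s t hs h := by
    rw [intervalIntegral.integral_const_mul, ← hg.eq s t hs h]
    ring

lemma congr {g₁ g₁' : ℝ → ℝ} (hg : AC τ g g') (h : ∀ t, τ < t → g₁ t = g t)
    (h' : ∀ t, τ < t → g₁' t = g' t) : AC τ g₁ g₁' where
  int s t hs hst := by
    refine (intervalIntegrable_congr fun r hr => ?_).1 (hg.int s t hs hst)
    rw [Set.uIoc_of_le hst] at hr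
    exact (h' r (hs.trans hr.1)).symm
  eq s t hs hst := by
    rw [h t (hs.trans_le hst), h s hs, hg.eq s t hs hst]
    refine intervalIntegral.integral_congr fun r hr => ?_
    rw [Set.uIcc_of_le hst] at hr
    exact (h' r (hs.trans_le hr.1)).symm

lemma hasDerivAt (hg : AC τ g g') (hc : ContinuousOn g' (Set.Ioi τ)) {t : ℝ} (ht : τ < t) :
    HasDerivAt g (g' t) t := by
  obtain ⟨s, hs1, hs2⟩ := exists_between ht
  have hd : HasDerivAt (fun r => g s + ∫ y in s..r, g' y) (g' t) t := by
    refine HasDerivAt.const_add _ ?_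
    exact intervalIntegral.integral_hasDerivAt_right (hg.int s t hs1 hs2.le)
      (hc.stronglyMeasurableAtFilter isOpen_Ioi _ ht) (hc.continuousAt (lt_mem_nhds ht))
  refine hd.congr_of_eventuallyEq ?_
  filter_upwards [lt_mem_nhds hs2] with r hr
  rw [← hg.eq s r hs1 hr.le]; ring

end AC

/-- A primitive of a continuous function. -/
lemma hasDerivAt_primitive {τ s t : ℝ} {φ : ℝ → ℝ} (hc : ContinuousOn φ (Set.Ioi τ)) (hs : τ < s)
    (ht : τ < t) : HasDerivAt (fun r => ∫ y in s..r, φ y) (φ t) t := by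
  refine intervalIntegral.integral_hasDerivAt_right ?_
    (hc.stronglyMeasurableAtFilter isOpen_Ioi _ ht) (hc.continuousAt (lt_mem_nhds ht))
  refine ContinuousOn.intervalIntegrable (hc.mono fun y hy => ?_)
  exact lt_of_lt_of_le (lt_min hs ht) hy.1

lemma TF.ac_mul {τ : ℝ} {a a' b b' : ℝ → ℝ → ℝ} (ha : TF τ a a') (hb : TF τ b b') :
    AC τ (fun t => ∫ x, a t x * b t x) (fun t => (∫ x, a' t x * b t x) + ∫ x, a t x * b' t x) := by
  have h : AC τ (fun t => ∫ x, a t x * b t x) (fun t => ∫ x, (a' t x * b t x + a t x * b' t x)) :=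
    ⟨fun s t hs hst => (ha.integral_mul_sub hb hs hst).1,
      fun s t hs hst => (ha.integral_mul_sub hb hs hst).2⟩
  refine h.congr (fun _ _ => rfl) fun t ht => ?_
  rw [integral_add ((ha.l2' ht).mul_int (hb.l2 ht)) ((ha.l2 ht).mul_int (hb.l2' ht))]

lemma TF.ac_sq {τ : ℝ} {a a' : ℝ → ℝ → ℝ} (ha : TF τ a a') :
    AC τ (fun t => ∫ x, a t x ^ 2) (fun t => 2 * ∫ x, a t x * a' t x) :=
  (ha.ac_mul ha).congr (fun t _ => by simp_rw [pow_two]) fun t _ => by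
    simp_rw [mul_comm (a' t _)]; ring

lemma TF.continuousOn_integral_sq {τ : ℝ} {a a' : ℝ → ℝ → ℝ} (ha : TF τ a a') :
    ContinuousOn (fun t => ∫ x, a t x ^ 2) (Set.Ioi τ) := by
  simpa only [pow_two] using ha.continuousOn_integral_mul ha

/-- A function with nonnegative derivative on a half-line is monotone. -/
lemma mono_of_hasDerivAt {τ : ℝ} {g g' : ℝ → ℝ} (hd : ∀ t, τ < t → HasDerivAt g (g' t) t)
    {s t : ℝ} (hs : τ < s) (hst : s ≤ t) (h0 : ∀ r, s ≤ r → r ≤ t → 0 ≤ g' r) : g s ≤ g t := by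
  rcases hst.eq_or_lt with rfl | hlt
  · exact le_rfl
  obtain ⟨c, hc, e⟩ := exists_hasDerivAt_eq_slope g g' hlt
    (fun r hr => (hd r (hs.trans_le hr.1)).continuousAt.continuousWithinAt)
    (fun r hr => hd r (hs.trans hr.1))
  have := h0 c hc.1.le hc.2.le
  rw [e, div_nonneg_iff] at this
  rcases this with h | h
  · linarith
  · linarith

lemma anti_of_hasDerivAt {τ : ℝ} {g g' : ℝ → ℝ} (hd : ∀ t, τ < t → HasDerivAt g (g' t) t)
    {s t : ℝ} (hs : τ < s) (hst : s ≤ t) (h0 : ∀ r, s ≤ r → r ≤ t → g' r ≤ 0) : g t ≤ g s := by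
  have := mono_of_hasDerivAt (g := fun t => -g t) (g' := fun t => -g' t)
    (fun t ht => (hd t ht).neg) hs hst fun r h1 h2 => neg_nonneg.2 (h0 r h1 h2)
  linarith

/-- A Gronwall inequality. -/
lemma gronwall_le {τ c : ℝ} {g g' : ℝ → ℝ} (hd : ∀ t, τ < t → HasDerivAt g (g' t) t)
    {s t : ℝ} (hs : τ < s) (hst : s ≤ t) (h0 : ∀ r, s ≤ r → r ≤ t → g' r ≤ c * g r) :
    g t ≤ exp (c * (t - s)) * g s := by
  have h : ∀ r, τ < r → HasDerivAt (fun r => exp (-c * r) * g r)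
      (exp (-c * r) * (g' r - c * g r)) r := fun r hr => by
    have h1 : HasDerivAt (fun r => exp (-c * r)) (exp (-c * r) * (-c)) r := by
      simpa using ((hasDerivAt_id r).const_mul (-c)).exp
    refine (h1.mul (hd r hr)).congr_deriv ?_
    ring
  have := anti_of_hasDerivAt h hs hst fun r h1 h2 =>
    mul_nonpos_of_nonneg_of_nonpos (exp_pos _).le (by linarith [h0 r h1 h2])
  have e : exp (c * (t - s)) * g s = exp (c * t) * (exp (-c * s) * g s) := by
    rw [← mul_assoc, ← exp_add]; ring_nf
  have e2 : g t = exp (c * t) * (exp (-c * t) * g t) := by rw [← mul_assoc, ← exp_add]; simp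
  rw [e, e2]
  exact mul_le_mul_of_nonneg_left this (exp_pos _).le

lemma gronwall_ge {τ c : ℝ} {g g' : ℝ → ℝ} (hd : ∀ t, τ < t → HasDerivAt g (g' t) t)
    {s t : ℝ} (hs : τ < s) (hst : s ≤ t) (h0 : ∀ r, s ≤ r → r ≤ t → c * g r ≤ g' r) :
    exp (c * (t - s)) * g s ≤ g t := by
  have := gronwall_le (g := fun t => -g t) (g' := fun t => -g' t) (c := c)
    (fun t ht => (hd t ht).neg) hs hst fun r h1 h2 => by linarith [h0 r h1 h2]
  linarith

/-- A mean value property: a continuous function takes a value at most its average. -/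
lemma exists_le_average {τ s t : ℝ} {φ : ℝ → ℝ} (hc : ContinuousOn φ (Set.Ioi τ)) (hs : τ < s)
    (hst : s < t) : ∃ r, s ≤ r ∧ r ≤ t ∧ φ r * (t - s) ≤ ∫ y in s..t, φ y := by
  obtain ⟨c, hc, e⟩ := exists_hasDerivAt_eq_slope (fun r => ∫ y in s..r, φ y) φ hst
    (fun r hr => (hasDerivAt_primitive hc hs (hs.trans_le hr.1)).continuousAt.continuousWithinAt)
    (fun r hr => hasDerivAt_primitive hc hs (hs.trans hr.1))
  refine ⟨c, hc.1.le, hc.2.le, ?_⟩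
  rw [e, div_mul_cancel₀ _ (by linarith)]
  simp

/-- The (squared) energy norm. -/
noncomputable def nrm (u : ℝ × ℝ → ℝ) (t : ℝ) : ℝ :=
  (∫ x, ut u t x ^ 2) + (∫ x, ux u t x ^ 2) + ∫ x, U u t x ^ 2

/-- The energy. -/
noncomputable def energy (p : ℝ) (u : ℝ × ℝ → ℝ) (t : ℝ) : ℝ :=
  2⁻¹ * nrm u t - (p + 1)⁻¹ * ∫ x, nl p (U u t x) * U u t x

lemma nrm_nonneg (u : ℝ × ℝ → ℝ) (t : ℝ) : 0 ≤ nrm u t :=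
  add_nonneg (add_nonneg (integral_sq_nonneg _) (integral_sq_nonneg _)) (integral_sq_nonneg _)

namespace Sol

variable {p α : ℝ} {u : ℝ × ℝ → ℝ}

lemma tf_nl (S : Sol p α u) (hp : 2 < p) :
    TF 0 (fun t x => nl p (U u t x)) (fun t x => dnl p (U u t x) * ut u t x) :=
  S.tu.comp (hasDerivAt_nl hp) (continuous_dnl hp) nl_zero

lemma integral_mul_utt (S : Sol p α u) (hp : 2 < p) {t : ℝ} (ht : 0 < t) {b b' : ℝ → ℝ}
    (hb : L2c b) (hb' : L2c b') (hd : ∀ x, HasDerivAt b (b' x) x) :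
    ∫ x, b x * utt u t x = -(∫ x, b' x * ux u t x) - (∫ x, b x * U u t x)
      + (∫ x, b x * nl p (U u t x)) - 2 * α * ∫ x, b x * ut u t x := by
  have hf := (S.tf_nl hp).l2 ht
  have lu := S.tu.l2 ht
  have lut := S.tut.l2 ht
  have lux := S.tux.l2 ht
  have luxx := S.l2uxx t ht
  have e : ∀ x, b x * utt u t x = b x * uxx u t x - b x * U u t x + b x * nl p (U u t x)
      - (2 * α) * (b x * ut u t x) := fun x => by rw [S.eq t ht]; ring
  simp_rw [e]
  rw [integral_sub (by exact ((hb.mul_int luxx).sub (hb.mul_int lu)).add (hb.mul_int hf))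
      ((hb.mul_int lut).const_mul _),
    integral_add (by exact (hb.mul_int luxx).sub (hb.mul_int lu)) (hb.mul_int hf),
    integral_sub (hb.mul_int luxx) (hb.mul_int lu), integral_const_mul,
    hb.ibp hb' lux luxx hd (S.dxx t ht)]

lemma continuousOn_nrm (S : Sol p α u) : ContinuousOn (nrm u) (Set.Ioi 0) :=
  (S.tut.continuousOn_integral_sq.add S.tux.continuousOn_integral_sq).add
    S.tu.continuousOn_integral_sq

lemma hasDerivAt_sq (S : Sol p α u) {t : ℝ} (ht : 0 < t) :
    HasDerivAt (fun t => ∫ x, U u t x ^ 2) (2 * ∫ x, U u t x * ut u t x) t :=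
  S.tu.ac_sq.hasDerivAt (continuousOn_const.mul (S.tu.continuousOn_integral_mul S.tut)) ht

lemma hasDerivAt_nrm (S : Sol p α u) (hp : 2 < p) {t : ℝ} (ht : 0 < t) :
    HasDerivAt (nrm u) (2 * (∫ x, nl p (U u t x) * ut u t x) - 4 * α * ∫ x, ut u t x ^ 2) t := by
  refine (((S.tut.ac_sq.add S.tux.ac_sq).add S.tu.ac_sq).congr (fun _ _ => rfl)
    (g₁' := fun t => 2 * (∫ x, nl p (U u t x) * ut u t x) - 4 * α * ∫ x, ut u t x ^ 2)
    fun t ht => ?_).hasDerivAt ?_ ht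
  · rw [S.integral_mul_utt hp ht (S.tut.l2 ht) (S.tux.l2' ht) (S.dtx t ht)]
    simp_rw [pow_two, mul_comm (utx u t _), mul_comm (ut u t _) (U u t _),
      mul_comm (nl p _) (ut u t _)]
    ring
  · exact (continuousOn_const.mul ((S.tf_nl hp).continuousOn_integral_mul S.tut)).sub
      (continuousOn_const.mul S.tut.continuousOn_integral_sq)

lemma hasDerivAt_energy (S : Sol p α u) (hp : 2 < p) {t : ℝ} (ht : 0 < t) :
    HasDerivAt (energy p u) (-(2 * α) * ∫ x, ut u t x ^ 2) t := by
  have h1 : HasDerivAt (fun t => ∫ x, nl p (U u t x) * U u t x)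
      ((p + 1) * ∫ x, nl p (U u t x) * ut u t x) t := by
    refine (((S.tf_nl hp).ac_mul S.tu).congr (fun _ _ => rfl)
      (g₁' := fun t => (p + 1) * ∫ x, nl p (U u t x) * ut u t x)
      fun t ht => ?_).hasDerivAt ?_ ht
    · have e : ∀ x, dnl p (U u t x) * ut u t x * U u t x = p * (nl p (U u t x) * ut u t x) :=
        fun x => by unfold dnl nl; ring
      simp_rw [e]
      rw [integral_const_mul]; ring
    · exact continuousOn_const.mul ((S.tf_nl hp).continuousOn_integral_mul S.tut)
  refine (((S.hasDerivAt_nrm hp ht).const_mul 2⁻¹).sub (h1.const_mul (p + 1)⁻¹)).congr_deriv ?_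
  have : p + 1 ≠ 0 := by linarith
  field_simp
  ring

/-- The virial quantity `d/dt ‖u‖² + 2α ‖u‖²`. -/
noncomputable def vir (α : ℝ) (u : ℝ × ℝ → ℝ) (t : ℝ) : ℝ :=
  2 * (∫ x, U u t x * ut u t x) + 2 * α * ∫ x, U u t x ^ 2

lemma hasDerivAt_vir (S : Sol p α u) (hp : 2 < p) {t : ℝ} (ht : 0 < t) :
    HasDerivAt (vir α u) ((p + 3) * (∫ x, ut u t x ^ 2)
      + (p - 1) * ((∫ x, ux u t x ^ 2) + ∫ x, U u t x ^ 2) - 2 * (p + 1) * energy p u t) t := by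
  have hE : ContinuousOn (energy p u) (Set.Ioi 0) := fun t ht =>
    (S.hasDerivAt_energy hp ht).continuousAt.continuousWithinAt
  refine ((((S.tu.ac_mul S.tut).const_mul 2).add (S.tu.ac_sq.const_mul (2 * α))).congr
    (fun _ _ => rfl) (g₁' := fun t => (p + 3) * (∫ x, ut u t x ^ 2)
      + (p - 1) * ((∫ x, ux u t x ^ 2) + ∫ x, U u t x ^ 2) - 2 * (p + 1) * energy p u t)
    fun t ht => ?_).hasDerivAt ?_ ht
  · rw [S.integral_mul_utt hp ht (S.tu.l2 ht) (S.tux.l2 ht) (S.dx t ht)]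
    unfold energy nrm
    simp_rw [mul_comm (nl p _), pow_two]
    have : p + 1 ≠ 0 := by linarith
    field_simp
    ring
  · exact ((continuousOn_const.mul S.tut.continuousOn_integral_sq).add (continuousOn_const.mul
      (S.tux.continuousOn_integral_sq.add S.tu.continuousOn_integral_sq))).sub
      (continuousOn_const.mul hE)

lemma energy_anti (S : Sol p α u) (hp : 2 < p) (hα : 0 < α) {s t : ℝ} (hs : 0 < s)
    (hst : s ≤ t) : energy p u t ≤ energy p u s :=
  anti_of_hasDerivAt (fun t ht => S.hasDerivAt_energy hp ht) hs hst fun r _ _ => by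
    have := integral_sq_nonneg (ut u r)
    have : 0 ≤ 2 * α * ∫ x, ut u r x ^ 2 := by positivity
    linarith

lemma quadratic_nonneg (S : Sol p α u) {t : ℝ} (ht : 0 < t) (r : ℝ) :
    0 ≤ (∫ x, U u t x ^ 2) * r ^ 2 + 2 * (∫ x, U u t x * ut u t x) * r + ∫ x, ut u t x ^ 2 := by
  have lu := S.tu.l2 ht
  have lut := S.tut.l2 ht
  have h := integral_sq_nonneg (fun x => U u t x * r + ut u t x)
  have e : ∀ x, (U u t x * r + ut u t x) ^ 2
      = r ^ 2 * U u t x ^ 2 + (2 * r) * (U u t x * ut u t x) + ut u t x ^ 2 := fun x => by ring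
  simp_rw [e] at h
  rw [integral_add (by exact (lu.int.const_mul _).add ((lu.mul_int lut).const_mul _)) lut.int,
    integral_add (lu.int.const_mul _) ((lu.mul_int lut).const_mul _), integral_const_mul,
    integral_const_mul] at h
  linarith

/-- The energy of a global solution is nonnegative. -/
lemma energy_nonneg (S : Sol p α u) (hp : 2 < p) (hα : 0 < α) {t₀ : ℝ} (h0 : 0 < t₀) :
    0 ≤ energy p u t₀ := by
  by_contra! hneg
  set N : ℝ → ℝ := fun t => ∫ x, U u t x ^ 2 with hN
  set E := energy p u
  set G : ℝ → ℝ := fun t => N t + 2 * α * ∫ r in t₀..t, N r with hG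
  have hNc : ContinuousOn N (Set.Ioi 0) := S.tu.continuousOn_integral_sq
  have hN0 : ∀ t, 0 ≤ N t := fun t => integral_sq_nonneg _
  have dI : ∀ t, 0 < t → HasDerivAt (fun t => ∫ r in t₀..t, N r) (N t) t := fun t ht =>
    hasDerivAt_primitive hNc h0 ht
  have dG : ∀ t, 0 < t → HasDerivAt G (vir α u t) t := fun t ht => by
    refine ((S.hasDerivAt_sq ht).add ((dI t ht).const_mul (2 * α))).congr_deriv ?_
    unfold vir; rfl
  have hGnn : ∀ t, t₀ ≤ t → 0 ≤ G t := fun t ht =>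
    add_nonneg (hN0 t) (mul_nonneg (by positivity)
      (intervalIntegral.integral_nonneg ht fun r _ => hN0 r))
  have hdisc : ∀ t, t₀ ≤ t → (vir α u t - 2 * α * N t₀) ^ 2
      ≤ 4 * G t * ((∫ x, ut u t x ^ 2) + (E t₀ - E t)) := by
    intro t ht
    have hq : ∀ r : ℝ, 0 ≤ G t * (r * r) + (vir α u t - 2 * α * N t₀) * r
        + ((∫ x, ut u t x ^ 2) + (E t₀ - E t)) := by
      intro r
      have d1 : ∀ t, 0 < t → HasDerivAt (fun t => 2 * α * r ^ 2 * (∫ y in t₀..t, N y)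
          + 2 * α * r * N t - E t) (2 * α * (N t * r ^ 2 + 2 * (∫ x, U u t x * ut u t x) * r
          + ∫ x, ut u t x ^ 2)) t := fun t ht => by
        refine ((((dI t ht).const_mul (2 * α * r ^ 2)).add
          ((S.hasDerivAt_sq ht).const_mul (2 * α * r))).sub
          (S.hasDerivAt_energy hp ht)).congr_deriv ?_
        ring
      have m := mono_of_hasDerivAt d1 h0 ht fun y hy _ =>
        mul_nonneg (by positivity) (S.quadratic_nonneg (h0.trans_le hy) r)
      simp only [intervalIntegral.integral_same] at m
      have := S.quadratic_nonneg (h0.trans_le ht) r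
      simp only [hG, hN, vir] at m ⊢
      linarith
    have := discrim_le_zero hq
    unfold discrim at this
    linarith
  set h' : ℝ → ℝ := fun t => (p + 3) * (∫ x, ut u t x ^ 2)
      + (p - 1) * ((∫ x, ux u t x ^ 2) + ∫ x, U u t x ^ 2) - 2 * (p + 1) * E t with hh'
  have dv : ∀ t, 0 < t → HasDerivAt (vir α u) (h' t) t := fun t ht => S.hasDerivAt_vir hp ht
  have hlow : ∀ t, t₀ ≤ t → (p + 3) * ((∫ x, ut u t x ^ 2) + (E t₀ - E t)) ≤ h' t ∧
      -(E t₀) ≤ h' t := by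
    intro t ht
    have a1 : 0 ≤ ∫ x, ut u t x ^ 2 := integral_sq_nonneg _
    have a2 : 0 ≤ ∫ x, ux u t x ^ 2 := integral_sq_nonneg _
    have a3 : 0 ≤ ∫ x, U u t x ^ 2 := integral_sq_nonneg _
    have a4 : E t ≤ E t₀ := S.energy_anti hp hα h0 ht
    have b1 : 0 ≤ (p - 1) * ((∫ x, ux u t x ^ 2) + ∫ x, U u t x ^ 2) :=
      mul_nonneg (by linarith) (by linarith)
    have b2 : 0 ≤ (p + 3) * ∫ x, ut u t x ^ 2 := mul_nonneg (by linarith) a1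
    constructor
    · have : 0 ≤ (p - 1) * (E t₀ - E t) := mul_nonneg (by linarith) (by linarith)
      have : 0 ≤ (p + 1) * (-E t₀) := mul_nonneg (by linarith) (by linarith)
      simp only [hh']
      linarith
    · have : 0 ≤ (2 * p + 1) * (-E t) := mul_nonneg (by linarith) (by linarith)
      simp only [hh']
      linarith
  have hconv : ∀ t, t₀ ≤ t → 5 / 4 * (vir α u t - 2 * α * N t₀) ^ 2 ≤ G t * h' t := by
    intro t ht
    have e1 := hdisc t ht
    have e2 := mul_le_mul_of_nonneg_left (hlow t ht).1 (hGnn t ht)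
    have e3 : (0:ℝ) ≤ (p - 2) * (vir α u t - 2 * α * N t₀) ^ 2 :=
      mul_nonneg (by linarith) (sq_nonneg _)
    have e4 := mul_le_mul_of_nonneg_left e1 (by linarith : (0:ℝ) ≤ p + 3)
    linarith
  obtain ⟨t₁, ht₁, hbig⟩ : ∃ t₁, t₀ ≤ t₁ ∧ ∀ t, t₁ ≤ t → 40 * α * N t₀ + 1 ≤ vir α u t := by
    set L := 40 * α * N t₀ + 1 + |vir α u t₀| with hL
    have hL0 : 0 ≤ L := by
      have := hN0 t₀
      positivity
    refine ⟨t₀ + L / (-(E t₀)), ?_, fun t ht => ?_⟩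
    · have : 0 ≤ L / (-(E t₀)) := div_nonneg hL0 (by linarith)
      linarith
    · have ht0 : t₀ ≤ t := by
        have : 0 ≤ L / (-(E t₀)) := div_nonneg hL0 (by linarith)
        linarith
      have m := mono_of_hasDerivAt (g := fun t => vir α u t - (-(E t₀)) * t)
        (fun t ht => (dv t ht).sub ((hasDerivAt_id t).const_mul (-(E t₀)))) h0 ht0
        fun r hr _ => by have := (hlow r hr).2; linarith
      have : L ≤ (t - t₀) * (-(E t₀)) := by rw [← div_le_iff₀ (by linarith)]; linarith
      have := neg_abs_le (vir α u t₀)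
      linarith
  have hpos : ∀ t, t₁ < t → 0 < vir α u t := fun t ht => by
    have := hbig t ht.le
    have := mul_nonneg hα.le (hN0 t₀)
    linarith
  have ht1 : 0 < t₁ := h0.trans_le ht₁
  have dq : ∀ t, t₁ < t → HasDerivAt (fun t => G t / vir α u t + t / 8)
      ((vir α u t * vir α u t - G t * h' t) / vir α u t ^ 2 + 1 / 8) t := fun t ht =>
    ((dG t (ht1.trans ht)).div (dv t (ht1.trans ht)) (hpos t ht).ne').add
      ((hasDerivAt_id t).div_const 8)
  have hle : ∀ t, t₁ < t → (vir α u t * vir α u t - G t * h' t) / vir α u t ^ 2 + 1 / 8 ≤ 0 := by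
    intro t ht
    have hv := hpos t ht
    have e1 := hconv t (ht₁.trans ht.le)
    have e2 : 19 / 20 * vir α u t ≤ vir α u t - 2 * α * N t₀ := by
      have := hbig t ht.le
      linarith
    have e3 : (19 / 20 * vir α u t) ^ 2 ≤ (vir α u t - 2 * α * N t₀) ^ 2 :=
      pow_le_pow_left₀ (by positivity) e2 2
    have : (vir α u t * vir α u t - G t * h' t) / vir α u t ^ 2 ≤ -1 / 8 := by
      rw [div_le_iff₀ (by positivity)]
      nlinarith [sq_nonneg (vir α u t)]
    linarith
  set s := t₁ + 1
  set q := G s / vir α u s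
  have hs1 : t₁ < s := lt_add_one _
  have hq0 : 0 ≤ q := div_nonneg (hGnn s (ht₁.trans hs1.le)) (hpos s hs1).le
  have hfin := anti_of_hasDerivAt dq hs1 (t := s + (8 * q + 8)) (by linarith)
    fun r hr _ => hle r (hs1.trans_le hr)
  have hq1 : 0 ≤ G (s + (8 * q + 8)) / vir α u (s + (8 * q + 8)) :=
    div_nonneg (hGnn _ (by linarith)) (hpos _ (by linarith)).le
  have : G s / vir α u s = q := rfl
  linarith

/-- The dissipation identity bounds the time integral of `‖∂ₜu‖²`. -/
lemma two_alpha_integral_ut (S : Sol p α u) (hp : 2 < p) {s t : ℝ} (hs : 0 < s) (hst : s ≤ t) :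
    2 * α * (∫ r in s..t, ∫ x, ut u r x ^ 2) = energy p u s - energy p u t := by
  have hc : ContinuousOn (fun t => ∫ x, ut u t x ^ 2) (Set.Ioi 0) := S.tut.continuousOn_integral_sq
  have h := intervalIntegral.integral_eq_sub_of_hasDerivAt_of_le (f := energy p u)
    (f' := fun t => -(2 * α) * ∫ x, ut u t x ^ 2) hst
    (fun r hr => (S.hasDerivAt_energy hp (hs.trans_le hr.1)).continuousAt.continuousWithinAt)
    (fun r hr => S.hasDerivAt_energy hp (hs.trans hr.1))
    (ContinuousOn.intervalIntegrable ((continuousOn_const.mul hc).mono fun r hr => by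
      rw [Set.uIcc_of_le hst] at hr; exact hs.trans_le hr.1))
  rw [intervalIntegral.integral_const_mul] at h
  linarith

lemma vir_le (S : Sol p α u) (hp : 2 < p) (hα : 0 < α) :
    ∃ H, 0 ≤ H ∧ ∀ t, 1 ≤ t → vir α u t ≤ H := by
  set A : ℝ → ℝ := fun t => ∫ x, ut u t x ^ 2 with hA
  set P : ℝ → ℝ := fun t => ∫ x, ux u t x ^ 2 with hP
  set N : ℝ → ℝ := fun t => ∫ x, U u t x ^ 2 with hN
  set E := energy p u with hE
  have hA0 : ∀ t, 0 ≤ A t := fun t => integral_sq_nonneg _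
  have hP0 : ∀ t, 0 ≤ P t := fun t => integral_sq_nonneg _
  have hN0 : ∀ t, 0 ≤ N t := fun t => integral_sq_nonneg _
  have hE0 : ∀ t, 0 < t → 0 ≤ E t := fun t ht => S.energy_nonneg hp hα ht
  have hE1 : ∀ t, 1 ≤ t → E t ≤ E 1 := fun t ht => S.energy_anti hp hα one_pos ht
  have hy : ∀ t, 0 < t → ∀ r, 0 < r →
      2 * |∫ x, U u t x * ut u t x| ≤ r * N t + r⁻¹ * A t := fun t ht r hr =>
    (S.tu.l2 ht).young (S.tut.l2 ht) hr
  have e1pos : 0 ≤ E 1 := hE0 1 one_pos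
  set c := (p - 1) / (4 * α) with hc
  have hcpos : 0 < c := div_pos (by linarith) (by linarith)
  set k := c / (4 * α ^ 2) with hk
  have hkpos : 0 < k := by positivity
  set C0 := 2 * (p + 1) * E 1 with hC0
  have hC0n : 0 ≤ C0 := mul_nonneg (by linarith) e1pos
  have h2M : ∀ t, 1 ≤ t → vir α u t ≤ 4 * α * N t + (2 * α)⁻¹ * A t := by
    intro t ht
    have h1 := hy t (by linarith) (2 * α) (by linarith)
    have h2 := le_abs_self (∫ x, U u t x * ut u t x)
    simp only [vir, hN] at *
    linarith
  set g : ℝ → ℝ := fun t => vir α u t - k * E t - C0 / c with hg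
  have dg : ∀ t, 0 < t → HasDerivAt g ((p + 3) * A t + (p - 1) * (P t + N t)
      - 2 * (p + 1) * E t + 2 * α * k * A t) t := fun t ht => by
    refine (((S.hasDerivAt_vir hp ht).sub ((S.hasDerivAt_energy hp ht).const_mul k)).sub
      (hasDerivAt_const _ (C0 / c))).congr_deriv ?_
    simp only [hA, hP, hN, hE]
    ring
  have hgrow : ∀ t, 1 ≤ t → c * g t ≤ (p + 3) * A t + (p - 1) * (P t + N t)
      - 2 * (p + 1) * E t + 2 * α * k * A t := by
    intro t ht
    have h1 := mul_le_mul_of_nonneg_left (h2M t ht) hcpos.le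
    have e2 : c * (4 * α * N t + (2 * α)⁻¹ * A t) = (p - 1) * N t + 2 * α * k * A t := by
      rw [hk, hc]; field_simp; ring
    have e3 : c * (C0 / c) = C0 := by field_simp
    have e4 : (p + 1) * E t ≤ (p + 1) * E 1 := mul_le_mul_of_nonneg_left (hE1 t ht) (by linarith)
    have e5 : 0 ≤ c * (k * E t) := by have := hE0 t (by linarith); positivity
    have e6 : 0 ≤ (p + 3) * A t := mul_nonneg (by linarith) (hA0 t)
    have e7 : 0 ≤ (p - 1) * P t := mul_nonneg (by linarith) (hP0 t)
    have : c * g t = c * vir α u t - c * (k * E t) - c * (C0 / c) := by simp only [hg]; ring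
    rw [this, e3]
    linarith
  have hgle : ∀ s, 1 ≤ s → g s ≤ 0 := by
    intro s hs
    by_contra! hpos
    set ε := c / 2 with hε
    have hεpos : 0 < ε := by positivity
    set C := N s + (2 * α * ε)⁻¹ * E s
    have hCn : 0 ≤ C := by
      have := hN0 s
      have := hE0 s (by linarith)
      positivity
    have hNle : ∀ t, s ≤ t → N t ≤ exp (ε * (t - s)) * C := by
      intro t ht
      have dn : ∀ t, 0 < t → HasDerivAt (fun t => N t + (2 * α * ε)⁻¹ * E t)
          (2 * (∫ x, U u t x * ut u t x) - ε⁻¹ * A t) t := fun t ht => by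
        refine ((S.hasDerivAt_sq ht).add
          ((S.hasDerivAt_energy hp ht).const_mul (2 * α * ε)⁻¹)).congr_deriv ?_
        simp only [hA]
        field_simp
        ring
      have := gronwall_le (c := ε) dn (show 0 < s by linarith) ht fun r hr _ => by
        have h1 := hy r (by linarith) ε hεpos
        have h2 := le_abs_self (∫ x, U u r x * ut u r x)
        have h3 : 0 ≤ ε * ((2 * α * ε)⁻¹ * E r) := by
          have := hE0 r (by linarith)
          positivity
        linarith
      have h4 : 0 ≤ (2 * α * ε)⁻¹ * E t := by
        have := hE0 t (by linarith)
        positivity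
      linarith
    set a := g s / c with ha
    have hapos : 0 < a := by positivity
    set b := 2 * α * C / ε with hb
    have hbn : 0 ≤ b := by positivity
    have dexp : ∀ d t : ℝ, HasDerivAt (fun t => exp (d * (t - s)))
        (d * exp (d * (t - s))) t := fun d t => by
      have := (((hasDerivAt_id t).sub_const s).const_mul d).exp
      simpa [mul_comm] using this
    have key : ∀ t, s ≤ t → a * exp (c * (t - s)) ≤ (C + b) * exp (ε * (t - s)) + a := by
      intro t ht
      have dψ : ∀ t, 0 < t → HasDerivAt (fun t => N t - a * exp (c * (t - s))
          + b * exp (ε * (t - s)))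
          (2 * (∫ x, U u t x * ut u t x) - a * (c * exp (c * (t - s)))
            + b * (ε * exp (ε * (t - s)))) t := fun t ht =>
        ((S.hasDerivAt_sq ht).sub ((dexp c t).const_mul a)).add ((dexp ε t).const_mul b)
      have m := mono_of_hasDerivAt dψ (show 0 < s by linarith) ht fun r hr _ => by
        have h1 := gronwall_ge dg (show 0 < s by linarith) hr fun y hy _ => hgrow y (hs.trans hy)
        have h2 := mul_le_mul_of_nonneg_left (hNle r hr) (show 0 ≤ 2 * α by linarith)
        have e1 : a * (c * exp (c * (r - s))) = exp (c * (r - s)) * g s := by rw [ha]; field_simp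
        have e2 : b * (ε * exp (ε * (r - s))) = 2 * α * (exp (ε * (r - s)) * C) := by
          rw [hb]; field_simp
        have h3 : g r ≤ vir α u r := by
          have : 0 ≤ k * E r := by have := hE0 r (by linarith); positivity
          have : 0 ≤ C0 / c := by positivity
          simp only [hg]; linarith
        rw [e1, e2]
        simp only [vir] at h3
        linarith
      simp only [sub_self, mul_zero, exp_zero, mul_one] at m
      have h1 := hNle t ht
      have h2 := hN0 s
      linarith
    set x := (C + b + a) / a + 1 with hx
    have hx1 : 1 ≤ x := by
      have : 0 ≤ (C + b + a) / a := by positivity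
      linarith
    have hk2 := key (s + log x / ε) (by
      have := log_nonneg hx1
      have : 0 ≤ log x / ε := by positivity
      linarith)
    have e1 : exp (ε * (s + log x / ε - s)) = x := by
      rw [show ε * (s + log x / ε - s) = log x by field_simp; ring, exp_log (by linarith)]
    have e2 : exp (c * (s + log x / ε - s)) = x ^ 2 := by
      rw [show c * (s + log x / ε - s) = log x + log x by
        rw [hε]; field_simp; ring, exp_add, exp_log (by linarith), pow_two]
    rw [e1, e2] at hk2
    have h1 : a * x = C + b + 2 * a := by rw [hx]; field_simp; ring
    have h2 : a ≤ a * x := le_mul_of_one_le_right hapos.le hx1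
    have h3 : a * x ^ 2 = (C + b + 2 * a) * x := by rw [← h1]; ring
    have h4 : a * 1 ≤ a * x := mul_le_mul_of_nonneg_left hx1 hapos.le
    linarith
  refine ⟨k * E 1 + C0 / c, by positivity, fun t ht => ?_⟩
  have h1 := hgle t ht
  have h2 := mul_le_mul_of_nonneg_left (hE1 t ht) hkpos.le
  simp only [hg] at h1
  linarith

/-- Bounds on the `L²` norm and on time averages of the energy norm. -/
lemma exists_window_bound (S : Sol p α u) (hp : 2 < p) (hα : 0 < α) :
    ∃ C, 0 ≤ C ∧ (∀ t, 1 ≤ t → ∫ x, U u t x ^ 2 ≤ C) ∧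
      ∀ t, 2 ≤ t → ∫ r in (t - 1)..t, nrm u r ≤ C := by
  obtain ⟨H, hH0, hH⟩ := S.vir_le hp hα
  have e1pos : 0 ≤ energy p u 1 := S.energy_nonneg hp hα one_pos
  set B := (∫ x, U u 1 x ^ 2) + H / (2 * α) with hB
  have hB0 : 0 ≤ B := add_nonneg (integral_sq_nonneg _) (by positivity)
  have hN : ∀ t, 1 ≤ t → ∫ x, U u t x ^ 2 ≤ B := by
    intro t ht
    have d : ∀ t, 0 < t → HasDerivAt (fun t => (∫ x, U u t x ^ 2) - H / (2 * α))
        (2 * ∫ x, U u t x * ut u t x) t := fun t ht => (S.hasDerivAt_sq ht).sub_const _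
    have h1 := gronwall_le (c := -(2 * α)) d one_pos ht fun r hr _ => by
      have h := hH r hr
      simp only [vir] at h
      have : -(2 * α) * ((∫ x, U u r x ^ 2) - H / (2 * α)) = -(2 * α) * (∫ x, U u r x ^ 2) + H := by
        field_simp
        ring
      linarith
    have h2 : exp (-(2 * α) * (t - 1)) ≤ 1 := by
      rw [exp_le_one_iff]
      have : 0 ≤ 2 * α * (t - 1) := mul_nonneg (by linarith) (by linarith)
      linarith
    have h3 : 0 ≤ ∫ x, U u 1 x ^ 2 := integral_sq_nonneg _
    have h4 := mul_le_mul_of_nonneg_right h2 h3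
    have h5 : 0 ≤ exp (-(2 * α) * (t - 1)) * (H / (2 * α)) := by positivity
    have e : exp (-(2 * α) * (t - 1)) * ((∫ x, U u 1 x ^ 2) - H / (2 * α))
      = exp (-(2 * α) * (t - 1)) * (∫ x, U u 1 x ^ 2)
        - exp (-(2 * α) * (t - 1)) * (H / (2 * α)) := by ring
    linarith
  set A₁ := energy p u 1 / (2 * α) with hA₁
  have hA₁0 : 0 ≤ A₁ := by positivity
  set W := H + B + A₁ + 4 * (p + 1) * energy p u 1 with hW
  have hW0 : 0 ≤ W := by
    have : 0 ≤ 4 * (p + 1) * energy p u 1 := mul_nonneg (by linarith) e1pos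
    linarith
  have hwin : ∀ t, 3 ≤ t → ∫ r in (t - 1)..t, nrm u r ≤ W / (p - 1) := by
    intro t ht
    obtain ⟨s, hs1, hs2, hs⟩ := exists_le_average S.tut.continuousOn_integral_sq
      (show 0 < t - 2 by linarith) (show t - 2 < t - 1 by linarith)
    have hAs : ∫ x, ut u s x ^ 2 ≤ A₁ := by
      have h1 := S.two_alpha_integral_ut hp (show 0 < t - 2 by linarith)
        (show t - 2 ≤ t - 1 by linarith)
      have h2 := S.energy_nonneg hp hα (show 0 < t - 1 by linarith)
      have h3 := S.energy_anti hp hα one_pos (show 1 ≤ t - 2 by linarith)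
      rw [hA₁, le_div_iff₀ (by linarith)]
      have h4 := mul_le_mul_of_nonneg_left hs (show 0 ≤ 2 * α by linarith)
      linarith
    have hvs : -(B + A₁) ≤ vir α u s := by
      have h1 := (S.tu.l2 (show 0 < s by linarith)).young (S.tut.l2 (show 0 < s by linarith)) one_pos
      have h2 := hN s (by linarith)
      have h3 := neg_abs_le (∫ x, U u s x * ut u s x)
      have h4 : 0 ≤ 2 * α * ∫ x, U u s x ^ 2 := mul_nonneg (by linarith) (integral_sq_nonneg _)
      simp only [vir]
      linarith
    have d : ∀ t, 0 < t → HasDerivAt (fun t => vir α u t - (p - 1) * (∫ r in s..t, nrm u r)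
        + 2 * (p + 1) * energy p u 1 * t) _ t := fun t ht =>
      ((S.hasDerivAt_vir hp ht).sub ((hasDerivAt_primitive S.continuousOn_nrm
        (show 0 < s by linarith) ht).const_mul (p - 1))).add
        ((hasDerivAt_id t).const_mul (2 * (p + 1) * energy p u 1))
    have m := mono_of_hasDerivAt d (show 0 < s by linarith) (show s ≤ t by linarith)
      fun r hr _ => by
        have h1 := S.energy_anti hp hα one_pos (show 1 ≤ r by linarith)
        have h2 := mul_le_mul_of_nonneg_left h1 (show 0 ≤ p + 1 by linarith)
        have h3 : 0 ≤ ∫ x, ut u r x ^ 2 := integral_sq_nonneg _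
        simp only [nrm]
        linarith
    simp only [intervalIntegral.integral_same] at m
    have h5 := hH t (by linarith)
    have hci : ∀ a b : ℝ, 0 < a → 0 < b → IntervalIntegrable (nrm u) volume a b :=
      fun a b ha hb => (S.continuousOn_nrm.mono fun y hy =>
        lt_of_lt_of_le (lt_min ha hb) hy.1).intervalIntegrable
    have h6 := intervalIntegral.integral_add_adjacent_intervals
      (hci s (t - 1) (by linarith) (by linarith)) (hci (t - 1) t (by linarith) (by linarith))
    have h7 : 0 ≤ ∫ r in s..(t - 1), nrm u r :=
      intervalIntegral.integral_nonneg hs2 fun r _ => nrm_nonneg u r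
    rw [le_div_iff₀ (by linarith)]
    have h8 : (p - 1) * (∫ r in (t - 1)..t, nrm u r) ≤ (p - 1) * ∫ r in s..t, nrm u r :=
      mul_le_mul_of_nonneg_left (by linarith) (by linarith)
    have h9 : 2 * (p + 1) * energy p u 1 * (t - s) ≤ 2 * (p + 1) * energy p u 1 * 2 :=
      mul_le_mul_of_nonneg_left (by linarith) (mul_nonneg (by linarith) e1pos)
    linarith
  have hci : IntervalIntegrable (nrm u) volume 1 3 := (S.continuousOn_nrm.mono fun y hy => by
      rw [Set.uIcc_of_le (by norm_num)] at hy
      exact lt_of_lt_of_le one_pos hy.1).intervalIntegrable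
  have hW1 : 0 ≤ W / (p - 1) := div_nonneg hW0 (by linarith)
  have hi0 : 0 ≤ ∫ r in (1:ℝ)..3, nrm u r :=
    intervalIntegral.integral_nonneg (by norm_num) fun r _ => nrm_nonneg u r
  refine ⟨B + W / (p - 1) + ∫ r in (1:ℝ)..3, nrm u r, by positivity, fun t ht =>
    (hN t ht).trans (by linarith), fun t ht => ?_⟩
  rcases le_total 3 t with h | h
  · exact (hwin t h).trans (by linarith)
  · have : ∫ r in (t - 1)..t, nrm u r ≤ ∫ r in (1:ℝ)..3, nrm u r :=
      intervalIntegral.integral_mono_interval (by linarith) (by linarith) h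
        (Eventually.of_forall fun r => nrm_nonneg u r) hci
    linarith

lemma tf_pow (S : Sol p α u) (n : ℕ) : TF 0 (fun t x => U u t x ^ (n + 1))
    (fun t x => ((n : ℝ) + 1) * U u t x ^ n * ut u t x) :=
  S.tu.comp (φ := fun s => s ^ (n + 1)) (φ' := fun s => ((n : ℝ) + 1) * s ^ n)
    (fun s => by simpa using hasDerivAt_pow (n + 1) s) (by fun_prop) (by simp)

lemma intervalIntegrable_nrm (S : Sol p α u) {s t : ℝ} (hs : 0 < s) (ht : 0 < t) :
    IntervalIntegrable (nrm u) volume s t :=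
  (S.continuousOn_nrm.mono fun _ hy => lt_of_lt_of_le (lt_min hs ht) hy.1).intervalIntegrable

lemma integral_nrm_mono (S : Sol p α u) {s t r : ℝ} (hs : 0 < s) (hst : s ≤ t) (htr : t ≤ r) :
    ∫ y in t..r, nrm u y ≤ ∫ y in s..r, nrm u y := by
  have := intervalIntegral.integral_add_adjacent_intervals
    (S.intervalIntegrable_nrm hs (hs.trans_le hst))
    (S.intervalIntegrable_nrm (hs.trans_le hst) (hs.trans_le (hst.trans htr)))
  have h : 0 ≤ ∫ y in s..t, nrm u y :=
    intervalIntegral.integral_nonneg hst fun y _ => nrm_nonneg u y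
  linarith

lemma ut_le_nrm (u : ℝ × ℝ → ℝ) (t : ℝ) : ∫ x, ut u t x ^ 2 ≤ nrm u t := by
  have h1 := integral_sq_nonneg (ux u t)
  have h2 := integral_sq_nonneg (U u t)
  unfold nrm
  linarith

lemma sq_le_nrm (S : Sol p α u) {t : ℝ} (ht : 0 < t) (x : ℝ) : U u t x ^ 2 ≤ nrm u t := by
  have h1 := integral_sq_nonneg (ut u t)
  have h2 := (S.tu.l2 ht).sq_le (S.tux.l2 ht) (S.dx t ht) x
  unfold nrm
  linarith

lemma pow_sq_le (S : Sol p α u) (j : ℕ) {t : ℝ} (ht : 0 < t) (x : ℝ) : (U u t x ^ (j + 1)) ^ 2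
      ≤ (j + 1) * √(∫ x, (U u t x ^ (2 * j + 1)) ^ 2) * √(nrm u t) := by
  obtain ⟨B, hB⟩ := S.tu.bd t t ht
  have hB := (hB t le_rfl le_rfl).1
  have lux := S.tux.l2 ht
  have h2 : L2c (fun x => (((j : ℝ) + 1) * U u t x ^ j) * ux u t x) := by
    refine lux.bdd_mul ?_ (C := (j + 1) * B ^ j) fun y => ?_
    · exact continuous_const.mul ((S.tu.l2 ht).cont.pow j)
    · rw [abs_mul, abs_pow, abs_of_nonneg (by positivity : (0:ℝ) ≤ j + 1)]
      exact mul_le_mul_of_nonneg_left (pow_le_pow_left₀ (abs_nonneg _) (hB y) j) (by positivity)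
  have h := ((S.tf_pow j).l2 ht).sq_le_integral_abs h2 (fun y =>
    ((S.dx t ht y).pow (j + 1)).congr_deriv (by simp)) x
  have e : ∀ y, |U u t y ^ (j + 1) * (((j : ℝ) + 1) * U u t y ^ j * ux u t y)|
      = (j + 1) * |U u t y ^ (2 * j + 1) * ux u t y| := fun y => by
    rw [show U u t y ^ (j + 1) * (((j : ℝ) + 1) * U u t y ^ j * ux u t y)
      = (j + 1) * (U u t y ^ (2 * j + 1) * ux u t y) by ring, abs_mul,
      abs_of_nonneg (by positivity : (0:ℝ) ≤ j + 1)]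
  simp_rw [e] at h
  rw [integral_const_mul] at h
  have h3 := ((S.tf_pow (2 * j)).l2 ht).integral_abs_mul_le lux
  have h4 : √(∫ x, ux u t x ^ 2) ≤ √(nrm u t) := sqrt_le_sqrt (by
    have h1 := integral_sq_nonneg (ut u t)
    have h2 := integral_sq_nonneg (U u t)
    unfold nrm
    linarith)
  calc (U u t x ^ (j + 1)) ^ 2 ≤ (j + 1) * ∫ y, |U u t y ^ (2 * j + 1) * ux u t y| := h
    _ ≤ (j + 1) * (√(∫ x, (U u t x ^ (2 * j + 1)) ^ 2) * √(∫ x, ux u t x ^ 2)) := by gcongr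
    _ ≤ (j + 1) * (√(∫ x, (U u t x ^ (2 * j + 1)) ^ 2) * √(nrm u t)) := by gcongr
    _ = _ := by ring

lemma exists_pow_bound (S : Sol p α u) (hp : 2 < p) (hα : 0 < α) (j : ℕ) :
    ∃ T, 2 ≤ T ∧ ∃ C, 0 ≤ C ∧ ∀ t, T ≤ t → ∫ x, (U u t x ^ (2 * j + 1)) ^ 2 ≤ C := by
  obtain ⟨W, hW0, hN, hW⟩ := S.exists_window_bound hp hα
  induction j with
  | zero => exact ⟨2, le_rfl, W, hW0, fun t ht => by simpa using hN t (by linarith)⟩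
  | succ j ih =>
    obtain ⟨T, hT, C, hC0, hC⟩ := ih
    set Y : ℝ → ℝ := fun t => ∫ x, (U u t x ^ (2 * (j + 1) + 1)) ^ 2 with hY
    have hY0 : ∀ t, 0 ≤ Y t := fun t => integral_sq_nonneg _
    set c : ℝ := (j + 1) * √C with hc
    have hc0 : 0 ≤ c := by positivity
    have hsup : ∀ t, T ≤ t → ∀ x, (U u t x ^ (j + 1)) ^ 2 ≤ c * √(nrm u t) := fun t ht x => by
      refine (S.pow_sq_le j (by linarith) x).trans ?_
      have := sqrt_le_sqrt (hC t ht)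
      rw [hc]; gcongr
    set D : ℝ := 2 * (2 * (j + 1) + 1) * c with hD
    have hD0 : 0 ≤ D := by positivity
    set dY : ℝ → ℝ := fun t => 2 * ∫ x, U u t x ^ (2 * (j + 1) + 1)
      * ((((2 * (j + 1) : ℕ) : ℝ) + 1) * U u t x ^ (2 * (j + 1)) * ut u t x) with hdY
    have e0 : ∀ t, ∫ x, U u t x ^ (2 * (j + 1) + 1)
        * ((((2 * (j + 1) : ℕ) : ℝ) + 1) * U u t x ^ (2 * (j + 1)) * ut u t x)
        = (((2 * (j + 1) : ℕ) : ℝ) + 1)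
          * ∫ x, U u t x ^ (2 * (j + 1) + 1) * (U u t x ^ (2 * (j + 1)) * ut u t x) := fun t => by
      rw [← integral_const_mul]
      refine integral_congr_ae (Eventually.of_forall fun x => ?_)
      simp only
      ring
    have dYd : ∀ t, 0 < t → HasDerivAt Y (dY t) t := fun t ht => by
      refine (S.tf_pow (2 * (j + 1))).ac_sq.hasDerivAt ?_ ht
      have h1 := (S.tf_pow (2 * (j + 1))).mul (S.tf_pow (2 * j + 1))
      have h2 := (h1.continuousOn_integral_mul S.tut).const_smul (2 * (((2 * (j + 1) : ℕ) : ℝ) + 1))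
      refine h2.congr fun t _ => ?_
      simp only [Pi.smul_apply, smul_eq_mul]
      rw [e0 t, mul_assoc]
      congr 2
      refine integral_congr_ae (Eventually.of_forall fun x => ?_)
      simp only
      ring
    have hdYle : ∀ t, T ≤ t → dY t ≤ D * nrm u t * (1 + Y t) := by
      intro t ht
      have ht0 : 0 < t := by linarith
      have la := (S.tf_pow (2 * (j + 1))).l2 ht0
      have lut := S.tut.l2 ht0
      have l1 : L2c (fun x => U u t x ^ (2 * (j + 1)) * ut u t x) :=
        lut.bdd_mul ((S.tu.l2 ht0).cont.pow _) (C := c * √(nrm u t)) fun x => by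
          rw [abs_of_nonneg (by rw [pow_mul']; positivity), pow_mul']
          exact hsup t ht x
      have h1 := la.abs_integral_mul_le l1
      have h2 : ∫ x, (U u t x ^ (2 * (j + 1)) * ut u t x) ^ 2
          ≤ (c * √(nrm u t)) ^ 2 * ∫ x, ut u t x ^ 2 :=
        lut.integral_le_of_bound l1.cont fun x => by
          rw [abs_mul, abs_of_nonneg (by rw [pow_mul']; positivity), pow_mul']
          exact mul_le_mul_of_nonneg_right (hsup t ht x) (abs_nonneg _)
      have hX := nrm_nonneg u t
      have h3 : √(∫ x, (U u t x ^ (2 * (j + 1)) * ut u t x) ^ 2) ≤ c * nrm u t := by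
        refine sqrt_le_iff.2 ⟨by positivity, h2.trans ?_⟩
        rw [mul_pow, sq_sqrt hX, mul_pow]
        have := mul_le_mul_of_nonneg_left (ut_le_nrm u t) (show 0 ≤ c ^ 2 * nrm u t by positivity)
        linarith
      have h4 : √(Y t) ≤ 1 + Y t := by
        have := sq_sqrt (hY0 t)
        nlinarith [sq_nonneg (√(Y t) - 1), hY0 t]
      have e : dY t = 2 * (2 * (j + 1) + 1)
          * ∫ x, U u t x ^ (2 * (j + 1) + 1) * (U u t x ^ (2 * (j + 1)) * ut u t x) := by
        rw [hdY]
        simp only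
        rw [e0 t]
        push_cast
        ring
      rw [e]
      calc _ ≤ 2 * (2 * ((j : ℝ) + 1) + 1) * (√(Y t) * (c * nrm u t)) := by
            refine mul_le_mul_of_nonneg_left ((le_abs_self _).trans (h1.trans ?_)) (by positivity)
            exact mul_le_mul_of_nonneg_left h3 (sqrt_nonneg _)
        _ ≤ 2 * (2 * ((j : ℝ) + 1) + 1) * ((1 + Y t) * (c * nrm u t)) := by gcongr
        _ = _ := by rw [hD]; ring
    refine ⟨T + 1, by linarith, (1 + c ^ 2 * W * W) * exp (D * W), by positivity, fun t ht => ?_⟩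
    obtain ⟨s, hs1, hs2, hs⟩ := exists_le_average S.continuousOn_nrm
      (show 0 < t - 1 by linarith) (show t - 1 < t by linarith)
    have hXs : nrm u s ≤ W := by
      have := hW t (by linarith)
      rw [sub_sub_cancel, mul_one] at hs
      linarith
    have hs0 : 0 < s := by linarith
    have hYs : Y s ≤ c ^ 2 * W * W := by
      have h1 := (S.tu.l2 hs0).integral_le_of_bound ((S.tf_pow (2 * (j + 1))).l2 hs0).cont
        (C := c * √(nrm u s)) fun x => by
          rw [pow_succ, abs_mul, abs_of_nonneg (by rw [pow_mul']; positivity), pow_mul']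
          exact mul_le_mul_of_nonneg_right (hsup s (by linarith) x) (abs_nonneg _)
      refine h1.trans ?_
      rw [mul_pow, sq_sqrt (nrm_nonneg u s)]
      have := hN s (by linarith)
      have h3 := integral_sq_nonneg (U u s)
      gcongr
    have dlog : ∀ r, 0 < r → HasDerivAt (fun r => log (1 + Y r)
        - D * ∫ y in s..r, nrm u y) (dY r / (1 + Y r) - D * nrm u r) r := fun r hr =>
      (((dYd r hr).const_add 1).log (by have := hY0 r; linarith)).sub
        ((hasDerivAt_primitive S.continuousOn_nrm hs0 hr).const_mul D)
    have m := anti_of_hasDerivAt dlog hs0 hs2 fun r h1 h2 => by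
      have := hY0 r
      rw [sub_nonpos, div_le_iff₀ (by linarith)]
      exact hdYle r (by linarith)
    simp only [intervalIntegral.integral_same] at m
    have h5 : ∫ y in s..t, nrm u y ≤ W :=
      (S.integral_nrm_mono (by linarith) hs1 hs2).trans (hW t (by linarith))
    have h6 : log (1 + Y t) ≤ log (1 + Y s) + D * W := by
      have := mul_le_mul_of_nonneg_left h5 hD0
      linarith
    have h7 : 1 + Y t ≤ (1 + Y s) * exp (D * W) := by
      have p1 : 0 < 1 + Y t := by have := hY0 t; linarith
      have p2 : 0 < 1 + Y s := by have := hY0 s; linarith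
      calc 1 + Y t = exp (log (1 + Y t)) := (exp_log p1).symm
        _ ≤ exp (log (1 + Y s) + D * W) := exp_le_exp.2 h6
        _ = _ := by rw [exp_add, exp_log p2]
    have h8 : (1 + Y s) * exp (D * W) ≤ (1 + c ^ 2 * W * W) * exp (D * W) := by gcongr
    show Y t ≤ _
    linarith

/-- Global solutions are bounded in the energy space. -/
lemma exists_nrm_bound (S : Sol p α u) (hp : 2 < p) (hα : 0 < α) :
    ∃ T, 2 ≤ T ∧ ∃ C, 0 < C ∧ ∀ t, T ≤ t → nrm u t ≤ C := by
  obtain ⟨W, hW0, hN, hW⟩ := S.exists_window_bound hp hα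
  obtain ⟨j, hj⟩ := exists_nat_ge p
  obtain ⟨T, hT, C, hC0, hC⟩ := S.exists_pow_bound hp hα j
  have hnl : ∀ t, T ≤ t → 2 * (∫ x, nl p (U u t x) * ut u t x) ≤ (W + C) + nrm u t := by
    intro t ht
    have ht0 : 0 < t := by linarith
    have ln := (S.tf_nl hp).l2 ht0
    have h1 := ln.young (S.tut.l2 ht0) one_pos
    have h2 : ∫ x, nl p (U u t x) ^ 2 ≤ W + C := by
      refine le_trans (b := (∫ x, U u t x ^ 2) + ∫ x, (U u t x ^ (2 * j + 1)) ^ 2) ?_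
        (add_le_add (hN t (by linarith)) (hC t ht))
      rw [← integral_add (S.tu.l2 ht0).int ((S.tf_pow (2 * j)).l2 ht0).int]
      refine integral_mono ln.int ((S.tu.l2 ht0).int.add ((S.tf_pow (2 * j)).l2 ht0).int)
        fun x => ?_
      simp only
      generalize U u t x = s
      have h0 := abs_nonneg s
      have e1 : |nl p s| = |s| ^ p := abs_nl hp s
      rw [← sq_abs (nl p s), e1, ← sq_abs s, ← sq_abs (s ^ _), abs_pow]
      rcases le_total |s| 1 with h | h
      · have : |s| ^ p ≤ |s| := by
          simpa using rpow_le_rpow_of_exponent_ge' h0 h (zero_le_one) (by linarith : 1 ≤ p)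
        have := pow_le_pow_left₀ (rpow_nonneg h0 p) this 2
        have : 0 ≤ (|s| ^ (2 * j + 1)) ^ 2 := by positivity
        linarith
      · have : |s| ^ p ≤ |s| ^ (2 * j + 1) := by
          rw [← rpow_natCast]
          refine rpow_le_rpow_of_exponent_le h ?_
          push_cast
          linarith
        have := pow_le_pow_left₀ (rpow_nonneg h0 p) this 2
        have : 0 ≤ |s| ^ 2 := by positivity
        linarith
    have h3 := le_abs_self (∫ x, nl p (U u t x) * ut u t x)
    have h4 := ut_le_nrm u t
    simp only [one_mul, inv_one] at h1
    linarith
  refine ⟨T + 1, by linarith, W + (W + C) + W + 1, by positivity, fun t ht => ?_⟩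
  obtain ⟨s, hs1, hs2, hs⟩ := exists_le_average S.continuousOn_nrm
      (show 0 < t - 1 by linarith) (show t - 1 < t by linarith)
  have hXs : nrm u s ≤ W := by
    have := hW t (by linarith)
    rw [sub_sub_cancel, mul_one] at hs
    linarith
  have hs0 : 0 < s := by linarith
  have d : ∀ r, 0 < r → HasDerivAt (fun r => nrm u r - (W + C) * r - ∫ y in s..r, nrm u y) _ r :=
    fun r hr => ((S.hasDerivAt_nrm hp hr).sub ((hasDerivAt_id r).const_mul (W + C))).sub
      (hasDerivAt_primitive S.continuousOn_nrm hs0 hr)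
  have m := anti_of_hasDerivAt d hs0 hs2 fun r h1 h2 => by
    have h3 := hnl r (by linarith)
    have h4 : 0 ≤ 4 * α * ∫ x, ut u r x ^ 2 := mul_nonneg (by linarith) (integral_sq_nonneg _)
    linarith
  simp only [intervalIntegral.integral_same] at m
  have h5 : ∫ y in s..t, nrm u y ≤ W :=
    (S.integral_nrm_mono (by linarith) hs1 hs2).trans (hW t (by linarith))
  have h6 : (W + C) * (t - s) ≤ (W + C) * 1 := mul_le_mul_of_nonneg_left (by linarith) (by linarith)
  linarith

end Sol

lemma AC.sub_le {τ : ℝ} {g g' φ : ℝ → ℝ} (hg : AC τ g g') (hφ : ContinuousOn φ (Set.Ioi τ))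
    {s t : ℝ} (hs : τ < s) (hst : s ≤ t) (h : ∀ r, s ≤ r → r ≤ t → g' r ≤ φ r) :
    g t - g s ≤ ∫ r in s..t, φ r := by
  rw [hg.eq s t hs hst]
  refine intervalIntegral.integral_mono_on hst (hg.int s t hs hst) ?_ fun r hr => h r hr.1 hr.2
  refine ContinuousOn.intervalIntegrable (hφ.mono fun y hy => ?_)
  rw [Set.uIcc_of_le hst] at hy
  exact hs.trans_le hy.1

/-- The nonlinear field `(1 - ∂ₓ²)⁻¹ (|u|^(p-1) u)`. -/
noncomputable def vv (p : ℝ) (u : ℝ × ℝ → ℝ) (t : ℝ) : ℝ → ℝ := res (fun y => nl p (U u t y))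

/-- The space derivative of `vv`. -/
noncomputable def vvx (p : ℝ) (u : ℝ × ℝ → ℝ) (t : ℝ) : ℝ → ℝ := resx (fun y => nl p (U u t y))

/-- The time derivative of `vv`. -/
noncomputable def vvt (p : ℝ) (u : ℝ × ℝ → ℝ) (t : ℝ) : ℝ → ℝ :=
  res (fun y => dnl p (U u t y) * ut u t y)

/-- The mixed derivative of `vv`. -/
noncomputable def vvtx (p : ℝ) (u : ℝ × ℝ → ℝ) (t : ℝ) : ℝ → ℝ :=
  resx (fun y => dnl p (U u t y) * ut u t y)

/-- The defect of stationarity `u - vv`. -/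
noncomputable def ww (p : ℝ) (u : ℝ × ℝ → ℝ) (t x : ℝ) : ℝ := U u t x - vv p u t x

/-- The space derivative of `ww`. -/
noncomputable def wwx (p : ℝ) (u : ℝ × ℝ → ℝ) (t x : ℝ) : ℝ := ux u t x - vvx p u t x

/-- The dissipation functional. -/
noncomputable def dd (p : ℝ) (u : ℝ × ℝ → ℝ) (t : ℝ) : ℝ :=
  (∫ x, ut u t x ^ 2) + (∫ x, ww p u t x ^ 2) + ∫ x, wwx p u t x ^ 2

lemma dd_nonneg (p : ℝ) (u : ℝ × ℝ → ℝ) (t : ℝ) : 0 ≤ dd p u t :=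
  add_nonneg (add_nonneg (integral_sq_nonneg _) (integral_sq_nonneg _)) (integral_sq_nonneg _)

namespace Sol

variable {p α : ℝ} {u : ℝ × ℝ → ℝ}

lemma exists_bound_dnl_mul_ut (S : Sol p α u) (hp : 2 < p) (s T : ℝ) (hs : 0 < s) :
    ∃ B, ∀ t, s ≤ t → t ≤ T → ∀ x, |dnl p (U u t x) * ut u t x| ≤ B := by
  obtain ⟨A, hA⟩ := S.tu.bd s T hs
  obtain ⟨B, hB⟩ := S.tut.bd s T hs
  refine ⟨p * A ^ (p - 1) * B, fun t h1 h2 x => ?_⟩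
  rw [abs_mul, abs_of_nonneg (dnl_nonneg hp _)]
  have h3 := (hA t h1 h2).1 x
  have h4 := (hB t h1 h2).1 x
  have h5 : 0 ≤ p * A ^ (p - 1) :=
    mul_nonneg (by linarith) (rpow_nonneg ((abs_nonneg _).trans h3) _)
  exact mul_le_mul (dnl_mono hp h3) h4 (abs_nonneg _) h5

lemma tf_vv (S : Sol p α u) (hp : 2 < p) : TF 0 (vv p u) (vvt p u) :=
  ((S.tf_nl hp).res (S.exists_bound_dnl_mul_ut hp)).1

lemma tf_vvx (S : Sol p α u) (hp : 2 < p) : TF 0 (vvx p u) (vvtx p u) :=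
  ((S.tf_nl hp).res (S.exists_bound_dnl_mul_ut hp)).2

lemma tf_ww (S : Sol p α u) (hp : 2 < p) :
    TF 0 (ww p u) (fun t x => ut u t x - vvt p u t x) := S.tu.sub (S.tf_vv hp)

lemma tf_wwx (S : Sol p α u) (hp : 2 < p) :
    TF 0 (wwx p u) (fun t x => utx u t x - vvtx p u t x) := S.tux.sub (S.tf_vvx hp)

lemma hasDerivAt_vv (S : Sol p α u) (hp : 2 < p) {t : ℝ} (ht : 0 < t) (x : ℝ) :
    HasDerivAt (vv p u t) (vvx p u t x) x := by
  obtain ⟨B, hB⟩ := (S.tf_nl hp).bd t t ht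
  exact hasDerivAt_res ((S.tf_nl hp).l2 ht).cont (hB t le_rfl le_rfl).1 x

lemma hasDerivAt_vvx (S : Sol p α u) (hp : 2 < p) {t : ℝ} (ht : 0 < t) (x : ℝ) :
    HasDerivAt (vvx p u t) (vv p u t x - nl p (U u t x)) x := by
  obtain ⟨B, hB⟩ := (S.tf_nl hp).bd t t ht
  exact hasDerivAt_resx ((S.tf_nl hp).l2 ht).cont (hB t le_rfl le_rfl).1 x

lemma hasDerivAt_vvt (S : Sol p α u) (hp : 2 < p) {t : ℝ} (ht : 0 < t) (x : ℝ) :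
    HasDerivAt (vvt p u t) (vvtx p u t x) x := by
  obtain ⟨B, hB⟩ := S.exists_bound_dnl_mul_ut hp t t ht
  exact hasDerivAt_res ((S.tf_nl hp).l2' ht).cont (hB t le_rfl le_rfl) x

lemma hasDerivAt_vvtx (S : Sol p α u) (hp : 2 < p) {t : ℝ} (ht : 0 < t) (x : ℝ) :
    HasDerivAt (vvtx p u t) (vvt p u t x - dnl p (U u t x) * ut u t x) x := by
  obtain ⟨B, hB⟩ := S.exists_bound_dnl_mul_ut hp t t ht
  exact hasDerivAt_resx ((S.tf_nl hp).l2' ht).cont (hB t le_rfl le_rfl) x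

lemma hasDerivAt_ww (S : Sol p α u) (hp : 2 < p) {t : ℝ} (ht : 0 < t) (x : ℝ) :
    HasDerivAt (ww p u t) (wwx p u t x) x :=
  (S.dx t ht x).sub (S.hasDerivAt_vv hp ht x)

lemma hasDerivAt_wwx (S : Sol p α u) (hp : 2 < p) {t : ℝ} (ht : 0 < t) (x : ℝ) :
    HasDerivAt (wwx p u t) (utt u t x + 2 * α * ut u t x + ww p u t x) x := by
  refine ((S.dxx t ht x).sub (S.hasDerivAt_vvx hp ht x)).congr_deriv ?_
  rw [S.eq t ht x, ww]
  ring

lemma continuousOn_dd (S : Sol p α u) (hp : 2 < p) : ContinuousOn (dd p u) (Set.Ioi 0) :=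
  (S.tut.continuousOn_integral_sq.add (S.tf_ww hp).continuousOn_integral_sq).add
    (S.tf_wwx hp).continuousOn_integral_sq

lemma ac_dd (S : Sol p α u) (hp : 2 < p) : AC 0 (dd p u) (fun t =>
    -(4 * α) * (∫ x, ut u t x ^ 2) - 2 * ∫ x, ww p u t x * (dnl p (U u t x) * ut u t x)) := by
  refine ((S.tut.ac_sq.add (S.tf_ww hp).ac_sq).add (S.tf_wwx hp).ac_sq).congr
    (fun _ _ => rfl) fun t ht => ?_
  have lut := S.tut.l2 ht
  have lutt := S.tut.l2' ht
  have lutx := S.tux.l2' ht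
  have lw := (S.tf_ww hp).l2 ht
  have lwx := (S.tf_wwx hp).l2 ht
  have lvt := (S.tf_vv hp).l2' ht
  have lvtx := (S.tf_vvx hp).l2' ht
  have lg := (S.tf_nl hp).l2' ht
  have e1 := lut.ibp lutx lwx ((lutt.add (lut.const_mul (2 * α))).add lw) (S.dtx t ht)
    (S.hasDerivAt_wwx hp ht)
  have e2 := lw.ibp lwx lvtx (lvt.sub lg) (S.hasDerivAt_ww hp ht) (S.hasDerivAt_vvtx hp ht)
  have e3 : ∫ x, ut u t x * (utt u t x + 2 * α * ut u t x + ww p u t x)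
      = (∫ x, ut u t x * utt u t x) + 2 * α * (∫ x, ut u t x ^ 2) + ∫ x, ww p u t x * ut u t x := by
    rw [← integral_const_mul, ← integral_add (lut.mul_int lutt) (lut.int.const_mul _),
      ← integral_add (by exact (lut.mul_int lutt).add (lut.int.const_mul _)) (lw.mul_int lut)]
    exact integral_congr_ae (Eventually.of_forall fun x => by simp only; ring)
  have e4 : ∫ x, ww p u t x * (vvt p u t x - dnl p (U u t x) * ut u t x)
      = (∫ x, ww p u t x * vvt p u t x) - ∫ x, ww p u t x * (dnl p (U u t x) * ut u t x) := by
    rw [← integral_sub (lw.mul_int lvt) (lw.mul_int lg)]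
    exact integral_congr_ae (Eventually.of_forall fun x => by simp only; ring)
  have e5 : ∫ x, ww p u t x * (ut u t x - vvt p u t x)
      = (∫ x, ww p u t x * ut u t x) - ∫ x, ww p u t x * vvt p u t x := by
    rw [← integral_sub (lw.mul_int lut) (lw.mul_int lvt)]
    exact integral_congr_ae (Eventually.of_forall fun x => by simp only; ring)
  have e6 : ∫ x, wwx p u t x * (utx u t x - vvtx p u t x)
      = (∫ x, utx u t x * wwx p u t x) - ∫ x, wwx p u t x * vvtx p u t x := by
    rw [← integral_sub (lutx.mul_int lwx) (lwx.mul_int lvtx)]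
    exact integral_congr_ae (Eventually.of_forall fun x => by simp only; ring)
  rw [e5, e6]
  rw [e3] at e1
  rw [e4] at e2
  linarith

lemma ac_ut_ww (S : Sol p α u) (hp : 2 < p) : AC 0 (fun t => ∫ x, ut u t x * ww p u t x) (fun t =>
    -(∫ x, wwx p u t x ^ 2) - (∫ x, ww p u t x ^ 2) - 2 * α * (∫ x, ut u t x * ww p u t x)
      + (∫ x, ut u t x ^ 2) - ∫ x, ut u t x * vvt p u t x) := by
  refine (S.tut.ac_mul (S.tf_ww hp)).congr (fun _ _ => rfl) fun t ht => ?_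
  have lut := S.tut.l2 ht
  have lutt := S.tut.l2' ht
  have lw := (S.tf_ww hp).l2 ht
  have lwx := (S.tf_wwx hp).l2 ht
  have lvt := (S.tf_vv hp).l2' ht
  have e1 := lw.ibp lwx lwx ((lutt.add (lut.const_mul (2 * α))).add lw) (S.hasDerivAt_ww hp ht)
    (S.hasDerivAt_wwx hp ht)
  have e3 : ∫ x, ww p u t x * (utt u t x + 2 * α * ut u t x + ww p u t x)
      = (∫ x, utt u t x * ww p u t x) + 2 * α * (∫ x, ut u t x * ww p u t x)
        + ∫ x, ww p u t x ^ 2 := by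
    rw [← integral_const_mul, ← integral_add (lutt.mul_int lw) ((lut.mul_int lw).const_mul _),
      ← integral_add (by exact (lutt.mul_int lw).add ((lut.mul_int lw).const_mul _)) lw.int]
    exact integral_congr_ae (Eventually.of_forall fun x => by simp only; ring)
  have e4 : ∫ x, ut u t x * (ut u t x - vvt p u t x)
      = (∫ x, ut u t x ^ 2) - ∫ x, ut u t x * vvt p u t x := by
    rw [← integral_sub lut.int (lut.mul_int lvt)]
    exact integral_congr_ae (Eventually.of_forall fun x => by simp only; ring)
  simp_rw [← pow_two] at e1
  rw [e4]
  linarith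

/-- Existence of a Lyapunov functional controlling the dissipation, and decay of the latter. -/
lemma exists_lyapunov (S : Sol p α u) (hp : 2 < p) (hα : 0 < α) :
    ∃ T, 2 ≤ T ∧ ∃ M, 1 ≤ M ∧ (∀ t, T ≤ t → nrm u t ≤ M ^ 2) ∧
    ∃ c, 0 < c ∧ ∃ L, 0 < L ∧ ∃ H : ℝ → ℝ, ∃ E : ℝ, (∀ t, T ≤ t → |H t - energy p u t| ≤ dd p u t) ∧
      (∀ s t, T ≤ s → s ≤ t → c * (∫ r in s..t, dd p u r) ≤ H s - H t) ∧
      (∀ s t, T ≤ s → s ≤ t → dd p u t ≤ dd p u s + L * ∫ r in s..t, dd p u r) ∧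
      Tendsto (dd p u) atTop (nhds 0) ∧ Tendsto H atTop (nhds E) := by
  obtain ⟨T, hT, C, hC0, hC⟩ := S.exists_nrm_bound hp hα
  set M := 1 + C with hM
  have hM1 : 1 ≤ M := by linarith
  have hnM : ∀ t, T ≤ t → nrm u t ≤ M ^ 2 := fun t ht => by
    have := hC t ht
    nlinarith
  have hUM : ∀ t, T ≤ t → ∀ x, |U u t x| ≤ M := fun t ht x =>
    abs_le_of_sq_le_sq ((S.sq_le_nrm (by linarith) x).trans (hnM t ht)) (by linarith)
  set l := p * M ^ (p - 1) with hl
  have hl0 : 0 < l := mul_pos (by linarith) (rpow_pos_of_pos (by linarith) _)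
  have hdl : ∀ t, T ≤ t → ∀ x, |dnl p (U u t x) * ut u t x| ≤ l * |ut u t x| := fun t ht x => by
    rw [abs_mul, abs_of_nonneg (dnl_nonneg hp _)]
    exact mul_le_mul_of_nonneg_right (dnl_mono hp (hUM t ht x)) (abs_nonneg _)
  have hdint : ∀ t, T ≤ t → ∫ x, (dnl p (U u t x) * ut u t x) ^ 2
      ≤ l ^ 2 * ∫ x, ut u t x ^ 2 := fun t ht =>
    (S.tut.l2 (by linarith)).integral_le_of_bound ((S.tf_nl hp).l2' (by linarith)).cont (hdl t ht)
  have hA0 : ∀ t, 0 ≤ ∫ x, ut u t x ^ 2 := fun t => integral_sq_nonneg _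
  have hW0 : ∀ t, 0 ≤ ∫ x, ww p u t x ^ 2 := fun t => integral_sq_nonneg _
  have hV0 : ∀ t, 0 ≤ ∫ x, wwx p u t x ^ 2 := fun t => integral_sq_nonneg _
  have hDc := S.continuousOn_dd hp
  have hD0 := dd_nonneg p u
  have hci : ∀ a b : ℝ, 0 < a → 0 < b → IntervalIntegrable (dd p u) volume a b :=
    fun a b ha hb => (hDc.mono fun y hy => lt_of_lt_of_le (lt_min ha hb) hy.1).intervalIntegrable
  -- growth of the dissipation
  have hgrow : ∀ s t, T ≤ s → s ≤ t → dd p u t ≤ dd p u s + l * ∫ r in s..t, dd p u r := by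
    intro s t hs hst
    have := (S.ac_dd hp).sub_le (φ := fun t => l * dd p u t) (continuousOn_const.mul hDc)
      (show 0 < s by linarith) hst fun r h1 _ => by
        have hr : 0 < r := by linarith
        have h2 := ((S.tf_ww hp).l2 hr).young ((S.tf_nl hp).l2' hr) hl0
        have h3 := hdint r (by linarith)
        have h4 := neg_abs_le (∫ x, ww p u r x * (dnl p (U u r x) * ut u r x))
        have h5 : l⁻¹ * (∫ x, (dnl p (U u r x) * ut u r x) ^ 2) ≤ l * ∫ x, ut u r x ^ 2 := by
          rw [inv_mul_le_iff₀ hl0]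
          linarith
        have h6 := mul_nonneg hl0.le (hV0 r)
        have h7 := mul_nonneg hα.le (hA0 r)
        unfold dd
        linarith
    rw [intervalIntegral.integral_const_mul] at this
    linarith
  set K := α * (2 * α) + 1 + (1 + l ^ 2) / 2 with hK
  have hK0 : 0 < K := by positivity
  set δ := min 1 (α / K) with hδ
  have hδ0 : 0 < δ := lt_min one_pos (by positivity)
  have hδ1 : δ ≤ 1 := min_le_left _ _
  have hδK : δ * K ≤ α := by
    have := mul_le_mul_of_nonneg_right (min_le_right 1 (α / K)) hK0.le
    rwa [div_mul_cancel₀ _ hK0.ne'] at this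
  set c := min α (δ / 2) with hc
  have hc0 : 0 < c := lt_min hα (by linarith)
  set H : ℝ → ℝ := fun t => energy p u t + δ * ∫ x, ut u t x * ww p u t x with hH
  have hHE : ∀ t, T ≤ t → |H t - energy p u t| ≤ dd p u t := by
    intro t ht
    have ht0 : 0 < t := by linarith
    simp only [hH, add_sub_cancel_left]
    rw [abs_mul, abs_of_pos hδ0]
    have := (S.tut.l2 ht0).young ((S.tf_ww hp).l2 ht0) one_pos
    have h1 := mul_le_mul_of_nonneg_right hδ1 (abs_nonneg (∫ x, ut u t x * ww p u t x))
    have := hV0 t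
    have := hA0 t
    have := hW0 t
    unfold dd
    simp only [inv_one, one_mul] at *
    linarith
  have hHd : ∀ s t, T ≤ s → s ≤ t → c * (∫ r in s..t, dd p u r) ≤ H s - H t := by
    intro s t hs hst
    have hEac : AC 0 (energy p u) (fun t => -(2 * α) * ∫ x, ut u t x ^ 2) := by
      refine ⟨fun a b ha hab => ?_, fun a b ha hab => ?_⟩
      · refine ContinuousOn.intervalIntegrable ((continuousOn_const.mul
          S.tut.continuousOn_integral_sq).mono fun y hy => ?_)
        rw [Set.uIcc_of_le hab] at hy
        exact ha.trans_le hy.1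
      · rw [intervalIntegral.integral_const_mul]
        have := S.two_alpha_integral_ut hp ha hab
        linarith
    have := (hEac.add ((S.ac_ut_ww hp).const_mul δ)).sub_le (φ := fun t => -c * dd p u t)
      (continuousOn_const.mul hDc) (show 0 < s by linarith) hst fun r h1 _ => by
        have hr : 0 < r := by linarith
        have y1 := (S.tut.l2 hr).young ((S.tf_ww hp).l2 hr) (show 0 < 2 * α by linarith)
        have y2 := (S.tut.l2 hr).young ((S.tf_vv hp).l2' hr) one_pos
        obtain ⟨B, hB⟩ := S.exists_bound_dnl_mul_ut hp r r hr
        have y3 : ∫ x, vvt p u r x ^ 2 ≤ l ^ 2 * ∫ x, ut u r x ^ 2 :=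
          (l2c_res ((S.tf_nl hp).l2' hr) (hB r le_rfl le_rfl)).2.2.trans (hdint r (by linarith))
        have y4 := neg_abs_le (∫ x, ut u r x * ww p u r x)
        have y5 := neg_abs_le (∫ x, ut u r x * vvt p u r x)
        have y6 := mul_le_mul_of_nonneg_left y4 hα.le
        have y7 := mul_le_mul_of_nonneg_left y1 hα.le
        have y8 : α * (2 * α * (∫ x, ut u r x ^ 2) + (2 * α)⁻¹ * ∫ x, ww p u r x ^ 2)
          = α * (2 * α) * (∫ x, ut u r x ^ 2) + 2⁻¹ * ∫ x, ww p u r x ^ 2 := by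
          field_simp
        have key : -(∫ x, wwx p u r x ^ 2) - (∫ x, ww p u r x ^ 2)
            - 2 * α * (∫ x, ut u r x * ww p u r x)
            + (∫ x, ut u r x ^ 2) - (∫ x, ut u r x * vvt p u r x)
            ≤ K * (∫ x, ut u r x ^ 2) - 2⁻¹ * ((∫ x, ww p u r x ^ 2) + ∫ x, wwx p u r x ^ 2) := by
          have := hV0 r
          rw [hK]
          simp only [inv_one, one_mul] at y2
          linarith
        have k1 := mul_le_mul_of_nonneg_left key hδ0.le
        have k2 := mul_le_mul_of_nonneg_right hδK (hA0 r)
        have k3 := mul_le_mul_of_nonneg_right (min_le_left α (δ / 2)) (hA0 r)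
        have k4 := mul_le_mul_of_nonneg_right (min_le_right α (δ / 2)) (add_nonneg (hW0 r) (hV0 r))
        unfold dd
        rw [← hc] at k3 k4
        linarith
    rw [intervalIntegral.integral_const_mul] at this
    simp only [hH]
    linarith
  have hDb : ∀ t, T ≤ t → dd p u t ≤ (4 + 4 * l ^ 2) * M ^ 2 := by
    intro t ht
    have ht0 : 0 < t := by linarith
    have lv := (S.tf_vv hp).l2 ht0
    have lvx := (S.tf_vvx hp).l2 ht0
    have ln := (S.tf_nl hp).l2 ht0
    have lu := S.tu.l2 ht0
    obtain ⟨B, hB⟩ := (S.tf_nl hp).bd t t ht0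
    have h1 : ∫ x, vv p u t x ^ 2 ≤ ∫ x, nl p (U u t x) ^ 2 :=
      (l2c_res ln (hB t le_rfl le_rfl).1).2.2
    have h2 : ∫ x, nl p (U u t x) ^ 2 ≤ l ^ 2 * ∫ x, U u t x ^ 2 :=
      lu.integral_le_of_bound ln.cont fun x => by
        have := nl_lip hp (a := 0) (b := U u t x) (M := M) (by simpa using by linarith) (hUM t ht x)
        simpa [nl_zero] using this
    have h3 := lv.ibp lvx lvx (lv.sub ln) (S.hasDerivAt_vv hp ht0) (S.hasDerivAt_vvx hp ht0)
    have h4 : ∫ x, vv p u t x * (vv p u t x - nl p (U u t x))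
        = (∫ x, vv p u t x ^ 2) - ∫ x, vv p u t x * nl p (U u t x) := by
      rw [← integral_sub lv.int (lv.mul_int ln)]
      exact integral_congr_ae (Eventually.of_forall fun x => by simp only; ring)
    simp_rw [← pow_two] at h3
    have h5 := lv.young ln one_pos
    have h6 := le_abs_self (∫ x, vv p u t x * nl p (U u t x))
    have h7 : ∫ x, ww p u t x ^ 2 ≤ _ := lu.integral_sub_sq_le lv
    have h8 : ∫ x, wwx p u t x ^ 2 ≤ _ := (S.tux.l2 ht0).integral_sub_sq_le lvx
    have h9 := hnM t ht
    have n1 := hA0 t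
    have n2 := integral_sq_nonneg (ux u t)
    have n3 := integral_sq_nonneg (U u t)
    have n4 := integral_sq_nonneg (vv p u t)
    have h10 : l ^ 2 * (∫ x, U u t x ^ 2) ≤ l ^ 2 * M ^ 2 :=
      mul_le_mul_of_nonneg_left (by unfold nrm at h9; linarith) (by positivity)
    simp only [inv_one, one_mul] at h5
    unfold nrm at h9
    unfold dd
    nlinarith [sq_nonneg M]
  have hDint0 : ∀ s t, s ≤ t → 0 ≤ ∫ r in s..t, dd p u r := fun s t hst =>
    intervalIntegral.integral_nonneg hst fun r _ => hD0 r
  have hHanti : ∀ s t, T ≤ s → s ≤ t → H t ≤ H s := fun s t hs hst => by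
    have h1 := hHd s t hs hst
    have h2 := mul_nonneg hc0.le (hDint0 s t hst)
    linarith
  have hHlow : ∀ t, T ≤ t → -((4 + 4 * l ^ 2) * M ^ 2) ≤ H t := fun t ht => by
    have h1 := (abs_le.1 (hHE t ht)).1
    have h2 := hDb t ht
    have h3 := S.energy_nonneg hp hα (show 0 < t by linarith)
    linarith
  obtain ⟨E, hE⟩ : ∃ E, Tendsto H atTop (nhds E) := by
    have hanti : Antitone (fun t => H (max t T)) := fun a b hab =>
      hHanti _ _ (le_max_right _ _) (max_le_max_right _ hab)
    have hbdd : BddBelow (Set.range fun t => H (max t T)) :=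
      ⟨-((4 + 4 * l ^ 2) * M ^ 2), by rintro _ ⟨t, rfl⟩; exact hHlow _ (le_max_right _ _)⟩
    refine ⟨_, (tendsto_atTop_ciInf hanti hbdd).congr' ?_⟩
    filter_upwards [eventually_ge_atTop T] with t ht
    rw [max_eq_left ht]
  refine ⟨T, hT, M, hM1, hnM, c, hc0, l, hl0, H, E, hHE, hHd, hgrow, ?_, hE⟩
  have hlim : Tendsto (fun t => (1 + l) * ((H (t - 1) - H t) / c)) atTop (nhds 0) := by
    have h1 : Tendsto (fun t : ℝ => t - 1) atTop atTop := tendsto_atTop_add_const_right _ _ tendsto_id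
    have := (((hE.comp h1).sub hE).div_const c).const_mul (1 + l)
    simpa using this
  refine squeeze_zero' (Eventually.of_forall hD0) ?_ hlim
  filter_upwards [eventually_ge_atTop (T + 1)] with t ht
  obtain ⟨s, hs1, hs2, hs⟩ := exists_le_average hDc (show 0 < t - 1 by linarith)
    (show t - 1 < t by linarith)
  rw [sub_sub_cancel, mul_one] at hs
  have h1 := hgrow s t (by linarith) hs2
  have h2 : ∫ r in s..t, dd p u r ≤ ∫ r in (t - 1)..t, dd p u r := by
    have := intervalIntegral.integral_add_adjacent_intervals
      (hci (t - 1) s (by linarith) (by linarith)) (hci s t (by linarith) (by linarith))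
    have := hDint0 (t - 1) s hs1
    linarith
  have h3 := hHd (t - 1) t (by linarith) (by linarith)
  have h4 : ∫ r in (t - 1)..t, dd p u r ≤ (H (t - 1) - H t) / c := by rw [le_div_iff₀ hc0]; linarith
  have h5 := mul_le_mul_of_nonneg_left (h2.trans h4) hl0.le
  linarith

end Sol

section

variable {p : ℝ}

/-- The derivative of the ground state. -/
noncomputable def Q1 (p x : ℝ) : ℝ := -tanh ((p - 1) / 2 * x) * Q p x

/-- The second derivative of the ground state. -/
noncomputable def Q2 (p x : ℝ) : ℝ := Q p x - nl p (Q p x)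

lemma Q_base_pos (hp : 2 < p) (x : ℝ) : 0 < (p + 1) / (2 * cosh ((p - 1) / 2 * x) ^ 2) := by
  have := cosh_pos ((p - 1) / 2 * x)
  have : 0 < p + 1 := by linarith
  positivity

lemma Q_pos (hp : 2 < p) (x : ℝ) : 0 < Q p x := rpow_pos_of_pos (Q_base_pos hp x) _

lemma Q_even (p x : ℝ) : Q p (-x) = Q p x := by
  unfold Q
  rw [mul_neg, cosh_neg]

lemma Q1_odd (p x : ℝ) : Q1 p (-x) = -Q1 p x := by
  unfold Q1
  rw [Q_even, mul_neg, tanh_neg]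
  ring

lemma Q_rpow (hp : 2 < p) (x : ℝ) :
    Q p x ^ (p - 1) = (p + 1) / (2 * cosh ((p - 1) / 2 * x) ^ 2) := by
  unfold Q
  rw [← rpow_mul (Q_base_pos hp x).le, one_div_mul_cancel (by linarith), rpow_one]

lemma hasDerivAt_Q (hp : 2 < p) (x : ℝ) : HasDerivAt (Q p) (Q1 p x) x := by
  have hc := cosh_pos ((p - 1) / 2 * x)
  have h1 : HasDerivAt (fun x => cosh ((p - 1) / 2 * x))
      (sinh ((p - 1) / 2 * x) * ((p - 1) / 2)) x := by
    simpa using ((hasDerivAt_id x).const_mul ((p - 1) / 2)).cosh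
  have h2 := (((hasDerivAt_const x (p + 1)).fun_div ((h1.fun_pow 2).const_mul 2)
    (by positivity)).rpow_const (p := 1 / (p - 1)) (Or.inl (Q_base_pos hp x).ne'))
  refine h2.congr_deriv ?_
  rw [rpow_sub_one (Q_base_pos hp x).ne']
  unfold Q1 Q
  rw [tanh_eq_sinh_div_cosh]
  have : p - 1 ≠ 0 := by linarith
  have : p + 1 ≠ 0 := by linarith
  generalize ((p + 1) / (2 * cosh ((p - 1) / 2 * x) ^ 2)) ^ (1 / (p - 1)) = q
  field_simp
  push_cast
  ring

lemma continuous_Q (hp : 2 < p) : Continuous (Q p) :=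
  continuous_iff_continuousAt.2 fun x => (hasDerivAt_Q hp x).continuousAt

lemma deriv_Q (hp : 2 < p) : deriv (Q p) = Q1 p := funext fun x => (hasDerivAt_Q hp x).deriv

lemma nl_Q (hp : 2 < p) (x : ℝ) : nl p (Q p x) = Q p x ^ p := by
  unfold nl
  rw [abs_of_pos (Q_pos hp x), ← rpow_add_one (Q_pos hp x).ne']
  ring_nf

lemma hasDerivAt_Q1 (hp : 2 < p) (x : ℝ) : HasDerivAt (Q1 p) (Q2 p x) x := by
  have hc := cosh_pos ((p - 1) / 2 * x)
  have h0 : HasDerivAt (fun x => (p - 1) / 2 * x) ((p - 1) / 2) x := by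
    simpa using (hasDerivAt_id x).const_mul ((p - 1) / 2)
  have h1 := (h0.sinh.fun_div h0.cosh hc.ne').fun_neg.fun_mul (hasDerivAt_Q hp x)
  have : Q1 p = fun x => -(sinh ((p - 1) / 2 * x) / cosh ((p - 1) / 2 * x)) * Q p x := by
    funext x
    rw [Q1, tanh_eq_sinh_div_cosh]
  rw [this]
  refine h1.congr_deriv ?_
  have h3 := cosh_sq ((p - 1) / 2 * x)
  unfold Q2 nl Q1
  rw [abs_of_pos (Q_pos hp x), Q_rpow hp, tanh_eq_sinh_div_cosh]
  generalize Q p x = q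
  generalize sinh ((p - 1) / 2 * x) = s at *
  generalize cosh ((p - 1) / 2 * x) = c at *
  have h4 : s ^ 2 = c ^ 2 - 1 := by linarith
  field_simp
  simp only [h4]
  ring_nf

lemma continuous_Q1 (hp : 2 < p) : Continuous (Q1 p) :=
  continuous_iff_continuousAt.2 fun x => (hasDerivAt_Q1 hp x).continuousAt

lemma continuous_Q2 (hp : 2 < p) : Continuous (Q2 p) :=
  (continuous_Q hp).sub ((continuous_nl hp).comp (continuous_Q hp))

lemma cQ_pos (hp : 2 < p) : 0 < cQ p := rpow_pos_of_pos (by linarith) _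

lemma Q_eq (hp : 2 < p) (x : ℝ) : Q p x = cQ p * exp (-x)
    * (1 + exp (-((p - 1) * x))) ^ (-(2 / (p - 1))) := by
  have hp1 : p - 1 ≠ 0 := by linarith
  have he := exp_pos (-((p - 1) * x))
  have h1 : (p + 1) / (2 * cosh ((p - 1) / 2 * x) ^ 2)
      = (2 * p + 2) * exp (-((p - 1) * x)) * ((1 + exp (-((p - 1) * x))) ^ (2 : ℝ))⁻¹ := by
    have h3 : exp ((p - 1) / 2 * x) * exp (-((p - 1) / 2 * x)) = 1 := by rw [← exp_add]; simp
    have h4 : exp (-((p - 1) * x)) = exp (-((p - 1) / 2 * x)) ^ 2 := by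
      rw [← exp_nat_mul]; congr 1; push_cast; ring
    rw [cosh_eq, rpow_two, h4]
    generalize exp ((p - 1) / 2 * x) = a at *
    have hb := exp_pos (-((p - 1) / 2 * x))
    generalize exp (-((p - 1) / 2 * x)) = b at *
    have ha : 0 < a := by
      by_contra h
      nlinarith
    have : a = b⁻¹ := eq_inv_of_mul_eq_one_left h3
    subst this
    have : 0 < 1 + b ^ 2 := by positivity
    field_simp
  unfold Q cQ
  rw [h1, mul_rpow (mul_nonneg (by linarith) he.le) (by positivity),
    mul_rpow (by linarith) he.le, rpow_neg (by positivity),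
    inv_rpow (by positivity), ← rpow_mul (by positivity), ← exp_mul]
  congr 3
  · field_simp
  · ring_nf

lemma Q_le (hp : 2 < p) (x : ℝ) : Q p x ≤ cQ p * exp (-|x|) := by
  have key : ∀ x, Q p x ≤ cQ p * exp (-x) := fun x => by
    rw [Q_eq hp]
    refine mul_le_of_le_one_right (mul_pos (cQ_pos hp) (exp_pos _)).le ?_
    refine rpow_le_one_of_one_le_of_nonpos ?_ ?_
    · linarith [exp_pos (-((p - 1) * x))]
    · have : 0 < 2 / (p - 1) := div_pos two_pos (by linarith)
      linarith
  rcases abs_cases x with ⟨h, _⟩ | ⟨h, _⟩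
  · rw [h]; exact key x
  · rw [h, ← Q_even]; exact key (-x)

lemma abs_Q1_le (hp : 2 < p) (x : ℝ) : |Q1 p x| ≤ Q p x := by
  unfold Q1
  rw [abs_mul, abs_neg, abs_of_pos (Q_pos hp x)]
  exact mul_le_of_le_one_left (Q_pos hp x).le (abs_tanh_lt_one _).le

lemma Q_le_cQ (hp : 2 < p) (x : ℝ) : Q p x ≤ cQ p :=
  (Q_le hp x).trans (mul_le_of_le_one_right (cQ_pos hp).le (by simp))

lemma Q_asymp (hp : 2 < p) (x : ℝ) : |Q p x - cQ p * exp (-x)|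
    ≤ cQ p * 2 / (p - 1) * (exp (-x) * exp (-((p - 1) * x))) := by
  have he := exp_pos (-((p - 1) * x))
  have hc := mul_pos (cQ_pos hp) (exp_pos (-x))
  have hb : 0 < 2 / (p - 1) := div_pos two_pos (by linarith)
  have h1 : (1 + exp (-((p - 1) * x))) ^ (-(2 / (p - 1))) ≤ 1 :=
    rpow_le_one_of_one_le_of_nonpos (by linarith) (by linarith)
  have h2 : 1 - 2 / (p - 1) * exp (-((p - 1) * x))
      ≤ (1 + exp (-((p - 1) * x))) ^ (-(2 / (p - 1))) := by
    rw [rpow_def_of_pos (by linarith)]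
    have h3 := log_le_sub_one_of_pos (show 0 < 1 + exp (-((p - 1) * x)) by linarith)
    have h4 := add_one_le_exp (log (1 + exp (-((p - 1) * x))) * -(2 / (p - 1)))
    nlinarith
  rw [Q_eq hp, abs_sub_comm, abs_of_nonneg (by nlinarith)]
  have h5 := mul_le_mul_of_nonneg_left h2 hc.le
  have h6 : cQ p * 2 / (p - 1) * (exp (-x) * exp (-((p - 1) * x)))
    = cQ p * exp (-x) * (2 / (p - 1) * exp (-((p - 1) * x))) := by ring
  rw [h6]
  linarith

lemma one_sub_tanh_le (x : ℝ) : 1 - tanh x ≤ 2 * exp (-(2 * x)) := by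
  have hc := cosh_pos x
  rw [tanh_eq_sinh_div_cosh, one_sub_div hc.ne', div_le_iff₀ hc, cosh_sub_sinh, cosh_eq]
  have h2 : exp (-(2 * x)) * exp x = exp (-x) := by rw [← exp_add]; congr 1; ring
  have := exp_pos (-x)
  have := exp_pos (-(2 * x))
  nlinarith

/-- Exponential asymptotics of `Q'`, with a remainder valid on the whole line. -/
lemma exists_Q1_asymp (hp : 2 < p) :
    ∃ C > 0, ∀ x, |Q1 p x + cQ p * exp (-x)| ≤ C * exp (-(5 / 4 * x)) := by
  have hc := cQ_pos hp
  have hb : 0 < cQ p * 2 / (p - 1) := div_pos (by linarith) (by linarith)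
  refine ⟨2 * cQ p + cQ p * 2 / (p - 1), by linarith, fun x => ?_⟩
  have he := exp_pos (-(5 / 4 * x))
  rcases le_total 0 x with hx | hx
  · have h1 : exp (-x) * exp (-((p - 1) * x)) ≤ exp (-(5 / 4 * x)) := by
      rw [← exp_add]
      exact exp_le_exp.2 (by nlinarith)
    have h2 := Q_asymp hp x
    have h3 : Q1 p x + cQ p * exp (-x)
        = -(Q p x - cQ p * exp (-x)) + (1 - tanh ((p - 1) / 2 * x)) * Q p x := by
      unfold Q1; ring
    have h4 : 0 ≤ 1 - tanh ((p - 1) / 2 * x) := by linarith [tanh_lt_one ((p - 1) / 2 * x)]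
    have h5 : (1 - tanh ((p - 1) / 2 * x)) * Q p x ≤ 2 * cQ p * exp (-(5 / 4 * x)) := by
      have h6 := one_sub_tanh_le ((p - 1) / 2 * x)
      rw [show 2 * ((p - 1) / 2 * x) = (p - 1) * x by ring] at h6
      have h7 := Q_le hp x
      rw [abs_of_nonneg hx] at h7
      calc _ ≤ (2 * exp (-((p - 1) * x))) * (cQ p * exp (-x)) :=
            mul_le_mul h6 h7 (Q_pos hp x).le (by positivity)
        _ = 2 * cQ p * (exp (-x) * exp (-((p - 1) * x))) := by ring
        _ ≤ _ := mul_le_mul_of_nonneg_left h1 (by linarith)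
    rw [h3]
    refine (abs_add_le _ _).trans ?_
    rw [abs_neg, abs_of_nonneg (mul_nonneg h4 (Q_pos hp x).le)]
    have := mul_le_mul_of_nonneg_left h1 hb.le
    linarith
  · have h1 : exp (-x) ≤ exp (-(5 / 4 * x)) := exp_le_exp.2 (by linarith)
    have h2 : exp (-|x|) ≤ exp (-(5 / 4 * x)) := by
      rw [abs_of_nonpos hx]; exact exp_le_exp.2 (by linarith)
    have h3 := (abs_Q1_le hp x).trans (Q_le hp x)
    have h4 : |cQ p * exp (-x)| = cQ p * exp (-x) := abs_of_pos (by positivity)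
    have h5 := abs_add_le (Q1 p x) (cQ p * exp (-x))
    nlinarith [mul_pos hb he]

lemma integrable_exp_neg_mul_abs {a : ℝ} (ha : 0 < a) :
    Integrable (fun x : ℝ => exp (-(a * |x|))) := by
  have h1 : IntegrableOn (fun x : ℝ => exp (-(a * |x|))) (Set.Ioi 0) :=
    (integrableOn_exp_mul_Ioi (neg_lt_zero.2 ha) 0).congr_fun (fun x hx => by
      simp only [abs_of_pos (show (0:ℝ) < x from hx)]; ring_nf) measurableSet_Ioi
  have h2 : IntegrableOn (fun x : ℝ => exp (-(a * |x|))) (Set.Iic 0) :=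
    (integrableOn_exp_mul_Iic ha 0).congr_fun (fun x hx => by
      simp only [abs_of_nonpos (show x ≤ (0:ℝ) from hx)]; ring_nf) measurableSet_Iic
  rw [← integrableOn_univ, ← Set.Iic_union_Ioi (a := (0 : ℝ))]
  exact h2.union h1

lemma l2c_exp_neg_abs : L2c (fun x : ℝ => exp (-|x|)) := by
  refine ⟨by fun_prop, (integrable_exp_neg_mul_abs two_pos).congr
    (Eventually.of_forall fun x => ?_)⟩
  simp only [← exp_nat_mul]
  congr 1
  push_cast
  ring

lemma l2c_Q (hp : 2 < p) : L2c (Q p) :=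
  l2c_exp_neg_abs.of_bound (continuous_Q hp) (C := cQ p) fun x => by
    rw [abs_of_pos (Q_pos hp x), abs_exp]; exact Q_le hp x

lemma l2c_Q1 (hp : 2 < p) : L2c (Q1 p) :=
  (l2c_Q hp).of_bound (continuous_Q1 hp) (C := 1) fun x => by
    rw [one_mul, abs_of_pos (Q_pos hp x)]; exact abs_Q1_le hp x

lemma exists_abs_Q2_le (hp : 2 < p) : ∃ C > 0, ∀ x, |Q2 p x| ≤ C * Q p x := by
  have := rpow_pos_of_pos (cQ_pos hp) (p - 1)
  refine ⟨1 + cQ p ^ (p - 1), by linarith, fun x => ?_⟩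
  have hq := Q_pos hp x
  have h := abs_nl_le hp (s := Q p x) (M := cQ p) (by rw [abs_of_pos hq]; exact Q_le_cQ hp x)
  rw [abs_of_pos hq] at h
  have := abs_sub (Q p x) (nl p (Q p x))
  rw [abs_of_pos hq] at this
  unfold Q2
  linarith

lemma l2c_Q2 (hp : 2 < p) : L2c (Q2 p) := by
  obtain ⟨C, _, hC⟩ := exists_abs_Q2_le hp
  exact (l2c_Q hp).of_bound (continuous_Q2 hp) (C := C) fun x => by
    rw [abs_of_pos (Q_pos hp x)]; exact hC x

lemma c₁_pos (hp : 2 < p) : 0 < c₁ p := by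
  unfold c₁
  rw [deriv_Q hp]
  refine integral_pos_of_integrable_nonneg_nonzero (x := 1) ((continuous_Q1 hp).pow 2)
    (l2c_Q1 hp).int (fun x => sq_nonneg _) ?_
  have h1 : tanh ((p - 1) / 2 * 1) ≠ 0 := by
    rw [tanh_eq_sinh_div_cosh]
    exact div_ne_zero (sinh_pos_iff.2 (by linarith)).ne' (cosh_pos _).ne'
  exact pow_ne_zero _ (mul_ne_zero (neg_ne_zero.2 h1) (Q_pos hp 1).ne')

lemma nl_Q_le (hp : 2 < p) (x : ℝ) : nl p (Q p x) ≤ cQ p ^ p * exp (-(p * |x|)) := by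
  have := rpow_le_rpow (Q_pos hp x).le (Q_le hp x) (by linarith : (0:ℝ) ≤ p)
  rw [mul_rpow (cQ_pos hp).le (exp_pos _).le, ← exp_mul] at this
  rw [nl_Q hp]
  convert this using 3
  ring

lemma nl_Q_pos (hp : 2 < p) (x : ℝ) : 0 < nl p (Q p x) := by
  rw [nl_Q hp]; exact rpow_pos_of_pos (Q_pos hp x) _

lemma integrable_nl_Q_mul_exp (hp : 2 < p) {b : ℝ} (hb : |b| < p) :
    Integrable (fun x => nl p (Q p x) * exp (b * x)) := by
  refine ((integrable_exp_neg_mul_abs (sub_pos.2 hb)).const_mul (cQ p ^ p)).mono'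
    (((continuous_nl hp).comp (continuous_Q hp)).mul (by fun_prop)).aestronglyMeasurable
    (Eventually.of_forall fun x => ?_)
  have h1 := nl_Q_pos hp x
  rw [norm_eq_abs, abs_of_pos (mul_pos h1 (exp_pos _))]
  have h2 : exp (b * x) ≤ exp (|b| * |x|) := exp_le_exp.2 ((le_abs_self _).trans (abs_mul b x).le)
  calc _ ≤ cQ p ^ p * exp (-(p * |x|)) * exp (|b| * |x|) :=
        mul_le_mul (nl_Q_le hp x) h2 (exp_pos _).le (h1.le.trans (nl_Q_le hp x))
    _ = _ := by rw [mul_assoc, ← exp_add]; congr 2; ring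

lemma κ_mul_c₁ (hp : 2 < p) : κ p * c₁ p = cQ p * ∫ x, nl p (Q p x) * exp (-x) := by
  unfold κ
  simp_rw [nl_Q hp]
  field_simp [(c₁_pos hp).ne']

lemma κ_pos (hp : 2 < p) : 0 < κ p := by
  have h : 0 < ∫ x, nl p (Q p x) * exp (-x) := by
    refine integral_pos_of_integrable_nonneg_nonzero (x := 0)
      (((continuous_nl hp).comp (continuous_Q hp)).mul (by fun_prop)) ?_
      (fun x => (mul_pos (nl_Q_pos hp x) (exp_pos _)).le)
      (mul_pos (nl_Q_pos hp _) (exp_pos _)).ne'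
    simpa using integrable_nl_Q_mul_exp hp (b := -1) (by rw [abs_neg, abs_one]; linarith)
  have h1 := mul_pos (cQ_pos hp) h
  rw [← κ_mul_c₁ hp] at h1
  exact pos_of_mul_pos_left h1 (c₁_pos hp).le

/-- The energy of the ground state. -/
noncomputable def jQ (p : ℝ) : ℝ :=
  ((∫ x, Q1 p x ^ 2) + ∫ x, Q p x ^ 2) / 2 - (p + 1)⁻¹ * ∫ x, nl p (Q p x) * Q p x

lemma l2c_nl_Q (hp : 2 < p) : L2c (fun x => nl p (Q p x)) :=
  ((l2c_Q hp).sub (l2c_Q2 hp)).of_bound (C := 1) ((continuous_nl hp).comp (continuous_Q hp))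
    fun x => by unfold Q2; simp

lemma jQ_eq (hp : 2 < p) : jQ p = (1 / 2 - (p + 1)⁻¹) * ∫ x, nl p (Q p x) * Q p x := by
  have h := (l2c_Q hp).ibp (l2c_Q1 hp) (l2c_Q1 hp) (l2c_Q2 hp) (hasDerivAt_Q hp) (hasDerivAt_Q1 hp)
  have h2 : ∫ x, Q p x * Q2 p x = (∫ x, Q p x ^ 2) - ∫ x, nl p (Q p x) * Q p x := by
    rw [← integral_sub (l2c_Q hp).int ((l2c_nl_Q hp).mul_int (l2c_Q hp))]
    exact integral_congr_ae (Eventually.of_forall fun x => by simp only [Q2]; ring)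
  simp_rw [← pow_two] at h
  unfold jQ
  linarith

lemma jQ_pos (hp : 2 < p) : 0 < jQ p := by
  rw [jQ_eq hp]
  refine mul_pos ?_ (integral_pos_of_integrable_nonneg_nonzero (x := 0)
    (((continuous_nl hp).comp (continuous_Q hp)).mul (continuous_Q hp))
    ((l2c_nl_Q hp).mul_int (l2c_Q hp)) (fun x => (mul_pos (nl_Q_pos hp x) (Q_pos hp x)).le)
    (mul_pos (nl_Q_pos hp _) (Q_pos hp _)).ne')
  have : (p + 1)⁻¹ < 2⁻¹ := inv_strictAnti₀ two_pos (by linarith)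
  linarith

lemma exists_nl_sum_le (hp : 2 < p) (n : ℕ) : ∃ C > 0, ∀ (s : Finset ℕ) (a : ℕ → ℝ), s.card ≤ n →
    |nl p (∑ k ∈ s, a k) - ∑ k ∈ s, nl p (a k)|
      ≤ C * ∑ k ∈ s, ∑ j ∈ s.erase k, |a j| * |a k| ^ (p - 1) := by
  have hn1 : (0 : ℝ) < ((n : ℝ) + 1) ^ (p - 1) := rpow_pos_of_pos (by positivity) _
  have hp0 : 0 < p := by linarith
  refine ⟨p * ((n : ℝ) + 1) ^ (p - 1) + 1, by positivity, fun s a hs => ?_⟩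
  rcases s.eq_empty_or_nonempty with rfl | hne
  · simp [nl_zero]
  obtain ⟨i, hi, hmax⟩ := s.exists_max_image (fun k => |a k|) hne
  set B := ∑ j ∈ s.erase i, |a j| with hB
  have hB0 : 0 ≤ B := sum_nonneg fun _ _ => abs_nonneg _
  have hm : 0 ≤ |a i| ^ (p - 1) := rpow_nonneg (abs_nonneg _) _
  have h1 : |∑ j ∈ s.erase i, a j| ≤ B := abs_sum_le_sum_abs _ _
  have h2 : B ≤ n * |a i| := by
    calc B ≤ ∑ _j ∈ s.erase i, |a i| :=
          sum_le_sum fun j hj => hmax j (mem_of_mem_erase hj)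
      _ = (s.erase i).card * |a i| := by simp
      _ ≤ n * |a i| := by
          gcongr
          exact (card_erase_le).trans hs
  have h3 := nl_lip hp (a := a i) (b := ∑ k ∈ s, a k) (M := (n + 1) * |a i|)
    (by nlinarith [abs_nonneg (a i), (Nat.cast_nonneg n : (0:ℝ) ≤ n)])
    (by rw [← add_sum_erase s a hi]
        have := abs_add_le (a i) (∑ j ∈ s.erase i, a j)
        linarith)
  have h4 : |∑ k ∈ s, a k - a i| ≤ B := by
    rw [← add_sum_erase s a hi, add_sub_cancel_left]; exact h1
  rw [mul_rpow (by positivity) (abs_nonneg _)] at h3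
  have h5 : |∑ j ∈ s.erase i, nl p (a j)| ≤ |a i| ^ (p - 1) * B := by
    refine (abs_sum_le_sum_abs _ _).trans ?_
    rw [hB, mul_sum]
    exact sum_le_sum fun j hj => abs_nl_le hp (hmax j (mem_of_mem_erase hj))
  have h6 : nl p (∑ k ∈ s, a k) - ∑ k ∈ s, nl p (a k)
      = (nl p (∑ k ∈ s, a k) - nl p (a i)) - ∑ j ∈ s.erase i, nl p (a j) := by
    rw [← add_sum_erase s (fun k => nl p (a k)) hi]; ring
  have h7 : B * |a i| ^ (p - 1) ≤ ∑ k ∈ s, ∑ j ∈ s.erase k, |a j| * |a k| ^ (p - 1) := by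
    rw [hB, sum_mul]
    exact single_le_sum (f := fun k => ∑ j ∈ s.erase k, |a j| * |a k| ^ (p - 1))
      (fun k _ => sum_nonneg fun j _ => by positivity) hi
  rw [h6]
  have h8 := abs_sub (nl p (∑ k ∈ s, a k) - nl p (a i)) (∑ j ∈ s.erase i, nl p (a j))
  have h9 : p * (((n : ℝ) + 1) ^ (p - 1) * |a i| ^ (p - 1)) * |∑ k ∈ s, a k - a i|
      ≤ p * (((n : ℝ) + 1) ^ (p - 1) * |a i| ^ (p - 1)) * B := by gcongr
  calc _ ≤ (p * ((n : ℝ) + 1) ^ (p - 1) + 1) * (B * |a i| ^ (p - 1)) := by linarith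
    _ ≤ _ := by gcongr

/-- Sum of exponential bumps. -/
noncomputable def bumps (a : ℝ) (K : ℕ) (z : ℕ → ℝ) (x : ℝ) : ℝ :=
  ∑ k ∈ range K, exp (-(a * |x - z k|))

lemma bumps_nonneg (a : ℝ) (K : ℕ) (z : ℕ → ℝ) (x : ℝ) : 0 ≤ bumps a K z x :=
  sum_nonneg fun _ _ => (exp_pos _).le

lemma bumps_le {a : ℝ} (ha : 0 < a) (K : ℕ) (z : ℕ → ℝ) (x : ℝ) : bumps a K z x ≤ K := by
  have : ∀ k ∈ range K, exp (-(a * |x - z k|)) ≤ 1 := fun k _ =>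
    exp_le_one_iff.2 (by have := abs_nonneg (x - z k); nlinarith)
  simpa [bumps] using sum_le_sum this

lemma integrable_bumps {a : ℝ} (ha : 0 < a) (K : ℕ) (z : ℕ → ℝ) : Integrable (bumps a K z) :=
  integrable_finsetSum _ fun k _ => (integrable_exp_neg_mul_abs ha).comp_sub_right (z k)

lemma integral_bumps {a : ℝ} (ha : 0 < a) (K : ℕ) (z : ℕ → ℝ) :
    ∫ x, bumps a K z x = K * ∫ x : ℝ, exp (-(a * |x|)) := by
  unfold bumps
  rw [integral_finsetSum _ fun k _ => (integrable_exp_neg_mul_abs ha).comp_sub_right (z k)]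
  simp_rw [integral_comp_sub (fun x => exp (-(a * |x|)))]
  simp

lemma exp_neg_abs_mul_le (x y z : ℝ) : exp (-|x - y|) * exp (-|x - z|) ≤ exp (-|y - z|) := by
  rw [← exp_add]
  refine exp_le_exp.2 ?_
  have := abs_sub_le y x z
  rw [abs_sub_comm y x] at this
  linarith

/-- The superposition of solitary waves with signs `σ` and centers `z`. -/
noncomputable def rr (p : ℝ) (K : ℕ) (σ z : ℕ → ℝ) (x : ℝ) : ℝ := ∑ k ∈ range K, σ k * Q p (x - z k)

/-- The space derivative of `rr`. -/
noncomputable def rrx (p : ℝ) (K : ℕ) (σ z : ℕ → ℝ) (x : ℝ) : ℝ :=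
  ∑ k ∈ range K, σ k * Q1 p (x - z k)

/-- The sum of the nonlinear terms of the individual solitary waves. -/
noncomputable def rn (p : ℝ) (K : ℕ) (σ z : ℕ → ℝ) (x : ℝ) : ℝ :=
  ∑ k ∈ range K, σ k * nl p (Q p (x - z k))

/-- Signs and pairwise interactions bounded by `q`. -/
structure Cfg (K : ℕ) (σ z : ℕ → ℝ) (q : ℝ) : Prop where
  sgn : ∀ k < K, |σ k| = 1
  le : ∀ j < K, ∀ k < K, j ≠ k → exp (-|z j - z k|) ≤ q
  nonneg : 0 ≤ q
  le_one : q ≤ 1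

section
variable {K : ℕ} {σ z : ℕ → ℝ}

lemma hasDerivAt_rr (hp : 2 < p) (x : ℝ) : HasDerivAt (rr p K σ z) (rrx p K σ z x) x := by
  refine HasDerivAt.fun_sum fun k _ => ?_
  simpa using (((hasDerivAt_Q hp (x - z k)).comp_sub_const x (z k)).const_mul (σ k))

lemma hasDerivAt_rrx (hp : 2 < p) (x : ℝ) :
    HasDerivAt (rrx p K σ z) (rr p K σ z x - rn p K σ z x) x := by
  have : rr p K σ z x - rn p K σ z x = ∑ k ∈ range K, σ k * Q2 p (x - z k) := by
    unfold rr rn Q2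
    rw [← sum_sub_distrib]
    exact sum_congr rfl fun k _ => by ring
  rw [this]
  refine HasDerivAt.fun_sum fun k _ => ?_
  simpa using (((hasDerivAt_Q1 hp (x - z k)).comp_sub_const x (z k)).const_mul (σ k))

lemma l2c_rr (hp : 2 < p) : L2c (rr p K σ z) :=
  L2c.sum _ fun k _ => ((l2c_Q hp).comp_sub (z k)).const_mul (σ k)

lemma l2c_rrx (hp : 2 < p) : L2c (rrx p K σ z) :=
  L2c.sum _ fun k _ => ((l2c_Q1 hp).comp_sub (z k)).const_mul (σ k)

lemma l2c_rn (hp : 2 < p) : L2c (rn p K σ z) :=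
  L2c.sum _ fun k _ => ((l2c_nl_Q hp).comp_sub (z k)).const_mul (σ k)

lemma Cfg.abs_term {q : ℝ} (h : Cfg K σ z q) (hp : 2 < p) {k : ℕ} (hk : k < K) (x : ℝ) :
    |σ k * Q p (x - z k)| = Q p (x - z k) := by
  rw [abs_mul, h.sgn k hk, one_mul, abs_of_pos (Q_pos hp _)]

lemma Cfg.nl_term {q : ℝ} (h : Cfg K σ z q) {k : ℕ} (hk : k < K) (y : ℝ) :
    nl p (σ k * y) = σ k * nl p y := by
  unfold nl
  rw [abs_mul, h.sgn k hk, one_mul]; ring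

lemma Cfg.abs_rr_le {q : ℝ} (h : Cfg K σ z q) (hp : 2 < p) (x : ℝ) :
    |rr p K σ z x| ≤ cQ p * bumps 1 K z x := by
  unfold rr bumps
  rw [mul_sum]
  refine (abs_sum_le_sum_abs _ _).trans (sum_le_sum fun k hk => ?_)
  rw [h.abs_term hp (mem_range.1 hk), one_mul]
  exact Q_le hp _

lemma Cfg.abs_rr_le' {q : ℝ} (h : Cfg K σ z q) (hp : 2 < p) (x : ℝ) :
    |rr p K σ z x| ≤ cQ p * K :=
  (h.abs_rr_le hp x).trans (mul_le_mul_of_nonneg_left (bumps_le one_pos K z x) (cQ_pos hp).le)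

lemma Cfg.pair_le {q : ℝ} (h : Cfg K σ z q) (hp : 2 < p) {j k : ℕ} (hj : j < K) (hk : k < K)
    (hjk : j ≠ k) (x : ℝ) : Q p (x - z j) * Q p (x - z k) ^ (p - 1)
      ≤ cQ p ^ p * q * exp (-((p - 2) * |x - z k|)) := by
  have hc := cQ_pos hp
  have h1 := rpow_le_rpow (Q_pos hp (x - z k)).le (Q_le hp (x - z k)) (by linarith : (0:ℝ) ≤ p - 1)
  rw [mul_rpow hc.le (exp_pos _).le, ← exp_mul] at h1
  have h2 : exp (-|x - z k| * (p - 1)) = exp (-|x - z k|) * exp (-((p - 2) * |x - z k|)) := by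
    rw [← exp_add]; congr 1; ring
  have h3 := (exp_neg_abs_mul_le x (z j) (z k)).trans (h.le j hj k hk hjk)
  have h4 : cQ p ^ p = cQ p * cQ p ^ (p - 1) := by rw [rpow_sub_one hc.ne']; field_simp
  have h5 := rpow_pos_of_pos hc (p - 1)
  rw [h2] at h1
  calc _ ≤ cQ p * exp (-|x - z j|) * (cQ p ^ (p - 1) *
          (exp (-|x - z k|) * exp (-((p - 2) * |x - z k|)))) :=
        mul_le_mul (Q_le hp _) h1 (rpow_nonneg (Q_pos hp _).le _) (by positivity)
    _ = cQ p ^ p * (exp (-|x - z j|) * exp (-|x - z k|)) *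
          exp (-((p - 2) * |x - z k|)) := by rw [h4]; ring
    _ ≤ _ := by gcongr

end

/-- Pointwise control of the nonlinear interactions. -/
lemma exists_interaction_le (hp : 2 < p) (K : ℕ) : ∃ C > 0, ∀ σ z q, Cfg K σ z q → ∀ x,
    |nl p (rr p K σ z x) - rn p K σ z x| ≤ C * q * bumps (p - 2) K z x ∧
    |rr p K σ z x * rn p K σ z x - ∑ k ∈ range K, nl p (Q p (x - z k)) * Q p (x - z k)|
      ≤ C * q * bumps (p - 2) K z x := by
  obtain ⟨C, hC, hCs⟩ := exists_nl_sum_le hp K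
  have hc := cQ_pos hp
  have hcp := rpow_pos_of_pos hc p
  refine ⟨(C + 1 + cQ p) * (K + 1) * cQ p ^ p, by positivity, fun σ z q h x => ?_⟩
  have hsum : ∀ k ∈ range K, ∑ j ∈ (range K).erase k, Q p (x - z j) * Q p (x - z k) ^ (p - 1)
      ≤ (K + 1) * (cQ p ^ p * q * exp (-((p - 2) * |x - z k|))) := fun k hk => by
    calc _ ≤ ∑ _j ∈ (range K).erase k, cQ p ^ p * q * exp (-((p - 2) * |x - z k|)) :=
          sum_le_sum fun j hj => h.pair_le hp (mem_range.1 (mem_of_mem_erase hj)) (mem_range.1 hk)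
            (ne_of_mem_erase hj) x
      _ = (((range K).erase k).card : ℝ) * (cQ p ^ p * q *
            exp (-((p - 2) * |x - z k|))) := by rw [sum_const, nsmul_eq_mul]
      _ ≤ _ := by
          have := h.nonneg
          gcongr
          have := (card_erase_le (s := range K) (a := k))
          rw [card_range] at this
          have h2 : (((range K).erase k).card : ℝ) ≤ K := by exact_mod_cast this
          linarith
  have htot : ∑ k ∈ range K, ∑ j ∈ (range K).erase k,
      Q p (x - z j) * Q p (x - z k) ^ (p - 1) ≤ (K + 1) * cQ p ^ p * q * bumps (p - 2) K z x := by
    refine (sum_le_sum hsum).trans (le_of_eq ?_)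
    unfold bumps
    rw [mul_sum]
    exact sum_congr rfl fun k _ => by ring
  have hb := bumps_nonneg (p - 2) K z x
  have hq := h.nonneg
  have hqb : 0 ≤ (K + 1) * cQ p ^ p * q * bumps (p - 2) K z x := by positivity
  constructor
  · have h1 := hCs (range K) (fun k => σ k * Q p (x - z k)) (by simp)
    have h2 : ∑ k ∈ range K, nl p (σ k * Q p (x - z k)) = rn p K σ z x :=
      sum_congr rfl fun k hk => h.nl_term (mem_range.1 hk) _
    have h3 : ∑ k ∈ range K, ∑ j ∈ (range K).erase k,
        |σ j * Q p (x - z j)| * |σ k * Q p (x - z k)| ^ (p - 1)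
        = ∑ k ∈ range K, ∑ j ∈ (range K).erase k, Q p (x - z j) * Q p (x - z k) ^ (p - 1) :=
      sum_congr rfl fun k hk => sum_congr rfl fun j hj => by
        rw [h.abs_term hp (mem_range.1 hk), h.abs_term hp (mem_range.1 (mem_of_mem_erase hj))]
    rw [h2, h3] at h1
    refine h1.trans ((mul_le_mul_of_nonneg_left htot hC.le).trans ?_)
    nlinarith [mul_nonneg hc.le hqb]
  · have h1 : rr p K σ z x * rn p K σ z x - ∑ k ∈ range K, nl p (Q p (x - z k)) * Q p (x - z k)
        = ∑ k ∈ range K, σ k * nl p (Q p (x - z k)) *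
          ∑ j ∈ (range K).erase k, σ j * Q p (x - z j) := by
      unfold rn
      rw [mul_sum, ← sum_sub_distrib]
      refine sum_congr rfl fun k hk => ?_
      have h2 : σ k * σ k = 1 := by rw [← abs_mul_abs_self, h.sgn k (mem_range.1 hk), one_mul]
      unfold rr
      rw [← add_sum_erase _ _ hk]
      linear_combination (nl p (Q p (x - z k)) * Q p (x - z k)) * h2
    rw [h1]
    refine (abs_sum_le_sum_abs _ _).trans ?_
    have h3 : ∀ k ∈ range K, |σ k * nl p (Q p (x - z k)) *
          ∑ j ∈ (range K).erase k, σ j * Q p (x - z j)|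
        ≤ cQ p * ∑ j ∈ (range K).erase k, Q p (x - z j) * Q p (x - z k) ^ (p - 1) := by
      intro k hk
      have h4 : |∑ j ∈ (range K).erase k, σ j * Q p (x - z j)|
          ≤ ∑ j ∈ (range K).erase k, Q p (x - z j) :=
        (abs_sum_le_sum_abs _ _).trans (sum_le_sum fun j hj =>
          (h.abs_term hp (mem_range.1 (mem_of_mem_erase hj)) x).le)
      have hQ := Q_pos hp (x - z k)
      rw [abs_mul, abs_mul, h.sgn k (mem_range.1 hk), one_mul, abs_of_pos (nl_Q_pos hp _),
        ← sum_mul]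
      have h5 : nl p (Q p (x - z k)) ≤ cQ p * Q p (x - z k) ^ (p - 1) := by
        unfold nl
        rw [abs_of_pos hQ, mul_comm]
        exact mul_le_mul_of_nonneg_right (Q_le_cQ hp _) (rpow_nonneg hQ.le _)
      calc _ ≤ (cQ p * Q p (x - z k) ^ (p - 1)) * ∑ j ∈ (range K).erase k, Q p (x - z j) :=
            mul_le_mul h5 h4 (abs_nonneg _) ((nl_Q_pos hp _).le.trans h5)
        _ = _ := by ring
    refine (sum_le_sum h3).trans ?_
    rw [← mul_sum]
    refine (mul_le_mul_of_nonneg_left htot hc.le).trans ?_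
    nlinarith [mul_nonneg hC.le hqb]

/-- The static energy. -/
noncomputable def jj (p : ℝ) (a ax : ℝ → ℝ) : ℝ :=
  ((∫ x, ax x ^ 2) + ∫ x, a x ^ 2) / 2 - ∫ x, Fp p (a x)

lemma integrable_Fp (hp : 2 < p) {a : ℝ → ℝ} (ha : L2c a) {M : ℝ} (hM : ∀ x, |a x| ≤ M) :
    Integrable (fun x => Fp p (a x)) := by
  refine (ha.int.const_mul (M ^ (p - 1))).mono'
    ((continuous_Fp hp).comp ha.cont).aestronglyMeasurable (Eventually.of_forall fun x => ?_)
  rw [norm_eq_abs, abs_of_nonneg (Fp_nonneg hp _)]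
  exact Fp_le hp (hM x)

lemma L2c.nl (hp : 2 < p) {a : ℝ → ℝ} (ha : L2c a) {M : ℝ} (hM : ∀ x, |a x| ≤ M) :
    L2c (fun x => nl p (a x)) :=
  ha.of_bound (C := M ^ (p - 1)) ((continuous_nl hp).comp ha.cont) fun x => abs_nl_le hp (hM x)

lemma exists_interaction_integral_le (hp : 2 < p) (K : ℕ) : ∃ C > 0, ∀ σ z q, Cfg K σ z q →
    L2c (fun x => nl p (rr p K σ z x) - rn p K σ z x) ∧
    ∫ x, (nl p (rr p K σ z x) - rn p K σ z x) ^ 2 ≤ C ^ 2 * q ^ 2 := by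
  obtain ⟨C, hC, hCs⟩ := exists_interaction_le hp K
  set m := ∫ x : ℝ, exp (-((p - 2) * |x|)) with hm
  have hm0 : 0 ≤ m := integral_nonneg fun _ => (exp_pos _).le
  have ha : 0 < p - 2 := by linarith
  refine ⟨C * (K * (m + 1) + 1), by positivity, fun σ z q h => ?_⟩
  have h1 : L2c (fun x => NLKG.nl p (rr p K σ z x)) := (l2c_rr hp).nl hp (h.abs_rr_le' hp)
  have h2 := h1.sub (l2c_rn hp (K := K) (σ := σ) (z := z))
  refine ⟨h2, ?_⟩
  have h3 : ∫ x, (NLKG.nl p (rr p K σ z x) - rn p K σ z x) ^ 2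
      ≤ ∫ x, C ^ 2 * q ^ 2 * K * bumps (p - 2) K z x := by
    refine integral_mono h2.int ((integrable_bumps ha K z).const_mul _) fun x => ?_
    have h4 := (hCs σ z q h x).1
    have h5 := bumps_le ha K z x
    have h6 := bumps_nonneg (p - 2) K z x
    have h7 := pow_le_pow_left₀ (abs_nonneg _) h4 2
    rw [sq_abs] at h7
    refine h7.trans ?_
    have h8 : bumps (p - 2) K z x ^ 2 ≤ K * bumps (p - 2) K z x := by nlinarith
    calc _ = C ^ 2 * q ^ 2 * bumps (p - 2) K z x ^ 2 := by ring
      _ ≤ C ^ 2 * q ^ 2 * (K * bumps (p - 2) K z x) := by gcongr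
      _ = _ := by ring
  refine h3.trans ?_
  rw [integral_const_mul, integral_bumps ha, ← hm]
  have hK : (0:ℝ) ≤ K := Nat.cast_nonneg K
  have : (K : ℝ) * (K * m) ≤ (K * (m + 1) + 1) ^ 2 := by nlinarith [mul_nonneg hK hm0]
  calc C ^ 2 * q ^ 2 * K * (K * m) = (C ^ 2 * q ^ 2) * (K * (K * m)) := by ring
    _ ≤ (C ^ 2 * q ^ 2) * (K * (m + 1) + 1) ^ 2 := by gcongr
    _ = _ := by ring

/-- The energy of a superposition of solitary waves. -/
lemma exists_jj_rr_le (hp : 2 < p) (K : ℕ) : ∃ C > 0, ∀ σ z q, Cfg K σ z q →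
    |jj p (rr p K σ z) (rrx p K σ z) - K * jQ p| ≤ C * q := by
  obtain ⟨C, hC, hCs⟩ := exists_interaction_le hp K
  set m := ∫ x : ℝ, exp (-((p - 2) * |x|)) with hm
  have hm0 : 0 ≤ m := integral_nonneg fun _ => (exp_pos _).le
  have ha : 0 < p - 2 := by linarith
  have hc := cQ_pos hp
  refine ⟨(1 + cQ p * K) * C * (K * m + 1), by positivity, fun σ z q h => ?_⟩
  have lr := l2c_rr hp (K := K) (σ := σ) (z := z)
  have lrx := l2c_rrx hp (K := K) (σ := σ) (z := z)
  have ln := l2c_rn hp (K := K) (σ := σ) (z := z)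
  have lnl : L2c (fun x => nl p (rr p K σ z x)) := lr.nl hp (h.abs_rr_le' hp)
  have hd := lr.ibp lrx lrx (lr.sub ln) (hasDerivAt_rr hp) (hasDerivAt_rrx hp)
  have h1 : ∫ x, rr p K σ z x * (rr p K σ z x - rn p K σ z x)
      = (∫ x, rr p K σ z x ^ 2) - ∫ x, rr p K σ z x * rn p K σ z x := by
    rw [← integral_sub lr.int (lr.mul_int ln)]
    exact integral_congr_ae (Eventually.of_forall fun x => by simp only; ring)
  simp_rw [← pow_two] at hd
  have lq := fun k => ((l2c_nl_Q hp).comp_sub (z k)).mul_int ((l2c_Q hp).comp_sub (z k))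
  have hi : Integrable (fun x => ∑ k ∈ range K,
      nl p (Q p (x - z k)) * Q p (x - z k)) := integrable_finsetSum _ fun k _ => lq k
  have h2 : ∫ x, (∑ k ∈ range K, nl p (Q p (x - z k)) * Q p (x - z k))
      = K * ∫ x, nl p (Q p x) * Q p x := by
    rw [integral_finsetSum _ fun k _ => lq k]
    simp_rw [integral_comp_sub (fun x => nl p (Q p x) * Q p x)]
    simp
  have h3 : (∫ x, Fp p (rr p K σ z x)) = (p + 1)⁻¹ * ((∫ x, rr p K σ z x * rn p K σ z x)
      + ∫ x, rr p K σ z x * (nl p (rr p K σ z x) - rn p K σ z x)) := by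
    rw [← integral_add (lr.mul_int ln) (lr.mul_int (lnl.sub ln)), ← integral_const_mul]
    refine integral_congr_ae (Eventually.of_forall fun x => ?_)
    have := Fp_mul hp (rr p K σ z x)
    have : p + 1 ≠ 0 := by linarith
    simp only
    field_simp
    linarith
  have hbi := (integrable_bumps ha K z).const_mul (C * q)
  have hbv : ∫ x, C * q * bumps (p - 2) K z x = C * q * (K * m) := by
    rw [integral_const_mul, integral_bumps ha]
  have h4 : |(∫ x, rr p K σ z x * rn p K σ z x) - K * ∫ x, nl p (Q p x) * Q p x|
      ≤ C * q * (K * m) := by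
    rw [← h2, ← integral_sub (lr.mul_int ln) hi, ← hbv]
    exact (abs_integral_le_integral_abs).trans
      (integral_mono ((lr.mul_int ln).sub hi).abs hbi fun x => (hCs σ z q h x).2)
  have h5 : |∫ x, rr p K σ z x * (nl p (rr p K σ z x) - rn p K σ z x)|
      ≤ (cQ p * K) * (C * q * (K * m)) := by
    rw [← hbv, ← integral_const_mul]
    refine (abs_integral_le_integral_abs).trans
      (integral_mono (lr.mul_int (lnl.sub ln)).abs (hbi.const_mul _) fun x => ?_)
    simp only [abs_mul]
    exact mul_le_mul (h.abs_rr_le' hp x) (hCs σ z q h x).1 (abs_nonneg _) (by positivity)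
  have hpi : (p + 1)⁻¹ ≤ 1 / 2 := by rw [one_div]; exact inv_anti₀ two_pos (by linarith)
  have hpi0 : 0 < (p + 1)⁻¹ := inv_pos.2 (by linarith)
  rw [jQ_eq hp]
  have h6 : jj p (rr p K σ z) (rrx p K σ z) - K * ((1 / 2 - (p + 1)⁻¹) * ∫ x, nl p (Q p x) * Q p x)
      = (1 / 2 - (p + 1)⁻¹) * ((∫ x, rr p K σ z x * rn p K σ z x) - K * ∫ x, nl p (Q p x) * Q p x)
        - (p + 1)⁻¹ * ∫ x, rr p K σ z x * (nl p (rr p K σ z x) - rn p K σ z x) := by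
    unfold jj
    rw [h3]
    linarith
  rw [h6]
  refine (abs_sub _ _).trans ?_
  rw [abs_mul, abs_mul, abs_of_nonneg (by linarith : 0 ≤ 1 / 2 - (p + 1)⁻¹), abs_of_pos hpi0]
  have hq := h.nonneg
  have e1 := mul_le_mul (show 1 / 2 - (p + 1)⁻¹ ≤ 1 by linarith) h4 (abs_nonneg _) zero_le_one
  have e2 := mul_le_mul (show (p + 1)⁻¹ ≤ 1 by linarith) h5 (abs_nonneg _) zero_le_one
  have e3 : 0 ≤ (1 + cQ p * K) * C * q := by positivity
  linarith

/-- Expansion of the energy around a superposition of solitary waves. -/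
lemma exists_jj_sub_le (hp : 2 < p) (K : ℕ) (M : ℝ) : ∃ C > 0, ∀ σ z q, Cfg K σ z q →
    ∀ a ax, L2c a → L2c ax → (∀ x, HasDerivAt a (ax x) x) → (∀ x, |a x| ≤ M) →
    ∀ E, 0 ≤ E → ∫ x, (a x - rr p K σ z x) ^ 2 ≤ E ^ 2 → ∫ x, (ax x - rrx p K σ z x) ^ 2 ≤ E ^ 2 →
    |jj p a ax - jj p (rr p K σ z) (rrx p K σ z)| ≤ C * (E ^ 2 + q * E) := by
  obtain ⟨C, hC, hCs⟩ := exists_interaction_integral_le hp K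
  have hc := cQ_pos hp
  set L := |M| + cQ p * K with hL
  have hL0 : 0 ≤ L := by positivity
  have hLp : 0 ≤ p * L ^ (p - 1) := mul_nonneg (by linarith) (rpow_nonneg hL0 _)
  refine ⟨C + 1 + p * L ^ (p - 1), by positivity, fun σ z q h a ax la lax da hM E hE h1 h2 => ?_⟩
  have lr := l2c_rr hp (K := K) (σ := σ) (z := z)
  have lrx := l2c_rrx hp (K := K) (σ := σ) (z := z)
  have ln := l2c_rn hp (K := K) (σ := σ) (z := z)
  have lnl : L2c (fun x => nl p (rr p K σ z x)) := lr.nl hp (h.abs_rr_le' hp)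
  have le := la.sub lr
  have lex := lax.sub lrx
  obtain ⟨lI, hI⟩ := hCs σ z q h
  have e1 := le.ibp lex lrx (lr.sub ln) (fun x => (da x).sub (hasDerivAt_rr hp x))
    (hasDerivAt_rrx hp)
  have e2 : ∫ x, ax x ^ 2 = (∫ x, rrx p K σ z x ^ 2)
      + 2 * (∫ x, (ax x - rrx p K σ z x) * rrx p K σ z x)
      + ∫ x, (ax x - rrx p K σ z x) ^ 2 := by
    rw [← integral_const_mul, ← integral_add lrx.int ((lex.mul_int lrx).const_mul 2),
      ← integral_add (by exact lrx.int.add ((lex.mul_int lrx).const_mul 2)) lex.int]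
    exact integral_congr_ae (Eventually.of_forall fun x => by simp only; ring)
  have e3 : ∫ x, a x ^ 2 = (∫ x, rr p K σ z x ^ 2) + 2 * (∫ x, (a x - rr p K σ z x) * rr p K σ z x)
      + ∫ x, (a x - rr p K σ z x) ^ 2 := by
    rw [← integral_const_mul, ← integral_add lr.int ((le.mul_int lr).const_mul 2),
      ← integral_add (by exact lr.int.add ((le.mul_int lr).const_mul 2)) le.int]
    exact integral_congr_ae (Eventually.of_forall fun x => by simp only; ring)
  have e4 : ∫ x, (a x - rr p K σ z x) * (rr p K σ z x - rn p K σ z x)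
      = (∫ x, (a x - rr p K σ z x) * rr p K σ z x) - ∫ x, (a x - rr p K σ z x) * rn p K σ z x := by
    rw [← integral_sub (le.mul_int lr) (le.mul_int ln)]
    exact integral_congr_ae (Eventually.of_forall fun x => by simp only; ring)
  have hRL : ∀ x, |rr p K σ z x| ≤ L := fun x =>
    (h.abs_rr_le' hp x).trans (by rw [hL]; linarith [abs_nonneg M])
  have haL : ∀ x, |a x| ≤ L := fun x =>
    ((hM x).trans (le_abs_self M)).trans (by rw [hL]; linarith [mul_nonneg hc.le (Nat.cast_nonneg (α := ℝ) K)])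
  have iFa := integrable_Fp hp la haL
  have iFr := integrable_Fp hp lr hRL
  have e5 : (∫ x, Fp p (a x)) - (∫ x, Fp p (rr p K σ z x))
      = (∫ x, (a x - rr p K σ z x) * nl p (rr p K σ z x))
      + ∫ x, (Fp p (a x) - Fp p (rr p K σ z x) - (a x - rr p K σ z x) * nl p (rr p K σ z x)) := by
    rw [integral_sub (by exact iFa.sub iFr) (le.mul_int lnl), integral_sub iFa iFr]
    ring
  have e6 : |∫ x, (Fp p (a x) - Fp p (rr p K σ z x) - (a x - rr p K σ z x) * nl p (rr p K σ z x))|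
      ≤ p * L ^ (p - 1) * ∫ x, (a x - rr p K σ z x) ^ 2 := by
    rw [← integral_const_mul]
    refine (abs_integral_le_integral_abs).trans (integral_mono
      (((iFa.sub iFr).sub (le.mul_int lnl)).abs) (le.int.const_mul _) fun x => ?_)
    have := Fp_quad hp (a := rr p K σ z x) (b := a x - rr p K σ z x) (M := L) (hRL x)
      (by simpa using haL x)
    rw [add_sub_cancel] at this
    rw [mul_comm (a x - rr p K σ z x)]
    exact this
  have e7 : ∫ x, (a x - rr p K σ z x) * (nl p (rr p K σ z x) - rn p K σ z x)
      = (∫ x, (a x - rr p K σ z x) * nl p (rr p K σ z x))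
        - ∫ x, (a x - rr p K σ z x) * rn p K σ z x := by
    rw [← integral_sub (le.mul_int lnl) (le.mul_int ln)]
    exact integral_congr_ae (Eventually.of_forall fun x => by simp only; ring)
  have e8 : |∫ x, (a x - rr p K σ z x) * (nl p (rr p K σ z x) - rn p K σ z x)| ≤ E * (C * q) := by
    refine (le.abs_integral_mul_le lI).trans (mul_le_mul ?_ ?_ (sqrt_nonneg _) hE)
    · exact sqrt_le_iff.2 ⟨hE, h1⟩
    · exact sqrt_le_iff.2 ⟨mul_nonneg hC.le h.nonneg, by rw [mul_pow]; exact hI⟩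
  have e9 : jj p a ax - jj p (rr p K σ z) (rrx p K σ z)
      = ((∫ x, (ax x - rrx p K σ z x) ^ 2) + ∫ x, (a x - rr p K σ z x) ^ 2) / 2
        - (∫ x, (a x - rr p K σ z x) * (nl p (rr p K σ z x) - rn p K σ z x))
        - ∫ x, (Fp p (a x) - Fp p (rr p K σ z x) - (a x - rr p K σ z x) * nl p (rr p K σ z x)) := by
    unfold jj
    linarith
  rw [e9]
  have e10 : p * L ^ (p - 1) * (∫ x, (a x - rr p K σ z x) ^ 2) ≤ p * L ^ (p - 1) * E ^ 2 := by
    gcongr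
  have n1 : 0 ≤ ∫ x, (ax x - rrx p K σ z x) ^ 2 := integral_nonneg fun _ => sq_nonneg _
  have n2 : 0 ≤ ∫ x, (a x - rr p K σ z x) ^ 2 := integral_nonneg fun _ => sq_nonneg _
  have n3 := mul_nonneg hC.le (sq_nonneg E)
  have n4 := mul_nonneg hLp (mul_nonneg h.nonneg hE)
  have n5 := mul_nonneg h.nonneg hE
  rw [abs_le] at e6 e8 ⊢
  constructor <;> linarith

/-- Interaction integral of two solitary waves at signed distance `D`. -/
noncomputable def pf (p D : ℝ) : ℝ := ∫ y, nl p (Q p y) * Q1 p (y + D)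

lemma pf_neg (D : ℝ) : pf p (-D) = -pf p D := by
  unfold pf
  rw [← integral_neg_eq_self, ← integral_neg]
  refine integral_congr_ae (Eventually.of_forall fun y => ?_)
  simp only
  rw [Q_even, show -y + -D = -(y + D) by ring, Q1_odd]
  ring

lemma integral_nl_Q_mul_Q1 (y z : ℝ) : ∫ x, nl p (Q p (x - y)) * Q1 p (x - z) = pf p (y - z) := by
  unfold pf
  rw [← integral_comp_sub (fun x => nl p (Q p x) * Q1 p (x + (y - z))) y]
  refine integral_congr_ae (Eventually.of_forall fun x => ?_)
  simp only
  congr 2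
  ring

lemma exists_pf_asymp (hp : 2 < p) : ∃ C > 0, ∀ D,
    |pf p D + κ p * c₁ p * exp (-D)| ≤ C * exp (-(5 / 4 * D)) := by
  obtain ⟨C, hC, hCs⟩ := exists_Q1_asymp hp
  have i1 : Integrable (fun x => nl p (Q p x) * exp (-x)) := by
    simpa using integrable_nl_Q_mul_exp hp (b := -1) (by rw [abs_neg, abs_one]; linarith)
  have i2 : Integrable (fun x => nl p (Q p x) * exp (-(5 / 4 * x))) := by
    have := integrable_nl_Q_mul_exp hp (b := -(5 / 4)) (by rw [abs_neg, abs_of_pos (by norm_num)]; linarith)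
    simpa using this
  have h0 : 0 ≤ ∫ x, nl p (Q p x) * exp (-(5 / 4 * x)) :=
    integral_nonneg fun x => (mul_pos (nl_Q_pos hp x) (exp_pos _)).le
  refine ⟨C * (∫ x, nl p (Q p x) * exp (-(5 / 4 * x))) + 1, by positivity, fun D => ?_⟩
  have i3 : Integrable (fun y => nl p (Q p y) * Q1 p (y + D)) :=
    (l2c_nl_Q hp).mul_int (by simpa using (l2c_Q1 hp).comp_sub (-D))
  have e1 : pf p D + κ p * c₁ p * exp (-D)
      = ∫ y, nl p (Q p y) * (Q1 p (y + D) + cQ p * exp (-(y + D))) := by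
    have : ∀ y, nl p (Q p y) * (Q1 p (y + D) + cQ p * exp (-(y + D))) = nl p (Q p y) * Q1 p (y + D)
          + cQ p * exp (-D) * (nl p (Q p y) * exp (-y)) := fun y => by
      rw [neg_add, exp_add]; ring
    simp_rw [this]
    rw [integral_add i3 (i1.const_mul _), integral_const_mul, κ_mul_c₁ hp]
    unfold pf
    ring
  rw [e1]
  have e2 : ∀ y, |nl p (Q p y) * (Q1 p (y + D) + cQ p * exp (-(y + D)))|
      ≤ C * exp (-(5 / 4 * D)) * (nl p (Q p y) * exp (-(5 / 4 * y))) := fun y => by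
    rw [abs_mul, abs_of_pos (nl_Q_pos hp y)]
    have h2 := mul_le_mul_of_nonneg_left (hCs (y + D)) (nl_Q_pos hp y).le
    refine h2.trans (le_of_eq ?_)
    rw [show -(5 / 4 * (y + D)) = -(5 / 4 * D) + -(5 / 4 * y) by ring, exp_add]
    ring
  have e3 := norm_integral_le_of_norm_le (i2.const_mul (C * exp (-(5 / 4 * D))))
    (f := fun y => nl p (Q p y) * (Q1 p (y + D) + cQ p * exp (-(y + D))))
    (Eventually.of_forall fun y => by rw [norm_eq_abs]; exact e2 y)
  rw [integral_const_mul, norm_eq_abs] at e3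
  refine e3.trans ?_
  have := exp_pos (-(5 / 4 * D))
  nlinarith

/-- The leading-order force acting on the `k`-th solitary wave. -/
noncomputable def gg (K : ℕ) (σ z : ℕ → ℝ) (k : ℕ) : ℝ :=
  (if 0 < k then σ (k - 1) * exp (-(z k - z (k - 1))) else 0)
    - (if k + 1 < K then σ (k + 1) * exp (-(z (k + 1) - z k)) else 0)

section
variable {K : ℕ} {σ z : ℕ → ℝ} {q : ℝ}

lemma Cfg.exp_le_sq (h : Cfg K σ z q) (hz : ∀ j k, j < k → k < K → z j < z k) {j k : ℕ}
    (hjk : j + 1 < k) (hk : k < K) : exp (-(z k - z j)) ≤ q ^ 2 := by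
  have h1 := h.le (j + 1) (by omega) k hk (by omega)
  have h2 := h.le j (by omega) (j + 1) (by omega) (by omega)
  rw [abs_sub_comm, abs_of_pos (sub_pos.2 (hz _ _ hjk hk))] at h1
  rw [abs_sub_comm, abs_of_pos (sub_pos.2 (hz _ _ (by omega) (by omega)))] at h2
  have : exp (-(z k - z j)) = exp (-(z k - z (j + 1))) * exp (-(z (j + 1) - z j)) := by
    rw [← exp_add]; congr 1; ring
  rw [this, pow_two]
  exact mul_le_mul h1 h2 (exp_pos _).le h.nonneg

lemma exp_five_fourths (x : ℝ) : exp (-(5 / 4 * x)) = exp (-x) ^ (5 / 4 : ℝ) := by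
  rw [← exp_mul]; congr 1; ring

end

lemma exists_sum_pf (hp : 2 < p) (K : ℕ) : ∃ C > 0, ∀ σ z q, Cfg K σ z q →
    (∀ j k, j < k → k < K → z j < z k) → ∀ k < K,
    |(∑ j ∈ (range K).erase k, σ j * pf p (z j - z k)) - κ p * c₁ p * gg K σ z k|
      ≤ C * q ^ (5 / 4 : ℝ) := by
  obtain ⟨C, hC, hCs⟩ := exists_pf_asymp hp
  have hκ : 0 < κ p * c₁ p := mul_pos (κ_pos hp) (c₁_pos hp)
  refine ⟨(K + 1) * (C + κ p * c₁ p), by positivity, fun σ z q h hz k hk => ?_⟩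
  have hq := h.nonneg
  have hq54 : 0 ≤ q ^ (5 / 4 : ℝ) := rpow_nonneg hq _
  have hq2 : q ^ 2 ≤ q ^ (5 / 4 : ℝ) := by
    rw [← rpow_two]
    rcases hq.eq_or_lt with h0 | h0
    · rw [← h0, zero_rpow two_ne_zero, zero_rpow (by norm_num)]
    · exact rpow_le_rpow_of_exponent_ge h0 h.le_one (by norm_num)
  have hee : ∀ D, 0 < D → exp (-D) ≤ q → exp (-(5 / 4 * D)) ≤ q ^ (5 / 4 : ℝ) := fun D _ h1 => by
      rw [exp_five_fourths]
      exact rpow_le_rpow (exp_pos _).le h1 (by norm_num)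
  set g : ℕ → ℝ := fun j => (if j + 1 = k then σ j * exp (-(z k - z j)) else 0)
    - (if j = k + 1 then σ j * exp (-(z j - z k)) else 0) with hg
  have hsum : ∑ j ∈ (range K).erase k, g j = gg K σ z k := by
    rw [hg, sum_sub_distrib]
    unfold gg
    congr 1
    · rcases Nat.eq_zero_or_pos k with rfl | h0
      · simp
      · obtain ⟨m, rfl⟩ : ∃ m, k = m + 1 := ⟨k - 1, by omega⟩
        simp only [add_left_inj, Nat.succ_pos, if_true, add_tsub_cancel_right]
        rw [sum_ite_eq' (s := (range K).erase (m + 1)) (a := m)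
          (b := fun j => σ j * exp (-(z (m + 1) - z j))), if_pos]
        simp only [mem_erase, mem_range]
        omega
    · rw [sum_ite_eq' (s := (range K).erase k) (a := k + 1)
          (b := fun j => σ j * exp (-(z j - z k)))]
      simp
  have hterm : ∀ j ∈ (range K).erase k,
      |σ j * pf p (z j - z k) - κ p * c₁ p * g j| ≤ (C + κ p * c₁ p) * q ^ (5 / 4 : ℝ) := by
    intro j hj
    have hjK : j < K := mem_range.1 (mem_of_mem_erase hj)
    have hjk : j ≠ k := ne_of_mem_erase hj
    have hqj := h.le j hjK k hk hjk
    have hs := h.sgn j hjK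
    have hCq : 0 ≤ κ p * c₁ p * q ^ (5 / 4 : ℝ) := by positivity
    rcases lt_or_gt_of_ne hjk with hlt | hlt
    · have hD := sub_pos.2 (hz j k hlt hk)
      rw [abs_sub_comm, abs_of_pos hD] at hqj
      have h1 := (hCs (z k - z j)).trans (mul_le_mul_of_nonneg_left (hee _ hD hqj) hC.le)
      rw [← neg_sub (z k) (z j), pf_neg]
      by_cases hadj : j + 1 = k
      · have : g j = σ j * exp (-(z k - z j)) := by
          simp only [hg, if_pos hadj, if_neg (show ¬ j = k + 1 by omega), sub_zero]
        rw [this, show σ j * -pf p (z k - z j) - κ p * c₁ p * (σ j * exp (-(z k - z j)))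
          = -(σ j * (pf p (z k - z j) + κ p * c₁ p * exp (-(z k - z j)))) by ring, abs_neg,
          abs_mul, hs, one_mul]
        linarith
      · have : g j = 0 := by
          simp only [hg, if_neg hadj, if_neg (show ¬ j = k + 1 by omega), sub_zero]
        have h3 := h.exp_le_sq hz (show j + 1 < k by omega) hk
        rw [this, mul_zero, sub_zero, abs_mul, hs, one_mul, abs_neg]
        have h4 := abs_sub (pf p (z k - z j) + κ p * c₁ p * exp (-(z k - z j)))
          (κ p * c₁ p * exp (-(z k - z j)))
        rw [add_sub_cancel_right, abs_of_pos (mul_pos hκ (exp_pos _))] at h4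
        have := mul_le_mul_of_nonneg_left (h3.trans hq2) hκ.le
        linarith
    · have hD := sub_pos.2 (hz k j hlt hjK)
      rw [abs_of_pos hD] at hqj
      have h1 := (hCs (z j - z k)).trans (mul_le_mul_of_nonneg_left (hee _ hD hqj) hC.le)
      by_cases hadj : j = k + 1
      · have : g j = -(σ j * exp (-(z j - z k))) := by
          simp only [hg, if_pos hadj, if_neg (show ¬ j + 1 = k by omega), zero_sub]
        rw [this, show σ j * pf p (z j - z k) - κ p * c₁ p * -(σ j * exp (-(z j - z k)))
          = (σ j * (pf p (z j - z k) + κ p * c₁ p * exp (-(z j - z k)))) by ring,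
          abs_mul, hs, one_mul]
        linarith
      · have : g j = 0 := by
          simp only [hg, if_neg hadj, if_neg (show ¬ j + 1 = k by omega), sub_zero]
        have h3 := h.exp_le_sq hz (show k + 1 < j by omega) hjK
        rw [this, mul_zero, sub_zero, abs_mul, hs, one_mul]
        have h4 := abs_sub (pf p (z j - z k) + κ p * c₁ p * exp (-(z j - z k)))
          (κ p * c₁ p * exp (-(z j - z k)))
        rw [add_sub_cancel_right, abs_of_pos (mul_pos hκ (exp_pos _))] at h4
        have := mul_le_mul_of_nonneg_left (h3.trans hq2) hκ.le
        linarith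
  rw [← hsum, mul_sum, ← sum_sub_distrib]
  refine (abs_sum_le_sum_abs _ _).trans ((sum_le_sum hterm).trans ?_)
  rw [sum_const, nsmul_eq_mul]
  have h5 : (((range K).erase k).card : ℝ) ≤ K + 1 := by
    have := (card_erase_le (s := range K) (a := k))
    rw [card_range] at this
    have h2 : (((range K).erase k).card : ℝ) ≤ K := by exact_mod_cast this
    linarith
  have := mul_le_mul_of_nonneg_right h5 (show 0 ≤ (C + κ p * c₁ p) * q ^ (5 / 4 : ℝ) by positivity)
  linarith

section
variable {K : ℕ} {σ z : ℕ → ℝ} {q : ℝ}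

lemma rpow_five_fourths_eq {q : ℝ} (hq : 0 ≤ q) : q ^ (5 / 4 : ℝ) = q ^ (3 / 4 : ℝ) * √q := by
  rw [sqrt_eq_rpow, ← rpow_add_of_nonneg hq (by norm_num) (by norm_num)]; norm_num

lemma Cfg.mul_exp_le (h : Cfg K σ z q) {j k : ℕ} (hj : j < K) (hk : k < K) (hjk : j ≠ k) (x : ℝ) :
    exp (-|x - z j|) * exp (-|x - z k|) ≤ q ^ (3 / 4 : ℝ) * exp (-(1 / 4 * |x - z k|)) := by
  have h1 := (exp_neg_abs_mul_le x (z j) (z k)).trans (h.le j hj k hk hjk)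
  have h2 := rpow_le_rpow (by positivity) h1 (by norm_num : (0:ℝ) ≤ 3 / 4)
  rw [← exp_add, ← exp_mul] at h2
  have h3 : exp (-|x - z j|) * exp (-|x - z k|) = exp ((-|x - z j| + -|x - z k|) * (3 / 4)) *
        exp ((-|x - z j| + -|x - z k|) * (1 / 4)) := by
    rw [← exp_add, ← exp_add]; congr 1; ring
  rw [h3]
  refine mul_le_mul h2 (exp_le_exp.2 ?_) (exp_pos _).le (rpow_nonneg h.nonneg _)
  have := abs_nonneg (x - z j)
  linarith

lemma Cfg.triple_le (h : Cfg K σ z q) {i j k : ℕ} (hi : i < K) (hj : j < K) (hk : k < K)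
    (hij : i ≠ j) (hjk : j ≠ k) (hik : i ≠ k) (x : ℝ) :
    exp (-|x - z i|) * exp (-|x - z j|) * exp (-|x - z k|) ≤ q ^ (5 / 4 : ℝ) := by
  have h1 := (exp_neg_abs_mul_le x (z i) (z j)).trans (h.le i hi j hj hij)
  have h2 := (exp_neg_abs_mul_le x (z j) (z k)).trans (h.le j hj k hk hjk)
  have h3 := (exp_neg_abs_mul_le x (z i) (z k)).trans (h.le i hi k hk hik)
  have hq := h.nonneg
  have h4 : (exp (-|x - z i|) * exp (-|x - z j|) * exp (-|x - z k|)) ^ 2 ≤ (q * √q) ^ 2 := by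
    have e1 := mul_le_mul (mul_le_mul h1 h2 (by positivity) hq) h3 (by positivity) (by positivity)
    rw [mul_pow q, sq_sqrt hq]
    refine le_trans (le_of_eq ?_) (e1.trans (le_of_eq ?_)) <;> ring
  refine (abs_le_of_sq_le_sq' h4 (by positivity)).2.trans ?_
  rw [rpow_five_fourths_eq hq]
  refine mul_le_mul_of_nonneg_right ?_ (sqrt_nonneg _)
  rcases hq.eq_or_lt with h0 | h0
  · rw [← h0, zero_rpow (by norm_num)]
  · simpa using rpow_le_rpow_of_exponent_ge h0 h.le_one (by norm_num : (3 / 4 : ℝ) ≤ 1)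

end

lemma mul_le_sq_add_sq (a b : ℝ) : a * b ≤ a ^ 2 + b ^ 2 := by
  nlinarith [sq_nonneg (a - b), sq_nonneg (a + b)]

lemma exists_force_pointwise (hp : 2 < p) (K : ℕ) (M : ℝ) : ∃ C > 0, ∀ σ z q, Cfg K σ z q →
    ∀ k < K, ∀ x a, |a| ≤ M →
    |(nl p a - dnl p (Q p (x - z k)) * a) * Q1 p (x - z k)
        - (1 - p) * σ k * (nl p (Q p (x - z k)) * Q1 p (x - z k))
        - ∑ j ∈ (range K).erase k, σ j * (nl p (Q p (x - z j)) * Q1 p (x - z k))|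
      ≤ C * (a - rr p K σ z x) ^ 2 + C * q ^ (5 / 4 : ℝ) *
          (exp (-(1 / 4 * |x - z k|)) + bumps (p - 2) K z x) := by
  have hc := cQ_pos hp
  have hK0 : (0 : ℝ) ≤ K := Nat.cast_nonneg K
  have hKK : (K : ℝ) ≤ (K + 1) ^ 2 := by nlinarith
  set N : ℝ := max M (cQ p * (K + 1)) with hN
  have hcK : 0 ≤ cQ p * K := by positivity
  have hcN : cQ p ≤ N := le_trans (by linarith) (le_max_right _ _)
  have hKN : cQ p * K ≤ N := le_trans (by linarith) (le_max_right _ _)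
  have hN0 : 0 < N := hc.trans_le hcN
  obtain ⟨C3, hC3, hT3⟩ := nl_triple hp hN0.le
  obtain ⟨C4, hC4, hT4⟩ := exists_nl_sum_le hp K
  set m := p * (p - 1) * N ^ (p - 2) with hm
  have hm0 : 0 ≤ m := by
    have := rpow_nonneg hN0.le (p - 2)
    have : 0 ≤ p * (p - 1) := by nlinarith
    positivity
  have hcp := rpow_pos_of_pos hc p
  set CB := cQ p ^ 2 * K with hCB
  set C := m * cQ p + m + m * CB ^ 2 + C3 * CB * (cQ p * (K + 1)) + C4 * cQ p ^ p * cQ p * K + 1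
    with hC
  refine ⟨C, by positivity, fun σ z q h k hk x a ha => ?_⟩
  have hq := h.nonneg
  set s := (range K).erase k with hs
  have hscard : (s.card : ℝ) ≤ K := by
    exact_mod_cast (card_le_card (erase_subset _ _)).trans (by simp)
  have hmem : ∀ j ∈ s, j < K ∧ j ≠ k := fun j hj =>
    ⟨mem_range.1 (mem_of_mem_erase hj), ne_of_mem_erase hj⟩
  set A := σ k * Q p (x - z k) with hA
  set b := ∑ j ∈ s, σ j * Q p (x - z j) with hb
  set R := rr p K σ z x with hR
  set Qk := Q p (x - z k) with hQk
  set w := exp (-(1 / 4 * |x - z k|)) with hw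
  have hw0 : 0 < w := exp_pos _
  have hw1 : w ≤ 1 := exp_le_one_iff.2 (by have := abs_nonneg (x - z k); linarith)
  have hRAb : R = A + b := (add_sum_erase _ _ (mem_range.2 hk)).symm
  have hQ0 : 0 < Qk := Q_pos hp _
  have hAQ : |A| = Qk := h.abs_term hp hk x
  have hbabs : |b| ≤ ∑ j ∈ s, Q p (x - z j) := by
    refine (abs_sum_le_sum_abs _ _).trans (sum_le_sum fun j hj => ?_)
    rw [h.abs_term hp (hmem j hj).1]
  have hbN : |b| ≤ N := by
    refine hbabs.trans ((sum_le_sum fun j _ => Q_le_cQ hp _).trans ?_)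
    rw [sum_const, nsmul_eq_mul, mul_comm]
    exact (mul_le_mul_of_nonneg_left hscard hc.le).trans hKN
  have hAN : |A| ≤ N := by rw [hAQ]; exact (Q_le_cQ hp _).trans hcN
  have hRN : |R| ≤ N := (h.abs_rr_le' hp x).trans hKN
  have haN : |a| ≤ N := ha.trans (le_max_left _ _)
  have hbQ : |b| * Qk ≤ cQ p ^ 2 * ∑ j ∈ s, exp (-|x - z j|) * exp (-|x - z k|) := by
    refine (mul_le_mul_of_nonneg_right hbabs hQ0.le).trans ?_
    rw [sum_mul, mul_sum]
    refine sum_le_sum fun j _ => ?_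
    calc _ ≤ (cQ p * exp (-|x - z j|)) * (cQ p * exp (-|x - z k|)) :=
          mul_le_mul (Q_le hp _) (Q_le hp _) hQ0.le (by positivity)
      _ = _ := by ring
  have hbQ1 : |b| * Qk ≤ CB * (q ^ (3 / 4 : ℝ) * w) := by
    refine hbQ.trans ?_
    have : ∑ j ∈ s, exp (-|x - z j|) * exp (-|x - z k|) ≤ K * (q ^ (3 / 4 : ℝ) * w) := by
      refine (sum_le_sum fun j hj => h.mul_exp_le (hmem j hj).1 hk (hmem j hj).2 x).trans ?_
      rw [sum_const, nsmul_eq_mul]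
      gcongr
    calc _ ≤ cQ p ^ 2 * (K * (q ^ (3 / 4 : ℝ) * w)) := by gcongr
      _ = _ := by rw [hCB]; ring
  have hbQ2 : |b| * Qk ≤ CB * q := by
    refine hbQ.trans ?_
    have : ∑ j ∈ s, exp (-|x - z j|) * exp (-|x - z k|) ≤ K * q := by
      refine (sum_le_sum fun j hj => (exp_neg_abs_mul_le x (z j) (z k)).trans
        (h.le j (hmem j hj).1 k hk (hmem j hj).2)).trans ?_
      rw [sum_const, nsmul_eq_mul]
      gcongr
    calc _ ≤ cQ p ^ 2 * (K * q) := by gcongr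
      _ = _ := by rw [hCB]; ring
  set ε := a - R with hε
  set q54 := q ^ (5 / 4 : ℝ) with hq54
  have hq54' : q54 = q ^ (3 / 4 : ℝ) * √q := rpow_five_fourths_eq hq
  have hq34 : 0 ≤ q ^ (3 / 4 : ℝ) := rpow_nonneg hq _
  have hq54n : 0 ≤ q54 := rpow_nonneg hq _
  have hQ1 : |Q1 p (x - z k)| ≤ Qk := abs_Q1_le hp _
  have hdA : dnl p Qk = dnl p A := by unfold dnl; rw [hAQ, abs_of_pos hQ0]
  have hnA : nl p A - dnl p A * A = (1 - p) * σ k * nl p Qk := by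
    rw [hA, h.nl_term hk, ← hA, ← hdA]
    unfold nl dnl
    rw [hA]; ring
  have t1 : |nl p a - nl p R - dnl p R * ε| ≤ m * ε ^ 2 := by
    have := nl_quad hp (a := R) (b := ε) hRN (by rw [hε]; simpa using haN)
    rwa [hε, add_sub_cancel] at this
  have t2 : |dnl p R - dnl p A| ≤ m * |b| := by
    have := dnl_lip hp (a := A) (b := R) hAN hRN
    rwa [hRAb, add_sub_cancel_left, ← hRAb] at this
  have t3 : |nl p R - nl p A - nl p b - dnl p A * b| ≤ C3 * |b| * min |A| |b| := by
    rw [hRAb]; exact hT3 A b hAN hbN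
  have hminle : min |A| |b| ≤ cQ p * (K + 1) * √q := by
    have h0 : 0 ≤ min |A| |b| := le_min (abs_nonneg _) (abs_nonneg _)
    have : (min |A| |b|) ^ 2 ≤ (cQ p * (K + 1) * √q) ^ 2 := by
      rw [mul_pow, sq_sqrt hq, pow_two]
      refine (mul_le_mul (min_le_right _ _) (min_le_left _ _) h0 (abs_nonneg _)).trans ?_
      rw [hAQ]
      refine hbQ2.trans (mul_le_mul_of_nonneg_right ?_ hq)
      rw [hCB, mul_pow]
      gcongr
    exact (abs_le_of_sq_le_sq' this (by positivity)).2
  have t4 : |nl p b - ∑ j ∈ s, σ j * nl p (Q p (x - z j))| * Qk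
      ≤ C4 * cQ p ^ p * cQ p * K * (q54 * bumps (p - 2) K z x) := by
    have e1 := hT4 s (fun j => σ j * Q p (x - z j)) (by exact_mod_cast hscard)
    have e2 : ∑ j ∈ s, nl p (σ j * Q p (x - z j)) = ∑ j ∈ s, σ j * nl p (Q p (x - z j)) :=
      sum_congr rfl fun j hj => h.nl_term (hmem j hj).1 _
    rw [e2] at e1
    refine (mul_le_mul_of_nonneg_right e1 hQ0.le).trans ?_
    have e3 : (∑ j ∈ s, ∑ i ∈ s.erase j, |σ i * Q p (x - z i)| * |σ j * Q p (x - z j)| ^ (p - 1))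
        * Qk ≤ cQ p ^ p * cQ p * K * (q54 * bumps (p - 2) K z x) := by
      have e4 : ∀ j ∈ s, ∀ i ∈ s.erase j,
          |σ i * Q p (x - z i)| * |σ j * Q p (x - z j)| ^ (p - 1) * Qk
          ≤ cQ p ^ p * cQ p * (q54 * exp (-((p - 2) * |x - z j|))) := by
        intro j hj i hi
        have hi' := hmem i (mem_of_mem_erase hi)
        have hj' := hmem j hj
        have hij : i ≠ j := ne_of_mem_erase hi
        rw [h.abs_term hp hi'.1, h.abs_term hp hj'.1]
        have f1 := rpow_le_rpow (Q_pos hp (x - z j)).le (Q_le hp (x - z j))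
          (by linarith : (0:ℝ) ≤ p - 1)
        rw [mul_rpow hc.le (exp_pos _).le, ← exp_mul,
          show -|x - z j| * (p - 1) = -|x - z j| + -((p - 2) * |x - z j|) by ring,
          exp_add] at f1
        have f2 : cQ p ^ p = cQ p * cQ p ^ (p - 1) := by rw [rpow_sub_one hc.ne']; field_simp
        have f3 := h.triple_le hi'.1 hj'.1 hk hij hj'.2 hi'.2 x
        have f4 := rpow_pos_of_pos hc (p - 1)
        calc _ ≤ (cQ p * exp (-|x - z i|)) * (cQ p ^ (p - 1) *
              (exp (-|x - z j|) * exp (-((p - 2) * |x - z j|))))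
              * (cQ p * exp (-|x - z k|)) :=
              mul_le_mul (mul_le_mul (Q_le hp _) f1 (rpow_nonneg (Q_pos hp _).le _)
                (by positivity)) (Q_le hp _) hQ0.le (by positivity)
          _ = cQ p ^ p * cQ p * ((exp (-|x - z i|) * exp (-|x - z j|)
              * exp (-|x - z k|)) * exp (-((p - 2) * |x - z j|))) := by rw [f2]; ring
          _ ≤ _ := by gcongr
      rw [sum_mul]
      calc _ ≤ ∑ j ∈ s, K * (cQ p ^ p * cQ p * (q54 * exp (-((p - 2) * |x - z j|)))) := by
            refine sum_le_sum fun j hj => ?_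
            rw [sum_mul]
            refine (sum_le_sum (e4 j hj)).trans ?_
            rw [sum_const, nsmul_eq_mul]
            refine mul_le_mul_of_nonneg_right ?_ (by positivity)
            refine le_trans ?_ hscard
            exact_mod_cast card_le_card (erase_subset _ _)
        _ ≤ ∑ j ∈ range K, K * (cQ p ^ p * cQ p * (q54 * exp (-((p - 2) * |x - z j|)))) :=
            sum_le_sum_of_subset_of_nonneg (erase_subset _ _) fun _ _ _ => by positivity
        _ = _ := by
            unfold bumps
            rw [mul_sum, mul_sum]
            exact sum_congr rfl fun j _ => by ring
    calc _ = C4 * ((∑ j ∈ s, ∑ i ∈ s.erase j,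
          |σ i * Q p (x - z i)| * |σ j * Q p (x - z j)| ^ (p - 1)) * Qk) := by ring
      _ ≤ C4 * (cQ p ^ p * cQ p * K * (q54 * bumps (p - 2) K z x)) := by gcongr
      _ = _ := by ring
  have hdec : (nl p a - dnl p Qk * a) * Q1 p (x - z k) - (1 - p) * σ k * (nl p Qk * Q1 p (x - z k))
        - ∑ j ∈ s, σ j * (nl p (Q p (x - z j)) * Q1 p (x - z k))
      = ((nl p a - nl p R - dnl p R * ε) + (dnl p R - dnl p A) * ε
          + (nl p R - nl p A - nl p b - dnl p A * b)
          + (nl p b - ∑ j ∈ s, σ j * nl p (Q p (x - z j)))) * Q1 p (x - z k) := by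
    have : ∑ j ∈ s, σ j * (nl p (Q p (x - z j)) * Q1 p (x - z k))
        = (∑ j ∈ s, σ j * nl p (Q p (x - z j))) * Q1 p (x - z k) := by
      rw [sum_mul]; exact sum_congr rfl fun j _ => by ring
    rw [this, hdA, ← mul_assoc ((1 - p) * σ k), ← hnA, hε, hRAb]
    ring
  rw [hdec, abs_mul]
  set X1 := nl p a - nl p R - dnl p R * ε
  set X2 := dnl p R - dnl p A
  set X3 := nl p R - nl p A - nl p b - dnl p A * b
  set X4 := nl p b - ∑ j ∈ s, σ j * nl p (Q p (x - z j))
  have g1 : |X1| * Qk ≤ m * cQ p * ε ^ 2 := by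
    have := mul_le_mul t1 (Q_le_cQ hp (x - z k)) hQ0.le (by positivity)
    linarith
  have g2 : |X2 * ε| * Qk ≤ m * ε ^ 2 + m * CB ^ 2 * (q54 * w) := by
    rw [abs_mul]
    have e1 : |X2| * |ε| * Qk ≤ m * |ε| * (CB * (q ^ (3 / 4 : ℝ) * w)) := by
      calc _ ≤ m * |b| * |ε| * Qk := by gcongr
        _ = m * |ε| * (|b| * Qk) := by ring
        _ ≤ _ := by gcongr
    refine e1.trans ?_
    have e2 : (q ^ (3 / 4 : ℝ) * w) ^ 2 ≤ q54 * w := by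
      rw [hq54', mul_pow, pow_two, pow_two]
      have e3 : q ^ (3 / 4 : ℝ) ≤ √q := by
        rw [sqrt_eq_rpow]
        rcases hq.eq_or_lt with h0 | h0
        · rw [← h0, zero_rpow (by norm_num), zero_rpow (by norm_num)]
        · exact rpow_le_rpow_of_exponent_ge h0 h.le_one (by norm_num)
      have e4 : w * w ≤ w := mul_le_of_le_one_left hw0.le hw1
      gcongr
    have e7 : |ε| * (CB * (q ^ (3 / 4 : ℝ) * w)) ≤ ε ^ 2 + CB ^ 2 * (q54 * w) := by
      refine (mul_le_sq_add_sq _ _).trans ?_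
      rw [sq_abs, mul_pow CB]
      gcongr
    calc _ = m * (|ε| * (CB * (q ^ (3 / 4 : ℝ) * w))) := by ring
      _ ≤ m * (ε ^ 2 + CB ^ 2 * (q54 * w)) := by gcongr
      _ = _ := by ring
  have g3 : |X3| * Qk ≤ C3 * CB * (cQ p * (K + 1)) * (q54 * w) := by
    calc _ ≤ C3 * |b| * min |A| |b| * Qk := by gcongr
      _ = C3 * ((|b| * Qk) * min |A| |b|) := by ring
      _ ≤ C3 * ((CB * (q ^ (3 / 4 : ℝ) * w)) * (cQ p * (K + 1) * √q)) := by gcongr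
      _ = _ := by rw [hq54']; ring
  have g4 := t4
  have hB := bumps_nonneg (p - 2) K z x
  have hfin : |X1 + X2 * ε + X3 + X4| * |Q1 p (x - z k)|
      ≤ |X1| * Qk + |X2 * ε| * Qk + |X3| * Qk + |X4| * Qk := by
    rw [← add_mul, ← add_mul, ← add_mul]
    refine mul_le_mul ?_ hQ1 (abs_nonneg _) (by positivity)
    exact (abs_add_le _ _).trans (add_le_add ((abs_add_le _ _).trans
      (add_le_add (abs_add_le _ _) le_rfl)) le_rfl)
  refine hfin.trans ?_
  have u1 : (m * cQ p + m) * ε ^ 2 ≤ C * ε ^ 2 := by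
    refine mul_le_mul_of_nonneg_right ?_ (sq_nonneg _)
    rw [hC]
    have : 0 ≤ m * CB ^ 2 + C3 * CB * (cQ p * (K + 1)) + C4 * cQ p ^ p * cQ p * K := by positivity
    linarith
  have u2 : (m * CB ^ 2 + C3 * CB * (cQ p * (K + 1))) * (q54 * w) ≤ C * (q54 * w) := by
    refine mul_le_mul_of_nonneg_right ?_ (by positivity)
    rw [hC]
    have : 0 ≤ m * cQ p + m + C4 * cQ p ^ p * cQ p * K := by positivity
    linarith
  have u3 : C4 * cQ p ^ p * cQ p * K * (q54 * bumps (p - 2) K z x)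
      ≤ C * (q54 * bumps (p - 2) K z x) := by
    refine mul_le_mul_of_nonneg_right ?_ (by positivity)
    rw [hC]
    have : 0 ≤ m * cQ p + m + m * CB ^ 2 + C3 * CB * (cQ p * (K + 1)) := by positivity
    linarith
  linarith

/-- The force exerted on the `k`-th solitary wave by a profile `a`. -/
noncomputable def force (p : ℝ) (a : ℝ → ℝ) (z : ℝ) : ℝ :=
  ∫ x, (nl p (a x) - dnl p (Q p (x - z)) * a x) * Q1 p (x - z)

lemma pf_zero : pf p 0 = 0 := by
  have := pf_neg (p := p) 0
  rw [neg_zero] at this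
  linarith

lemma L2c.dnl_mul (hp : 2 < p) {a b : ℝ → ℝ} (ha : L2c a) (hb : Continuous b) {M : ℝ}
    (hM : ∀ x, |b x| ≤ M) : L2c (fun x => dnl p (b x) * a x) :=
  ha.bdd_mul ((continuous_dnl hp).comp hb) (C := p * M ^ (p - 1)) fun x => by
    rw [abs_of_nonneg (dnl_nonneg hp _)]; exact dnl_mono hp (hM x)

lemma integrable_force (hp : 2 < p) {a : ℝ → ℝ} (ha : L2c a) {M : ℝ} (hM : ∀ x, |a x| ≤ M)
    (z : ℝ) : Integrable fun x => (nl p (a x) - dnl p (Q p (x - z)) * a x) * Q1 p (x - z) :=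
  ((ha.nl hp hM).sub (ha.dnl_mul hp ((continuous_Q hp).comp (by fun_prop : Continuous fun x => x - z))
    (M := cQ p) fun x => by
      rw [Function.comp_apply, abs_of_pos (Q_pos hp _)]; exact Q_le_cQ hp _)).mul_int
    ((l2c_Q1 hp).comp_sub z)

lemma exists_force_le (hp : 2 < p) (K : ℕ) (M : ℝ) : ∃ C > 0, ∀ σ z q, Cfg K σ z q →
    (∀ j k, j < k → k < K → z j < z k) → ∀ a, L2c a → (∀ x, |a x| ≤ M) → ∀ k < K,
    |force p a (z k) - κ p * c₁ p * gg K σ z k|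
      ≤ C * (q ^ (5 / 4 : ℝ) + ∫ x, (a x - rr p K σ z x) ^ 2) := by
  obtain ⟨C, hC, hCs⟩ := exists_force_pointwise hp K M
  obtain ⟨C', hC', hCs'⟩ := exists_sum_pf hp K
  have h14 : (0 : ℝ) < 1 / 4 := by norm_num
  have ha : 0 < p - 2 := by linarith
  set m1 := ∫ x : ℝ, exp (-(1 / 4 * |x|)) with hm1
  set m2 := ∫ x : ℝ, exp (-((p - 2) * |x|)) with hm2
  have hm1' : 0 ≤ m1 := integral_nonneg fun _ => (exp_pos _).le
  have hm2' : 0 ≤ m2 := integral_nonneg fun _ => (exp_pos _).le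
  refine ⟨C + C * (m1 + K * m2) + C', by positivity, fun σ z q h hz a hla haM k hk => ?_⟩
  have i1 := integrable_force hp hla haM (z k)
  have iQ : ∀ j, Integrable fun x => nl p (Q p (x - z j)) * Q1 p (x - z k) := fun j =>
    ((l2c_nl_Q hp).comp_sub (z j)).mul_int ((l2c_Q1 hp).comp_sub (z k))
  have iS : Integrable fun x =>
      ∑ j ∈ (range K).erase k, σ j * (nl p (Q p (x - z j)) * Q1 p (x - z k)) :=
    integrable_finsetSum _ fun j _ => (iQ j).const_mul _
  have i2 : Integrable fun x => (nl p (a x) - dnl p (Q p (x - z k)) * a x) * Q1 p (x - z k)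
      - (1 - p) * σ k * (nl p (Q p (x - z k)) * Q1 p (x - z k)) := i1.sub ((iQ k).const_mul _)
  have ie : Integrable fun x => (a x - rr p K σ z x) ^ 2 := (hla.sub (l2c_rr hp)).int
  have iw : Integrable fun x => exp (-(1 / 4 * |x - z k|)) :=
    (integrable_exp_neg_mul_abs h14).comp_sub_right (z k)
  have iwb : Integrable fun x => exp (-(1 / 4 * |x - z k|)) + bumps (p - 2) K z x :=
    iw.add (integrable_bumps ha K z)
  have e1 := norm_integral_le_of_norm_le
    ((ie.const_mul C).add (iwb.const_mul (C * q ^ (5 / 4 : ℝ))))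
    (f := fun x => (nl p (a x) - dnl p (Q p (x - z k)) * a x) * Q1 p (x - z k)
        - (1 - p) * σ k * (nl p (Q p (x - z k)) * Q1 p (x - z k))
        - ∑ j ∈ (range K).erase k, σ j * (nl p (Q p (x - z j)) * Q1 p (x - z k)))
    (Eventually.of_forall fun x => by rw [norm_eq_abs]; exact hCs σ z q h k hk x (a x) (haM x))
  simp only [Pi.add_apply] at e1
  rw [integral_add (ie.const_mul C) (iwb.const_mul _), integral_const_mul, integral_const_mul] at e1
  rw [integral_add iw (integrable_bumps ha K z), integral_bumps ha,
    integral_comp_sub (fun x => exp (-(1 / 4 * |x|))),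
    integral_sub i2 iS, integral_sub i1 ((iQ k).const_mul _),
    integral_const_mul, integral_nl_Q_mul_Q1, sub_self, pf_zero, mul_zero, sub_zero,
    integral_finsetSum _ fun j _ => (iQ j).const_mul _, norm_eq_abs] at e1
  simp_rw [integral_const_mul, integral_nl_Q_mul_Q1] at e1
  have e2 := hCs' σ z q h hz k hk
  have hq54 : 0 ≤ q ^ (5 / 4 : ℝ) := rpow_nonneg h.nonneg _
  have hI : 0 ≤ ∫ x, (a x - rr p K σ z x) ^ 2 := integral_nonneg fun _ => sq_nonneg _
  have e3 := abs_sub_le (force p a (z k))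
    (∑ j ∈ (range K).erase k, σ j * pf p (z j - z k)) (κ p * c₁ p * gg K σ z k)
  unfold force at e3 ⊢
  have u1 : 0 ≤ (C * (m1 + K * m2) + C') * ∫ x, (a x - rr p K σ z x) ^ 2 := by positivity
  have u2 : 0 ≤ C * q ^ (5 / 4 : ℝ) := by positivity
  linarith

lemma hasDerivAt_Q2 (hp : 2 < p) (x : ℝ) : HasDerivAt (Q2 p) (Q1 p x - dnl p (Q p x) * Q1 p x) x :=
  (hasDerivAt_Q hp x).sub ((hasDerivAt_nl hp _).comp x (hasDerivAt_Q hp x))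

lemma l2c_dnl_mul_Q1 {p : ℝ} (hp : 2 < p) : L2c fun x => dnl p (Q p x) * Q1 p x :=
  (l2c_Q1 hp).dnl_mul hp (continuous_Q hp) (M := cQ p) fun x => by
    rw [abs_of_pos (Q_pos hp _)]; exact Q_le_cQ hp _

lemma hasDerivAt_Q1_sub {p : ℝ} (hp : 2 < p) (z x : ℝ) :
    HasDerivAt (fun y => Q1 p (y - z)) (Q2 p (x - z)) x :=
  (hasDerivAt_Q1 hp (x - z)).comp_sub_const x z

lemma integral_mul_Q1 {p : ℝ} (hp : 2 < p) {v vx vxx : ℝ → ℝ} (lv : L2c v) (lvx : L2c vx)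
    (lvxx : L2c vxx) (dv : ∀ x, HasDerivAt v (vx x) x) (dvx : ∀ x, HasDerivAt vx (vxx x) x)
    (z : ℝ) : ∫ x, vxx x * Q1 p (x - z) = (∫ x, v x * Q1 p (x - z))
      - ∫ x, v x * (dnl p (Q p (x - z)) * Q1 p (x - z)) := by
  have l1 := (l2c_Q1 hp).comp_sub z
  have l4 := (l2c_dnl_mul_Q1 hp).comp_sub z
  have i1 := lvx.ibp lvxx l1 ((l2c_Q2 hp).comp_sub z) dvx (hasDerivAt_Q1_sub hp z)
  have i2 := lv.ibp lvx ((l2c_Q2 hp).comp_sub z) (l1.sub l4) dv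
    fun x => (hasDerivAt_Q2 hp (x - z)).comp_sub_const x z
  rw [← integral_sub (lv.mul_int l1) (lv.mul_int l4)]
  simp only [← mul_sub]
  linarith

lemma force_eq_sub {p : ℝ} (hp : 2 < p) {a : ℝ → ℝ} {M : ℝ} (la : L2c a) (ha : ∀ x, |a x| ≤ M)
    (z : ℝ) : force p a z = (∫ x, nl p (a x) * Q1 p (x - z))
      - ∫ x, a x * (dnl p (Q p (x - z)) * Q1 p (x - z)) := by
  unfold force
  rw [← integral_sub ((la.nl hp ha).mul_int ((l2c_Q1 hp).comp_sub z))
    (la.mul_int ((l2c_dnl_mul_Q1 hp).comp_sub z))]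
  exact integral_congr_ae (Eventually.of_forall fun x => by simp only; ring)

/-- A profile `a` which is close to the solution `v` of `v - v'' = nl a`. -/
structure Prof (p : ℝ) (a v vx : ℝ → ℝ) (M : ℝ) : Prop where
  la : L2c a
  lv : L2c v
  lvx : L2c vx
  dv : ∀ x, HasDerivAt v (vx x) x
  dvx : ∀ x, HasDerivAt vx (v x - nl p (a x)) x
  ba : ∀ x, |a x| ≤ M

section
variable {a v vx : ℝ → ℝ} {M : ℝ}

lemma Prof.force_eq (hp : 2 < p) (h : Prof p a v vx M) (z : ℝ) :
    force p a z = -∫ x, dnl p (Q p (x - z)) * Q1 p (x - z) * (a x - v x) := by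
  have l1 := (l2c_Q1 hp).comp_sub z
  have l4 := (l2c_dnl_mul_Q1 hp).comp_sub z
  have ln := h.la.nl hp h.ba
  have i1 := integral_mul_Q1 hp h.lv h.lvx (h.lv.sub ln) h.dv h.dvx z
  have e1 : ∫ x, (v x - nl p (a x)) * Q1 p (x - z)
      = (∫ x, v x * Q1 p (x - z)) - ∫ x, nl p (a x) * Q1 p (x - z) := by
    rw [← integral_sub (h.lv.mul_int l1) (ln.mul_int l1)]
    exact integral_congr_ae (Eventually.of_forall fun x => by simp only; ring)
  have e4 : ∫ x, dnl p (Q p (x - z)) * Q1 p (x - z) * (a x - v x)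
      = (∫ x, a x * (dnl p (Q p (x - z)) * Q1 p (x - z)))
        - ∫ x, v x * (dnl p (Q p (x - z)) * Q1 p (x - z)) := by
    rw [← integral_sub (h.la.mul_int l4) (h.lv.mul_int l4)]
    exact integral_congr_ae (Eventually.of_forall fun x => by simp only; ring)
  rw [force_eq_sub hp h.la h.ba, e4]
  linarith

lemma exists_abs_force_le (hp : 2 < p) : ∃ C > 0, ∀ a v vx M, Prof p a v vx M → ∀ d, 0 ≤ d →
    ∫ x, (a x - v x) ^ 2 ≤ d ^ 2 → ∀ z, |force p a z| ≤ C * d := by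
  have l4 := l2c_dnl_mul_Q1 hp
  refine ⟨√(∫ x, (dnl p (Q p x) * Q1 p x) ^ 2) + 1, by positivity, fun a v vx M h d hd hw z => ?_⟩
  rw [h.force_eq hp, abs_neg]
  refine ((l4.comp_sub z).abs_integral_mul_le (h.la.sub h.lv)).trans ?_
  rw [integral_comp_sub (fun x => (dnl p (Q p x) * Q1 p x) ^ 2)]
  have h1 : √(∫ x, (a x - v x) ^ 2) ≤ d := (sqrt_le_left hd).2 hw
  have h2 := sqrt_nonneg (∫ x, (dnl p (Q p x) * Q1 p x) ^ 2)
  nlinarith [sqrt_nonneg (∫ x, (a x - v x) ^ 2)]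

end

/-- The sum of the nearest-neighbour interactions. -/
noncomputable def qq (K : ℕ) (z : ℕ → ℝ) : ℝ := ∑ k ∈ range (K - 1), exp (-(z (k + 1) - z k))

lemma qq_nonneg (K : ℕ) (z : ℕ → ℝ) : 0 ≤ qq K z := sum_nonneg fun _ _ => (exp_pos _).le

lemma exp_le_qq {K : ℕ} {z : ℕ → ℝ} {k : ℕ} (hk : k + 1 < K) : exp (-(z (k + 1) - z k)) ≤ qq K z :=
  single_le_sum (f := fun k => exp (-(z (k + 1) - z k)))
    (fun _ _ => (exp_pos _).le) (mem_range.2 (by omega))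

section
variable {K : ℕ} {σ z : ℕ → ℝ}

lemma le_of_sorted (hz : ∀ j k, j < k → k < K → z j < z k) {j k : ℕ} (hjk : j ≤ k) (hk : k < K) :
    z j ≤ z k := by
  rcases hjk.eq_or_lt with rfl | h
  · exact le_rfl
  · exact (hz j k h hk).le

lemma cfg_qq (hs : ∀ k < K, |σ k| = 1) (hz : ∀ j k, j < k → k < K → z j < z k)
    (h1 : qq K z ≤ 1) : Cfg K σ z (qq K z) := by
  have key : ∀ j k, j < k → k < K → exp (-|z j - z k|) ≤ qq K z := fun j k hjk hk => by
    refine le_trans (exp_le_exp.2 ?_) (exp_le_qq (k := j) (z := z) (K := K) (by omega))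
    rw [abs_sub_comm, abs_of_pos (sub_pos.2 (hz j k hjk hk))]
    have := le_of_sorted hz (show j + 1 ≤ k by omega) hk
    linarith
  refine ⟨hs, fun j hj k hk hjk => ?_, qq_nonneg K z, h1⟩
  rcases lt_or_gt_of_ne hjk with h | h
  · exact key j k h hk
  · rw [abs_sub_comm]; exact key k j h hj

lemma sum_gg (m : ℕ) (hm : m + 1 < K) : ∑ k ∈ range (m + 1), σ k * gg K σ z k
      = -(σ m * σ (m + 1) * exp (-(z (m + 1) - z m))) := by
  induction m with
  | zero => simp [gg, hm]; ring
  | succ n ih =>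
    rw [sum_range_succ, ih (by omega)]
    simp only [gg, Nat.succ_pos, if_true, hm, add_tsub_cancel_right]
    ring

lemma qq_le_sum_gg (hs : ∀ k < K, |σ k| = 1) : qq K z ≤ K * ∑ k ∈ range K, |gg K σ z k| := by
  unfold qq
  have : ∀ m ∈ range (K - 1), exp (-(z (m + 1) - z m))
      ≤ ∑ k ∈ range K, |gg K σ z k| := fun m hm => by
    have hm' : m + 1 < K := by have := mem_range.1 hm; omega
    have h1 := congrArg abs (sum_gg (σ := σ) (z := z) m hm')
    rw [abs_neg, abs_mul, abs_mul, hs m (by omega), hs (m + 1) hm', one_mul, one_mul, abs_exp] at h1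
    rw [← h1]
    refine (abs_sum_le_sum_abs _ _).trans ?_
    refine (sum_le_sum fun k hk => ?_).trans
      (sum_le_sum_of_subset_of_nonneg (f := fun k => |gg K σ z k|)
        (range_subset_range.2 hm'.le) fun _ _ _ => abs_nonneg _)
    rw [abs_mul, hs k (by have := mem_range.1 hk; omega), one_mul]
  refine (sum_le_sum this).trans ?_
  rw [sum_const, nsmul_eq_mul, card_range]
  refine mul_le_mul_of_nonneg_right ?_ (sum_nonneg fun _ _ => abs_nonneg _)
  exact_mod_cast Nat.sub_le _ _

end

/-- The interactions are controlled by the defect, once they are small. -/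
lemma exists_qq_le (hp : 2 < p) (K : ℕ) (M B : ℝ) (hB : 0 ≤ B) : ∃ C > 0, ∃ q₀ > 0, q₀ ≤ 1 ∧
    ∀ σ z, (∀ k < K, |σ k| = 1) → (∀ j k, j < k → k < K → z j < z k) → qq K z ≤ q₀ →
    ∀ a v vx, Prof p a v vx M → ∀ d, 0 ≤ d → d ≤ 1 → ∫ x, (a x - v x) ^ 2 ≤ d ^ 2 →
    ∫ x, (a x - rr p K σ z x) ^ 2 ≤ B * (d + qq K z) ^ 2 → qq K z ≤ C * d := by
  obtain ⟨C1, hC1, h1⟩ := exists_force_le hp K M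
  obtain ⟨C2, hC2, h2⟩ := exists_abs_force_le (p := p) hp
  have hk0 : 0 < κ p * c₁ p := mul_pos (κ_pos hp) (c₁_pos hp)
  set k0 := κ p * c₁ p with hk
  set L := (K : ℝ) * K / k0 * (C2 + C1 * (1 + 4 * B)) + 1 with hL
  have hL1 : 1 ≤ L := by
    have : 0 ≤ (K : ℝ) * K / k0 * (C2 + C1 * (1 + 4 * B)) := by positivity
    linarith
  have hL0 : 0 < L := by linarith
  refine ⟨2 * L, by positivity, (1 / (2 * L)) ^ 4, by positivity, ?_, ?_⟩
  · refine pow_le_one₀ (by positivity) ?_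
    rw [div_le_one (by positivity)]; linarith
  intro σ z hs hz hq0 a v vx hP d hd hd1 hw hE
  set q := qq K z with hq
  have hqn : 0 ≤ q := qq_nonneg K z
  have hq1 : q ≤ 1 := hq0.trans (pow_le_one₀ (by positivity) (by
    rw [div_le_one (by positivity)]; linarith))
  have hc := cfg_qq hs hz hq1
  have hq14 : q ^ (5 / 4 : ℝ) ≤ 1 / (2 * L) * q := by
    have e1 : q ^ (5 / 4 : ℝ) = q ^ (1 / 4 : ℝ) * q := by
      rw [show (5 / 4 : ℝ) = 1 / 4 + 1 by norm_num, rpow_add_of_nonneg hqn (by norm_num)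
        (by norm_num), rpow_one]
    rw [e1]
    refine mul_le_mul_of_nonneg_right ?_ hqn
    have := rpow_le_rpow hqn hq0 (by norm_num : (0:ℝ) ≤ 1 / 4)
    rwa [← rpow_natCast, ← rpow_mul (by positivity),
      show ((4 : ℕ) : ℝ) * (1 / 4) = 1 by norm_num, rpow_one] at this
  have hqq : q ^ 2 ≤ q ^ (5 / 4 : ℝ) := by
    rw [← rpow_two]
    rcases hqn.eq_or_lt with h0 | h0
    · rw [← h0, zero_rpow two_ne_zero, zero_rpow (by norm_num)]
    · exact rpow_le_rpow_of_exponent_ge h0 hq1 (by norm_num)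
  have hq54 : 0 ≤ q ^ (5 / 4 : ℝ) := rpow_nonneg hqn _
  have hE2 : ∫ x, (a x - rr p K σ z x) ^ 2 ≤ 2 * B * (d + q ^ (5 / 4 : ℝ)) := by
    refine hE.trans ?_
    have : (d + q) ^ 2 ≤ 2 * (d + q ^ (5 / 4 : ℝ)) := by nlinarith [sq_nonneg (d - q)]
    calc _ ≤ B * (2 * (d + q ^ (5 / 4 : ℝ))) := by gcongr
      _ = _ := by ring
  have hgk : ∀ k ∈ range K, |gg K σ z k|
      ≤ (C2 + C1 * (1 + 4 * B)) / k0 * (d + q ^ (5 / 4 : ℝ)) := fun k hk' => by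
    have hk := mem_range.1 hk'
    have e1 := h1 σ z q hc hz a hP.la hP.ba k hk
    have e2 := h2 a v vx M hP d hd hw (z k)
    have e3 : |k0 * gg K σ z k| ≤ |force p a (z k)| + |force p a (z k) - k0 * gg K σ z k| := by
      have := abs_sub (force p a (z k)) (force p a (z k) - k0 * gg K σ z k)
      rwa [sub_sub_cancel] at this
    rw [abs_mul, abs_of_pos hk0] at e3
    rw [div_mul_eq_mul_div, le_div_iff₀ hk0, mul_comm]
    have e4 : C1 * (q ^ (5 / 4 : ℝ) + ∫ x, (a x - rr p K σ z x) ^ 2)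
        ≤ C1 * (q ^ (5 / 4 : ℝ) + 2 * B * (d + q ^ (5 / 4 : ℝ))) := by gcongr
    have e5 : 0 ≤ C1 * B * (d + q ^ (5 / 4 : ℝ)) := by positivity
    have e6 : 0 ≤ C2 * q ^ (5 / 4 : ℝ) := by positivity
    have e7 : 0 ≤ C1 * d := by positivity
    linarith
  have hfin := (qq_le_sum_gg (z := z) hs).trans
    (mul_le_mul_of_nonneg_left (sum_le_sum hgk) (Nat.cast_nonneg K))
  rw [sum_const, nsmul_eq_mul, card_range] at hfin
  have e8 : q ≤ L * (d + q ^ (5 / 4 : ℝ)) := by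
    refine hfin.trans ?_
    have : (K : ℝ) * (K * ((C2 + C1 * (1 + 4 * B)) / k0 * (d + q ^ (5 / 4 : ℝ))))
        = (L - 1) * (d + q ^ (5 / 4 : ℝ)) := by rw [hL]; ring
    rw [this]
    exact mul_le_mul_of_nonneg_right (by linarith) (by positivity)
  have e9 : L * q ^ (5 / 4 : ℝ) ≤ q / 2 := by
    refine (mul_le_mul_of_nonneg_left hq14 hL0.le).trans (le_of_eq ?_)
    field_simp
  linarith

lemma Fp_eq {s : ℝ} (hs : 0 ≤ s) (hp : 2 < p) : Fp p s = s ^ 2 * s ^ (p - 1) / (p + 1) := by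
  unfold Fp
  rw [abs_of_nonneg hs, ← rpow_two, ← rpow_add_of_nonneg hs (by norm_num) (by linarith)]
  congr 2; ring

lemma Fp_abs (s : ℝ) : Fp p |s| = Fp p s := by unfold Fp; rw [abs_abs]

lemma Q1_sq (hp : 2 < p) (x : ℝ) : Q1 p x ^ 2 = Q p x ^ 2 - 2 * Fp p (Q p x) := by
  rw [Fp_eq (Q_pos hp x).le hp, Q_rpow hp]
  unfold Q1
  rw [mul_pow, neg_sq, tanh_eq_sinh_div_cosh, div_pow, sinh_sq]
  have : p + 1 ≠ 0 := by linarith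
  have := (cosh_pos ((p - 1) / 2 * x)).ne'
  field_simp

lemma Q0_rpow (hp : 2 < p) : Q p 0 ^ (p - 1) = (p + 1) / 2 := by rw [Q_rpow hp]; simp

lemma one_lt_Q0 (hp : 2 < p) : 1 < Q p 0 := by
  by_contra h
  have := rpow_le_one (Q_pos hp 0).le (not_lt.1 h) (by linarith : (0:ℝ) ≤ p - 1)
  rw [Q0_rpow hp] at this
  linarith

lemma ham_eq (hp : 2 < p) {s : ℝ} (hs : 0 ≤ s) :
    s ^ 2 - 2 * Fp p s = s ^ 2 * (1 - (s / Q p 0) ^ (p - 1)) := by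
  rw [Fp_eq hs hp, div_rpow hs (Q_pos hp 0).le, Q0_rpow hp]
  have : p + 1 ≠ 0 := by linarith
  field_simp

lemma ham_nonpos (hp : 2 < p) {s : ℝ} (hs : Q p 0 ≤ s) : s ^ 2 - 2 * Fp p s ≤ 0 := by
  have h0 := Q_pos hp 0
  rw [ham_eq hp (h0.le.trans hs)]
  have := one_le_rpow ((one_le_div h0).2 hs) (by linarith : (0:ℝ) ≤ p - 1)
  nlinarith [sq_nonneg s]

lemma ham_abs (hp : 2 < p) {s : ℝ} (hs : 0 ≤ s) :
    s ^ 2 * |s - Q p 0| ≤ Q p 0 * |s ^ 2 - 2 * Fp p s| := by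
  have h0 := Q_pos hp 0
  rw [ham_eq hp hs, abs_mul, abs_of_nonneg (sq_nonneg s)]
  have h1 : |s - Q p 0| = Q p 0 * |1 - s / Q p 0| := by
    rw [← abs_of_pos h0, ← abs_mul, abs_of_pos h0, abs_sub_comm]
    congr 1; field_simp
  rw [h1]
  have h2 : 0 ≤ s / Q p 0 := by positivity
  have h3 : |1 - s / Q p 0| ≤ |1 - (s / Q p 0) ^ (p - 1)| := by
    rcases le_total (s / Q p 0) 1 with h | h
    · have h4 : (s / Q p 0) ^ (p - 1) ≤ s / Q p 0 := by
        rcases h2.eq_or_lt with h5 | h5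
        · rw [← h5, zero_rpow (by linarith)]
        · simpa using rpow_le_rpow_of_exponent_ge h5 h (by linarith : (1:ℝ) ≤ p - 1)
      rw [abs_of_nonneg (by linarith), abs_of_nonneg (by linarith)]; linarith
    · have h4 : s / Q p 0 ≤ (s / Q p 0) ^ (p - 1) := by
        simpa using rpow_le_rpow_of_exponent_le h (by linarith : (1:ℝ) ≤ p - 1)
      rw [abs_of_nonpos (by linarith), abs_of_nonpos (by linarith)]; linarith
  calc s ^ 2 * (Q p 0 * |1 - s / Q p 0|) = Q p 0 * (s ^ 2 * |1 - s / Q p 0|) := by ring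
    _ ≤ _ := by gcongr

lemma Q_anti (hp : 2 < p) {x y : ℝ} (hx : 0 ≤ x) (hxy : x ≤ y) : Q p y ≤ Q p x :=
  anti_of_hasDerivAt (τ := -1) (fun t _ => hasDerivAt_Q hp t) (by linarith) hxy fun r h1 _ => by
    unfold Q1
    have : 0 ≤ tanh ((p - 1) / 2 * r) := by
      rw [tanh_eq_sinh_div_cosh]
      exact div_nonneg (sinh_nonneg_iff.2 (mul_nonneg (by linarith) (hx.trans h1))) (cosh_pos _).le
    nlinarith [Q_pos hp r]

lemma Q1_neg_of_pos (hp : 2 < p) {x : ℝ} (hx : 0 < x) : Q1 p x < 0 := by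
  unfold Q1
  have : 0 < tanh ((p - 1) / 2 * x) := by
    rw [tanh_eq_sinh_div_cosh]
    exact div_pos (sinh_pos_iff.2 (mul_pos (by linarith) hx)) (cosh_pos _)
  nlinarith [Q_pos hp x]

lemma exists_Q_eq (hp : 2 < p) {β s : ℝ} (hβ : 0 < β) (h1 : β ≤ s) (h2 : s ≤ Q p 0) :
    ∃ ξ, 0 ≤ ξ ∧ ξ ≤ log (cQ p / β) ∧ Q p ξ = s := by
  have hc := cQ_pos hp
  have hL : ∀ ξ, 0 ≤ ξ → s ≤ Q p ξ → ξ ≤ log (cQ p / β) := fun ξ h0 h => by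
    have h3 := h1.trans (h.trans (Q_le hp ξ))
    rw [abs_of_nonneg h0, exp_neg, ← div_eq_mul_inv, le_div_iff₀ (exp_pos _)] at h3
    rw [le_log_iff_exp_le (by positivity), le_div_iff₀ hβ]
    linarith
  set X := max 0 (log (cQ p / β)) + 1 with hX
  have hX0 : 0 ≤ X := by have := le_max_left 0 (log (cQ p / β)); linarith
  have h3 : Q p X ≤ s := by
    by_contra h
    have := hL X hX0 (not_le.1 h).le
    have := le_max_right 0 (log (cQ p / β))
    linarith
  obtain ⟨ξ, hξ, e⟩ := intermediate_value_Icc' hX0 (continuous_Q hp).continuousOn ⟨h3, h2⟩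
  exact ⟨ξ, hξ.1, hL ξ hξ.1 e.ge, e⟩

/-- A profile `a` at distance `d` (in the energy space) from the solution `v` of
`v - v'' = nl a`, with uniform bounds. -/
structure Stat (p : ℝ) (a ax v vx : ℝ → ℝ) (M d : ℝ) : Prop extends Prof p a v vx M where
  lax : L2c ax
  da : ∀ x, HasDerivAt a (ax x) x
  bv : ∀ x, |v x| ≤ M
  iv : ∫ x, v x ^ 2 ≤ M ^ 2
  ivx : ∫ x, vx x ^ 2 ≤ M ^ 2
  hd : (∫ x, (a x - v x) ^ 2) + ∫ x, (ax x - vx x) ^ 2 ≤ d ^ 2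
  d_nonneg : 0 ≤ d
  cQ_le : cQ p ≤ M

section
variable {a ax v vx : ℝ → ℝ} {M d : ℝ}

lemma Stat.M_pos (hp : 2 < p) (h : Stat p a ax v vx M d) : 0 < M := (cQ_pos hp).trans_le h.cQ_le

lemma Stat.abs_sub_le (h : Stat p a ax v vx M d) (x : ℝ) : |a x - v x| ≤ d := by
  have := ((h.la.sub h.lv).sq_le (h.lax.sub h.lvx) (fun x => (h.da x).sub (h.dv x)) x).trans h.hd
  exact abs_le_of_sq_le_sq this h.d_nonneg

lemma Stat.nl_sub_le (hp : 2 < p) (h : Stat p a ax v vx M d) (x : ℝ) :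
    |nl p (a x) - nl p (v x)| ≤ p * M ^ (p - 1) * |a x - v x| := nl_lip hp (h.bv x) (h.ba x)

lemma Stat.P_pos (hp : 2 < p) (h : Stat p a ax v vx M d) : 0 < p * M ^ (p - 1) :=
  mul_pos (by linarith) (rpow_pos_of_pos (h.M_pos hp) _)

lemma Stat.neg (h : Stat p a ax v vx M d) :
    Stat p (fun x => -a x) (fun x => -ax x) (fun x => -v x) (fun x => -vx x) M d where
  la := h.la.neg
  lv := h.lv.neg
  lvx := h.lvx.neg
  dv x := (h.dv x).neg
  dvx x := by
    have := (h.dvx x).neg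
    rwa [show -(v x - nl p (a x)) = -v x - nl p (-a x) by rw [nl_neg]; ring] at this
  ba x := by rw [abs_neg]; exact h.ba x
  lax := h.lax.neg
  da x := (h.da x).neg
  bv x := by rw [abs_neg]; exact h.bv x
  iv := by simpa using h.iv
  ivx := by simpa using h.ivx
  hd := by
    refine le_trans (le_of_eq ?_) h.hd
    congr 1 <;> exact integral_congr_ae (Eventually.of_forall fun x => by simp only; ring)
  d_nonneg := h.d_nonneg
  cQ_le := h.cQ_le

lemma Stat.integral_nl_sub_le (hp : 2 < p) (h : Stat p a ax v vx M d) :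
    L2c (fun x => nl p (a x) - nl p (v x)) ∧
    ∫ x, (nl p (a x) - nl p (v x)) ^ 2 ≤ (p * M ^ (p - 1) * d) ^ 2 := by
  have hc : Continuous fun x => nl p (a x) - nl p (v x) :=
    ((continuous_nl hp).comp h.la.cont).sub ((continuous_nl hp).comp h.lv.cont)
  refine ⟨(h.la.sub h.lv).of_bound hc (h.nl_sub_le hp), ?_⟩
  have h1 : ∫ x, (a x - v x) ^ 2 ≤ d ^ 2 := by
    have : 0 ≤ ∫ x, (ax x - vx x) ^ 2 := integral_sq_nonneg _
    linarith [h.hd]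
  calc _ ≤ _ := (h.la.sub h.lv).integral_le_of_bound hc (h.nl_sub_le hp)
    _ ≤ (p * M ^ (p - 1)) ^ 2 * d ^ 2 := by gcongr
    _ = _ := by ring

/-- Approximate conservation of the Hamiltonian. -/
lemma Stat.ham_le (hp : 2 < p) (h : Stat p a ax v vx M d) (x : ℝ) :
    |vx x ^ 2 - (v x ^ 2 - 2 * Fp p (v x))| ≤ p * M ^ (p - 1) * M * d := by
  have hP := h.P_pos hp
  have hM := h.M_pos hp
  obtain ⟨lg, ig⟩ := h.integral_nl_sub_le hp
  have hder : ∀ x, HasDerivAt (fun x => vx x ^ 2 - (v x ^ 2 - 2 * Fp p (v x)))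
      (-2 * (vx x * (nl p (a x) - nl p (v x)))) x := fun x => by
    have h1 := ((h.dvx x).pow 2).sub (((h.dv x).pow 2).sub
      (((hasDerivAt_Fp hp (v x)).comp x (h.dv x)).const_mul 2))
    refine h1.congr_deriv ?_
    ring
  have i1 : Integrable fun x => vx x ^ 2 - (v x ^ 2 - 2 * Fp p (v x)) :=
    h.lvx.int.sub (h.lv.int.sub ((integrable_Fp hp h.lv h.bv).const_mul 2))
  have h2 := two_mul_abs_le_integral hder i1 ((h.lvx.mul_int lg).const_mul (-2)) x
  have h3 : ∫ y, |-2 * (vx y * (nl p (a y) - nl p (v y)))|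
      = 2 * ∫ y, |vx y * (nl p (a y) - nl p (v y))| := by
    rw [← integral_const_mul]
    exact integral_congr_ae (Eventually.of_forall fun y => by simp only; rw [abs_mul]; norm_num)
  have h4 := h.lvx.integral_abs_mul_le lg
  have h5 : √(∫ x, vx x ^ 2) ≤ M := (sqrt_le_left hM.le).2 h.ivx
  have h6 : √(∫ x, (nl p (a x) - nl p (v x)) ^ 2) ≤ p * M ^ (p - 1) * d :=
    (sqrt_le_left (mul_nonneg hP.le h.d_nonneg)).2 ig
  have h7 := mul_le_mul h5 h6 (sqrt_nonneg _) hM.le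
  rw [h3] at h2
  linarith

/-- Comparison with a solitary wave by the Gronwall inequality. -/
lemma Stat.gronwall (hp : 2 < p) (h : Stat p a ax v vx M d) {σ : ℝ} (hσ : |σ| = 1) (z x₀ x : ℝ) :
    (v x - σ * Q p (x - z)) ^ 2 + (vx x - σ * Q1 p (x - z)) ^ 2
      ≤ ((v x₀ - σ * Q p (x₀ - z)) ^ 2 + (vx x₀ - σ * Q1 p (x₀ - z)) ^ 2 + d ^ 2)
        * exp ((2 + 2 * (p * M ^ (p - 1))) * |x - x₀|) := by
  have hP := h.P_pos hp
  set P := p * M ^ (p - 1) with hPd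
  set N : ℝ → ℝ := fun x => (v x - σ * Q p (x - z)) ^ 2 + (vx x - σ * Q1 p (x - z)) ^ 2 + d ^ 2
    with hN
  set N' : ℝ → ℝ := fun x => 2 * (vx x - σ * Q1 p (x - z)) *
    ((v x - σ * Q p (x - z)) + (v x - nl p (a x) - σ * Q2 p (x - z))) with hN'
  have hder : ∀ x, HasDerivAt N (N' x) x := fun x => by
    have h1 := ((h.dv x).sub (((hasDerivAt_Q hp (x - z)).comp_sub_const x z).const_mul σ)).pow 2
    have h2 := ((h.dvx x).sub (((hasDerivAt_Q1 hp (x - z)).comp_sub_const x z).const_mul σ)).pow 2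
    refine ((h1.add h2).add_const (d ^ 2)).congr_deriv ?_
    simp only [hN', Nat.cast_ofNat, Nat.add_one_sub_one, pow_one, Pi.sub_apply]
    ring
  have hbd : ∀ x, |N' x| ≤ (2 + 2 * P) * N x := fun x => by
    set y := v x - σ * Q p (x - z) with hy
    set y1 := vx x - σ * Q1 p (x - z) with hy1
    have hq : |σ * Q p (x - z)| ≤ M := by
      rw [abs_mul, hσ, one_mul, abs_of_pos (Q_pos hp _)]
      exact (Q_le_cQ hp _).trans h.cQ_le
    have e1 : |nl p (v x) - nl p (σ * Q p (x - z))| ≤ P * |y| := nl_lip hp hq (h.bv x)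
    have e2 : |nl p (a x) - nl p (v x)| ≤ P * d :=
      (h.nl_sub_le hp x).trans (mul_le_mul_of_nonneg_left (h.abs_sub_le x) hP.le)
    have e3 : nl p (σ * Q p (x - z)) = σ * nl p (Q p (x - z)) := by
      unfold nl; rw [abs_mul, hσ, one_mul]; ring
    have e4 : y + (v x - nl p (a x) - σ * Q2 p (x - z))
        = 2 * y - (nl p (v x) - nl p (σ * Q p (x - z))) - (nl p (a x) - nl p (v x)) := by
      rw [e3, hy]; unfold Q2; ring
    have e5 : |y + (v x - nl p (a x) - σ * Q2 p (x - z))| ≤ (2 + P) * |y| + P * d := by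
      rw [e4]
      refine (abs_sub _ _).trans ?_
      have := abs_sub (2 * y) (nl p (v x) - nl p (σ * Q p (x - z)))
      rw [abs_mul, abs_two] at this
      linarith
    have e6 : |N' x| = 2 * |y1| * |y + (v x - nl p (a x) - σ * Q2 p (x - z))| := by
      simp only [hN']
      rw [abs_mul, abs_mul, abs_two]
    have e7 : N x = |y| ^ 2 + |y1| ^ 2 + d ^ 2 := by simp only [hN, sq_abs]; rfl
    rw [e6, e7]
    have e8 : 2 * |y1| * |y + (v x - nl p (a x) - σ * Q2 p (x - z))|
        ≤ 2 * |y1| * ((2 + P) * |y| + P * d) := by gcongr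
    refine e8.trans ?_
    nlinarith [mul_nonneg (by linarith : 0 ≤ 2 + P) (sq_nonneg (|y| - |y1|)),
      mul_nonneg hP.le (sq_nonneg (d - |y1|)), mul_nonneg hP.le (sq_nonneg |y|), sq_nonneg d]
  have hmain : N x ≤ N x₀ * exp ((2 + 2 * P) * |x - x₀|) := by
    rcases le_total x₀ x with hx | hx
    · have := gronwall_le (τ := x₀ - 1) (fun t _ => hder t) (by linarith) hx
        fun r _ _ => (le_abs_self _).trans (hbd r)
      rw [abs_of_nonneg (by linarith), mul_comm]; exact this
    · have := gronwall_ge (τ := x - 1) (c := -(2 + 2 * P)) (fun t _ => hder t) (by linarith) hx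
        fun r _ _ => by have := (abs_le.1 (hbd r)).1; linarith
      rw [abs_of_nonpos (by linarith)]
      rw [← mul_le_mul_iff_right₀ (exp_pos (-(2 + 2 * P) * (x₀ - x)))]
      refine this.trans (le_of_eq ?_)
      rw [mul_comm (N x₀), ← mul_assoc, ← exp_add, show -(2 + 2 * P) * (x₀ - x)
        + (2 + 2 * P) * -(x - x₀) = 0 by ring, exp_zero, one_mul]
  refine le_trans ?_ hmain
  simp only [hN]
  nlinarith [sq_nonneg d]

end

/-- Threshold above which a profile is close to a solitary wave. -/
noncomputable def bt (p : ℝ) : ℝ := min (Q p 1 / 2) ((1 / (4 * p)) ^ (1 / (p - 1)))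

lemma bt_pos (hp : 2 < p) : 0 < bt p :=
  lt_min (by have := Q_pos hp 1; linarith) (rpow_pos_of_pos (by
    have : 0 < p := by linarith
    positivity) _)

lemma two_bt_le : 2 * bt p ≤ Q p 1 := by
  have : bt p ≤ Q p 1 / 2 := min_le_left _ _
  linarith

lemma mul_bt_rpow_le (hp : 2 < p) : p * bt p ^ (p - 1) ≤ 1 / 4 := by
  have h1 : bt p ^ (p - 1) ≤ 1 / (4 * p) := by
    have h0 : 0 ≤ 1 / (4 * p) := by
      have : 0 < p := by linarith
      positivity
    calc bt p ^ (p - 1) ≤ ((1 / (4 * p)) ^ (1 / (p - 1))) ^ (p - 1) :=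
          rpow_le_rpow (bt_pos hp).le (min_le_right _ _) (by linarith)
      _ = 1 / (4 * p) := by rw [← rpow_mul h0, one_div_mul_cancel (by linarith), rpow_one]
  have hp0 : 0 < p := by linarith
  calc p * bt p ^ (p - 1) ≤ p * (1 / (4 * p)) := by gcongr
    _ = 1 / 4 := by field_simp

lemma bt_le_Q (hp : 2 < p) {x : ℝ} (hx : |x| ≤ 1) : 2 * bt p ≤ Q p x := by
  have h : Q p x = Q p |x| := by
    rcases abs_cases x with ⟨h, _⟩ | ⟨h, _⟩ <;> rw [h]
    rw [Q_even]
  rw [h]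
  exact two_bt_le.trans (Q_anti hp (abs_nonneg x) hx)

/-- Radius of the region where a solitary wave exceeds the threshold. -/
noncomputable def rad (p : ℝ) : ℝ := log (cQ p / bt p)

lemma rad_nonneg (hp : 2 < p) : 0 ≤ rad p := by
  refine log_nonneg ?_
  rw [one_le_div (bt_pos hp)]
  have := bt_pos hp
  have := bt_le_Q hp (x := 0) (by simp)
  have := Q_le_cQ hp 0
  linarith

lemma sq_sub_le_abs {A B : ℝ} (h : 0 ≤ A * B) : (A - B) ^ 2 ≤ |A ^ 2 - B ^ 2| := by
  have h1 : |A - B| ≤ |A + B| := sq_le_sq.1 (by nlinarith)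
  calc (A - B) ^ 2 = |A - B| * |A - B| := by rw [← sq, sq_abs]
    _ ≤ |A - B| * |A + B| := by gcongr
    _ = _ := by rw [← abs_mul]; congr 1; ring

section
variable {a ax v vx : ℝ → ℝ} {M d : ℝ}

lemma Stat.exists_near_pos (hp : 2 < p) (h : Stat p a ax v vx M d) {y : ℝ} (hy : bt p ≤ v y) :
    ∃ z, |z - y| ≤ rad p ∧ (v y - Q p (y - z)) ^ 2 + (vx y - Q1 p (y - z)) ^ 2
      ≤ p * M ^ (p - 1) * M * (1 + M ^ 2) * d := by
  have hM := h.M_pos hp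
  have hΓ : 0 ≤ p * M ^ (p - 1) * M * d := mul_nonneg (mul_nonneg (h.P_pos hp).le hM.le) h.d_nonneg
  have hH := abs_le.1 (h.ham_le hp y)
  have hv0 : 0 < v y := (bt_pos hp).trans_le hy
  have hQM : Q p 0 ≤ M := (Q_le_cQ hp 0).trans h.cQ_le
  set Γ := p * M ^ (p - 1) * M * d with hΓd
  have e : p * M ^ (p - 1) * M * (1 + M ^ 2) * d = Γ + M ^ 2 * Γ := by rw [hΓd]; ring
  rw [e]
  rcases le_total (Q p 0) (v y) with hQ | hQ
  · refine ⟨y, by simpa using rad_nonneg hp, ?_⟩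
    have h1 := ham_nonpos hp hQ
    have h2 := ham_abs hp hv0.le
    have h3 : |v y ^ 2 - 2 * Fp p (v y)| ≤ Γ := by
      rw [abs_of_nonpos h1]; nlinarith [sq_nonneg (vx y)]
    have h4 : |v y - Q p 0| ≤ M * Γ := by
      have h5 : 1 ≤ v y ^ 2 := one_le_pow₀ ((one_lt_Q0 hp).le.trans hQ)
      calc |v y - Q p 0| = 1 * |v y - Q p 0| := (one_mul _).symm
        _ ≤ v y ^ 2 * |v y - Q p 0| := by gcongr
        _ ≤ _ := h2
        _ ≤ M * Γ := mul_le_mul hQM h3 (abs_nonneg _) hM.le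
    have h5 : |v y - Q p 0| ≤ M := by
      rw [abs_of_nonneg (by linarith)]
      linarith [(abs_le.1 (h.bv y)).2, Q_pos hp 0]
    have h6 : (v y - Q p 0) ^ 2 ≤ M * (M * Γ) := by
      rw [← sq_abs, sq]; exact mul_le_mul h5 h4 (abs_nonneg _) hM.le
    have h7 : Q1 p 0 = 0 := by simp [Q1]
    rw [sub_self, h7]
    nlinarith
  · obtain ⟨ξ, h0, h1, h2⟩ := exists_Q_eq hp (bt_pos hp) hy hQ
    have h3 := Q1_sq hp ξ
    rw [h2] at h3
    have h4 : Q1 p ξ ≤ 0 := by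
      rcases h0.eq_or_lt with h5 | h5
      · rw [← h5]; simp [Q1]
      · exact (Q1_neg_of_pos hp h5).le
    have h5 : |vx y ^ 2 - Q1 p ξ ^ 2| ≤ Γ := by rw [h3, abs_le]; exact hH
    have h6 : 0 ≤ M ^ 2 * Γ := mul_nonneg (sq_nonneg _) hΓ
    rcases le_total (vx y) 0 with h7 | h7
    · refine ⟨y - ξ, by simpa [abs_of_nonneg h0, rad] using h1, ?_⟩
      have := sq_sub_le_abs (mul_nonneg_of_nonpos_of_nonpos h7 h4)
      rw [sub_sub_cancel, h2]
      linarith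
    · refine ⟨y + ξ, by simpa [abs_of_nonneg h0, rad] using h1, ?_⟩
      have h8 : Q1 p (-ξ) = -Q1 p ξ := Q1_odd p ξ
      have := sq_sub_le_abs (mul_nonneg h7 (neg_nonneg.2 h4))
      rw [neg_sq] at this
      rw [show y - (y + ξ) = -ξ by ring, Q_even, h2, h8]
      linarith

lemma Stat.exists_near (hp : 2 < p) (h : Stat p a ax v vx M d) {y : ℝ} (hy : bt p ≤ |v y|) :
    ∃ z σ, |σ| = 1 ∧ |z - y| ≤ rad p ∧ (v y - σ * Q p (y - z)) ^ 2 + (vx y - σ * Q1 p (y - z)) ^ 2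
      ≤ p * M ^ (p - 1) * M * (1 + M ^ 2) * d := by
  rcases abs_cases (v y) with ⟨h1, _⟩ | ⟨h1, _⟩ <;> rw [h1] at hy
  · obtain ⟨z, hz, h2⟩ := h.exists_near_pos hp hy
    exact ⟨z, 1, by simp, hz, by simpa using h2⟩
  · obtain ⟨z, hz, h2⟩ := h.neg.exists_near_pos hp (y := y) hy
    exact ⟨z, -1, by simp, hz, h2.trans' (le_of_eq (by ring))⟩

/-- Critical points at which the profile is not small. -/
def IsPk (p : ℝ) (v vx : ℝ → ℝ) (z : ℝ) : Prop := vx z = 0 ∧ bt p ≤ |v z|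

end

lemma exists_peak_near (hp : 2 < p) (M : ℝ) : ∃ d₀ > 0, ∀ {a ax v vx : ℝ → ℝ} {d : ℝ},
    Stat p a ax v vx M d → d ≤ d₀ → ∀ y, bt p ≤ |v y| →
    ∃ z, |z - y| ≤ rad p + 1 ∧ IsPk p v vx z := by
  have hb := bt_pos hp
  have hq1 := Q1_neg_of_pos hp one_pos
  set η := min (bt p) (-Q1 p 1 / 2) with hη
  have hη0 : 0 < η := lt_min hb (by linarith)
  set A := p * M ^ (p - 1) * M * (1 + M ^ 2) with hA
  set G := 2 + 2 * (p * M ^ (p - 1)) with hG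
  set B := (|A| + 1) * exp (|G| * (rad p + 1)) with hB
  have hB0 : 0 < B := by positivity
  refine ⟨min 1 (η ^ 2 / B), lt_min one_pos (by positivity), fun {a ax v vx d} h hd y hy => ?_⟩
  obtain ⟨z, σ, hσ, hz, h1⟩ := h.exists_near hp hy
  have hd0 := h.d_nonneg
  have hd1 : d ≤ 1 := hd.trans (min_le_left _ _)
  have hdB : B * d ≤ η ^ 2 := by
    have := hd.trans (min_le_right _ _)
    rw [le_div_iff₀ hB0] at this; linarith
  have key : ∀ x, |x - z| ≤ 1 → (v x - σ * Q p (x - z)) ^ 2 + (vx x - σ * Q1 p (x - z)) ^ 2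
      ≤ η ^ 2 := fun x hx => by
    refine (h.gronwall hp hσ z y x).trans (le_trans ?_ hdB)
    have h2 : |x - y| ≤ rad p + 1 := by
      have := abs_add_le (x - z) (z - y)
      rw [sub_add_sub_cancel] at this; linarith
    have h3 : (v y - σ * Q p (y - z)) ^ 2 + (vx y - σ * Q1 p (y - z)) ^ 2 + d ^ 2
        ≤ (|A| + 1) * d := by
      have : A * d ≤ |A| * d := by gcongr; exact le_abs_self A
      nlinarith
    calc _ ≤ ((|A| + 1) * d) * exp (|G| * (rad p + 1)) := by
          gcongr
          · exact le_abs_self G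
      _ = B * d := by rw [hB]; ring
  have hcv : Continuous fun x => σ * vx x := h.lvx.cont.const_mul _
  have hσσ : σ * σ = 1 := by rw [← abs_mul_abs_self, hσ, one_mul]
  have e1 : ∀ x, |x - z| ≤ 1 → |σ * vx x - Q1 p (x - z)| ≤ η := fun x hx => by
    refine abs_le_of_sq_le_sq (le_trans (le_of_eq ?_) ((le_add_of_nonneg_left
      (sq_nonneg _)).trans (key x hx))) hη0.le
    linear_combination (vx x ^ 2 - Q1 p (x - z) ^ 2) * hσσ
  have e2 : ∀ x, |x - z| ≤ 1 → |σ * v x - Q p (x - z)| ≤ η := fun x hx => by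
    refine abs_le_of_sq_le_sq (le_trans (le_of_eq ?_) ((le_add_of_nonneg_right
      (sq_nonneg _)).trans (key x hx))) hη0.le
    linear_combination (v x ^ 2 - Q p (x - z) ^ 2) * hσσ
  have f1 : σ * vx (z + 1) ≤ 0 := by
    have := (abs_le.1 (e1 (z + 1) (by simp))).2
    rw [add_sub_cancel_left] at this
    have : η ≤ -Q1 p 1 / 2 := min_le_right _ _
    linarith
  have f2 : 0 ≤ σ * vx (z - 1) := by
    have := (abs_le.1 (e1 (z - 1) (by simp))).1
    rw [show z - 1 - z = -1 by ring, Q1_odd p 1] at this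
    have : η ≤ -Q1 p 1 / 2 := min_le_right _ _
    linarith
  obtain ⟨x, hx, hx0⟩ := intermediate_value_Icc' (by linarith : z - 1 ≤ z + 1)
    hcv.continuousOn ⟨f1, f2⟩
  have hxz : |x - z| ≤ 1 := abs_le.2 ⟨by linarith [hx.1], by linarith [hx.2]⟩
  refine ⟨x, ?_, ?_, ?_⟩
  · have := abs_add_le (x - z) (z - y)
    rw [sub_add_sub_cancel] at this; linarith
  · have hσ0 : σ ≠ 0 := fun h => by simp [h] at hσ
    simpa [hσ0] using hx0
  · have h3 := (abs_le.1 (e2 x hxz)).1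
    have h4 := bt_le_Q hp hxz
    have h5 : η ≤ bt p := min_le_left _ _
    have h6 : σ * v x ≤ |v x| := by
      have := le_abs_self (σ * v x)
      rwa [abs_mul, hσ, one_mul] at this
    linarith

/-- Near a peak, the profile is close to a solitary wave. -/
lemma exists_peak_le (hp : 2 < p) (M : ℝ) : ∃ C > 0, ∃ G > 0, ∀ {a ax v vx : ℝ → ℝ} {d : ℝ},
    Stat p a ax v vx M d → ∀ z, IsPk p v vx z → ∀ x,
    |v x - v z / |v z| * Q p (x - z)| ≤ C * d * exp (G * |x - z|) ∧
    |vx x - v z / |v z| * Q1 p (x - z)| ≤ C * d * exp (G * |x - z|) := by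
  have hb := bt_pos hp
  set Γ := p * M ^ (p - 1) * M with hΓ
  set A := M * Γ / bt p ^ 2 with hA
  set G := 2 + 2 * (p * M ^ (p - 1)) with hG
  refine ⟨|A| + 1, by positivity, |G| / 2 + 1, by positivity, fun {a ax v vx d} h z hz x => ?_⟩
  have hM := h.M_pos hp
  have hd := h.d_nonneg
  obtain ⟨hz0, hz1⟩ := hz
  have hvz : 0 < |v z| := hb.trans_le hz1
  set σ := v z / |v z| with hσd
  have hσ : |σ| = 1 := by rw [hσd, abs_div, abs_abs, div_self hvz.ne']
  have hH := h.ham_le hp z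
  rw [hz0, ← sq_abs (v z), ← Fp_abs (v z), zero_pow two_ne_zero, zero_sub, abs_neg] at hH
  have h1 := ham_abs hp hvz.le
  have h2 : |(|v z| - Q p 0)| ≤ |A| * d := by
    have h3 : bt p ^ 2 * |(|v z| - Q p 0)| ≤ M * (Γ * d) := by
      calc bt p ^ 2 * |(|v z| - Q p 0)| ≤ |v z| ^ 2 * |(|v z| - Q p 0)| := by gcongr
        _ ≤ _ := h1
        _ ≤ M * (Γ * d) := by
          gcongr
          exact (Q_le_cQ hp 0).trans h.cQ_le
    calc |(|v z| - Q p 0)| ≤ A * d := by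
          rw [hA, div_mul_eq_mul_div, le_div_iff₀ (by positivity)]; linarith
      _ ≤ |A| * d := by gcongr; exact le_abs_self A
  have h3 := h.gronwall hp hσ z z x
  have h7 : Q1 p 0 = 0 := by simp [Q1]
  have h8 : (v z - σ * Q p 0) ^ 2 = |(|v z| - Q p 0)| ^ 2 := by
    rw [sq_abs]
    have : v z = σ * |v z| := by rw [hσd]; field_simp
    have hσσ : σ * σ = 1 := by rw [← abs_mul_abs_self, hσ, one_mul]
    generalize |v z| = w at *
    rw [this]
    linear_combination ((w - Q p 0) ^ 2) * hσσ
  rw [sub_self, h7, hz0, mul_zero, sub_zero, zero_pow two_ne_zero, add_zero, h8] at h3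
  have h9 : (v x - σ * Q p (x - z)) ^ 2 + (vx x - σ * Q1 p (x - z)) ^ 2
      ≤ ((|A| + 1) * d * exp ((|G| / 2 + 1) * |x - z|)) ^ 2 := by
    refine h3.trans ?_
    rw [mul_pow, ← exp_nat_mul]
    have h10 : |(|v z| - Q p 0)| ^ 2 + d ^ 2 ≤ ((|A| + 1) * d) ^ 2 := by
      have : |(|v z| - Q p 0)| ^ 2 ≤ (|A| * d) ^ 2 := by gcongr
      nlinarith [mul_nonneg (abs_nonneg A) (sq_nonneg d)]
    have h11 : G * |x - z| ≤ ↑2 * ((|G| / 2 + 1) * |x - z|) := by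
      have := le_abs_self G
      have := abs_nonneg (x - z)
      nlinarith
    exact mul_le_mul h10 (exp_le_exp.2 h11) (exp_pos _).le (sq_nonneg _)
  have h0 : 0 ≤ (|A| + 1) * d * exp ((|G| / 2 + 1) * |x - z|) := by positivity
  exact ⟨abs_le_of_sq_le_sq ((le_add_of_nonneg_right (sq_nonneg _)).trans h9) h0,
    abs_le_of_sq_le_sq ((le_add_of_nonneg_left (sq_nonneg _)).trans h9) h0⟩

lemma sub_one_le_nl_sub (hp : 2 < p) {m s : ℝ} (hm : 1 ≤ m) (hs : m ≤ s) : m - 1 ≤ nl p s - s := by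
  have h1 : s ≤ s ^ (p - 1) := by
    simpa using rpow_le_rpow_of_exponent_le (hm.trans hs) (by linarith : (1:ℝ) ≤ p - 1)
  unfold nl
  rw [abs_of_nonneg (by linarith)]
  nlinarith

lemma Stat.le_abs_sub_nl {a ax v vx : ℝ → ℝ} {M d : ℝ} (hp : 2 < p) (h : Stat p a ax v vx M d)
    (hd : p * M ^ (p - 1) * d ≤ (Q p 0 - 1) / 4) {x : ℝ} (hx : (1 + Q p 0) / 2 ≤ |v x|) :
    (Q p 0 - 1) / 4 ≤ |v x - nl p (a x)| := by
  have h1 := sub_one_le_nl_sub hp (by linarith [one_lt_Q0 hp]) hx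
  have h2 : |v x - nl p (v x)| = |nl p (|v x|) - (|v x|)| := by
    rcases abs_cases (v x) with ⟨h, _⟩ | ⟨h, _⟩ <;> rw [h]
    · exact abs_sub_comm _ _
    · rw [nl_neg]; congr 1; ring
  have h3 : |nl p (a x) - nl p (v x)| ≤ p * M ^ (p - 1) * d :=
    (h.nl_sub_le hp x).trans (mul_le_mul_of_nonneg_left (h.abs_sub_le x) (h.P_pos hp).le)
  have h4 := abs_sub_abs_le_abs_sub (v x - nl p (v x)) (nl p (a x) - nl p (v x))
  rw [show v x - nl p (v x) - (nl p (a x) - nl p (v x)) = v x - nl p (a x) by ring, h2] at h4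
  have h5 := le_abs_self (nl p (|v x|) - (|v x|))
  linarith

lemma exists_small {A B : ℝ} (hA : 0 ≤ A) (hB : 0 < B) : ∃ d₀ > 0, ∀ d, 0 ≤ d → d ≤ d₀ → A * d ≤ B := by
  refine ⟨B / (A + 1), by positivity, fun d h0 h => ?_⟩
  rw [le_div_iff₀ (by positivity)] at h
  nlinarith

lemma exists_sep (hp : 2 < p) (M L : ℝ) : ∃ d₀ > 0, ∀ {a ax v vx : ℝ → ℝ} {d : ℝ},
    Stat p a ax v vx M d → d ≤ d₀ →
    (∀ z, IsPk p v vx z → (1 + Q p 0) / 2 ≤ |v z| ∧ (Q p 0 - 1) / 4 ≤ |v z - nl p (a z)|) ∧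
    ∀ z z', IsPk p v vx z → IsPk p v vx z' → z < z' → L ≤ z' - z := by
  obtain ⟨C, hC, G, hG, hpk⟩ := exists_peak_le hp M
  have hQ0 := one_lt_Q0 hp
  set D := C * exp (G * |L|) with hD
  have hD0 : 0 < D := by positivity
  obtain ⟨d₁, hd₁, h₁⟩ := exists_small (A := 3 * D) (B := (Q p 0 - 1) / 2) (by positivity)
    (by linarith)
  obtain ⟨d₂, hd₂, h₂⟩ := exists_small (A := |p * M ^ (p - 1)|) (B := (Q p 0 - 1) / 4)
    (abs_nonneg _) (by linarith)
  refine ⟨min d₁ d₂, lt_min hd₁ hd₂, fun {a ax v vx d} h hd => ?_⟩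
  have hd0 := h.d_nonneg
  have hb := bt_pos hp
  have e1 := h₁ d hd0 (hd.trans (min_le_left _ _))
  have e2 : p * M ^ (p - 1) * d ≤ (Q p 0 - 1) / 4 :=
    (mul_le_mul_of_nonneg_right (le_abs_self _) hd0).trans (h₂ d hd0 (hd.trans (min_le_right _ _)))
  have hσ : ∀ z, IsPk p v vx z → |v z / (|v z|)| = 1 := fun z hz => by
    have : 0 < |v z| := hb.trans_le hz.2
    rw [abs_div, abs_abs, div_self this.ne']
  have hin : ∀ z, IsPk p v vx z → ∀ x, |x - z| ≤ |L| →
      |v x - v z / |v z| * Q p (x - z)| ≤ D * d := fun z hz x hx => by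
    refine ((hpk h z hz x).1).trans ?_
    rw [hD, mul_right_comm]
    gcongr
  have hval : ∀ z, IsPk p v vx z → Q p 0 - D * d ≤ |v z| := fun z hz => by
    have h3 := hin z hz z (by simp)
    have h4 := abs_sub_abs_le_abs_sub (v z / |v z| * Q p (z - z)) (v z)
    rw [abs_mul, hσ z hz, one_mul, sub_self, abs_of_pos (Q_pos hp 0), abs_sub_comm,
      ← sub_self z] at h4
    rw [sub_self] at h3 h4
    linarith
  have hDd : 0 ≤ D * d := by positivity
  refine ⟨fun z hz => ?_, fun z z' hz hz' hlt => ?_⟩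
  · have h3 : (1 + Q p 0) / 2 ≤ |v z| := by linarith [hval z hz]
    exact ⟨h3, h.le_abs_sub_nl hp e2 h3⟩
  by_contra hL
  have hL' : z' - z ≤ |L| := (not_le.1 hL).le.trans (le_abs_self L)
  have hm : ∀ x, z ≤ x → x ≤ z' → (1 + Q p 0) / 2 ≤ |v x| := fun x h1 h2 => by
    have h3 := hin z hz z' (by rw [abs_of_pos (by linarith)]; exact hL')
    have h4 := hin z hz x (by rw [abs_of_nonneg (by linarith)]; linarith)
    have h5 := abs_sub_abs_le_abs_sub (v z') (v z / |v z| * Q p (z' - z))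
    have h6 := abs_sub_abs_le_abs_sub (v z / |v z| * Q p (x - z)) (v x)
    rw [abs_mul, hσ z hz, one_mul, abs_of_pos (Q_pos hp _)] at h5 h6
    rw [abs_sub_comm (_ * _)] at h6
    have h7 := Q_anti hp (by linarith : 0 ≤ x - z) (by linarith : x - z ≤ z' - z)
    have h8 := hval z' hz'
    linarith
  obtain ⟨c, hc, hc0⟩ := exists_hasDerivAt_eq_zero hlt h.lvx.cont.continuousOn
    (hz.1.trans hz'.1.symm) (fun x _ => h.dvx x)
  have := h.le_abs_sub_nl hp e2 (hm c hc.1.le hc.2.le)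
  rw [hc0, abs_zero] at this
  linarith

lemma exists_card_le (hp : 2 < p) (M : ℝ) : ∃ d₀ > 0, ∃ N : ℕ, ∀ {a ax v vx : ℝ → ℝ} {d : ℝ},
    Stat p a ax v vx M d → d ≤ d₀ →
    {z | IsPk p v vx z}.Finite ∧ {z | IsPk p v vx z}.ncard ≤ N := by
  obtain ⟨d₁, hd₁, hsep⟩ := exists_sep hp M 2
  obtain ⟨C, hC, G, hG, hpk⟩ := exists_peak_le hp M
  have hb := bt_pos hp
  obtain ⟨d₂, hd₂, h₂⟩ := exists_small (A := C * exp G) (B := bt p) (by positivity) hb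
  refine ⟨min d₁ d₂, lt_min hd₁ hd₂, ⌊M ^ 2 / bt p ^ 2⌋₊, fun {a ax v vx d} h hd => ?_⟩
  have hs := (hsep h (hd.trans (min_le_left _ _))).2
  have hd2 := h₂ d h.d_nonneg (hd.trans (min_le_right _ _))
  have hcore : ∀ z, IsPk p v vx z → ∀ x, |x - z| ≤ 1 → bt p ≤ |v x| := fun z hz x hx => by
    have h1 := (hpk h z hz x).1
    have h2 : C * d * exp (G * |x - z|) ≤ C * exp G * d := by
      rw [mul_right_comm]
      have := h.d_nonneg
      gcongr
      nlinarith
    have h3 := abs_sub_abs_le_abs_sub (v z / |v z| * Q p (x - z)) (v x)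
    have : 0 < |v z| := hb.trans_le hz.2
    rw [abs_mul, abs_div, abs_abs, div_self this.ne', one_mul, abs_of_pos (Q_pos hp _),
      abs_sub_comm] at h3
    have := bt_le_Q hp hx
    linarith
  have key : ∀ F : Finset ℝ, (∀ z ∈ F, IsPk p v vx z) → F.card ≤ ⌊M ^ 2 / bt p ^ 2⌋₊ := fun F hF => by
    refine Nat.le_floor ?_
    rw [le_div_iff₀ (by positivity)]
    have hmeas : ∀ z : ℝ, MeasurableSet (Set.Icc (z - 1 / 2) (z + 1 / 2)) := fun z => measurableSet_Icc
    have hint : ∀ z ∈ F, Integrable ((Set.Icc (z - 1 / 2) (z + 1 / 2)).indicator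
        fun _ : ℝ => bt p ^ 2) := fun z _ =>
      (integrable_indicator_iff (hmeas z)).2 continuousOn_const.integrableOn_Icc
    have h1 : ∫ x, ∑ z ∈ F, (Set.Icc (z - 1 / 2) (z + 1 / 2)).indicator (fun _ : ℝ => bt p ^ 2) x
        = F.card * bt p ^ 2 := by
      rw [integral_finsetSum _ hint, sum_congr rfl (fun z _ => ?_), sum_const, nsmul_eq_mul]
      rw [integral_indicator (hmeas z), setIntegral_const, measureReal_def, volume_Icc,
        show z + 1 / 2 - (z - 1 / 2) = 1 by ring]
      simp
    rw [← h1]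
    refine (integral_mono (integrable_finsetSum _ hint) h.lv.int fun x => ?_).trans h.iv
    simp only
    by_cases hx : ∃ z ∈ F, x ∈ Set.Icc (z - 1 / 2) (z + 1 / 2)
    · obtain ⟨z, hz, hxz⟩ := hx
      rw [sum_eq_single_of_mem z hz, Set.indicator_of_mem hxz]
      · rw [← sq_abs (v x)]
        have := hcore z (hF z hz) x (abs_le.2 ⟨by linarith [hxz.1], by linarith [hxz.2]⟩)
        gcongr
      · intro w hw hwz
        refine Set.indicator_of_notMem (fun hxw => ?_) _
        rcases lt_or_gt_of_ne hwz with h2 | h2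
        · linarith [hs w z (hF w hw) (hF z hz) h2, hxw.2, hxz.1]
        · linarith [hs z w (hF z hz) (hF w hw) h2, hxw.1, hxz.2]
    · rw [sum_eq_zero fun z hz => Set.indicator_of_notMem (fun hxz => hx ⟨z, hz, hxz⟩) _]
      positivity
  have hfin : {z | IsPk p v vx z}.Finite := by
    by_contra hinf
    obtain ⟨F, hF, hc⟩ := Set.Infinite.exists_subset_card_eq hinf (⌊M ^ 2 / bt p ^ 2⌋₊ + 1)
    have := key F fun z hz => hF hz
    omega
  refine ⟨hfin, ?_⟩
  rw [Set.ncard_eq_toFinset_card _ hfin]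
  exact key _ fun z hz => by simpa using hz

/-- Increasing enumeration of the peaks of a profile. -/
structure Enum (p : ℝ) (v vx : ℝ → ℝ) (K : ℕ) (z : ℕ → ℝ) : Prop where
  lt : ∀ j k, j < k → k < K → z j < z k
  pk : ∀ k < K, IsPk p v vx (z k)
  surj : ∀ x, IsPk p v vx x → ∃ k < K, z k = x

lemma exists_enum {v vx : ℝ → ℝ} (h : {z | IsPk p v vx z}.Finite) :
    ∃ z, Enum p v vx {z | IsPk p v vx z}.ncard z := by
  rw [Set.ncard_eq_toFinset_card _ h]
  set F := h.toFinset
  refine ⟨fun k => if hk : k < F.card then F.orderEmbOfFin rfl ⟨k, hk⟩ else 0, ?_, ?_, ?_⟩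
  · intro j k hjk hk
    simp only [hk, hjk.trans hk, dif_pos]
    exact (F.orderEmbOfFin rfl).strictMono hjk
  · intro k hk
    simp only [hk, dif_pos]
    exact h.mem_toFinset.1 (F.orderEmbOfFin_mem rfl ⟨k, hk⟩)
  · intro x hx
    have : x ∈ Set.range (F.orderEmbOfFin rfl) := by
      rw [range_orderEmbOfFin]; exact h.mem_toFinset.2 hx
    obtain ⟨⟨k, hk⟩, rfl⟩ := this
    exact ⟨k, hk, by simp [hk]⟩

/-- Signs at the points `z k`. -/
noncomputable def sg (v : ℝ → ℝ) (z : ℕ → ℝ) (k : ℕ) : ℝ := v (z k) / |v (z k)|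

lemma Enum.sg_abs {v vx : ℝ → ℝ} {K : ℕ} {z : ℕ → ℝ} (hp : 2 < p) (h : Enum p v vx K z) :
    ∀ k < K, |sg v z k| = 1 := fun k hk => by
  have : 0 < |v (z k)| := (bt_pos hp).trans_le (h.pk k hk).2
  rw [sg, abs_div, abs_abs, div_self this.ne']

lemma exists_sub_rr_le (hp : 2 < p) (M : ℝ) (K : ℕ) : ∃ d₀ > 0, ∃ C > 0,
    ∀ {a ax v vx : ℝ → ℝ} {d : ℝ}, Stat p a ax v vx M d → d ≤ d₀ → ∀ z, Enum p v vx K z →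
    qq K z ≤ 1 →
    (∫ x, (v x - rr p K (sg v z) z x) ^ 2) + ∫ x, (vx x - rrx p K (sg v z) z x) ^ 2
      ≤ C * (d + qq K z) ^ 2 := by
  obtain ⟨d₁, hd₁, hnear⟩ := exists_peak_near hp M
  obtain ⟨C₁, hC₁, G, hG, hpk⟩ := exists_peak_le hp M
  obtain ⟨C₂, hC₂, hint⟩ := exists_interaction_integral_le hp K
  have hb := bt_pos hp
  have hcQ := cQ_pos hp
  set P := p * M ^ (p - 1) with hP
  set M' := max M (cQ p * K) with hM'
  set P' := p * M' ^ (p - 1) with hP'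
  set R := max (rad p + 1) (log (cQ p * (K + 1) / bt p)) with hR
  have hR0 : 0 ≤ R := le_max_of_le_left (by linarith [rad_nonneg hp])
  have hRb : cQ p * K * exp (-R) ≤ bt p := by
    have h1 := exp_le_exp.2 (neg_le_neg (le_max_right (rad p + 1) (log (cQ p * (K + 1) / bt p))))
    rw [← hR, exp_neg (log _), exp_log (by positivity)] at h1
    calc cQ p * K * exp (-R) ≤ cQ p * K * (cQ p * (K + 1) / bt p)⁻¹ := by gcongr
      _ ≤ cQ p * (K + 1) * (cQ p * (K + 1) / bt p)⁻¹ := by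
          have : (0:ℝ) < K + 1 := by positivity
          gcongr; linarith
      _ = bt p := by
          have : (0:ℝ) < K + 1 := by positivity
          field_simp
  set C₃ := C₁ * exp (G * R) + K * cQ p * exp R with hC₃
  have hC₃0 : 0 < C₃ := by positivity
  set I := ∫ x : ℝ, exp (-(1 * |x|)) with hI
  have hI0 : 0 ≤ I := integral_nonneg fun x => (exp_pos _).le
  set C₄ := |P'| * C₃ ^ 2 * exp R * (K * I) with hC₄
  have hC₄0 : 0 ≤ C₄ := by positivity
  refine ⟨d₁, hd₁, 4 * (P ^ 2 + C₂ ^ 2 + C₄) + 1, by positivity,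
    fun {a ax v vx d} h hd z hz hq => ?_⟩
  have hd0 := h.d_nonneg
  set q := qq K z with hqd
  set σ := sg v z with hσ
  have hcfg : Cfg K σ z q := cfg_qq (hz.sg_abs hp) hz.lt hq
  have hq0 := hcfg.nonneg
  obtain ⟨li, ii⟩ := hint σ z q hcfg
  obtain ⟨lg, ig⟩ := h.integral_nl_sub_le hp
  set e : ℝ → ℝ := fun x => v x - rr p K σ z x with he
  set ex : ℝ → ℝ := fun x => vx x - rrx p K σ z x with hex
  have le : L2c e := h.lv.sub (l2c_rr hp)
  have lex : L2c ex := h.lvx.sub (l2c_rrx hp)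
  have bR : ∀ x, |rr p K σ z x| ≤ M' := fun x => (hcfg.abs_rr_le' hp x).trans (le_max_right _ _)
  have bV : ∀ x, |v x| ≤ M' := fun x => (h.bv x).trans (le_max_left _ _)
  have lr : L2c fun x => nl p (v x) - nl p (rr p K σ z x) :=
    (L2c.nl hp h.lv bV).sub (L2c.nl hp (l2c_rr hp) bR)
  have lna : L2c fun x => nl p (a x) := L2c.nl hp h.la h.ba
  have hder : ∀ x, HasDerivAt ex (v x - nl p (a x) - (rr p K σ z x - rn p K σ z x)) x := fun x =>
    (h.dvx x).sub (hasDerivAt_rrx hp x)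
  have hibp := le.ibp lex lex ((h.lv.sub lna).sub ((l2c_rr hp).sub (l2c_rn hp)))
    (fun x => (h.dv x).sub (hasDerivAt_rr hp x)) hder
  have h1 : (∫ x, e x ^ 2) + ∫ x, ex x ^ 2 = (∫ x, e x * (nl p (a x) - nl p (v x)))
      + (∫ x, e x * (nl p (v x) - nl p (rr p K σ z x)))
      + ∫ x, e x * (nl p (rr p K σ z x) - rn p K σ z x) := by
    have i12 : Integrable fun x => e x * (nl p (a x) - nl p (v x))
      + e x * (nl p (v x) - nl p (rr p K σ z x)) := (le.mul_int lg).add (le.mul_int lr)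
    rw [← integral_add (le.mul_int lg) (le.mul_int lr), ← integral_add i12 (le.mul_int li)]
    have h2 : ∫ x, ex x ^ 2 = ∫ x, ex x * ex x :=
      integral_congr_ae (Eventually.of_forall fun x => sq _)
    have h3 : ∫ x, ex x * ex x = -∫ x, e x * (v x - nl p (a x) - (rr p K σ z x - rn p K σ z x)) := by
      rw [hibp, neg_neg]
    rw [h2, h3, ← sub_eq_add_neg, ← integral_sub le.int
      (le.mul_int ((h.lv.sub lna).sub ((l2c_rr hp).sub (l2c_rn hp))))]
    refine integral_congr_ae (Eventually.of_forall fun x => ?_)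
    simp only [he]; ring
  have y1 := le.young lg (r := 1 / 4) (by norm_num)
  have y3 := le.young li (r := 1 / 4) (by norm_num)
  have hpt : ∀ x, e x * (nl p (v x) - nl p (rr p K σ z x))
      ≤ 1 / 4 * e x ^ 2 + |P'| * C₃ ^ 2 * exp R * (d + q) ^ 2 * bumps 1 K z x := fun x => by
    have habs : ∀ B, |nl p (v x) - nl p (rr p K σ z x)| ≤ B * |e x| →
        e x * (nl p (v x) - nl p (rr p K σ z x)) ≤ B * |e x| ^ 2 := fun B hB => by
      calc _ ≤ |e x * (nl p (v x) - nl p (rr p K σ z x))| := le_abs_self _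
        _ = |e x| * |nl p (v x) - nl p (rr p K σ z x)| := abs_mul _ _
        _ ≤ |e x| * (B * |e x|) := by gcongr
        _ = _ := by ring
    have hB0 := bumps_nonneg 1 K z x
    by_cases hx : ∃ k < K, |x - z k| ≤ R
    · obtain ⟨k, hk, hxk⟩ := hx
      have e1 : |v x - σ k * Q p (x - z k)| ≤ C₁ * exp (G * R) * d := by
        refine ((hpk h (z k) (hz.pk k hk) x).1).trans ?_
        rw [mul_right_comm]
        gcongr
      have e2 : |rr p K σ z x - σ k * Q p (x - z k)| ≤ K * cQ p * exp R * q := by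
        unfold rr
        rw [← add_sum_erase _ _ (mem_range.2 hk), add_sub_cancel_left]
        have hterm : ∀ j ∈ (range K).erase k, |σ j * Q p (x - z j)|
            ≤ cQ p * (exp R * q) := fun j hj => by
          have hj' := mem_range.1 (mem_of_mem_erase hj)
          rw [hcfg.abs_term hp hj']
          refine (Q_le hp _).trans (mul_le_mul_of_nonneg_left ?_ hcQ.le)
          have h5 := exp_neg_abs_mul_le x (z j) (z k)
          have h6 := hcfg.le j hj' k hk (ne_of_mem_erase hj)
          calc exp (-|x - z j|)
              = exp |x - z k| * (exp (-|x - z j|) * exp (-|x - z k|)) := by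
                rw [mul_left_comm, ← exp_add, add_neg_cancel, exp_zero, mul_one]
            _ ≤ exp R * q := by gcongr; exact h5.trans h6
        refine (abs_sum_le_sum_abs _ _).trans ((sum_le_sum hterm).trans ?_)
        rw [sum_const, nsmul_eq_mul]
        have : (((range K).erase k).card : ℝ) ≤ K := by
          exact_mod_cast (card_le_card (erase_subset _ _)).trans (card_range K).le
        calc _ ≤ K * (cQ p * (exp R * q)) := by gcongr
          _ = _ := by ring
      have e3 : |e x| ≤ C₃ * (d + q) := by
        have h5 := abs_sub (v x - σ k * Q p (x - z k)) (rr p K σ z x - σ k * Q p (x - z k))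
        rw [sub_sub_sub_cancel_right] at h5
        have h6 : 0 ≤ C₁ * exp (G * R) * q := by positivity
        have h7 : 0 ≤ K * cQ p * exp R * d := by positivity
        calc |e x| ≤ _ := h5
          _ ≤ C₃ * (d + q) := by rw [hC₃]; linarith
      have e4 := habs |P'| ((nl_lip hp (bR x) (bV x)).trans
        (mul_le_mul_of_nonneg_right (le_abs_self _) (abs_nonneg _)))
      have e5 : 1 ≤ exp R * bumps 1 K z x := by
        have h5 : exp (-(1 * |x - z k|)) ≤ bumps 1 K z x :=
          single_le_sum (f := fun j => exp (-(1 * |x - z j|)))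
            (fun j _ => (exp_pos _).le) (mem_range.2 hk)
        calc (1:ℝ) = exp R * exp (-R) := by
              rw [← exp_add, add_neg_cancel, exp_zero]
          _ ≤ exp R * exp (-(1 * |x - z k|)) := by gcongr; linarith
          _ ≤ _ := by gcongr
      have e6 : 0 ≤ 1 / 4 * e x ^ 2 := by positivity
      calc _ ≤ |P'| * |e x| ^ 2 := e4
        _ ≤ |P'| * (C₃ * (d + q)) ^ 2 := by gcongr
        _ = |P'| * (C₃ * (d + q)) ^ 2 * 1 := (mul_one _).symm
        _ ≤ |P'| * (C₃ * (d + q)) ^ 2 * (exp R * bumps 1 K z x) := by gcongr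
        _ = |P'| * C₃ ^ 2 * exp R * (d + q) ^ 2 * bumps 1 K z x := by ring
        _ ≤ _ := by linarith
    · have hx' : ∀ k < K, R ≤ |x - z k| := fun k hk => (not_le.1 fun h' => hx ⟨k, hk, h'⟩).le
      have e1 : |v x| ≤ bt p := by
        by_contra hbv
        obtain ⟨w, hw, hwp⟩ := hnear h hd x (not_le.1 hbv).le
        obtain ⟨k, hk, rfl⟩ := hz.surj w hwp
        refine hx ⟨k, hk, ?_⟩
        rw [abs_sub_comm]
        exact hw.trans (le_max_left _ _)
      have e2 : |rr p K σ z x| ≤ bt p := by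
        refine (hcfg.abs_rr_le hp x).trans (le_trans ?_ hRb)
        rw [mul_assoc]
        refine mul_le_mul_of_nonneg_left ?_ hcQ.le
        have : ∀ k ∈ range K, exp (-(1 * |x - z k|)) ≤ exp (-R) := fun k hk =>
          exp_le_exp.2 (by have := hx' k (mem_range.1 hk); linarith)
        refine (sum_le_sum this).trans ?_
        simp
      have e4 := habs (1 / 4) ((nl_lip hp e2 e1).trans
        (mul_le_mul_of_nonneg_right (mul_bt_rpow_le hp) (abs_nonneg _)))
      rw [sq_abs] at e4
      have : 0 ≤ |P'| * C₃ ^ 2 * exp R * (d + q) ^ 2 * bumps 1 K z x := by positivity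
      linarith
  have h2 : ∫ x, e x * (nl p (v x) - nl p (rr p K σ z x))
      ≤ 1 / 4 * (∫ x, e x ^ 2) + C₄ * (d + q) ^ 2 := by
    have ib := integrable_bumps one_pos K z
    refine (integral_mono (le.mul_int lr) ((le.int.const_mul (1 / 4)).add
      (ib.const_mul (|P'| * C₃ ^ 2 * exp R * (d + q) ^ 2))) hpt).trans (le_of_eq ?_)
    rw [integral_add' (le.int.const_mul (1 / 4)) (ib.const_mul _), integral_const_mul,
      integral_const_mul, integral_bumps one_pos]
    ring
  have h3 := le_abs_self (∫ x, e x * (nl p (a x) - nl p (v x)))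
  have h4 := le_abs_self (∫ x, e x * (nl p (rr p K σ z x) - rn p K σ z x))
  have h5 : 0 ≤ ∫ x, ex x ^ 2 := integral_sq_nonneg _
  have h6 : 0 ≤ ∫ x, e x ^ 2 := integral_sq_nonneg _
  have h7 : (P * d) ^ 2 ≤ P ^ 2 * (d + q) ^ 2 := by rw [mul_pow]; gcongr; linarith
  have ig' : ∫ x, (nl p (a x) - nl p (v x)) ^ 2 ≤ (P * d) ^ 2 := ig
  have h8 : C₂ ^ 2 * q ^ 2 ≤ C₂ ^ 2 * (d + q) ^ 2 := by gcongr; linarith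
  have h9 : 0 ≤ (d + q) ^ 2 := sq_nonneg _
  rw [show ((1:ℝ) / 4)⁻¹ = 4 by norm_num] at y1 y3
  change (∫ x, e x ^ 2) + ∫ x, ex x ^ 2 ≤ _
  have h10 : (4 * (P ^ 2 + C₂ ^ 2 + C₄) + 1) * (d + q) ^ 2 = 4 * (P ^ 2 * (d + q) ^ 2)
    + 4 * (C₂ ^ 2 * (d + q) ^ 2) + 4 * (C₄ * (d + q) ^ 2) + (d + q) ^ 2 := by ring
  have h11 : 0 ≤ C₄ * (d + q) ^ 2 := by positivity
  rw [h10]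
  linarith

/-- The profile `a` is within `C * d` of the sum of solitary waves with signs `σ` located at the
points `z`, whose interaction is of size at most `C * d`. -/
structure Fit (p : ℝ) (a ax : ℝ → ℝ) (K : ℕ) (σ z : ℕ → ℝ) (C d : ℝ) : Prop where
  lt : ∀ j k, j < k → k < K → z j < z k
  cfg : Cfg K σ z (qq K z)
  qq_le : qq K z ≤ C * d
  sub_le : ∫ x, (a x - rr p K σ z x) ^ 2 ≤ (C * d) ^ 2
  subx_le : ∫ x, (ax x - rrx p K σ z x) ^ 2 ≤ (C * d) ^ 2
  jj_le : |jj p a ax - jj p (rr p K σ z) (rrx p K σ z)| ≤ C * d ^ 2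
  jj_rr_le : |jj p (rr p K σ z) (rrx p K σ z) - K * jQ p| ≤ C * qq K z

lemma Fit.mono {a ax : ℝ → ℝ} {K : ℕ} {σ z : ℕ → ℝ} {C C' d : ℝ} (h : Fit p a ax K σ z C d)
    (hd : 0 ≤ d) (hC : 0 ≤ C) (hCC : C ≤ C') : Fit p a ax K σ z C' d where
  lt := h.lt
  cfg := h.cfg
  qq_le := h.qq_le.trans (by gcongr)
  sub_le := h.sub_le.trans (by gcongr)
  subx_le := h.subx_le.trans (by gcongr)
  jj_le := h.jj_le.trans (by gcongr)
  jj_rr_le := h.jj_rr_le.trans (mul_le_mul_of_nonneg_right hCC (qq_nonneg K z))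

lemma exists_fit_of_enum (hp : 2 < p) (M : ℝ) (K : ℕ) : ∃ d₀ > 0, ∃ C > 0,
    ∀ {a ax v vx : ℝ → ℝ} {d : ℝ}, Stat p a ax v vx M d → d ≤ d₀ → ∀ z, Enum p v vx K z →
    Fit p a ax K (sg v z) z C d := by
  obtain ⟨d₁, hd₁, B, hB, h₁⟩ := exists_sub_rr_le hp M K
  obtain ⟨C₂, hC₂, q₀, hq₀, hq₁, h₂⟩ := exists_qq_le hp K M (2 + 2 * B) (by positivity)
  obtain ⟨d₃, hd₃, h₃⟩ := exists_sep hp M (log ((K + 1) / q₀))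
  obtain ⟨C₄, hC₄, h₄⟩ := exists_jj_rr_le hp K
  obtain ⟨C₅, hC₅, h₅⟩ := exists_jj_sub_le hp K M
  set A := (2 + 2 * B) * (1 + C₂) ^ 2 + 1 with hA
  have hA0 : 1 ≤ A := by
    have : 0 ≤ (2 + 2 * B) * (1 + C₂) ^ 2 := by positivity
    linarith
  refine ⟨min (min d₁ d₃) 1, lt_min (lt_min hd₁ hd₃) one_pos, A + C₂ + C₄ + C₅ * (A ^ 2 + C₂ * A),
    by positivity, fun {a ax v vx d} h hd z hz => ?_⟩
  have hd0 := h.d_nonneg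
  have hd1 : d ≤ 1 := hd.trans (min_le_right _ _)
  have hd13 := hd.trans (min_le_left _ _)
  have hsep := (h₃ h (hd13.trans (min_le_right _ _))).2
  have hqq : qq K z ≤ q₀ := by
    have hK : (0:ℝ) < K + 1 := by positivity
    have : ∀ k ∈ range (K - 1), exp (-(z (k + 1) - z k)) ≤ q₀ / (K + 1) := fun k hk => by
      have hk' := mem_range.1 hk
      have h6 := hsep _ _ (hz.pk k (by omega)) (hz.pk (k + 1) (by omega))
        (hz.lt k (k + 1) (by omega) (by omega))
      calc _ ≤ exp (-log ((K + 1) / q₀)) := exp_le_exp.2 (by linarith)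
        _ = q₀ / (K + 1) := by rw [exp_neg, exp_log (by positivity), inv_div]
    refine (sum_le_sum this).trans ?_
    rw [sum_const, nsmul_eq_mul, card_range]
    have h6 : ((K - 1 : ℕ) : ℝ) ≤ K + 1 := by
      have : ((K - 1 : ℕ) : ℝ) ≤ K := by exact_mod_cast Nat.sub_le K 1
      linarith
    calc ((K - 1 : ℕ) : ℝ) * (q₀ / (K + 1)) ≤ (K + 1) * (q₀ / (K + 1)) := by gcongr
      _ = q₀ := by field_simp
  have hsg := hz.sg_abs hp
  have hcfg := cfg_qq hsg hz.lt (hqq.trans hq₁)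
  have hq0 := qq_nonneg K z
  have hv := h₁ h (hd13.trans (min_le_left _ _)) z hz (hqq.trans hq₁)
  have i1 : 0 ≤ ∫ x, (v x - rr p K (sg v z) z x) ^ 2 := integral_sq_nonneg _
  have i2 : 0 ≤ ∫ x, (vx x - rrx p K (sg v z) z x) ^ 2 := integral_sq_nonneg _
  have i3 : 0 ≤ ∫ x, (a x - v x) ^ 2 := integral_sq_nonneg _
  have i4 : 0 ≤ ∫ x, (ax x - vx x) ^ 2 := integral_sq_nonneg _
  have hdq : d ^ 2 ≤ (d + qq K z) ^ 2 := by gcongr; linarith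
  have hadd : ∀ {f g k : ℝ → ℝ}, L2c f → L2c g → L2c k → ∫ x, (f x - k x) ^ 2
      ≤ 2 * (∫ x, (f x - g x) ^ 2) + 2 * ∫ x, (g x - k x) ^ 2 := fun hf hg hk => by
    simpa only [sub_add_sub_cancel] using (hf.sub hg).integral_add_sq_le (hg.sub hk)
  have e1 : ∫ x, (a x - rr p K (sg v z) z x) ^ 2 ≤ (2 + 2 * B) * (d + qq K z) ^ 2 := by
    linarith [hadd h.la h.lv (l2c_rr hp (K := K) (σ := sg v z) (z := z)), h.hd]
  have e2 : ∫ x, (ax x - rrx p K (sg v z) z x) ^ 2 ≤ (2 + 2 * B) * (d + qq K z) ^ 2 := by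
    linarith [hadd h.lax h.lvx (l2c_rrx hp (K := K) (σ := sg v z) (z := z)), h.hd]
  have hqd : qq K z ≤ C₂ * d := h₂ _ z hsg hz.lt hqq a v vx h.toProf d hd0 hd1
    (by linarith [h.hd]) e1
  have e3 : (2 + 2 * B) * (d + qq K z) ^ 2 ≤ (A * d) ^ 2 := by
    calc (2 + 2 * B) * (d + qq K z) ^ 2 ≤ (2 + 2 * B) * (d + C₂ * d) ^ 2 := by gcongr
      _ = (2 + 2 * B) * (1 + C₂) ^ 2 * d ^ 2 := by ring
      _ ≤ A ^ 2 * d ^ 2 := by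
          gcongr
          nlinarith
      _ = _ := by ring
  have hle : A ≤ A + C₂ + C₄ + C₅ * (A ^ 2 + C₂ * A) := by
    have : 0 ≤ C₅ * (A ^ 2 + C₂ * A) := by positivity
    linarith
  have hle2 : C₂ ≤ A + C₂ + C₄ + C₅ * (A ^ 2 + C₂ * A) := by
    have : 0 ≤ C₅ * (A ^ 2 + C₂ * A) := by positivity
    linarith
  have hle4 : C₄ ≤ A + C₂ + C₄ + C₅ * (A ^ 2 + C₂ * A) := by
    have : 0 ≤ C₅ * (A ^ 2 + C₂ * A) := by positivity
    linarith
  refine ⟨hz.lt, hcfg, hqd.trans (by gcongr), (e1.trans e3).trans (by gcongr),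
    (e2.trans e3).trans (by gcongr), ?_, (h₄ _ _ _ hcfg).trans (by gcongr)⟩
  refine (h₅ _ z _ hcfg a ax h.la h.lax h.da h.ba (A * d) (by positivity) (e1.trans e3)
    (e2.trans e3)).trans ?_
  calc C₅ * ((A * d) ^ 2 + qq K z * (A * d)) ≤ C₅ * ((A * d) ^ 2 + C₂ * d * (A * d)) := by gcongr
    _ = C₅ * (A ^ 2 + C₂ * A) * d ^ 2 := by ring
    _ ≤ _ := by gcongr; linarith

lemma exists_uniform {P : ℕ → ℝ → ℝ → Prop}
    (mono : ∀ K d d' C C', P K d C → d' ≤ d → 0 < C → C ≤ C' → P K d' C')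
    (h : ∀ K, ∃ d > 0, ∃ C > 0, P K d C) (N : ℕ) : ∃ d > 0, ∃ C > 0, ∀ K ≤ N, P K d C := by
  induction N with
  | zero =>
    obtain ⟨d, hd, C, hC, h⟩ := h 0
    exact ⟨d, hd, C, hC, fun K hK => by rwa [Nat.le_zero.1 hK]⟩
  | succ n ih =>
    obtain ⟨d, hd, C, hC, ih⟩ := ih
    obtain ⟨d', hd', C', hC', h'⟩ := h (n + 1)
    refine ⟨min d d', lt_min hd hd', max C C', lt_max_of_lt_left hC, fun K hK => ?_⟩
    rcases Nat.le_succ_iff.1 hK with hK | rfl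
    · exact mono _ _ _ _ _ (ih K hK) (min_le_left _ _) hC (le_max_left _ _)
    · exact mono _ _ _ _ _ h' (min_le_right _ _) hC' (le_max_right _ _)

lemma Enum.card {v vx : ℝ → ℝ} {K : ℕ} {z : ℕ → ℝ} (h : Enum p v vx K z) :
    {z | IsPk p v vx z}.ncard = K := by
  have h1 : {z | IsPk p v vx z} = ↑((range K).image z) := by
    ext x
    simp only [Set.mem_ofPred_eq, coe_image, coe_range, Set.mem_image, Set.mem_Iio]
    exact ⟨fun hx => h.surj x hx, fun ⟨k, hk, e⟩ => e ▸ h.pk k hk⟩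
  rw [h1, Set.ncard_coe_finset, card_image_of_injOn, card_range]
  intro j hj k hk e
  simp only [coe_range, Set.mem_Iio] at hj hk
  by_contra hne
  rcases lt_or_gt_of_ne hne with h2 | h2
  · exact (h.lt j k h2 hk).ne e
  · exact (h.lt k j h2 hj).ne e.symm

lemma exists_fit (hp : 2 < p) (M : ℝ) : ∃ d₀ > 0, ∃ C > 0,
    ∀ {a ax v vx : ℝ → ℝ} {d : ℝ}, Stat p a ax v vx M d → d ≤ d₀ →
    (∀ z, IsPk p v vx z → bt p < |v z| ∧ (Q p 0 - 1) / 4 ≤ |v z - nl p (a z)|) ∧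
    {z | IsPk p v vx z}.Finite ∧
    ∀ K z, Enum p v vx K z → Fit p a ax K (sg v z) z C d := by
  obtain ⟨d₁, hd₁, N, h₁⟩ := exists_card_le hp M
  obtain ⟨d₂, hd₂, C, hC, h₂⟩ := exists_uniform (P := fun K d₀ C => ∀ {a ax v vx : ℝ → ℝ} {d : ℝ},
    Stat p a ax v vx M d → d ≤ d₀ → ∀ z, Enum p v vx K z → Fit p a ax K (sg v z) z C d)
    (fun K d d' C C' h hd hC hCC a ax v vx e hs he z hz =>
      (h hs (he.trans hd) z hz).mono hs.d_nonneg hC.le hCC) (exists_fit_of_enum hp M) N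
  obtain ⟨d₃, hd₃, h₃⟩ := exists_sep hp M 1
  refine ⟨min (min d₁ d₂) d₃, lt_min (lt_min hd₁ hd₂) hd₃, C, hC, fun {a ax v vx d} h hd => ?_⟩
  have hd12 := hd.trans (min_le_left _ _)
  obtain ⟨hfin, hN⟩ := h₁ h (hd12.trans (min_le_left _ _))
  have hbt := bt_le_Q hp (x := 0) (by simp)
  refine ⟨fun z hz => ?_, hfin, fun K z hz => ?_⟩
  · have := (h₃ h (hd.trans (min_le_right _ _))).1 z hz
    exact ⟨by linarith, this.2⟩
  exact h₂ K (hz.card ▸ hN) h (hd12.trans (min_le_right _ _)) z hz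

/-- A nondegenerate peak persists under small perturbations of the time. -/
lemma eventually_exists_peak {V VX : ℝ → ℝ → ℝ} {t z m : ℝ}
    (hVX : ∀ᶠ s in 𝓝 t, Continuous (VX s)) (hVXt : ∀ y, ContinuousAt (fun s => VX s y) t)
    (hV : ContinuousAt (fun q : ℝ × ℝ => V q.1 q.2) (t, z)) (hz : VX t z = 0)
    (hm : HasDerivAt (VX t) m z) (hm0 : m ≠ 0) (hb : bt p < |V t z|) {ε : ℝ} (hε : 0 < ε) :
    ∀ᶠ s in 𝓝 t, ∃ y, |y - z| < ε ∧ IsPk p (V s) (VX s) y := by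
  have h1 : ∀ᶠ q : ℝ × ℝ in 𝓝 (t, z), bt p < |V q.1 q.2| := hV.abs.eventually_const_lt hb
  rw [nhds_prod_eq, eventually_prod_iff] at h1
  obtain ⟨P, hP, R, hR, hPR⟩ := h1
  obtain ⟨δ, hδ, hR⟩ := Metric.eventually_nhds_iff.1 hR
  have h2 : ∀ᶠ y in 𝓝[≠] z, 0 < (VX t y / (y - z)) * m :=
    (((hasDerivAt_iff_tendsto_slope.1 hm).mul_const m).eventually_const_lt
      (mul_self_pos.2 hm0)).mono fun y hy => by rwa [slope_def_field, hz, sub_zero] at hy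
  obtain ⟨δ', hδ', h2⟩ := Metric.eventually_nhds_iff.1 (eventually_nhdsWithin_iff.1 h2)
  obtain ⟨r, hr0, hr⟩ := exists_between (show 0 < min (min δ δ') ε by positivity)
  obtain ⟨⟨hrδ, hrδ'⟩, hrε⟩ : (r < δ ∧ r < δ') ∧ r < ε := by simpa only [lt_min_iff] using hr
  have h3 : 0 < VX t (z + r) * m := by
    have := h2 (y := z + r) (by simpa [dist_eq, abs_of_pos hr0] using hrδ') (by simp [hr0.ne'])
    rw [add_sub_cancel_left, div_mul_eq_mul_div] at this
    exact (div_pos_iff_of_pos_right hr0).1 this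
  have h4 : VX t (z - r) * m < 0 := by
    have := h2 (y := z - r) (by simpa [dist_eq, abs_of_pos hr0] using hrδ') (by simp [hr0.ne'])
    rw [sub_sub_cancel_left, div_neg, neg_mul, div_mul_eq_mul_div, ← neg_div] at this
    linarith [(div_pos_iff_of_pos_right hr0).1 this]
  filter_upwards [hP, hVX, ((hVXt (z + r)).mul_const m).eventually_const_lt h3,
    ((hVXt (z - r)).mul_const m).eventually_lt_const h4] with s hs1 hs2 hs3 hs4
  obtain ⟨y, hy, hy0⟩ := intermediate_value_Icc (by linarith : z - r ≤ z + r)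
    (f := fun y => VX s y * m) (by fun_prop) (Set.mem_Icc.2 ⟨hs4.le, hs3.le⟩)
  have hyz : |y - z| ≤ r := abs_le.2 ⟨by linarith [hy.1], by linarith [hy.2]⟩
  refine ⟨y, hyz.trans_lt hrε, (mul_eq_zero.1 hy0).resolve_right hm0, ?_⟩
  exact (hPR hs1 (hR (by rw [dist_eq]; exact hyz.trans_lt hrδ))).le

/-- Enumerations of the peaks are unique. -/
lemma Enum.eq {v vx : ℝ → ℝ} {K : ℕ} {z y : ℕ → ℝ} (h : Enum p v vx K z)
    (hlt : ∀ j k, j < k → k < K → y j < y k) (hpk : ∀ k < K, IsPk p v vx (y k)) :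
    ∀ k < K, y k = z k := by
  have h1 : ∀ k : Fin K, ∃ j : Fin K, z j = y k := fun k => by
    obtain ⟨j, hj, e⟩ := h.surj _ (hpk k k.2)
    exact ⟨⟨j, hj⟩, e⟩
  choose f hf using h1
  have hmono : StrictMono f := fun j k hjk => by
    by_contra hne
    have h2 : z (f k) ≤ z (f j) := by
      rcases (not_lt.1 hne).eq_or_lt with e | e
      · rw [e]
      · exact (h.lt _ _ e (f j).2).le
    rw [hf, hf] at h2
    exact absurd (hlt j k hjk k.2) (not_lt.2 h2)
  have h3 : f = id := (StrictMono.range_inj hmono strictMono_id).1 (by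
    rw [(Finite.injective_iff_surjective.1 hmono.injective).range_eq, Set.range_id])
  intro k hk
  have := hf ⟨k, hk⟩
  rw [h3] at this
  exact this.symm

lemma exists_sub_eq_mul {f f' : ℝ → ℝ} (hf : ∀ y, HasDerivAt f (f' y) y) (a b : ℝ) :
    ∃ y, f b - f a = f' y * (b - a) ∧ |y - a| ≤ |b - a| := by
  have hd : ∀ s, HasDerivAt (fun s => f (a + s * (b - a))) (f' (a + s * (b - a)) * (b - a)) s :=
    fun s => (hf _).comp s ((hasDerivAt_mul_const (b - a)).const_add a)
  obtain ⟨s, hs, e⟩ := exists_hasDerivAt_eq_slope _ _ one_pos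
    (fun s _ => (hd s).continuousAt.continuousWithinAt) fun s _ => hd s
  refine ⟨a + s * (b - a), by simp [e], ?_⟩
  rw [add_sub_cancel_left, abs_mul, abs_of_pos hs.1]
  exact mul_le_of_le_one_left (abs_nonneg _) hs.2.le

/-- Implicit differentiation along a continuous curve of zeros. -/
lemma hasDerivAt_of_zero {VX m n : ℝ → ℝ → ℝ} {z : ℝ → ℝ} {t : ℝ}
    (hm : ∀ᶠ s in 𝓝 t, ∀ y, HasDerivAt (VX s) (m s y) y)
    (hn : HasDerivAt (fun s => VX s (z t)) (n t (z t)) t)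
    (hmc : ContinuousAt (fun q : ℝ × ℝ => m q.1 q.2) (t, z t)) (hm0 : m t (z t) ≠ 0)
    (hz : ContinuousAt z t) (h0 : ∀ᶠ s in 𝓝 t, VX s (z s) = 0) :
    HasDerivAt z (-n t (z t) / m t (z t)) t := by
  have h1 := fun s (h : ∀ y, HasDerivAt (VX s) (m s y) y) => exists_sub_eq_mul h (z t) (z s)
  choose! y hy using h1
  have hyt : Tendsto y (𝓝 t) (𝓝 (z t)) := by
    rw [tendsto_iff_norm_sub_tendsto_zero]
    refine squeeze_zero' (Eventually.of_forall fun s => norm_nonneg _)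
      (hm.mono fun s hs => (hy s hs).2) ?_
    simpa using (hz.tendsto.sub_const (z t)).abs
  have hmt : Tendsto (fun s => m s (y s)) (𝓝 t) (𝓝 (m t (z t))) :=
    hmc.tendsto.comp (tendsto_id.prodMk_nhds hyt)
  rw [hasDerivAt_iff_tendsto_slope] at hn ⊢
  refine ((hn.neg.div (hmt.mono_left nhdsWithin_le_nhds) hm0)).congr' ?_
  have hzt := h0.self_of_nhds
  refine (eventually_nhdsWithin_of_forall fun s hs => hs).mp ?_
  refine ((hm.and (h0.and (hmt.eventually_ne hm0))).filter_mono nhdsWithin_le_nhds).mono ?_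
  rintro s ⟨hs1, hs2, hs3⟩ hst
  have h5 := (hy s hs1).1
  have h6 : s - t ≠ 0 := sub_ne_zero.2 hst
  simp only [Pi.div_apply, slope_def_field, hzt, sub_zero]
  rw [hs2] at h5
  grind

end

section

variable {p α : ℝ} {u : ℝ × ℝ → ℝ}

lemma energy_eq (hp : 2 < p) (u : ℝ × ℝ → ℝ) (t : ℝ) :
    energy p u t = (∫ x, ut u t x ^ 2) / 2 + jj p (U u t) (ux u t) := by
  have h : ∫ x, nl p (U u t x) * U u t x = (p + 1) * ∫ x, Fp p (U u t x) := by
    rw [← integral_const_mul]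
    exact integral_congr_ae (Eventually.of_forall fun x => (Fp_mul hp _).symm)
  have : p + 1 ≠ 0 := by linarith
  unfold energy jj nrm
  rw [h, inv_mul_cancel_left₀ this]
  ring

lemma integral_ut_sq_le_dd (p : ℝ) (u : ℝ × ℝ → ℝ) (t : ℝ) : ∫ x, ut u t x ^ 2 ≤ dd p u t := by
  unfold dd
  linarith [integral_sq_nonneg (ww p u t), integral_sq_nonneg (wwx p u t)]

lemma half_mem_nhds {t : ℝ} (ht : 0 < t) (x : ℝ) :
    Set.Ioi (0 : ℝ) ×ˢ Set.univ ∈ 𝓝 (t, x) := prod_mem_nhds (Ioi_mem_nhds ht) univ_mem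

lemma Sol.l2_vv (S : Sol p α u) (hp : 2 < p) {t : ℝ} (ht : 0 < t) :
    L2c (vv p u t) ∧ L2c (vvx p u t) :=
  ⟨(S.tf_vv hp).l2 ht, (S.tf_vvx hp).l2 ht⟩

lemma Sol.stat (S : Sol p α u) (hp : 2 < p) {M t : ℝ} (hM : 1 ≤ M) (ht : 0 < t)
    (hn : nrm u t ≤ M ^ 2) (hd : dd p u t ≤ 1) :
    Stat p (U u t) (ux u t) (vv p u t) (vvx p u t) (max (2 * M + 2) (cQ p)) √(dd p u t) := by
  obtain ⟨lv, lvx⟩ := S.l2_vv hp ht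
  have lU := S.tu.l2 ht
  have lux := S.tux.l2 ht
  have hU := integral_sq_nonneg (U u t)
  have hux := integral_sq_nonneg (ux u t)
  have hut := integral_sq_nonneg (ut u t)
  have hw := integral_sq_nonneg (ww p u t)
  have hwx := integral_sq_nonneg (wwx p u t)
  unfold nrm at hn
  unfold dd ww wwx at hd
  unfold ww at hw
  unfold wwx at hwx
  have hm : 2 * M + 2 ≤ max (2 * M + 2) (cQ p) := le_max_left _ _
  have hmm : (2 * M + 2) ^ 2 ≤ max (2 * M + 2) (cQ p) ^ 2 := by gcongr
  have hM2 : 2 * M ^ 2 + 2 ≤ (2 * M + 2) ^ 2 := by nlinarith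
  have h1 := lU.integral_sub_sq_le (lU.sub lv)
  have h2 := lux.integral_sub_sq_le (lux.sub lvx)
  simp only [sub_sub_cancel] at h1 h2
  refine ⟨⟨lU, lv, lvx, S.hasDerivAt_vv hp ht, S.hasDerivAt_vvx hp ht, fun x => ?_⟩, lux, S.dx t ht,
    fun x => ?_, by linarith, by linarith, ?_, sqrt_nonneg _, le_max_right _ _⟩
  · exact (abs_le_of_sq_le_sq ((S.sq_le_nrm ht x).trans hn) (by linarith)).trans (by linarith)
  · refine (abs_le_of_sq_le_sq (b := 2 * M + 2) ?_ (by linarith)).trans hm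
    have := lv.sq_le lvx (S.hasDerivAt_vv hp ht) x
    nlinarith only [this, h1, h2, hM, hn, hd, hU, hux, hut, hw, hwx]
  · rw [sq_sqrt (dd_nonneg _ _ _)]
    unfold dd ww wwx
    linarith

lemma Sol.vvtx_sq_le (S : Sol p α u) (hp : 2 < p) {M t : ℝ} (ht : 0 < t) (hM : ∀ x, |U u t x| ≤ M)
    (x : ℝ) : vvtx p u t x ^ 2 ≤ 5 * (p * M ^ (p - 1)) ^ 2 * ∫ x, ut u t x ^ 2 := by
  obtain ⟨B, hB⟩ := S.exists_bound_dnl_mul_ut hp t t ht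
  have lφ := (S.tf_nl hp).l2' ht
  obtain ⟨l1, l2, h1⟩ := l2c_res lφ (hB t le_rfl le_rfl)
  have l1' : L2c (vvt p u t) := l1
  have l2' : L2c (vvtx p u t) := l2
  have h1' : ∫ x, vvt p u t x ^ 2 ≤ ∫ x, (dnl p (U u t x) * ut u t x) ^ 2 := h1
  have h2 := l2'.sq_le (l1'.sub lφ) (S.hasDerivAt_vvtx hp ht) x
  have h3 := l1'.integral_sub_sq_le lφ
  have h4 := l1'.ibp l2' l2' (l1'.sub lφ) (S.hasDerivAt_vvt hp ht) (S.hasDerivAt_vvtx hp ht)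
  have h5 : ∫ x, vvtx p u t x * vvtx p u t x = ∫ x, vvtx p u t x ^ 2 := by simp only [sq]
  have h6 : ∫ x, vvt p u t x * (vvt p u t x - dnl p (U u t x) * ut u t x)
      = (∫ x, vvt p u t x ^ 2) - ∫ x, vvt p u t x * (dnl p (U u t x) * ut u t x) := by
    rw [← integral_sub l1'.int (l1'.mul_int lφ)]
    congr 1; ext x; ring
  have h7 := (l1'.young lφ one_pos)
  have h8 := le_abs_self (∫ x, vvt p u t x * (dnl p (U u t x) * ut u t x))
  have h9 := (S.tut.l2 ht).integral_le_of_bound lφ.cont (C := p * M ^ (p - 1)) fun x => by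
    rw [abs_mul, abs_of_nonneg (dnl_nonneg hp _)]
    gcongr
    exact dnl_mono hp (hM x)
  rw [h5, h6] at h4
  rw [inv_one, one_mul, one_mul] at h7
  have := integral_sq_nonneg (vvt p u t)
  linarith

/-- A solution which stays close to a superposition of moving ground states. -/
structure Track (p : ℝ) (u : ℝ × ℝ → ℝ) (T M C c : ℝ) (K : ℕ) (σ : ℕ → ℝ) (z z' : ℝ → ℕ → ℝ)
    (H : ℝ → ℝ) : Prop where
  two_le : 2 ≤ T
  C_pos : 0 < C
  c_pos : 0 < c
  nrm_le : ∀ t, T ≤ t → nrm u t ≤ M ^ 2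
  fit : ∀ t, T ≤ t → Fit p (U u t) (ux u t) K σ (z t) C √(dd p u t)
  deriv : ∀ t, T ≤ t → ∀ k < K, HasDerivAt (fun s => z s k) (z' t k) t
  deriv_cont : ∀ k < K, ContinuousOn (fun t => z' t k) (Set.Ici T)
  deriv_le : ∀ t, T ≤ t → ∀ k < K, |z' t k| ≤ C * √(dd p u t)
  sub_energy : ∀ t, T ≤ t → |H t - energy p u t| ≤ dd p u t
  diss : ∀ s t, T ≤ s → s ≤ t → c * (∫ r in s..t, dd p u r) ≤ H s - H t
  growth : ∀ s t, T ≤ s → s ≤ t → dd p u t ≤ dd p u s + C * ∫ r in s..t, dd p u r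
  lim : Tendsto H atTop (𝓝 (K * jQ p))

lemma Fit.congr {a ax : ℝ → ℝ} {K : ℕ} {σ σ' z : ℕ → ℝ} {C d : ℝ} (h : Fit p a ax K σ z C d)
    (hσ : ∀ k < K, σ k = σ' k) : Fit p a ax K σ' z C d := by
  have h1 : rr p K σ z = rr p K σ' z := funext fun x =>
    sum_congr rfl fun k hk => by rw [hσ k (mem_range.1 hk)]
  have h2 : rrx p K σ z = rrx p K σ' z := funext fun x =>
    sum_congr rfl fun k hk => by rw [hσ k (mem_range.1 hk)]
  obtain ⟨a1, ⟨b1, b2, b3, b4⟩, a3, a4, a5, a6, a7⟩ := h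
  rw [h1] at a4
  rw [h2] at a5
  rw [h1, h2] at a6 a7
  exact ⟨a1, ⟨fun k hk => hσ k hk ▸ b1 k hk, b2, b3, b4⟩, a3, a4, a5, a6, a7⟩

/-- A continuous nonvanishing function has constant sign. -/
lemma sign_eq_of_continuousOn {f : ℝ → ℝ} {T : ℝ} (hf : ContinuousOn f (Set.Ici T))
    (h0 : ∀ t, T ≤ t → f t ≠ 0) {t : ℝ} (ht : T ≤ t) : f t / |f t| = f T / |f T| := by
  have h1 : ContinuousOn (fun t => f t / |f t|) (Set.Ici T) :=
    hf.div hf.abs fun t ht => abs_ne_zero.2 (h0 t ht)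
  have h2 := isPreconnected_Ici.eq_one_or_eq_neg_one_of_sq_eq h1 (fun t ht => by
    have := h0 t ht
    simp only [Pi.pow_apply, Pi.one_apply, div_pow, sq_abs]
    exact div_self (pow_ne_zero 2 this))
  rcases h2 with h2 | h2 <;> rw [show f t / |f t| = _ from h2 ht,
    show f T / |f T| = _ from h2 (Set.mem_Ici.2 le_rfl)] <;> rfl

lemma Sol.continuousAt_peak (S : Sol p α u) (hp : 2 < p) {K : ℕ} {z : ℝ → ℕ → ℝ} {t : ℝ}
    (ht : 0 < t) (hz : ∀ᶠ s in 𝓝 t, Enum p (vv p u s) (vvx p u s) K (z s))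
    (hb : ∀ k < K, bt p < |vv p u t (z t k)|)
    (hm : ∀ k < K, vv p u t (z t k) - nl p (U u t (z t k)) ≠ 0) :
    ∀ k < K, ContinuousAt (fun s => z s k) t := by
  have hzt := hz.self_of_nhds
  have key : ∀ k < K, ∀ ε, 0 < ε → ∀ᶠ s in 𝓝 t, ∃ y, |y - z t k| < ε ∧
      IsPk p (vv p u s) (vvx p u s) y := fun k hk ε hε =>
    eventually_exists_peak ((eventually_gt_nhds ht).mono fun s hs => ((S.tf_vvx hp).l2 hs).cont)
      (fun y => (continuousOn_time_slice (S.tf_vvx hp).cont y).continuousAt (Ioi_mem_nhds ht))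
      ((S.tf_vv hp).cont.continuousAt (half_mem_nhds ht _)) (hzt.pk k hk).1 (S.hasDerivAt_vvx hp ht _)
      (hm k hk) (hb k hk) hε
  obtain ⟨g, hg, hgap⟩ : ∃ g > 0, ∀ j k, j < k → k < K → g ≤ z t k - z t j := by
    have h : ∀ᶠ g in 𝓝[>] (0:ℝ), ∀ j ∈ range K, ∀ k ∈ range K, j < k → g < z t k - z t j := by
      simp only [Finset.eventually_all, eventually_imp_distrib_left]
      exact fun j _ k hk hjk => (eventually_lt_nhds (sub_pos.2 (hzt.lt j k hjk
        (mem_range.1 hk)))).filter_mono nhdsWithin_le_nhds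
    obtain ⟨g, hg, hg0⟩ := (h.and self_mem_nhdsWithin).exists
    exact ⟨g, hg0, fun j k hjk hk => (hg j (mem_range.2 (hjk.trans hk)) k (mem_range.2 hk) hjk).le⟩
  intro k hk
  refine Metric.continuousAt_iff'.2 fun ε hε => ?_
  have hall : ∀ᶠ s in 𝓝 t, ∀ j ∈ range K, ∃ y, |y - z t j| < min ε (g / 2) ∧
      IsPk p (vv p u s) (vvx p u s) y :=
    (Finset.eventually_all _).2 fun j hj => key j (mem_range.1 hj) _ (lt_min hε (half_pos hg))
  filter_upwards [hall, hz] with s hs hzs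
  choose! y hy using hs
  have := hzs.eq (y := y) (fun i j hij hj => by
    have h1 := abs_lt.1 ((hy i (mem_range.2 (hij.trans hj))).1.trans_le (min_le_right _ _))
    have h2 := abs_lt.1 ((hy j (mem_range.2 hj)).1.trans_le (min_le_right _ _))
    linarith [h1.2, h2.1, hgap i j hij hj]) (fun j hj => (hy j (mem_range.2 hj)).2) k hk
  rw [dist_eq, ← this]
  exact (hy k (mem_range.2 hk)).1.trans_le (min_le_left _ _)

lemma Sol.hasDerivAt_peak (S : Sol p α u) (hp : 2 < p) {K : ℕ} {z : ℝ → ℕ → ℝ} {t : ℝ}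
    (ht : 0 < t) (hz : ∀ᶠ s in 𝓝 t, Enum p (vv p u s) (vvx p u s) K (z s))
    (hb : ∀ k < K, bt p < |vv p u t (z t k)|)
    (hm : ∀ k < K, vv p u t (z t k) - nl p (U u t (z t k)) ≠ 0) (k : ℕ) (hk : k < K) :
    HasDerivAt (fun s => z s k)
      (-vvtx p u t (z t k) / (vv p u t (z t k) - nl p (U u t (z t k)))) t := by
  exact hasDerivAt_of_zero (VX := vvx p u) (m := fun s y => vv p u s y - nl p (U u s y))
    (n := vvtx p u) (z := fun s => z s k)
    ((eventually_gt_nhds ht).mono fun s hs y => S.hasDerivAt_vvx hp hs y)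
    ((S.tf_vvx hp).deriv t ht _)
    (((S.tf_vv hp).cont.sub (S.tf_nl hp).cont).continuousAt (half_mem_nhds ht _)) (hm k hk)
    (S.continuousAt_peak hp ht hz hb hm k hk) (hz.mono fun s hs => (hs.pk k hk).1)

lemma Fit.sub_jj_rr_le {t H C : ℝ} {K : ℕ} {σ z : ℕ → ℝ} (hp : 2 < p)
    (hf : Fit p (U u t) (ux u t) K σ z C √(dd p u t)) (hH : |H - energy p u t| ≤ dd p u t) :
    |H - jj p (rr p K σ z) (rrx p K σ z)| ≤ (2 + C) * dd p u t := by
  have h1 := hf.jj_le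
  rw [sq_sqrt (dd_nonneg _ _ _)] at h1
  have h4 := integral_ut_sq_le_dd p u t
  have h5 := integral_sq_nonneg (ut u t)
  rw [energy_eq hp] at hH
  rw [abs_le] at *
  constructor <;> linarith [h1.1, h1.2, hH.1, hH.2]

lemma Fit.dist_energy_le {t H e C B : ℝ} {K : ℕ} {σ z : ℕ → ℝ} (hp : 2 < p)
    (hf : Fit p (U u t) (ux u t) K σ z C √(dd p u t)) (hC : 0 ≤ C)
    (hH : |H - energy p u t| ≤ dd p u t) (he : |H - e| ≤ B) :
    |K * jQ p - e| ≤ B + (2 + C) * dd p u t + C * (C * √(dd p u t)) := by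
  have h1 := hf.sub_jj_rr_le hp hH
  have h2 := hf.jj_rr_le
  have h3 := mul_le_mul_of_nonneg_left hf.qq_le hC
  rw [abs_le] at *
  constructor <;> linarith [h1.1, h1.2, h2.1, h2.2, he.1, he.2]

lemma Sol.exists_track (S : Sol p α u) (hp : 2 < p) (hα : 0 < α) :
    ∃ T M C c K σ z z' H, Track p u T M C c K σ z z' H := by
  obtain ⟨T₀, hT₀, M, hM, hn, c, hc, L, hL, H, E, hHe, hdiss, hgrow, hdd, hH⟩ :=
    S.exists_lyapunov hp hα
  obtain ⟨d₀, hd₀, C, hC, hfit⟩ := exists_fit hp (max (2 * M + 2) (cQ p))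
  have hsq : Tendsto (fun t => √(dd p u t)) atTop (𝓝 0) := by
    simpa using hdd.sqrt
  obtain ⟨T₁, hT₁⟩ := eventually_atTop.1 ((hdd.eventually_le_const one_pos).and
    ((hsq.eventually_le_const hd₀).and (eventually_ge_atTop T₀)))
  have hstat : ∀ t, T₁ ≤ t → Stat p (U u t) (ux u t) (vv p u t) (vvx p u t)
      (max (2 * M + 2) (cQ p)) √(dd p u t) := fun t ht =>
    S.stat hp hM (by linarith [(hT₁ t ht).2.2]) (hn t (hT₁ t ht).2.2) (hT₁ t ht).1
  have hall := fun t ht => hfit (hstat t ht) (hT₁ t ht).2.1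
  have hez : ∀ t, T₁ ≤ t → ∃ z, Enum p (vv p u t) (vvx p u t)
      {z | IsPk p (vv p u t) (vvx p u t) z}.ncard z := fun t ht => exists_enum (hall t ht).2.1
  choose! z hz using hez
  set κ' := fun t => {z | IsPk p (vv p u t) (vvx p u t) z}.ncard
  have herr : Tendsto (fun t => |H t - E| + (2 + C) * dd p u t + C * (C * √(dd p u t)))
      atTop (𝓝 0) := by
    have h1 : Tendsto (fun t => |H t - E|) atTop (𝓝 0) := by simpa using (hH.sub_const E).abs
    simpa using (h1.add (hdd.const_mul (2 + C))).add ((hsq.const_mul C).const_mul C)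
  have hle : ∀ t, T₁ ≤ t → |κ' t * jQ p - E| ≤
      |H t - E| + (2 + C) * dd p u t + C * (C * √(dd p u t)) := fun t ht =>
    ((hall t ht).2.2 _ _ (hz t ht)).dist_energy_le hp hC.le (hHe t (hT₁ t ht).2.2) le_rfl
  have hj := jQ_pos hp
  obtain ⟨T₂, hT₂⟩ := eventually_atTop.1 ((herr.eventually_lt_const (half_pos hj)).and
    (eventually_ge_atTop T₁))
  set K := κ' T₂ with hK
  have hKt : ∀ t, T₂ ≤ t → κ' t = K := fun t ht => by
    have h1 := (hle t (hT₂ t ht).2).trans_lt (hT₂ t ht).1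
    have h2 := (hle T₂ (hT₂ T₂ le_rfl).2).trans_lt (hT₂ T₂ le_rfl).1
    rw [← hK] at h2
    rw [abs_lt] at h1 h2
    by_contra hne
    rcases lt_or_gt_of_ne hne with h | h
    · have : (κ' t : ℝ) + 1 ≤ K := by exact_mod_cast h
      nlinarith
    · have : (K : ℝ) + 1 ≤ κ' t := by exact_mod_cast h
      nlinarith
  have hEK : E = K * jQ p := by
    have h1 : |K * jQ p - E| ≤ 0 := ge_of_tendsto herr <| (eventually_ge_atTop T₂).mono
      fun t ht => by
        have := hle t (hT₂ t ht).2
        rwa [hKt t ht] at this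
    linarith [abs_eq_zero.1 (le_antisymm h1 (abs_nonneg _))]
  have hzK : ∀ t, T₂ ≤ t → Enum p (vv p u t) (vvx p u t) K (z t) := fun t ht =>
    hKt t ht ▸ hz t (hT₂ t ht).2
  have h0 : ∀ t, T₂ ≤ t → 0 < t := fun t ht => by linarith [(hT₁ t (hT₂ t ht).2).2.2]
  set m := fun t k => vv p u t (z t k) - nl p (U u t (z t k)) with hm
  have hQ0 := one_lt_Q0 hp
  have hb : ∀ t, T₂ ≤ t → ∀ k < K, bt p < |vv p u t (z t k)| ∧ (Q p 0 - 1) / 4 ≤ |m t k| :=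
    fun t ht k hk => (hall t (hT₂ t ht).2).1 _ ((hzK t ht).pk k hk)
  have hm0 : ∀ t, T₂ ≤ t → ∀ k < K, m t k ≠ 0 := fun t ht k hk h => by
    have := (hb t ht k hk).2
    rw [h, abs_zero] at this
    linarith
  have hev : ∀ t, T₂ + 1 ≤ t → ∀ᶠ s in 𝓝 t, Enum p (vv p u s) (vvx p u s) K (z s) := fun t ht =>
    (eventually_gt_nhds (by linarith : T₂ < t)).mono fun s hs => hzK s hs.le
  have hder : ∀ t, T₂ + 1 ≤ t → ∀ k < K, HasDerivAt (fun s => z s k)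
      (-vvtx p u t (z t k) / m t k) t := fun t ht => by
    have ht' : T₂ ≤ t := by linarith
    exact S.hasDerivAt_peak hp (h0 t ht') (hev t ht) (fun k hk => (hb t ht' k hk).1) (hm0 t ht')
  have hcmp : ∀ {f : ℝ → ℝ → ℝ}, ContinuousOn (fun q : ℝ × ℝ => f q.1 q.2)
      (Set.Ioi (0:ℝ) ×ˢ Set.univ) → ∀ s, T₂ + 1 ≤ s → ∀ k < K,
      ContinuousAt (fun s => f s (z s k)) s := fun {f} hf s hs k hk =>
    ContinuousAt.comp (f := fun s => (s, z s k)) (g := fun q : ℝ × ℝ => f q.1 q.2)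
      (hf.continuousAt (half_mem_nhds (h0 s (by linarith)) _))
      (continuousAt_id.prodMk (hder s hs k hk).continuousAt)
  have hsg : ∀ t, T₂ + 1 ≤ t → ∀ k < K,
      sg (vv p u t) (z t) k = sg (vv p u (T₂ + 1)) (z (T₂ + 1)) k := fun t ht k hk => by
    refine sign_eq_of_continuousOn (f := fun t => vv p u t (z t k)) (fun s hs => ?_)
      (fun s hs h => ?_) ht
    · exact (hcmp (S.tf_vv hp).cont s hs k hk).continuousWithinAt
    · have := (hb s (by linarith) k hk).1
      rw [h, abs_zero] at this
      linarith [bt_pos hp]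
  set B := 5 * (p * M ^ (p - 1)) ^ 2 with hB
  set G := √B / ((Q p 0 - 1) / 4) with hG
  have hG0 : 0 ≤ G := by
    have : 0 < (Q p 0 - 1) / 4 := by linarith
    positivity
  have hT02 : ∀ t, T₂ + 1 ≤ t → T₀ ≤ t := fun t ht => (hT₁ t (hT₂ t (by linarith)).2).2.2
  refine ⟨T₂ + 1, M, C + L + G, c, K, sg (vv p u (T₂ + 1)) (z (T₂ + 1)), z, fun t k => -vvtx p u t (z t k) / m t k, H, ⟨?_,
    by linarith, hc, fun t ht => hn t (hT02 t ht), fun t ht => ?_, hder,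
    fun k hk s hs => ?_, fun t ht k hk => ?_,
    fun t ht => hHe t (hT02 t ht), fun s t hs hst => hdiss s t (hT02 s hs) hst,
    fun s t hs hst => ?_, hEK ▸ hH⟩⟩
  · linarith [hT02 _ le_rfl]
  · exact (((hall t (hT₂ t (by linarith)).2).2.2 K (z t) (hzK t (by linarith))).mono
      (sqrt_nonneg _) hC.le (by linarith)).congr (hsg t ht)
  · have hs' : T₂ + 1 ≤ s := hs
    exact (ContinuousAt.div (hcmp (S.tf_vvx hp).cont' s hs' k hk).neg
      (hcmp (f := fun t x => vv p u t x - nl p (U u t x))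
        ((S.tf_vv hp).cont.sub (S.tf_nl hp).cont) s hs' k hk)
      (hm0 s (by linarith) k hk)).continuousWithinAt
  · have ht' : T₂ ≤ t := by linarith
    have h1 := S.vvtx_sq_le hp (h0 t ht') (fun x => abs_le_of_sq_le_sq
      ((S.sq_le_nrm (h0 t ht') x).trans (hn t (hT02 t ht))) (by linarith)) (z t k)
    have h2 := integral_ut_sq_le_dd p u t
    have h3 : |vvtx p u t (z t k)| ≤ √B * √(dd p u t) := by
      rw [← sqrt_mul (by positivity)]
      exact abs_le_sqrt (h1.trans (by gcongr))
    have h4 := (hb t ht' k hk).2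
    have h5 : |-vvtx p u t (z t k) / m t k| ≤ G * √(dd p u t) := by
      rw [abs_div, abs_neg, hG, div_mul_eq_mul_div]
      exact div_le_div₀ (by positivity) h3 (by linarith) h4
    exact h5.trans (by gcongr; linarith)
  · have h1 := hgrow s t (hT02 s hs) hst
    have h2 : 0 ≤ ∫ r in s..t, dd p u r :=
      intervalIntegral.integral_nonneg hst fun r _ => dd_nonneg _ _ _
    have : L * (∫ r in s..t, dd p u r) ≤ (C + L + G) * ∫ r in s..t, dd p u r := by
      gcongr
      linarith
    linarith

end

section

variable {p α : ℝ} {u : ℝ × ℝ → ℝ} {T M C c : ℝ} {K : ℕ} {σ : ℕ → ℝ} {z z' : ℝ → ℕ → ℝ} {H : ℝ → ℝ}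

/-- `I` is the integral of the dissipation from `t` to infinity. -/
structure Tail (p : ℝ) (u : ℝ × ℝ → ℝ) (T C c : ℝ) (K : ℕ) (H I : ℝ → ℝ) : Prop where
  deriv : ∀ t, T ≤ t → HasDerivAt I (-dd p u t) t
  nonneg : ∀ t, T ≤ t → 0 ≤ I t
  anti : ∀ s t, T ≤ s → s ≤ t → I t ≤ I s
  sub_le : ∀ s t, T ≤ s → s ≤ t → c * (I s - I t) ≤ H s - H t
  le : ∀ t, T ≤ t → c * I t ≤ H t - K * jQ p
  growth : ∀ s t, T ≤ s → s ≤ t → dd p u t ≤ dd p u s + C * (I s - I t)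

lemma Track.exists_tail (S : Sol p α u) (hp : 2 < p) (W : Track p u T M C c K σ z z' H) :
    ∃ I, Tail p u T C c K H I := by
  have hT := W.two_le
  set F := fun t => ∫ r in (1:ℝ)..t, dd p u r
  have hFd : ∀ t, T ≤ t → HasDerivAt F (dd p u t) t := fun t ht =>
    hasDerivAt_primitive (S.continuousOn_dd hp) one_pos (by linarith : (0:ℝ) < t)
  have hi : ∀ t, T ≤ t → IntervalIntegrable (dd p u) volume 1 t := fun t ht =>
    ((S.continuousOn_dd hp).mono fun x hx => show 0 < x from
      (lt_min one_pos (by linarith)).trans_le hx.1).intervalIntegrable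
  have hFs : ∀ s t, T ≤ s → T ≤ t → F t - F s = ∫ r in s..t, dd p u r := fun s t hs ht =>
    intervalIntegral.integral_interval_sub_left (hi t ht) (hi s hs)
  have hpos : ∀ s t, s ≤ t → 0 ≤ ∫ r in s..t, dd p u r := fun s t hst =>
    intervalIntegral.integral_nonneg hst fun r _ => dd_nonneg _ _ _
  have hH : ∀ t, T ≤ t → K * jQ p ≤ H t := fun t ht =>
    le_of_tendsto W.lim ((eventually_ge_atTop t).mono fun r hr => by
      have := W.diss t r ht hr
      have := mul_nonneg W.c_pos.le (hpos t r hr)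
      linarith)
  have hup : ∀ t, T ≤ t → ∀ r, T ≤ r → F r ≤ F t + (H t - K * jQ p) / c := fun t ht r hr => by
    rcases le_total t r with h | h
    · have h1 := W.diss t r ht h
      rw [← hFs t r ht hr] at h1
      have h3 : F r - F t ≤ (H t - K * jQ p) / c :=
        (le_div_iff₀ W.c_pos).2 (by linarith [hH r hr])
      linarith
    · linarith [hFs r t hr ht, hpos r t h, div_nonneg (sub_nonneg.2 (hH t ht)) W.c_pos.le]
  have hbdd : BddAbove (F '' Set.Ici T) := ⟨_, by
    rintro _ ⟨r, hr, rfl⟩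
    exact hup T le_rfl r hr⟩
  refine ⟨fun t => sSup (F '' Set.Ici T) - F t, fun t ht => ?_, fun t ht => ?_,
    fun s t hs hst => ?_, fun s t hs hst => ?_, fun t ht => ?_, fun s t hs hst => ?_⟩
  · simpa using (hFd t ht).const_sub (sSup (F '' Set.Ici T))
  · exact sub_nonneg.2 (le_csSup hbdd ⟨t, ht, rfl⟩)
  · linarith [hFs s t hs (hs.trans hst), hpos s t hst]
  · have := W.diss s t hs hst
    rw [← hFs s t hs (hs.trans hst)] at this
    rwa [sub_sub_sub_cancel_left]
  · have := csSup_le (Set.nonempty_Ici.image F) (by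
      rintro _ ⟨r, hr, rfl⟩
      exact hup t ht r hr)
    have h2 : sSup (F '' Set.Ici T) - F t ≤ (H t - K * jQ p) / c := by linarith
    linarith [(le_div_iff₀ W.c_pos).1 h2]
  · have := W.growth s t hs hst
    rw [← hFs s t hs (hs.trans hst)] at this
    rwa [sub_sub_sub_cancel_left]

lemma Track.sub_le (hp : 2 < p) (W : Track p u T M C c K σ z z' H) {t : ℝ} (ht : T ≤ t) :
    |H t - jj p (rr p K σ (z t)) (rrx p K σ (z t))| ≤ (2 + C) * dd p u t :=
  (W.fit t ht).sub_jj_rr_le hp (W.sub_energy t ht)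

lemma Tail.dd_le (hT : Tail p u T C c K H I) (hC : 0 < C) {t : ℝ} (ht : T + 1 ≤ t) :
    dd p u t ≤ (1 + C) * (I (t - 1) - I t) := by
  obtain ⟨r, hr, e⟩ := exists_hasDerivAt_eq_slope I (fun s => -dd p u s) (sub_one_lt t)
    (fun r hr => (hT.deriv r (by linarith [hr.1])).continuousAt.continuousWithinAt)
    (fun r hr => hT.deriv r (by linarith [hr.1]))
  have h1 := hT.growth r t (by linarith [hr.1]) hr.2.le
  have h2 := hT.anti (t - 1) r (by linarith) hr.1.le
  rw [sub_sub_cancel, div_one] at e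
  nlinarith

lemma Track.mul_le (hp : 2 < p) (W : Track p u T M C c K σ z z' H) (hT : Tail p u T C c K H I)
    {t : ℝ} (ht : T ≤ t) : c * I t ≤ (2 + C) * dd p u t + C * qq K (z t) := by
  have h1 := (abs_le.1 (W.sub_le hp ht)).2
  have h2 := (abs_le.1 (W.fit t ht).jj_rr_le).2
  linarith [hT.le t ht]

lemma Track.exists_dd_le_exp (S : Sol p α u) (hp : 2 < p) (W : Track p u T M C c K σ z z' H)
    (hK : K ≤ 1) : ∃ B > 0, ∃ γ > 0, ∀ t, T + 2 ≤ t → dd p u t ≤ B * exp (-γ * t) := by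
  obtain ⟨I, hI⟩ := W.exists_tail S hp
  have hC := W.C_pos
  have hc := W.c_pos
  set γ := c / (2 + C) with hγ
  have hγ0 : 0 < γ := by positivity
  refine ⟨(1 + C) * (exp (γ * (T + 2)) * (I (T + 1) + 1)), ?_, γ, hγ0, fun t ht => ?_⟩
  · have := hI.nonneg (T + 1) (by linarith)
    positivity
  have h1 := gronwall_le (g := I) (τ := T) (c := -γ) (s := T + 1) (t := t - 1)
    (fun r hr => hI.deriv r hr.le) (by linarith) (by linarith) fun r hr _ => by
      have h := W.mul_le hp hI (t := r) (by linarith)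
      rw [show qq K (z r) = 0 by
        unfold qq
        rw [show K - 1 = 0 by omega, range_zero, sum_empty], mul_zero, add_zero] at h
      have : γ * I r ≤ dd p u r := by
        rw [hγ, div_mul_eq_mul_div, div_le_iff₀ (by positivity)]
        linarith
      linarith
  have h2 := hI.dd_le hC (t := t) (by linarith)
  have h3 := hI.nonneg t (by linarith)
  have h4 : exp (-γ * (t - 1 - (T + 1))) = exp (γ * (T + 2)) * exp (-γ * t) := by
    rw [← exp_add]
    congr 1
    ring
  rw [h4] at h1
  calc dd p u t ≤ (1 + C) * I (t - 1) := h2.trans (by gcongr; linarith)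
    _ ≤ (1 + C) * (exp (γ * (T + 2)) * exp (-γ * t) * (I (T + 1) + 1)) := by
      gcongr
      exact h1.trans (by gcongr; linarith)
    _ = _ := by ring

end

lemma mono_of_hasDerivAt_Icc {g g' : ℝ → ℝ} {s t : ℝ} (hst : s ≤ t)
    (hd : ∀ r, s ≤ r → r ≤ t → HasDerivAt g (g' r) r) (h0 : ∀ r, s ≤ r → r ≤ t → 0 ≤ g' r) :
    g s ≤ g t := by
  rcases hst.eq_or_lt with rfl | hlt
  · exact le_rfl
  obtain ⟨c, hc, e⟩ := exists_hasDerivAt_eq_slope g g' hlt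
    (fun r hr => (hd r hr.1 hr.2).continuousAt.continuousWithinAt)
    (fun r hr => hd r hr.1.le hr.2.le)
  have := h0 c hc.1.le hc.2.le
  rw [e] at this
  have h2 : 0 < t - s := by linarith
  have := (div_nonneg_iff.1 this).resolve_right fun h => by linarith [h.2]
  linarith [this.1]

/-- A function whose derivative is controlled by that of a nonnegative function converges. -/
lemma exists_limit {f f' g g' : ℝ → ℝ} {T : ℝ} (hf : ∀ t, T ≤ t → HasDerivAt f (f' t) t)
    (hg : ∀ t, T ≤ t → HasDerivAt g (g' t) t) (h0 : ∀ t, T ≤ t → 0 ≤ g t)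
    (h : ∀ t, T ≤ t → |f' t| ≤ -g' t) : ∃ l, ∀ t, T ≤ t → |f t - l| ≤ g t := by
  have key : ∀ r t, T ≤ r → T ≤ t → f r - g r ≤ f t + g t := fun r t hr ht => by
    rcases le_total r t with hrt | hrt
    · have := mono_of_hasDerivAt_Icc (g := fun t => f t - g t) hrt
        (fun s hs _ => (hf s (hr.trans hs)).sub (hg s (hr.trans hs)))
        fun s hs _ => by linarith [(abs_le.1 (h s (hr.trans hs))).1]
      linarith [h0 t ht]
    · have := mono_of_hasDerivAt_Icc (g := fun t => -(f t + g t)) hrt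
        (fun s hs _ => ((hf s (ht.trans hs)).add (hg s (ht.trans hs))).neg)
        fun s hs _ => by linarith [(abs_le.1 (h s (ht.trans hs))).2]
      linarith [h0 r hr]
  refine ⟨sSup ((fun t => f t - g t) '' Set.Ici T), fun t ht => ?_⟩
  have h1 : f t - g t ≤ sSup ((fun t => f t - g t) '' Set.Ici T) :=
    le_csSup ⟨f t + g t, by rintro _ ⟨r, hr, rfl⟩; exact key r t hr ht⟩ ⟨t, ht, rfl⟩
  have h2 : sSup ((fun t => f t - g t) '' Set.Ici T) ≤ f t + g t :=
    csSup_le ⟨_, T, Set.self_mem_Ici, rfl⟩ (by rintro _ ⟨r, hr, rfl⟩; exact key r t hr ht)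
  rw [abs_le]
  constructor <;> linarith

section
variable {I D q q' : ℝ → ℝ} {T A B : ℝ}

lemma le_div_of_sq_le (hT : 0 ≤ T) (hA : 0 < A) (hI : ∀ t, T ≤ t → HasDerivAt I (-D t) t)
    (hD : ∀ t, T ≤ t → 0 < D t) (h0 : ∀ t, T ≤ t → 0 ≤ I t) (h : ∀ t, T ≤ t → I t ^ 2 ≤ A * D t)
    {t : ℝ} (ht : 2 * (T + 1) ≤ t) : I t ≤ 2 * A / t := by
  have hpos : ∀ t, T < t → 0 < I t := fun t ht => by
    refine (h0 t ht.le).lt_of_ne' fun he => ?_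
    have h1 : IsLocalMin I t := (eventually_gt_nhds ht).mono fun s hs => he ▸ h0 s hs.le
    have := h1.hasDerivAt_eq_zero (hI t ht.le)
    linarith [hD t ht.le]
  have h1 := mono_of_hasDerivAt_Icc (g := fun t => (I t)⁻¹ - A⁻¹ * t)
    (g' := fun t => D t / I t ^ 2 - A⁻¹) (s := T + 1) (t := t) (by linarith) (fun r hr _ => by
      refine (((hI r (by linarith)).inv (hpos r (by linarith)).ne').sub
        ((hasDerivAt_id r).const_mul A⁻¹)).congr_deriv ?_
      simp) (fun r hr _ => by
      have h2 := hpos r (by linarith)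
      rw [sub_nonneg, inv_eq_one_div, div_le_div_iff₀ hA (by positivity)]
      linarith [h r (by linarith)])
  have h2 := inv_pos.2 (hpos (T + 1) (by linarith))
  have h3 : A⁻¹ * (t / 2) ≤ (I t)⁻¹ := by
    have : A⁻¹ * (t / 2) ≤ A⁻¹ * (t - (T + 1)) := by gcongr; linarith
    linarith
  have h4 := hpos t (by linarith)
  have ht0 : 0 < t := by linarith
  rw [le_div_iff₀ ht0]
  rw [le_inv_comm₀ (by positivity) h4] at h3
  calc I t * t ≤ (A⁻¹ * (t / 2))⁻¹ * t := by gcongr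
    _ = 2 * A := by field_simp

lemma exists_le_div_of_deriv (hT : 0 < T) (hA : 0 < A) (hB : 0 < B)
    (hI : ∀ t, T ≤ t → HasDerivAt I (-D t) t) (hD : ∀ t, T ≤ t → 0 ≤ D t)
    (h0 : ∀ t, T ≤ t → 0 ≤ I t) (hIB : ∀ t, T ≤ t → I t ≤ B / t)
    (hq : ∀ t, T ≤ t → HasDerivAt q (q' t) t) (hq0 : ∀ t, T ≤ t → 0 ≤ q t)
    (hq' : ∀ t, T ≤ t → |q' t| ≤ A * √(D t) * q t) (hqD : ∀ t, T ≤ t → q t ≤ A * √(D t)) :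
    ∃ N > 0, ∀ t, T ≤ t → q t ≤ N / t := by
  set E := exp (A / 2 * (1 + B)) with hE
  have hE0 : 0 < E := exp_pos _
  refine ⟨E * A * √B, by positivity, fun t ht => ?_⟩
  have ht0 : 0 < t := by linarith
  have h1 : ∀ s, t ≤ s → s ≤ 2 * t → q t ≤ q s * E := fun s hs hs2 => by
    have h2 := mono_of_hasDerivAt_Icc (g := fun s => q s * exp (A / 2 * (s / t - t * I s)))
      (g' := fun s => q' s * exp (A / 2 * (s / t - t * I s)) +
        q s * (exp (A / 2 * (s / t - t * I s)) * (A / 2 * (1 / t - t * (-D s)))))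
      hs (fun r hr _ => (hq r (ht.trans hr)).mul ((((hasDerivAt_id r).div_const t).sub
        ((hI r (ht.trans hr)).const_mul t)).const_mul (A / 2)).exp) (fun r hr _ => by
        have h3 := (abs_le.1 (hq' r (ht.trans hr))).1
        have h4 := hq0 r (ht.trans hr)
        have h5 : 2 * √(D r) ≤ 1 / t + t * D r := by
          have h6 := sq_sqrt (hD r (ht.trans hr))
          have h7 : 1 / t + t * D r - 2 * √(D r) = t * (√(D r) - 1 / t) ^ 2 := by
            nth_rewrite 1 [← h6]
            field_simp
            ring
          have : 0 ≤ t * (√(D r) - 1 / t) ^ 2 := by positivity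
          linarith
        have h8 : 0 ≤ q' r + q r * (A / 2 * (1 / t - t * (-D r))) := by
          have := mul_le_mul_of_nonneg_left h5 (mul_nonneg hA.le h4)
          linarith
        have := mul_nonneg (exp_pos (A / 2 * (r / t - t * I r))).le h8
        linarith)
    rw [div_self ht0.ne'] at h2
    have h3 : q t * exp (A / 2 * (1 - t * I t)) ≤ (q s * E) * exp (A / 2 * (1 - t * I t)) := by
      refine h2.trans ?_
      rw [mul_assoc, hE, ← exp_add]
      refine mul_le_mul_of_nonneg_left (exp_le_exp.2 ?_) (hq0 s (ht.trans hs))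
      have h4 : s / t ≤ 2 := by rw [div_le_iff₀ ht0]; exact hs2
      have h5 : t * I t ≤ B := by
        have := hIB t ht
        rw [le_div_iff₀ ht0] at this
        linarith
      have h6 : 0 ≤ t * I s := mul_nonneg ht0.le (h0 s (ht.trans hs))
      rw [← mul_add]
      gcongr
      linarith
    exact le_of_mul_le_mul_right h3 (exp_pos _)
  have h2 := mono_of_hasDerivAt_Icc (g := fun s => -((E * A) ^ 2 * I s) - q t ^ 2 * s)
    (g' := fun s => -((E * A) ^ 2 * (-D s)) - q t ^ 2) (by linarith : t ≤ 2 * t)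
    (fun r hr _ => (((hI r (ht.trans hr)).const_mul ((E * A) ^ 2)).neg.sub
      ((hasDerivAt_id r).const_mul (q t ^ 2))).congr_deriv (by simp)) (fun r hr hr2 => by
      have h3 : q t ≤ (E * A) * √(D r) := (h1 r hr hr2).trans (by
        have := mul_le_mul_of_nonneg_right (hqD r (ht.trans hr)) hE0.le
        linarith)
      have h4 := pow_le_pow_left₀ (hq0 t ht) h3 2
      rw [mul_pow, sq_sqrt (hD r (ht.trans hr))] at h4
      linarith)
  have h3 := mul_nonneg (sq_nonneg (E * A)) (h0 (2 * t) (by linarith))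
  have h4 := mul_le_mul_of_nonneg_left (hIB t ht) (sq_nonneg (E * A))
  rw [le_div_iff₀ ht0]
  refine abs_le_of_sq_le_sq' ?_ (by positivity) |>.2
  rw [mul_pow, mul_pow (E * A), sq_sqrt hB.le]
  have h5 : q t ^ 2 * t ≤ (E * A) ^ 2 * (B / t) := by linarith
  have h6 := mul_le_mul_of_nonneg_right h5 ht0.le
  rw [show (E * A) ^ 2 * (B / t) * t = (E * A) ^ 2 * B by field_simp] at h6
  linarith

lemma exists_le_div_sq {c N : ℝ} {H φ : ℝ → ℝ} (hT : 2 ≤ T) (hc : 0 < c) (hA : 0 < A) (hN : 0 ≤ N)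
    (hB : 0 ≤ B) (hI : ∀ t, T ≤ t → HasDerivAt I (-D t) t) (h0 : ∀ t, T ≤ t → 0 ≤ I t)
    (hIB : ∀ t, T ≤ t → I t ≤ B) (hH : ∀ s t, T ≤ s → s ≤ t → c * (I s - I t) ≤ H s - H t)
    (hHφ : ∀ t, T ≤ t → |H t - φ t| ≤ A * D t)
    (hφ : ∀ s t, T ≤ s → s ≤ t → φ s - φ t ≤ c / 2 * (I s - I t) + N / s ^ 2 * (t - s))
    (hD : ∀ t, T + 1 ≤ t → D t ≤ A * (I (t - 1) - I t)) :
    ∃ G > 0, ∀ t, 2 * (T + 1) ≤ t → D t ≤ G / t ^ 2 := by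
  set l := c / (2 * A) with hl
  have hl0 : 0 < l := by positivity
  set X := 8 * N / A / l + 8 * N / A / l ^ 2 with hX
  have hX0 : 0 ≤ X := by positivity
  refine ⟨A * (X + exp l * (B * (8 / l ^ 2)) + 1), by positivity, fun t ht => ?_⟩
  have ht0 : 0 < t := by linarith
  set θ := 8 * N / A / t ^ 2 with hθ
  have hθ0 : 0 ≤ θ := by positivity
  have h1 := mono_of_hasDerivAt_Icc
    (g := fun m => (I (t - m) - I (t + m) - θ / l * m - θ / l ^ 2) * exp (-l * m))
    (g' := fun m => (-D (t - m) * (-1) - -D (t + m) * 1 - θ / l * 1) * exp (-l * m) +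
      (I (t - m) - I (t + m) - θ / l * m - θ / l ^ 2) * (exp (-l * m) * (-l * 1)))
    (s := 1) (t := t / 2) (by linarith) (fun m hm hm2 => by
      have d1 : HasDerivAt (fun m => I (t - m)) (-D (t - m) * (-1)) m :=
        (hI (t - m) (by linarith)).comp m ((hasDerivAt_id m).const_sub t)
      have d2 : HasDerivAt (fun m => I (t + m)) (-D (t + m) * 1) m :=
        (hI (t + m) (by linarith)).comp m ((hasDerivAt_id m).const_add t)
      exact (((d1.sub d2).sub ((hasDerivAt_id m).const_mul (θ / l))).sub_const _).mul
        ((hasDerivAt_id m).const_mul (-l)).exp) (fun m hm hm2 => by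
      have h2 := hH (t - m) (t + m) (by linarith) (by linarith)
      have h3 := hφ (t - m) (t + m) (by linarith) (by linarith)
      have h4 := (abs_le.1 (hHφ (t - m) (by linarith))).2
      have h5 := (abs_le.1 (hHφ (t + m) (by linarith))).1
      have h6 : N / (t - m) ^ 2 * (t + m - (t - m)) ≤ A * (θ * m) := by
        have h7 : N / (t - m) ^ 2 ≤ N / (t / 2) ^ 2 := by
          gcongr
          linarith
        calc N / (t - m) ^ 2 * (t + m - (t - m)) ≤ N / (t / 2) ^ 2 * (2 * m) := by
              rw [show t + m - (t - m) = 2 * m by ring]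
              gcongr
          _ = A * (θ * m) := by rw [hθ]; field_simp; norm_num
      have h8 : A * (l * (I (t - m) - I (t + m))) = c / 2 * (I (t - m) - I (t + m)) := by
        rw [hl]; field_simp
      have h9 : l * (I (t - m) - I (t + m)) ≤ D (t - m) + D (t + m) + θ * m := by
        refine le_of_mul_le_mul_left ?_ hA
        rw [h8]
        linarith
      have h10 : l * (I (t - m) - I (t + m) - θ / l * m - θ / l ^ 2)
          = l * (I (t - m) - I (t + m)) - θ * m - θ / l := by field_simp
      have h11 : 0 ≤ -D (t - m) * (-1) - -D (t + m) * 1 - θ / l * 1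
          - l * (I (t - m) - I (t + m) - θ / l * m - θ / l ^ 2) := by
        rw [h10]; linarith
      have := mul_nonneg h11 (exp_pos (-l * m)).le
      linarith)
  have h2 : (I (t - t / 2) - I (t + t / 2) - θ / l * (t / 2) - θ / l ^ 2) ≤ B := by
    have a1 := hIB (t - t / 2) (by linarith)
    have a2 := h0 (t + t / 2) (by linarith)
    have a3 : 0 ≤ θ / l * (t / 2) := by positivity
    have a4 : 0 ≤ θ / l ^ 2 := by positivity
    linarith
  have h3 : exp (-l * (t / 2)) ≤ 8 / l ^ 2 / t ^ 2 := by
    have a1 := quadratic_le_exp_of_nonneg (x := l * (t / 2)) (by positivity)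
    have a2 : (l * (t / 2)) ^ 2 / 2 ≤ exp (l * (t / 2)) := by
      have : 0 ≤ l * (t / 2) := by positivity
      linarith
    rw [neg_mul, exp_neg]
    calc (exp (l * (t / 2)))⁻¹ ≤ ((l * (t / 2)) ^ 2 / 2)⁻¹ := by gcongr
      _ = 8 / l ^ 2 / t ^ 2 := by field_simp; norm_num
  have h4 : I (t - 1) - I (t + 1) - θ / l * 1 - θ / l ^ 2 ≤ exp l * (B * (8 / l ^ 2 / t ^ 2)) := by
    have a1 := h1.trans ((mul_le_mul_of_nonneg_right h2 (exp_pos _).le).trans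
      (mul_le_mul_of_nonneg_left h3 hB))
    have a2 := mul_le_mul_of_nonneg_left a1 (exp_pos l).le
    rwa [mul_left_comm, mul_one (-l), ← exp_add, add_neg_cancel, exp_zero, mul_one] at a2
  have h5 : I (t + 1) ≤ I t := by
    have := mono_of_hasDerivAt_Icc (g := fun s => -I s) (g' := fun s => - -D s)
      (by linarith : t ≤ t + 1) (fun r hr _ => (hI r (by linarith)).neg) (fun r hr _ => by
        have := (abs_nonneg _).trans (hHφ r (by linarith))
        have := nonneg_of_mul_nonneg_right this hA
        linarith)
    linarith
  have h6 : θ / l * 1 + θ / l ^ 2 = X / t ^ 2 := by rw [hθ, hX]; ring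
  have h7 : I (t - 1) - I t ≤ (X + exp l * (B * (8 / l ^ 2)) + 1) / t ^ 2 := by
    have : 0 ≤ 1 / t ^ 2 := by positivity
    rw [add_div, add_div, show exp l * (B * (8 / l ^ 2)) / t ^ 2
      = exp l * (B * (8 / l ^ 2 / t ^ 2)) by ring]
    linarith
  calc D t ≤ A * (I (t - 1) - I t) := hD t (by linarith)
    _ ≤ A * ((X + exp l * (B * (8 / l ^ 2)) + 1) / t ^ 2) := by gcongr
    _ = _ := by ring

end

lemma exists_shift_le {f f' : ℝ → ℝ} {B : ℝ} (hB : 0 < B) (hd : ∀ x, HasDerivAt f (f' x) x)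
    (hb : ∀ x, |f' x| ≤ B * exp (-|x|)) : ∃ C > 0, ∀ z w : ℝ, |z - w| ≤ 1 →
    ∫ x, (f (x - z) - f (x - w)) ^ 2 ≤ C * (z - w) ^ 2 := by
  have hJ := integral_sq_nonneg fun x => exp (-|x|)
  refine ⟨(B * exp 1) ^ 2 * ((∫ x, exp (-|x|) ^ 2) + 1), by positivity, fun z w hzw => ?_⟩
  have hf : Continuous f := continuous_iff_continuousAt.2 fun x => (hd x).continuousAt
  have h1 := (l2c_exp_neg_abs.comp_sub z).integral_le_of_bound
    (b := fun x => f (x - z) - f (x - w)) (by fun_prop) (C := B * exp 1 * |z - w|) fun x => by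
    have hb' : ∀ y ∈ Set.uIcc (x - w) (x - z), ‖f' y‖ ≤ B * exp 1 * exp (-|x - z|) := fun y hy => by
        have h2 : |x - z| ≤ |y| + 1 := by
          have h3 := Set.abs_sub_right_of_mem_uIcc hy
          rw [show x - z - (x - w) = -(z - w) by ring, abs_neg] at h3
          have := abs_sub_abs_le_abs_sub (x - z) y
          linarith
        rw [mul_assoc, ← exp_add]
        exact (hb y).trans (mul_le_mul_of_nonneg_left (exp_le_exp.2 (by linarith)) hB.le)
    have := (convex_uIcc (x - w) (x - z)).norm_image_sub_le_of_norm_hasDerivWithin_le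
      (fun y _ => (hd y).hasDerivWithinAt) hb' Set.left_mem_uIcc Set.right_mem_uIcc
    rw [norm_eq_abs, norm_eq_abs, show x - z - (x - w) = -(z - w) by ring, abs_neg] at this
    rw [abs_of_pos (exp_pos _)]
    linarith
  rw [integral_comp_sub (fun x => exp (-|x|) ^ 2) z, mul_pow, sq_abs] at h1
  have : 0 ≤ (B * exp 1) ^ 2 * (z - w) ^ 2 := by positivity
  linarith

lemma exists_shift_Q_le {p : ℝ} (hp : 2 < p) : ∃ C > 0, ∀ z w : ℝ, |z - w| ≤ 1 →
    ∫ x, (Q p (x - z) - Q p (x - w)) ^ 2 ≤ C * (z - w) ^ 2 ∧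
    ∫ x, (Q1 p (x - z) - Q1 p (x - w)) ^ 2 ≤ C * (z - w) ^ 2 := by
  obtain ⟨B, hB, h⟩ := exists_abs_Q2_le hp
  obtain ⟨C₁, h1, k1⟩ := exists_shift_le (cQ_pos hp) (hasDerivAt_Q hp)
    fun x => (abs_Q1_le hp x).trans (Q_le hp x)
  obtain ⟨C₂, h2, k2⟩ := exists_shift_le (mul_pos hB (cQ_pos hp)) (hasDerivAt_Q1 hp)
    fun x => (h x).trans ((mul_le_mul_of_nonneg_left (Q_le hp x) hB.le).trans_eq
      (mul_assoc _ _ _).symm)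
  refine ⟨C₁ + C₂, by positivity, fun z w hzw => ⟨(k1 z w hzw).trans ?_, (k2 z w hzw).trans ?_⟩⟩ <;>
  gcongr <;> linarith

lemma exists_rr_sub_le {p : ℝ} (hp : 2 < p) (K : ℕ) : ∃ A > 0, ∀ σ z w : ℕ → ℝ,
    (∀ k < K, |σ k| = 1) → ∀ δ : ℝ, δ ≤ 1 → (∀ k < K, |z k - w k| ≤ δ) →
    ∫ x, (rr p K σ z x - rr p K σ w x) ^ 2 ≤ A * δ ^ 2 ∧
    ∫ x, (rrx p K σ z x - rrx p K σ w x) ^ 2 ≤ A * δ ^ 2 := by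
  obtain ⟨C, hC, h⟩ := exists_shift_Q_le hp
  have key : ∀ (f : ℝ → ℝ) (σ z w : ℕ → ℝ) (δ : ℝ), L2c f → (∀ k < K, |σ k| = 1) →
      (∀ k < K, ∫ x, (f (x - z k) - f (x - w k)) ^ 2 ≤ C * δ ^ 2) →
      ∫ x, ((∑ k ∈ range K, σ k * f (x - z k)) -
        ∑ k ∈ range K, σ k * f (x - w k)) ^ 2 ≤ (K ^ 2 * C + 1) * δ ^ 2 :=
    fun f σ z w δ hf hσ hfd => by
      simp_rw [← sum_sub_distrib, ← mul_sub]
      refine (L2c.integral_sum_sq_le _ fun k _ =>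
        ((hf.comp_sub (z k)).sub (hf.comp_sub (w k))).const_mul (σ k)).trans ?_
      have h1 : ∑ k ∈ range K, ∫ x, (σ k * (f (x - z k) - f (x - w k))) ^ 2
          ≤ ∑ k ∈ range K, C * δ ^ 2 := sum_le_sum fun k hk => by
        have hk' := mem_range.1 hk
        have e : σ k ^ 2 = 1 := by rw [← sq_abs, hσ k hk', one_pow]
        simp_rw [mul_pow, e, one_mul]
        exact hfd k hk'
      rw [sum_const, card_range, nsmul_eq_mul] at h1
      rw [card_range]
      have := mul_le_mul_of_nonneg_left h1 (Nat.cast_nonneg (α := ℝ) K)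
      linarith [sq_nonneg δ]
  refine ⟨K ^ 2 * C + 1, by positivity, fun σ z w hσ δ hδ hzw => ⟨key _ σ z w δ (l2c_Q hp) hσ ?_,
    key _ σ z w δ (l2c_Q1 hp) hσ ?_⟩⟩ <;> intro k hk
  · exact ((h _ _ ((hzw k hk).trans hδ)).1).trans (mul_le_mul_of_nonneg_left
      (sq_le_sq' (by linarith [(abs_le.1 (hzw k hk)).1]) (abs_le.1 (hzw k hk)).2) hC.le)
  · exact ((h _ _ ((hzw k hk).trans hδ)).2).trans (mul_le_mul_of_nonneg_left
      (sq_le_sq' (by linarith [(abs_le.1 (hzw k hk)).1]) (abs_le.1 (hzw k hk)).2) hC.le)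

lemma exists_jj_rr_sub_le {p : ℝ} (hp : 2 < p) (K : ℕ) : ∃ A > 0, ∀ (σ z w : ℕ → ℝ) (q : ℝ),
    Cfg K σ z q → ∀ δ : ℝ, 0 ≤ δ → δ ≤ 1 → (∀ k < K, |w k - z k| ≤ δ) →
    |jj p (rr p K σ w) (rrx p K σ w) - jj p (rr p K σ z) (rrx p K σ z)| ≤ A * (δ ^ 2 + q * δ) := by
  obtain ⟨A, hA, h⟩ := exists_rr_sub_le hp K
  obtain ⟨C, hC, k⟩ := exists_jj_sub_le hp K (K * cQ p)
  refine ⟨C * (A + √A), by positivity, fun σ z w q hz δ h0 h1 hw => ?_⟩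
  obtain ⟨a1, a2⟩ := h σ w z hz.sgn δ h1 hw
  have e : (√A * δ) ^ 2 = A * δ ^ 2 := by rw [mul_pow, sq_sqrt hA.le]
  refine (k σ z q hz _ _ (l2c_rr hp) (l2c_rrx hp) (hasDerivAt_rr hp) (fun x => ?_) (√A * δ)
    (by positivity) (a1.trans_eq e.symm) (a2.trans_eq e.symm)).trans ?_
  · refine (abs_sum_le_sum_abs _ _).trans ((sum_le_card_nsmul _ _ (cQ p)
      fun k hk => ?_).trans_eq ?_)
    · rw [abs_mul, hz.sgn k (mem_range.1 hk), one_mul, abs_of_pos (Q_pos hp _)]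
      exact Q_le_cQ hp _
    · rw [card_range, nsmul_eq_mul]
  · rw [e]
    have := hz.nonneg
    have b1 : 0 ≤ C * (A * (q * δ)) := by positivity
    have b2 : 0 ≤ C * (√A * δ ^ 2) := by positivity
    linarith

/-- A function controlled to first order by a moving configuration. -/
lemma sub_le_of_local {K : ℕ} {z z' : ℝ → ℕ → ℝ} {φ q B B' : ℝ → ℝ} {A T s t : ℝ} (hs : T ≤ s)
    (hst : s ≤ t) (hz : ∀ t, T ≤ t → ∀ k < K, HasDerivAt (fun s => z s k) (z' t k) t)
    (h : ∀ r t, T ≤ r → T ≤ t → ∑ k ∈ range K, |z r k - z t k| ≤ 1 → |φ r - φ t| ≤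
      A * ((∑ k ∈ range K, |z r k - z t k|) ^ 2 + q t * ∑ k ∈ range K, |z r k - z t k|))
    (hB : ∀ r, s ≤ r → HasDerivAt B (B' r) r)
    (hb : ∀ r, s ≤ r → A * (q r * ∑ k ∈ range K, |z' r k|) ≤ B' r) :
    φ s - φ t ≤ B t - B s := by
  set δ : ℝ → ℝ → ℝ := fun r t => ∑ k ∈ range K, |z r k - z t k| with hδ
  have h0 : ∀ t, T ≤ t → Tendsto (fun r => δ r t) (𝓝 t) (𝓝 0) := fun t ht => by
    have : Tendsto (fun r => δ r t) (𝓝 t) (𝓝 (∑ k ∈ range K, |z t k - z t k|)) :=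
      tendsto_finsetSum _ fun k hk =>
        ((hz t ht k (mem_range.1 hk)).continuousAt.tendsto.sub tendsto_const_nhds).abs
    simpa using this
  have h1 : ∀ t, T ≤ t → ∀ᶠ r in 𝓝 t, δ r t ≤ 1 := fun t ht =>
    (h0 t ht).eventually (eventually_le_nhds one_pos)
  have hc : ContinuousOn (fun r => φ s - φ r) (Set.Icc s t) := fun r hr => by
    have hr' := hs.trans hr.1
    refine continuousWithinAt_const.sub (tendsto_iff_dist_tendsto_zero.2 (squeeze_zero'
      (Eventually.of_forall fun _ => dist_nonneg) ?_ (?_ : Tendsto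
        (fun x => A * (δ x r ^ 2 + q r * δ x r)) (𝓝[Set.Icc s t] r) (𝓝 0))))
    · filter_upwards [nhdsWithin_le_nhds (h1 r hr'), self_mem_nhdsWithin] with x hx hx'
      exact h x r (hs.trans hx'.1) hr' hx
    · have := (((h0 r hr').pow 2).add ((h0 r hr').const_mul (q r))).const_mul A
      simp only [ne_eq, OfNat.ofNat_ne_zero, not_false_eq_true, zero_pow, mul_zero, add_zero] at this
      exact this.mono_left nhdsWithin_le_nhds
  have := image_le_of_liminf_slope_right_le_deriv_boundary hc (B := fun r => B r - B s) (B' := B')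
    (by simp) (fun r hr => ((hB r hr.1).sub_const _).continuousAt.continuousWithinAt)
    (fun r hr => ((hB r hr.1).sub_const _).hasDerivWithinAt) (fun r hr b hbr => by
      have hr' := hs.trans hr.1
      have hsl : Tendsto (fun x => δ x r / (x - r)) (𝓝[>] r) (𝓝 (∑ k ∈ range K, |z' r k|)) := by
        have : Tendsto (fun x => ∑ k ∈ range K, |slope (fun s => z s k) r x|) (𝓝[>] r)
            (𝓝 (∑ k ∈ range K, |z' r k|)) := tendsto_finsetSum _ fun k hk =>
          ((hasDerivAt_iff_tendsto_slope.1 (hz r hr' k (mem_range.1 hk))).mono_left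
            (nhdsWithin_mono _ fun x hx => (ne_of_gt hx : x ≠ r))).abs
        refine this.congr' ?_
        filter_upwards [self_mem_nhdsWithin] with x hx
        rw [hδ, sum_div]
        refine sum_congr rfl fun k _ => ?_
        rw [slope_def_field, abs_div, abs_of_pos (sub_pos.2 (Set.mem_Ioi.1 hx))]
      have hlim := ((((h0 r hr').mono_left nhdsWithin_le_nhds).mul hsl).add
        (hsl.const_mul (q r))).const_mul A
      rw [zero_mul, zero_add] at hlim
      refine Eventually.frequently ?_
      filter_upwards [hlim.eventually (gt_mem_nhds ((hb r hr.1).trans_lt hbr)),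
        nhdsWithin_le_nhds (h1 r hr'), self_mem_nhdsWithin] with x hx hx1 hx2
      have hx2' : 0 < x - r := sub_pos.2 hx2
      refine lt_of_le_of_lt ?_ hx
      rw [slope_def_field, div_le_iff₀ hx2']
      have h3 := (abs_le.1 (h x r (hr'.trans (le_of_lt hx2)) hr' hx1)).1
      have h4 : A * (δ x r * (δ x r / (x - r)) + q r * (δ x r / (x - r))) * (x - r)
          = A * (δ x r ^ 2 + q r * δ x r) := by field_simp
      rw [h4]
      linarith) (Set.right_mem_Icc.2 hst)
  exact this

section

variable {p α : ℝ} {u : ℝ × ℝ → ℝ} {T M C c : ℝ} {K : ℕ} {σ : ℕ → ℝ} {z z' : ℝ → ℕ → ℝ} {H I : ℝ → ℝ}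

lemma Track.sum_deriv_le (W : Track p u T M C c K σ z z' H) {t : ℝ} (ht : T ≤ t) :
    ∑ k ∈ range K, |z' t k| ≤ K * (C * √(dd p u t)) := by
  have := sum_le_card_nsmul (range K) (fun k => |z' t k|) _
    fun k hk => W.deriv_le t ht k (mem_range.1 hk)
  rwa [card_range, nsmul_eq_mul] at this

lemma Track.sub_jj_le (hp : 2 < p) (W : Track p u T M C c K σ z z' H) (J : Tail p u T C c K H I)
    {T₁ N : ℝ} (hT : T ≤ T₁) (hN : 0 < N) (hq : ∀ t, T₁ ≤ t → qq K (z t) ≤ N / t) :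
    ∃ B > 0, ∀ s t, T₁ ≤ s → s ≤ t →
      jj p (rr p K σ (z s)) (rrx p K σ (z s)) - jj p (rr p K σ (z t)) (rrx p K σ (z t))
        ≤ c / 2 * (I s - I t) + B / s ^ 2 * (t - s) := by
  obtain ⟨A, hA, hj⟩ := exists_jj_rr_sub_le hp K
  have hc := W.c_pos
  have hC := W.C_pos
  have hT2 := W.two_le
  refine ⟨(A * K * C * N) ^ 2 / (2 * c) + 1, by positivity, fun s t hs hst => ?_⟩
  set B := (A * K * C * N) ^ 2 / (2 * c) + 1 with hB
  have hs0 : 0 < s := by linarith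
  have := sub_le_of_local (φ := fun t => jj p (rr p K σ (z t)) (rrx p K σ (z t)))
    (q := fun t => qq K (z t)) (A := A) (B := fun r => -(c / 2 * I r) + B / s ^ 2 * r)
    (B' := fun r => -(c / 2 * -dd p u r) + B / s ^ 2 * 1) (hT.trans hs) hst W.deriv
    (fun r t hr ht h1 => hj σ (z t) (z r) _ (W.fit t ht).cfg _
      (sum_nonneg fun _ _ => abs_nonneg _) h1 fun k hk =>
        single_le_sum (f := fun k => |z r k - z t k|) (fun _ _ => abs_nonneg _) (mem_range.2 hk))
    (fun r hr => (((J.deriv r ((hT.trans hs).trans hr)).const_mul _).neg).add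
      ((hasDerivAt_id r).const_mul _)) (fun r hr => by
      have hr' := (hT.trans hs).trans hr
      have hD := sq_sqrt (dd_nonneg p u r)
      have h1 : qq K (z r) ≤ N / s := (hq r (hs.trans hr)).trans (by gcongr)
      have h2 : A * (qq K (z r) * ∑ k ∈ range K, |z' r k|)
          ≤ A * (N / s * (K * (C * √(dd p u r)))) := by
        have := W.sum_deriv_le hr'
        have := (W.fit r hr').cfg.nonneg
        gcongr
      have h3 : A * (N / s * (K * (C * √(dd p u r)))) = A * K * C * N / s * √(dd p u r) := by ring
      have h4 : A * K * C * N / s * √(dd p u r)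
          ≤ c / 2 * √(dd p u r) ^ 2 + (A * K * C * N / s) ^ 2 / (2 * c) := by
        have e : c / 2 * √(dd p u r) ^ 2 + (A * K * C * N / s) ^ 2 / (2 * c)
            - A * K * C * N / s * √(dd p u r)
            = (c * √(dd p u r) - A * K * C * N / s) ^ 2 / (2 * c) := by field_simp; ring
        have : 0 ≤ (c * √(dd p u r) - A * K * C * N / s) ^ 2 / (2 * c) := by positivity
        linarith
      have h5 : (A * K * C * N / s) ^ 2 / (2 * c) ≤ B / s ^ 2 := by
        rw [div_pow, div_right_comm]
        gcongr
        linarith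
      rw [hD] at h4
      linarith)
  linarith

lemma Track.exists_dd_le (S : Sol p α u) (hp : 2 < p) (W : Track p u T M C c K σ z z' H)
    (hK : 2 ≤ K) : ∃ G > 0, ∃ T' ≥ T, ∀ t, T' ≤ t → dd p u t ≤ G / t ^ 2 := by
  obtain ⟨I, J⟩ := W.exists_tail S hp
  have hc := W.c_pos
  have hC := W.C_pos
  have hT := W.two_le
  have hqD : ∀ t, T ≤ t → qq K (z t) ≤ C * √(dd p u t) := fun t ht => (W.fit t ht).qq_le
  have hD : ∀ t, T ≤ t → 0 < dd p u t := fun t ht => by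
    have h1 := (exp_pos _).trans_le (exp_le_qq (z := z t) (by omega : 0 + 1 < K))
    exact sqrt_pos.1 ((pos_iff_pos_of_mul_pos (h1.trans_le (hqD t ht))).1 hC)
  set m := dd p u T + C * I T with hm
  have hIT := J.nonneg T le_rfl
  have hm0 : 0 < m := by
    have := hD T le_rfl
    positivity
  have hDm : ∀ t, T ≤ t → √(dd p u t) ≤ √m := fun t ht => sqrt_le_sqrt (by
    have := J.growth T t le_rfl ht
    have := mul_nonneg hC.le (J.nonneg t ht)
    linarith)
  set A := (((2 + C) * √m + C ^ 2) / c) ^ 2 with hA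
  have hA0 : 0 < A := by positivity
  have h1 : ∀ t, T ≤ t → I t ^ 2 ≤ A * dd p u t := fun t ht => by
    rw [← sq_sqrt (hD t ht).le, hA, ← mul_pow]
    refine pow_le_pow_left₀ (J.nonneg t ht) ?_ 2
    rw [div_mul_eq_mul_div, le_div_iff₀ hc]
    have a1 := W.mul_le hp J ht
    have a2 := mul_le_mul_of_nonneg_left (hqD t ht) hC.le
    have a3 : (2 + C) * dd p u t ≤ (2 + C) * √m * √(dd p u t) := by
      have := mul_self_sqrt (hD t ht).le
      rw [mul_assoc]
      refine mul_le_mul_of_nonneg_left ?_ (by linarith)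
      calc _ = √(dd p u t) * √(dd p u t) := this.symm
        _ ≤ _ := mul_le_mul_of_nonneg_right (hDm t ht) (sqrt_nonneg _)
    linarith
  set T₁ := 2 * (T + 1) with hT₁
  have hTT : T ≤ T₁ := by linarith
  obtain ⟨N, hN, hqN⟩ := exists_le_div_of_deriv (q := fun t => qq K (z t)) (q' := fun t =>
      ∑ k ∈ range (K - 1), exp (-(z t (k + 1) - z t k)) * -(z' t (k + 1) - z' t k))
    (by linarith : 0 < T₁) (by linarith : 0 < 2 * C) (by positivity : 0 < 2 * A)
    (fun t ht => J.deriv t (hTT.trans ht)) (fun t ht => (hD t (hTT.trans ht)).le)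
    (fun t ht => J.nonneg t (hTT.trans ht))
    (fun t ht => le_div_of_sq_le (by linarith) hA0 J.deriv hD J.nonneg h1 ht)
    (fun t ht => by
      have : ∀ k ∈ range (K - 1), HasDerivAt (fun t => exp (-(z t (k + 1) - z t k)))
          (exp (-(z t (k + 1) - z t k)) * -(z' t (k + 1) - z' t k)) t := fun k hk => by
        have hk' := mem_range.1 hk
        exact (((W.deriv t (hTT.trans ht) (k + 1) (by omega)).sub
          (W.deriv t (hTT.trans ht) k (by omega))).neg).exp
      exact HasDerivAt.fun_sum this)
    (fun t _ => qq_nonneg K (z t))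
    (fun t ht => by
      refine (abs_sum_le_sum_abs _ _).trans ?_
      rw [qq, mul_sum]
      refine sum_le_sum fun k hk => ?_
      have hk' := mem_range.1 hk
      have a1 := W.deriv_le t (hTT.trans ht) (k + 1) (by omega)
      have a2 := W.deriv_le t (hTT.trans ht) k (by omega)
      rw [abs_mul, abs_neg, abs_exp, mul_comm]
      refine mul_le_mul_of_nonneg_right ?_ (exp_pos _).le
      linarith [abs_sub (z' t (k + 1)) (z' t k)])
    (fun t ht => by
      have := hqD t (hTT.trans ht)
      have : 0 ≤ C * √(dd p u t) := by positivity
      linarith)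
  obtain ⟨B, hB, hφ⟩ := W.sub_jj_le hp J hTT hN hqN
  obtain ⟨G, hG, h⟩ := exists_le_div_sq (by linarith) hc (by linarith : 0 < 2 + C) hB.le
    (J.nonneg T₁ hTT) (fun t ht => J.deriv t (hTT.trans ht)) (fun t ht => J.nonneg t (hTT.trans ht))
    (fun t ht => J.anti T₁ t hTT ht) (fun s t hs hst => J.sub_le s t (hTT.trans hs) hst)
    (fun t ht => W.sub_le hp (hTT.trans ht)) hφ (fun t ht => by
      refine (J.dd_le hC (by linarith)).trans (mul_le_mul_of_nonneg_right (by linarith) ?_)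
      have := J.anti (t - 1) t (by linarith) (by linarith)
      linarith)
  exact ⟨G, hG, _, by linarith, h⟩

end

/-- A barrier argument for the largest of finitely many functions. -/
lemma le_barrier {n : ℕ} {f f' : ℕ → ℝ → ℝ} {b b' : ℝ → ℝ} {T : ℝ}
    (hf : ∀ t, T ≤ t → ∀ k < n, HasDerivAt (f k) (f' k t) t)
    (hb : ∀ t, T ≤ t → HasDerivAt b (b' t) t) (h0 : ∀ k < n, f k T ≤ b T)
    (h : ∀ t, T ≤ t → ∀ k < n, (∀ j < n, f j t ≤ f k t) → f k t = b t → f' k t < b' t)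
    {t : ℝ} (ht : T ≤ t) : ∀ k < n, f k t ≤ b t := by
  have hcl : IsClosed ({r | ∀ k < n, f k r ≤ b r} ∩ Set.Icc T t) := by
    have e : {r | ∀ k < n, f k r ≤ b r} ∩ Set.Icc T t
        = Set.Icc T t ∩ ⋂ k ∈ Set.Iio n, {r ∈ Set.Icc T t | f k r ≤ b r} := by
      ext r
      simp only [Set.mem_inter_iff, Set.mem_ofPred_eq, Set.mem_iInter, Set.mem_Iio]
      exact ⟨fun hr => ⟨hr.2, fun k hk => ⟨hr.2, hr.1 k hk⟩⟩,
        fun hr => ⟨fun k hk => (hr.2 k hk).2, hr.1⟩⟩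
    rw [e]
    exact isClosed_Icc.inter (isClosed_biInter fun k hk => isClosed_Icc.isClosed_le
      (fun r hr => (hf r hr.1 k hk).continuousAt.continuousWithinAt)
      (fun r hr => (hb r hr.1).continuousAt.continuousWithinAt))
  refine hcl.mem_of_ge_of_forall_exists_gt h0 ht fun r hr => ?_
  have hev : ∀ᶠ s in 𝓝[>] r, ∀ k ∈ range n, f k s ≤ b s := by
    rw [Filter.eventually_all_finset]
    intro k hk
    have hk' := mem_range.1 hk
    have hd := (hf r hr.2.1 k hk').sub (hb r hr.2.1)
    rcases (hr.1 k hk').eq_or_lt with he | hlt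
    · have h1 := h r hr.2.1 k hk' (fun j hj => (hr.1 j hj).trans_eq he.symm) he
      have h2 := (hasDerivAt_iff_tendsto_slope.1 hd).mono_left
        (nhdsWithin_mono _ fun x hx => (ne_of_gt hx : x ≠ r))
      filter_upwards [h2.eventually (gt_mem_nhds (sub_neg.2 h1)), self_mem_nhdsWithin] with s hs hs'
      have h3 : r < s := hs'
      rw [slope_def_field, div_lt_iff₀ (sub_pos.2 h3), zero_mul] at hs
      simp only [Pi.sub_apply, he, sub_self, sub_zero] at hs
      linarith
    · filter_upwards [nhdsWithin_le_nhds (hd.continuousAt.eventually (gt_mem_nhds (sub_neg.2 hlt)))]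
        with s hs
      have : f k s - b s < 0 := hs
      linarith
  obtain ⟨s, hs, hs'⟩ := (hev.and (Ioc_mem_nhdsGT hr.2.2)).exists
  exact ⟨s, fun k hk => hs k (mem_range.2 hk), hs'⟩

lemma hasDerivAt_rpow_quarter {t : ℝ} (ht : 0 < t) : HasDerivAt (fun t : ℝ => t ^ (-(1 / 4) : ℝ))
    (-(1 / 4) * (t ^ (-(1 / 4) : ℝ) / t)) t := by
  have := hasDerivAt_rpow_const (p := -(1 / 4)) (Or.inl ht.ne')
  rwa [rpow_sub_one ht.ne'] at this

lemma exists_gap_le {n : ℕ} {f f' : ℕ → ℝ → ℝ} {T E : ℝ} (hE : 0 < E)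
    (hd : ∀ t, T ≤ t → ∀ k < n, HasDerivAt (f k) (f' k t) t)
    (h : ∀ t, T ≤ t → ∀ k < n, (∀ j < n, f j t ≤ f k t) →
      f' k t ≤ (-(1 - exp (-f k t)) + E * t ^ (-(1 / 4) : ℝ)) / t) :
    ∃ A > 0, ∀ᶠ t in atTop, ∀ k < n, f k t ≤ A * t ^ (-(1 / 4) : ℝ) := by
  have hlim := (tendsto_rpow_neg_atTop (by norm_num : (0:ℝ) < 1 / 4)).const_mul E
  rw [mul_zero] at hlim
  obtain ⟨S, hS⟩ := eventually_atTop.1 ((hlim.eventually (ge_mem_nhds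
    (by norm_num : (0:ℝ) < 1 / 4))).and ((eventually_ge_atTop T).and (eventually_gt_atTop 0)))
  obtain ⟨-, hST, hS0⟩ := hS S le_rfl
  have hw : ∀ t, S ≤ t → 0 < t ^ (-(1 / 4) : ℝ) := fun t ht => rpow_pos_of_pos (hS t ht).2.2 _
  have hsum : 0 ≤ ∑ k ∈ range n, exp (f k S) := sum_nonneg fun _ _ => (exp_pos _).le
  have := hw S le_rfl
  set A := 2 * E + 1 + (∑ k ∈ range n, exp (f k S)) / S ^ (-(1 / 4) : ℝ) with hA
  refine ⟨A, by positivity, eventually_atTop.2 ⟨S, fun t ht k hk => ?_⟩⟩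
  have hA2 : 2 * E < A := by
    have : 0 ≤ (∑ k ∈ range n, exp (f k S)) / S ^ (-(1 / 4) : ℝ) := by positivity
    linarith
  have := le_barrier (f := fun k t => exp (f k t) - 1) (b := fun t => A * t ^ (-(1 / 4) : ℝ))
    (fun t ht k hk => ((hd t (hS t ht).2.1 k hk).exp.sub_const 1))
    (fun t ht => (hasDerivAt_rpow_quarter (hS t ht).2.2).const_mul A) (fun k hk => by
      have h1 := single_le_sum (f := fun k => exp (f k S))
        (fun _ _ => (exp_pos _).le) (mem_range.2 hk)
      have h2 : A * S ^ (-(1 / 4) : ℝ) = (2 * E + 1) * S ^ (-(1 / 4) : ℝ)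
          + ∑ k ∈ range n, exp (f k S) := by rw [hA]; field_simp
      have h3 : 0 ≤ (2 * E + 1) * S ^ (-(1 / 4) : ℝ) := by positivity
      linarith) (fun t ht k hk hmax he => by
      obtain ⟨b1, b2, b3⟩ := hS t ht
      have hwt := hw t ht
      set w := t ^ (-(1 / 4) : ℝ)
      have hex := exp_pos (f k t)
      have h1 := mul_le_mul_of_nonneg_left (h t b2 k hk fun j hj => exp_le_exp.1
        (by linarith [hmax j hj])) hex.le
      refine h1.trans_lt ?_
      have h2 : exp (f k t) * exp (-f k t) = 1 := by rw [← exp_add]; simp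
      have h4 : exp (f k t) * (-(1 - exp (-f k t)) + E * w)
          = -(A * w) + E * w + A * w * (E * w) := by
        rw [← he]; linear_combination h2
      have h5 := mul_le_mul_of_nonneg_left b1 (by positivity : 0 ≤ A * w)
      have h6 := mul_lt_mul_of_pos_right hA2 hwt
      rw [← mul_div_assoc, h4, ← mul_assoc, ← mul_assoc, ← mul_div_assoc]
      refine div_lt_div_of_pos_right ?_ b3
      linarith) ht k hk
  linarith [add_one_le_exp (f k t)]

/-- Convergence to the explicit logarithmic solution for a perturbed first order Toda chain. -/
lemma exists_toda_limit {K : ℕ} {Y Y' f : ℕ → ℝ → ℝ} {L : ℕ → ℝ} {T E : ℝ} (hK : 2 ≤ K)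
    (hT : 1 ≤ T) (hE : 0 < E) (hf : ∀ k t, f k t = Y (k + 1) t - Y k t - log t - L k)
    (hd : ∀ t, T ≤ t → ∀ k < K, HasDerivAt (Y k) (Y' k t) t)
    (h : ∀ t, T ≤ t → ∀ k < K, |Y' k t - (k * (K - k) / 2 * exp (-f (k - 1) t)
      - (k + 1) * (K - (k + 1)) / 2 * exp (-f k t)) / t| ≤ E * t ^ (-(1 / 4) : ℝ) / t) :
    ∃ l, ∃ A > 0, ∀ᶠ t in atTop, ∀ k < K, |Y k t - (k - (K - 1) / 2) * log t
      - ∑ j ∈ range k, L j - l| ≤ A * t ^ (-(1 / 4) : ℝ) := by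
  have hfd : ∀ t, T ≤ t → ∀ k < K - 1,
      HasDerivAt (f k) (Y' (k + 1) t - Y' k t - 1 / t) t := fun t ht k hk => by
    rw [funext (hf k), one_div]
    exact (((hd t ht (k + 1) (by omega)).sub (hd t ht k (by omega))).sub
      (hasDerivAt_log (by linarith))).sub_const _
  have key : ∀ t, T ≤ t → ∀ k < K - 1, ∀ s : ℝ, |s| = 1 →
      (∀ j < K - 1, s * exp (-f k t) ≤ s * exp (-f j t)) →
      s * (Y' (k + 1) t - Y' k t - 1 / t)
        ≤ (s * (exp (-f k t) - 1) + 2 * E * t ^ (-(1 / 4) : ℝ)) / t := by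
    intro t ht k hk s hs1 hmin
    have ht0 : 0 < t := by linarith
    have h1 := h t ht (k + 1) (by omega)
    have h2 := h t ht k (by omega)
    rw [Nat.add_sub_cancel] at h1
    push_cast at h1
    set w := t ^ (-(1 / 4) : ℝ)
    have hkK : (k:ℝ) + 2 ≤ K := by exact_mod_cast (by omega : k + 2 ≤ K)
    have c1 : k * (K - k) / 2 * (s * exp (-f k t))
        ≤ k * (K - k) / 2 * (s * exp (-f (k - 1) t)) := by
      rcases Nat.eq_zero_or_pos k with rfl | hk0
      · simp
      · exact mul_le_mul_of_nonneg_left (hmin _ (by omega)) (div_nonneg (mul_nonneg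
          (Nat.cast_nonneg _) (by linarith)) two_pos.le)
    have c2 : ((k:ℝ) + 1 + 1) * (K - (k + 1 + 1)) / 2 * (s * exp (-f k t))
        ≤ (k + 1 + 1) * (K - (k + 1 + 1)) / 2 * (s * exp (-f (k + 1) t)) := by
      rcases eq_or_ne (k + 2) K with hk0 | hk0
      · have : (K:ℝ) - (k + 1 + 1) = 0 := by rw [← hk0]; push_cast; ring
        simp [this]
      · exact mul_le_mul_of_nonneg_left (hmin _ (by omega)) (div_nonneg (mul_nonneg
          (by positivity) (by linarith)) two_pos.le)
    set P := Y' (k + 1) t with hP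
    set R := Y' k t with hR
    have d1 := (le_abs_self (s * (P - _))).trans_eq (abs_mul _ _) |>.trans_eq
      (by rw [hs1, one_mul]) |>.trans h1
    have d2 := (neg_le_abs (s * (R - _))).trans_eq (abs_mul _ _) |>.trans_eq
      (by rw [hs1, one_mul]) |>.trans h2
    have e1 : ∀ x y : ℝ, s * (x - y / t) * t = s * x * t - s * y := fun x y => by field_simp
    rw [le_div_iff₀ ht0] at d1 d2 ⊢
    rw [neg_mul, e1] at d2
    rw [e1] at d1
    have e2 : s * (P - R - 1 / t) * t = s * P * t - s * R * t - s := by field_simp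
    rw [e2]
    linarith
  have hmono : ∀ a b : ℝ, a ≤ b → exp (-b) ≤ exp (-a) := fun a b hab => exp_le_exp.2 (by linarith)
  obtain ⟨A₁, hA₁, h1⟩ := exists_gap_le (by linarith : 0 < 2 * E) hfd fun t ht k hk hmax => by
    have := key t ht k hk 1 (by norm_num) fun j hj => by simpa using hmax j hj
    rwa [one_mul, one_mul, ← neg_sub 1] at this
  obtain ⟨A₂, hA₂, h2⟩ := exists_gap_le (f := fun k t => -f k t) (by linarith : 0 < 2 * E)
    (fun t ht k hk => (hfd t ht k hk).neg) fun t ht k hk hmax => by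
    have ht0 : 0 < t := by linarith
    have := key t ht k hk (-1) (by norm_num) fun j hj => by simpa using exp_le_exp.2 (hmax j hj)
    rw [neg_one_mul] at this
    refine this.trans (div_le_div_of_nonneg_right ?_ ht0.le)
    have := add_one_le_exp (f k t)
    have := add_one_le_exp (-f k t)
    rw [neg_neg]
    linarith
  set A := A₁ + A₂
  have hA : ∀ᶠ t in atTop, ∀ k < K - 1, |f k t| ≤ A * t ^ (-(1 / 4) : ℝ) := by
    filter_upwards [h1, h2, eventually_gt_atTop 0] with t h1 h2 ht k hk
    have := rpow_pos_of_pos ht (-(1 / 4))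
    have := h1 k hk
    have := h2 k hk
    have := mul_pos hA₁ ‹0 < t ^ (-(1 / 4) : ℝ)›
    have := mul_pos hA₂ ‹0 < t ^ (-(1 / 4) : ℝ)›
    rw [abs_le]
    constructor <;> linarith
  have hlim := (tendsto_rpow_neg_atTop (by norm_num : (0:ℝ) < 1 / 4)).const_mul A
  rw [mul_zero] at hlim
  obtain ⟨S, hS⟩ := eventually_atTop.1 (hA.and ((hlim.eventually (ge_mem_nhds one_pos)).and
    (eventually_ge_atTop T)))
  set B := (K - 1) * A + E with hB
  have hK' : (2:ℝ) ≤ K := by exact_mod_cast hK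
  have hB0 : 0 < B := by
    have : 0 ≤ (K - 1) * A := mul_nonneg (by linarith) (by positivity)
    linarith
  obtain ⟨l, hl⟩ := exists_limit (T := S) (f := fun t => Y 0 t + (K - 1) / 2 * log t)
    (g := fun t => 4 * B * t ^ (-(1 / 4) : ℝ))
    (fun t ht => (hd t (hS t ht).2.2 0 (by omega)).add
      ((hasDerivAt_log (by linarith [(hS t ht).2.2])).const_mul _))
    (fun t ht => (hasDerivAt_rpow_quarter (by linarith [(hS t ht).2.2])).const_mul (4 * B))
    (fun t ht => mul_nonneg (by positivity) (rpow_nonneg (by linarith [(hS t ht).2.2]) _))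
    (fun t ht => by
      obtain ⟨b1, b2, b3⟩ := hS t ht
      have ht0 : 0 < t := by linarith
      have h3 := h t b3 0 (by omega)
      have h4 := b1 0 (by omega)
      have h5 := abs_exp_sub_one_le (x := -f 0 t) (by rw [abs_neg]; exact h4.trans b2)
      rw [abs_neg] at h5
      set w := t ^ (-(1 / 4) : ℝ)
      simp only [Nat.cast_zero, zero_mul, zero_div, zero_sub, zero_add, one_mul] at h3
      have e : Y' 0 t + (K - 1) / 2 * t⁻¹ = (Y' 0 t - -((K - 1) / 2 * exp (-f 0 t)) / t)
          + -((K - 1) / 2 * (exp (-f 0 t) - 1) / t) := by field_simp; ring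
      rw [e]
      refine (abs_add_le _ _).trans ((add_le_add h3 (?_ : _ ≤ (K - 1) * A * w / t)).trans_eq ?_)
      · rw [abs_neg, abs_div, abs_mul, abs_of_pos ht0, abs_of_nonneg (by linarith)]
        refine div_le_div_of_nonneg_right ?_ ht0.le
        have := mul_le_mul_of_nonneg_left (h5.trans (mul_le_mul_of_nonneg_left h4 two_pos.le))
          (by linarith : 0 ≤ ((K:ℝ) - 1) / 2)
        linarith
      · rw [hB]; ring)
  refine ⟨l, 4 * B + K * A, by positivity, eventually_atTop.2 ⟨S, fun t ht => ?_⟩⟩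
  obtain ⟨b1, b2, b3⟩ := hS t ht
  have hw : 0 ≤ t ^ (-(1 / 4) : ℝ) := rpow_nonneg (by linarith) _
  have hi : ∀ k < K, |Y k t - (k - (K - 1) / 2) * log t - ∑ j ∈ range k, L j - l|
      ≤ (4 * B + k * A) * t ^ (-(1 / 4) : ℝ) := by
    intro k
    induction k with
    | zero =>
      intro _
      have := hl t ht
      simp only [Nat.cast_zero, zero_mul, add_zero, range_zero, sum_empty, sub_zero]
      rwa [show Y 0 t - (0 - (K - 1) / 2) * log t - l = Y 0 t + (K - 1) / 2 * log t - l by ring]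
    | succ k ih =>
      intro hk
      have a1 := ih (by omega)
      have a2 := b1 k (by omega)
      rw [hf] at a2
      rw [sum_range_succ]
      push_cast
      have := abs_add_le (Y k t - (k - (K - 1) / 2) * log t - ∑ j ∈ range k, L j - l)
        (Y (k + 1) t - Y k t - log t - L k)
      rw [show Y k t - (k - (K - 1) / 2) * log t - ∑ j ∈ range k, L j - l
        + (Y (k + 1) t - Y k t - log t - L k) = Y (k + 1) t - (k + 1 - (K - 1) / 2)
        * log t - (∑ j ∈ range k, L j + L k) - l by ring] at this
      linarith
  exact fun k hk => (hi k hk).trans (mul_le_mul_of_nonneg_right (by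
    have : (k:ℝ) * A ≤ K * A := mul_le_mul_of_nonneg_right (by exact_mod_cast hk.le) (by positivity)
    linarith) hw)

lemma TF.of_comp_sub {f f' : ℝ → ℝ} {z z' : ℝ → ℝ} {T : ℝ} (hf : ∀ x, HasDerivAt f (f' x) x)
    (l : L2c f) (l' : L2c f') (hz : ∀ t, T ≤ t → HasDerivAt z (z' t) t)
    (hz' : ContinuousOn z' (Set.Ici T)) :
    TF T (fun t x => f (x - z t)) (fun t x => -z' t * f' (x - z t)) := by
  have hzc : ContinuousOn (fun q : ℝ × ℝ => q.2 - z q.1) (Set.Ioi T ×ˢ Set.univ) := fun q hq =>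
    (continuousAt_snd.sub ((hz q.1 (Set.mem_Ioi.1 hq.1).le).continuousAt.comp continuousAt_fst)
      ).continuousWithinAt
  refine ⟨l.cont.comp_continuousOn hzc, ?_, fun t ht x => ?_, fun t _ => (l.comp_sub _).int,
    fun t _ => ((l'.comp_sub (z t)).const_mul _).int, fun s t hs => ?_⟩
  · exact (hz'.comp continuousOn_fst fun q hq => (Set.mem_Ioi.1 hq.1).le).neg.mul
      (l'.cont.comp_continuousOn hzc)
  · exact ((hf (x - z t)).comp t ((hz t ht.le).const_sub x)).congr_deriv (by ring)
  · obtain ⟨B, hB⟩ := (isCompact_Icc (a := s) (b := t)).exists_bound_of_continuousOn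
      (hz'.mono fun r hr => hs.le.trans hr.1)
    have h1 := integral_sq_nonneg f
    have h2 := integral_sq_nonneg f'
    have h0 := sqrt_nonneg ((∫ x, f x ^ 2) + ∫ x, f' x ^ 2)
    have h3 : 0 ≤ B ^ 2 * ∫ x, f' x ^ 2 := by positivity
    refine ⟨√((∫ x, f x ^ 2) + ∫ x, f' x ^ 2) + (∫ x, f x ^ 2) + B ^ 2 * ∫ x, f' x ^ 2,
      fun r h4 h5 => ⟨fun x => ?_, ?_, ?_⟩⟩
    · have := abs_le_sqrt (l.sq_le l' hf (x - z r))
      linarith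
    · rw [integral_comp_sub (fun x => f x ^ 2)]
      linarith
    · simp only [mul_pow, neg_sq]
      rw [integral_const_mul, integral_comp_sub (fun x => f' x ^ 2)]
      have h6 := hB r ⟨h4, h5⟩
      rw [norm_eq_abs] at h6
      have h7 : z' r ^ 2 ≤ B ^ 2 := sq_le_sq' (abs_le.1 h6).1 (abs_le.1 h6).2
      have := mul_le_mul_of_nonneg_right h7 h2
      linarith

lemma exists_integral_mul_sub_le {p : ℝ} (hp : 2 < p) (K : ℕ) {f : ℝ → ℝ} {C : ℝ} (hC : 0 < C)
    (hf : Continuous f) (hfQ : ∀ x, |f x| ≤ C * Q p x) : ∃ N > 0, ∀ σ z q, Cfg K σ z q → ∀ a,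
      L2c a → ∀ k < K, |(∫ x, a x * f (x - z k)) - σ k * ∫ x, Q p x * f x|
        ≤ N * (q ^ (1 / 4 : ℝ) + √(∫ x, (a x - rr p K σ z x) ^ 2)) := by
  have lf : L2c f := (l2c_Q hp).of_bound hf fun x => (hfQ x).trans_eq (by rw [abs_of_pos (Q_pos hp x)])
  have hexp := integrable_exp_neg_mul_abs (show (0:ℝ) < 1 / 4 by norm_num)
  set e := ∫ x : ℝ, exp (-(1 / 4 * |x|)) with he
  have he0 : 0 ≤ e := integral_nonneg fun x => (exp_pos _).le
  have hc := cQ_pos hp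
  refine ⟨√(∫ x, f x ^ 2) + K * (C * cQ p ^ 2 * e) + 1, by positivity, fun σ z q h a la k hk => ?_⟩
  have lk := lf.comp_sub (z k)
  have lr : L2c (rr p K σ z) := l2c_rr hp
  have lQ := fun j => (l2c_Q hp).comp_sub (z j)
  have hq4 : 0 ≤ q ^ (1 / 4 : ℝ) := rpow_nonneg h.nonneg _
  have hcr : ∀ j < K, |σ j * (∫ x, Q p (x - z j) * f (x - z k))
      - if j = k then σ k * ∫ x, Q p x * f x else 0| ≤ C * cQ p ^ 2 * e * q ^ (1 / 4 : ℝ) := by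
    intro j hj
    by_cases hjk : j = k
    · rw [hjk, if_pos rfl, integral_comp_sub (fun x => Q p x * f x), sub_self, abs_zero]
      positivity
    rw [if_neg hjk, sub_zero, abs_mul, h.sgn j hj, one_mul]
    have hqq : q ^ (3 / 4 : ℝ) ≤ q ^ (1 / 4 : ℝ) := by
      rcases h.nonneg.eq_or_lt with h0 | h0
      · rw [← h0, zero_rpow (by norm_num), zero_rpow (by norm_num)]
      · exact rpow_le_rpow_of_exponent_ge h0 h.le_one (by norm_num)
    rw [← norm_eq_abs, he, ← integral_comp_sub (fun x => exp (-(1 / 4 * |x|))) (z k),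
      mul_right_comm, ← integral_const_mul]
    refine norm_integral_le_of_norm_le ((hexp.comp_sub_right (z k)).const_mul _)
      (Eventually.of_forall fun x => ?_)
    rw [norm_eq_abs, abs_mul, abs_of_pos (Q_pos hp _)]
    have h1 := Q_le hp (x - z j)
    have h2 := (hfQ (x - z k)).trans (mul_le_mul_of_nonneg_left (Q_le hp (x - z k)) hC.le)
    calc _ ≤ cQ p * exp (-|x - z j|) * (C * (cQ p * exp (-|x - z k|))) := by gcongr
      _ = C * cQ p ^ 2 * (exp (-|x - z j|) * exp (-|x - z k|)) := by ring
      _ ≤ C * cQ p ^ 2 * (q ^ (1 / 4 : ℝ) * exp (-(1 / 4 * |x - z k|))) := by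
        refine mul_le_mul_of_nonneg_left ((h.mul_exp_le hj hk hjk x).trans ?_) (by positivity)
        gcongr
      _ = _ := by ring
  have e1 : (∫ x, a x * f (x - z k)) = (∫ x, (a x - rr p K σ z x) * f (x - z k))
      + ∑ j ∈ range K, σ j * ∫ x, Q p (x - z j) * f (x - z k) := by
    simp only [← integral_const_mul]
    rw [← integral_finsetSum _ fun j _ => ((lQ j).mul_int lk).const_mul (σ j),
      ← integral_add ((la.sub lr).mul_int lk)
      (integrable_finsetSum _ fun j _ => ((lQ j).mul_int lk).const_mul (σ j))]
    refine integral_congr_ae (Eventually.of_forall fun x => ?_)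
    simp only [rr, ← mul_assoc, ← sum_mul]
    ring
  have e2 : σ k * ∫ x, Q p x * f x
      = ∑ j ∈ range K, if j = k then σ k * ∫ x, Q p x * f x else 0 := by
    rw [sum_ite_eq' (range K) k, if_pos (mem_range.2 hk)]
  rw [e1, e2, add_sub_assoc, ← sum_sub_distrib]
  refine (abs_add_le _ _).trans ?_
  have b1 := (la.sub lr).abs_integral_mul_le lk
  rw [integral_comp_sub (fun x => f x ^ 2)] at b1
  have b2 := (abs_sum_le_sum_abs _ _).trans (sum_le_sum fun j hj => hcr j (mem_range.1 hj))
  rw [sum_const, card_range, nsmul_eq_mul] at b2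
  have s0 := sqrt_nonneg (∫ x, (a x - rr p K σ z x) ^ 2)
  have s1 := sqrt_nonneg (∫ x, f x ^ 2)
  refine (add_le_add b1 b2).trans (sub_nonneg.1 ?_)
  have : 0 ≤ √(∫ x, f x ^ 2) * q ^ (1 / 4 : ℝ) + K * (C * cQ p ^ 2 * e)
    * √(∫ x, (a x - rr p K σ z x) ^ 2) + (q ^ (1 / 4 : ℝ)
    + √(∫ x, (a x - rr p K σ z x) ^ 2)) := by positivity
  refine this.trans_eq ?_
  ring

section
variable {p α : ℝ} {u : ℝ × ℝ → ℝ} {T M C c : ℝ} {K : ℕ} {σ : ℕ → ℝ} {z z' : ℝ → ℕ → ℝ} {H : ℝ → ℝ}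

lemma Track.hasDerivAt_pairing (S : Sol p α u) (hp : 2 < p) (W : Track p u T M C c K σ z z' H)
    {k : ℕ} (hk : k < K) {t : ℝ} (ht : T < t) :
    HasDerivAt (fun t => ∫ x, (ut u t x + 2 * α * U u t x) * Q1 p (x - z t k))
      (force p (U u t) (z t k) - z' t k * ∫ x, (ut u t x + 2 * α * U u t x) * Q2 p (x - z t k)) t := by
  have hz := fun t ht => W.deriv t ht k hk
  have hz' := W.deriv_cont k hk
  have hT : 0 ≤ T := by linarith [W.two_le]
  have tQ1 : TF T _ _ := TF.of_comp_sub (hasDerivAt_Q1 hp) (l2c_Q1 hp) (l2c_Q2 hp) hz hz'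
  have tQ2 : TF T _ _ := TF.of_comp_sub (hasDerivAt_Q2 hp) (l2c_Q2 hp)
    ((l2c_Q1 hp).sub (l2c_dnl_mul_Q1 hp)) hz hz'
  have ta := (S.tut.add (S.tu.const_mul (2 * α))).mono hT
  have hf : ∀ t, T < t → force p (U u t) (z t k) = -(∫ x, ux u t x * Q2 p (x - z t k))
      - (∫ x, U u t x * Q1 p (x - z t k)) + ∫ x, nl p (U u t x) * Q1 p (x - z t k) := fun t ht => by
    have h0 : 0 < t := hT.trans_lt ht
    obtain ⟨B, hB⟩ := S.tu.bd t t h0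
    have h1 := integral_mul_Q1 hp (S.tu.l2 h0) (S.tux.l2 h0) (S.l2uxx t h0) (S.dx t h0)
      (S.dxx t h0) (z t k)
    have h2 := (S.tux.l2 h0).ibp (S.l2uxx t h0) (tQ1.l2 ht) (tQ2.l2 ht) (S.dxx t h0)
      (hasDerivAt_Q1_sub hp (z t k))
    rw [force_eq_sub hp (S.tu.l2 h0) (hB t le_rfl le_rfl).1]
    linarith
  refine ta.hasDerivAt_integral_mul tQ1 (φ := fun t => force p (U u t) (z t k)
    - z' t k * ∫ x, (ut u t x + 2 * α * U u t x) * Q2 p (x - z t k)) ?_ (fun t ht => ?_) ht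
  · refine ContinuousOn.sub (ContinuousOn.congr (((S.tux.mono hT).continuousOn_integral_mul tQ2).neg.sub
      ((S.tu.mono hT).continuousOn_integral_mul tQ1) |>.add
      (((S.tf_nl hp).mono hT).continuousOn_integral_mul tQ1)) hf)
      ((hz'.mono Set.Ioi_subset_Ici_self).mul (ta.continuousOn_integral_mul tQ2))
  · have h0 : 0 < t := hT.trans_lt ht
    have l1 := tQ1.l2 ht
    have e : ∫ x, (utt u t x + 2 * α * ut u t x) * Q1 p (x - z t k)
        = (∫ x, uxx u t x * Q1 p (x - z t k)) - (∫ x, U u t x * Q1 p (x - z t k))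
          + ∫ x, nl p (U u t x) * Q1 p (x - z t k) := by
      have k1 : ∫ x, (uxx u t x - U u t x) * Q1 p (x - z t k)
          = (∫ x, uxx u t x * Q1 p (x - z t k)) - ∫ x, U u t x * Q1 p (x - z t k) := by
        simp only [sub_mul]
        exact integral_sub ((S.l2uxx t h0).mul_int l1) ((S.tu.l2 h0).mul_int l1)
      rw [← k1, ← integral_add (((S.l2uxx t h0).sub (S.tu.l2 h0)).mul_int l1)
        (((S.tf_nl hp).l2 h0).mul_int l1)]
      refine integral_congr_ae (Eventually.of_forall fun x => ?_)
      simp only [S.eq t h0]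
      ring
    have h2 := (S.tux.l2 h0).ibp (S.l2uxx t h0) l1 (tQ2.l2 ht) (S.dxx t h0)
      (hasDerivAt_Q1_sub hp (z t k))
    have e2 : ∫ x, (ut u t x + 2 * α * U u t x) * (-z' t k * Q2 p (x - z t k))
        = -z' t k * ∫ x, (ut u t x + 2 * α * U u t x) * Q2 p (x - z t k) := by
      rw [← integral_const_mul]
      congr 1; ext x; ring
    rw [e, e2, hf t ht, h2]
    ring

end

section

variable {p α : ℝ} {u : ℝ × ℝ → ℝ} {T M C c : ℝ} {K : ℕ} {σ : ℕ → ℝ} {z z' : ℝ → ℕ → ℝ} {H : ℝ → ℝ}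

lemma Track.exists_modulation (S : Sol p α u) (hp : 2 < p) (hα : 0 < α)
    (W : Track p u T M C c K σ z z' H) (hK : 2 ≤ K) :
    ∃ Y Y' : ℕ → ℝ → ℝ, ∃ N > 0, ∃ E > 0, ∃ T₁ ≥ T, ∀ t, T₁ ≤ t → dd p u t ≤ N / t ^ 2 ∧
      qq K (z t) ≤ N / t ∧
      ∀ k < K, HasDerivAt (Y k) (Y' k t) t ∧ |Y k t - z t k| ≤ E * t ^ (-(1 / 4) : ℝ) ∧
        |Y' k t + κ p / (2 * α) * (σ k * gg K σ (z t) k)| ≤ E * t ^ (-(1 / 4) : ℝ) / t := by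
  obtain ⟨G, hG, T', hT', hdd⟩ := W.exists_dd_le S hp hK
  obtain ⟨D, hD, hF⟩ := exists_force_le hp K |M|
  obtain ⟨A, hA, hA2⟩ := exists_abs_Q2_le hp
  have hC := W.C_pos
  have hc := c₁_pos hp
  set n := C * √G with hn
  have hn0 : 0 < n := by positivity
  have h2 := W.two_le
  have hs : ∀ t, T' ≤ t → √(dd p u t) ≤ √G / t := fun t ht => by
    refine (sqrt_le_sqrt (hdd t ht)).trans_eq ?_
    rw [sqrt_div' _ (sq_nonneg _), sqrt_sq (by linarith)]
  have hCs : ∀ t, T' ≤ t → C * √(dd p u t) ≤ n / t := fun t ht => by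
    rw [hn, mul_div_assoc]
    exact mul_le_mul_of_nonneg_left (hs t ht) hC.le
  have hq : ∀ t, T' ≤ t → qq K (z t) ≤ n / t := fun t ht =>
    (W.fit t (hT'.trans ht)).qq_le.trans (hCs t ht)
  have hsub : ∀ t, T' ≤ t → ∫ x, (U u t x - rr p K σ (z t) x) ^ 2 ≤ (n / t) ^ 2 := fun t ht =>
    (W.fit t (hT'.trans ht)).sub_le.trans (pow_le_pow_left₀ (by positivity) (hCs t ht) 2)
  have hw1 : ∀ t, T' ≤ t → 1 / t ≤ t ^ (-(1 / 4) : ℝ) := fun t ht => by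
    rw [one_div, ← rpow_neg_one]
    exact rpow_le_rpow_of_exponent_le (by linarith) (by norm_num)
  have hpw : ∀ t, T' ≤ t → (n / t) ^ (1 / 4 : ℝ) = n ^ (1 / 4 : ℝ) * t ^ (-(1 / 4) : ℝ) :=
    fun t ht => by
      have : 0 < t := by linarith
      rw [div_rpow hn0.le this.le, rpow_neg this.le, div_eq_mul_inv]
  have key : ∀ f : ℝ → ℝ, Continuous f → ∀ B > 0, (∀ x, |f x| ≤ B * Q p x) → ∃ N > 0, ∀ t, T' ≤ t →
      ∀ k < K, |(∫ x, (ut u t x + 2 * α * U u t x) * f (x - z t k))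
        - 2 * α * (σ k * ∫ x, Q p x * f x)| ≤ N * t ^ (-(1 / 4) : ℝ) := by
    intro f hf B hB hfQ
    obtain ⟨N, hN, h⟩ := exists_integral_mul_sub_le hp K hB hf hfQ
    have lf : L2c f := (l2c_Q hp).of_bound hf fun x =>
      (hfQ x).trans_eq (by rw [abs_of_pos (Q_pos hp x)])
    refine ⟨√G * √(∫ x, f x ^ 2) + 2 * α * (N * (n ^ (1 / 4 : ℝ) + n)), by positivity,
      fun t ht k hk => ?_⟩
    have h0 : 0 < t := by linarith
    have lk := lf.comp_sub (z t k)
    have e : ∫ x, (ut u t x + 2 * α * U u t x) * f (x - z t k)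
        = (∫ x, ut u t x * f (x - z t k)) + 2 * α * ∫ x, U u t x * f (x - z t k) := by
      rw [← integral_const_mul, ← integral_add ((S.tut.l2 h0).mul_int lk)
        (((S.tu.l2 h0).mul_int lk).const_mul _)]
      congr 1; ext x; ring
    have h1 := h σ (z t) _ (W.fit t (hT'.trans ht)).cfg _ (S.tu.l2 h0) k hk
    have h2 := (S.tut.l2 h0).abs_integral_mul_le lk
    rw [integral_comp_sub (fun x => f x ^ 2)] at h2
    have h3 : √(∫ x, ut u t x ^ 2) ≤ √G * t ^ (-(1 / 4) : ℝ) := by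
      refine (sqrt_le_sqrt (?_ : _ ≤ dd p u t)).trans ((hs t ht).trans ?_)
      · have := integral_sq_nonneg (ww p u t)
        have := integral_sq_nonneg (wwx p u t)
        unfold dd
        linarith
      · rw [div_eq_mul_one_div]
        exact mul_le_mul_of_nonneg_left (hw1 t ht) (sqrt_nonneg _)
    have h4 : √(∫ x, (U u t x - rr p K σ (z t) x) ^ 2) ≤ n * t ^ (-(1 / 4) : ℝ) := by
      refine (sqrt_le_left (by positivity)).2 (hsub t ht) |>.trans ?_
      rw [div_eq_mul_one_div]
      exact mul_le_mul_of_nonneg_left (hw1 t ht) hn0.le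
    have h5 : qq K (z t) ^ (1 / 4 : ℝ) ≤ n ^ (1 / 4 : ℝ) * t ^ (-(1 / 4) : ℝ) :=
      (rpow_le_rpow (qq_nonneg _ _) (hq t ht) (by norm_num)).trans_eq (hpw t ht)
    rw [e, add_sub_assoc, ← mul_sub]
    refine (abs_add_le _ _).trans ?_
    rw [abs_mul (2 * α), abs_of_pos (show 0 < 2 * α by positivity), add_mul]
    refine add_le_add (h2.trans ?_) ?_
    · rw [mul_right_comm]
      exact mul_le_mul_of_nonneg_right h3 (sqrt_nonneg _)
    · rw [mul_assoc (2 * α), mul_assoc N, add_mul]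
      exact mul_le_mul_of_nonneg_left (h1.trans (mul_le_mul_of_nonneg_left (add_le_add h5 h4) hN.le))
        (by positivity)
  obtain ⟨N₁, hN₁, h₁⟩ := key _ (continuous_Q1 hp) 1 one_pos fun x => by
    rw [one_mul]; exact abs_Q1_le hp x
  obtain ⟨N₂, hN₂, h₂⟩ := key _ (continuous_Q2 hp) A hA hA2
  have i0 : ∫ x, Q p x * Q1 p x = 0 := by
    have := (l2c_Q hp).ibp (l2c_Q1 hp) (l2c_Q hp) (l2c_Q1 hp) (hasDerivAt_Q hp) (hasDerivAt_Q hp)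
    simp only [mul_comm (Q1 p _)] at this
    linarith
  have i1 : ∫ x, Q p x * Q2 p x = -c₁ p := by
    rw [(l2c_Q hp).ibp (l2c_Q1 hp) (l2c_Q1 hp) (l2c_Q2 hp) (hasDerivAt_Q hp) (hasDerivAt_Q1 hp)]
    simp only [c₁, deriv_Q hp, sq]
  rw [i0] at h₁
  rw [i1] at h₂
  set m := 2 * α * c₁ p with hm
  have hm0 : 0 < m := by positivity
  refine ⟨fun k t => z t k - σ k * (∫ x, (ut u t x + 2 * α * U u t x) * Q1 p (x - z t k)) / m, _,
    max G n, lt_max_of_lt_left hG, N₁ / m + (D * (n ^ (5 / 4 : ℝ) + n ^ 2) + n * N₂) / m,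
    by positivity, T' + 1, by linarith,
    fun t ht => ⟨(hdd t (by linarith)).trans (by gcongr; exact le_max_left _ _), (hq t (by linarith)).trans ?_, fun k hk =>
      ⟨(W.deriv t (by linarith) k hk).sub
        (((W.hasDerivAt_pairing S hp hk (by linarith)).const_mul (σ k)).div_const m), ?_, ?_⟩⟩⟩
  · have : 0 < t := by linarith
    gcongr
    exact le_max_right _ _
  all_goals
    have htT : T' ≤ t := by linarith
    have h0 : 0 < t := by linarith
    have hsg := (W.fit t (by linarith)).cfg.sgn k hk
    have hw0 : 0 ≤ t ^ (-(1 / 4) : ℝ) := rpow_nonneg h0.le _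
  · have := h₁ t htT k hk
    rw [mul_zero, mul_zero, sub_zero] at this
    rw [sub_sub_cancel_left, abs_neg, abs_div, abs_mul, hsg, one_mul, abs_of_pos hm0, add_mul,
      div_mul_eq_mul_div]
    refine le_add_of_le_of_nonneg (by gcongr) (by positivity)
  · have b1 := hF σ (z t) _ (W.fit t (by linarith)).cfg (W.fit t (by linarith)).lt _ (S.tu.l2 h0)
      (fun x => sq_le_sq.1 ((S.sq_le_nrm h0 x).trans (W.nrm_le t (by linarith)))) k hk
    have b2 := h₂ t htT k hk
    have b3 := (W.deriv_le t (by linarith) k hk).trans (hCs t htT)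
    set J := ∫ x, (ut u t x + 2 * α * U u t x) * Q2 p (x - z t k)
    set F := force p (U u t) (z t k)
    have hσ : σ k * σ k = 1 := by rw [← sq, ← sq_abs, hsg, one_pow]
    have e : z' t k - σ k * (F - z' t k * J) / m + κ p / (2 * α) * (σ k * gg K σ (z t) k)
        = (z' t k * (σ k * (J - 2 * α * (σ k * -c₁ p)))
          - σ k * (F - κ p * c₁ p * gg K σ (z t) k)) / m := by
      rw [hm]
      field_simp
      linear_combination (-(2 * α * c₁ p * z' t k)) * hσ
    rw [e, abs_div, abs_of_pos hm0, mul_div_assoc, add_mul]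
    refine le_add_of_nonneg_of_le (by positivity) ?_
    rw [div_mul_eq_mul_div]
    refine div_le_div_of_nonneg_right ((abs_sub _ _).trans ?_) hm0.le
    rw [abs_mul, abs_mul (σ k), abs_mul (σ k), hsg, one_mul, one_mul, add_comm, add_mul]
    refine add_le_add (b1.trans ?_) ?_
    · rw [mul_assoc]
      refine mul_le_mul_of_nonneg_left ?_ hD.le
      rw [add_mul]
      refine add_le_add ?_ ((hsub t htT).trans ?_)
      · refine (rpow_le_rpow (qq_nonneg _ _) (hq t htT) (by norm_num)).trans_eq ?_
        rw [show (5 / 4 : ℝ) = 1 + 1 / 4 by norm_num, rpow_add (by positivity),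
          rpow_add hn0, hpw t htT, rpow_one, rpow_one]
        ring
      · rw [div_pow, div_eq_mul_one_div, sq t, ← div_div]
        have := hw1 t htT
        gcongr
    · refine (mul_le_mul b3 b2 (abs_nonneg _) (by positivity)).trans_eq ?_
      ring

end

lemma abs_exp_sub_one_le (x : ℝ) : |exp x - 1| ≤ |x| * exp |x| := by
  have h1 := add_one_le_exp x
  have h2 := add_one_le_exp (-x)
  have h3 : exp (-x) * exp x = 1 := by rw [← exp_add]; simp
  rcases le_total 0 x with h | h
  · rw [abs_of_nonneg h, abs_of_nonneg (by linarith)]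
    nlinarith [exp_pos x]
  · have h4 : 1 ≤ exp |x| := one_le_exp (abs_nonneg x)
    rw [abs_of_nonpos (by linarith [exp_le_one_iff.2 h])]
    nlinarith [neg_abs_le x, abs_nonneg x]

section
variable {p α : ℝ} {u : ℝ × ℝ → ℝ} {T M C c : ℝ} {K : ℕ} {σ : ℕ → ℝ} {z z' : ℝ → ℕ → ℝ} {H : ℝ → ℝ}

/-- Neighbouring solitary waves which survive for all times have opposite signs. -/
lemma alternating_of_drift {Y Y' : ℕ → ℝ → ℝ} {N E β : ℝ} (hT : 1 ≤ T) (hE : 0 < E) (hβ : 0 < β)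
    (hσ : ∀ k < K, |σ k| = 1) (hz : ∀ t, T ≤ t → ∀ j k, j < k → k < K → z t j < z t k)
    (h : ∀ t, T ≤ t → qq K (z t) ≤ N / t ∧
      ∀ k < K, HasDerivAt (Y k) (Y' k t) t ∧ |Y k t - z t k| ≤ E * t ^ (-(1 / 4) : ℝ) ∧
        |Y' k t + β * (σ k * gg K σ (z t) k)| ≤ E * t ^ (-(1 / 4) : ℝ) / t) (i : ℕ)
    (hi : i + 1 < K) : σ i * σ (i + 1) = -1 := by
  have hs : ∀ k, k + 1 < K → σ k * σ (k + 1) = 1 ∨ σ k * σ (k + 1) = -1 := fun k hk =>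
    (abs_eq zero_le_one).1 (by rw [abs_mul, hσ k (by omega), hσ (k + 1) hk, one_mul])
  have hs' : ∀ k, k + 1 < K → σ (k + 1) * σ k = σ k * σ (k + 1) := fun _ _ => mul_comm _ _
  induction i using Nat.strong_induction_on with
  | _ i ih =>
    by_contra hne
    have hi1 := (hs i hi).resolve_right hne
    have hex : ∃ j, i < j ∧ (j + 1 < K → σ j * σ (j + 1) = -1) := ⟨K, by omega, fun h => by omega⟩
    classical
    obtain ⟨hij, hj⟩ := Nat.find_spec hex
    have hmin := fun m (hm : m < Nat.find hex) => Nat.find_min hex hm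
    set j := Nat.find hex
    have hjK : j < K := by
      by_contra hjK
      exact hmin (K - 1) (by omega) ⟨by omega, fun h => by omega⟩
    obtain ⟨m, hm⟩ : ∃ m, j = m + 1 := ⟨j - 1, by omega⟩
    have hm1 : σ m * σ (m + 1) = 1 := by
      rcases (show i ≤ m by omega).eq_or_lt with rfl | him
      · exact hi1
      · have := hmin m (by omega)
        push Not at this
        obtain ⟨h1, h2⟩ := this him
        exact (hs m h1).resolve_right h2
    have hx := fun (t : ℝ) k => (exp_pos (-(z t (k + 1) - z t k))).le
    have gj : ∀ t, 0 ≤ σ j * gg K σ (z t) j := fun t => by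
      have e : σ j * gg K σ (z t) j = σ m * σ (m + 1) * exp (-(z t (m + 1) - z t m))
          - if j + 1 < K then σ j * σ (j + 1) * exp (-(z t (j + 1) - z t j)) else 0 := by
        rw [gg, if_pos (by omega), mul_sub, mul_ite, mul_zero, mul_assoc (σ j), hm,
          Nat.add_sub_cancel]
        ring
      rw [e, hm1]
      have := hx t m
      have := hx t j
      split_ifs with h
      · rw [hj h]; linarith
      · linarith
    have gi : ∀ t, σ i * gg K σ (z t) i ≤ 0 := fun t => by
      rw [gg, if_pos hi, mul_sub, ← mul_assoc (σ i), hi1]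
      have := hx t i
      split_ifs with h
      · have h1 := ih (i - 1) (by omega) (by omega)
        have h2 := hx t (i - 1)
        rw [Nat.sub_add_cancel h] at h1 h2
        rw [← mul_assoc, mul_comm (σ i), h1]
        linarith
      · linarith
    have hmono : ∀ t, T ≤ t → Y j t - Y i t + 8 * E * t ^ (-(1 / 4) : ℝ)
        ≤ Y j T - Y i T + 8 * E * T ^ (-(1 / 4) : ℝ) := fun t ht => by
      refine neg_le_neg_iff.1 (mono_of_hasDerivAt_Icc
        (g := fun t => -(Y j t - Y i t + 8 * E * t ^ (-(1 / 4) : ℝ))) ht (fun r hr _ =>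
        (((((h r hr).2 j hjK).1.sub ((h r hr).2 i (by omega)).1).add
        ((hasDerivAt_rpow_quarter (by linarith : 0 < r)).const_mul (8 * E)))).neg) fun r hr _ => ?_)
      have h1 := (abs_le.1 ((h r hr).2 j hjK).2.2).2
      have h2 := (abs_le.1 ((h r hr).2 i (by omega)).2.2).1
      have h3 := mul_nonneg hβ.le (gj r)
      have h4 := mul_nonneg hβ.le (neg_nonneg.2 (gi r))
      rw [mul_div_assoc] at h1 h2
      linarith
    have hle : ∀ t, T ≤ t → exp (-(Y j T - Y i T + 8 * E + 2 * E)) ≤ N / t := fun t ht => by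
      refine le_trans (exp_le_exp.2 ?_) ((exp_le_qq hi).trans (h t ht).1)
      have h1 := hmono t ht
      have h2 := (abs_le.1 ((h t ht).2 j hjK).2.1).1
      have h3 := (abs_le.1 ((h t ht).2 i (by omega)).2.1).2
      have h4 := le_of_sorted (hz t ht) (show i + 1 ≤ j by omega) hjK
      have h5 : ∀ r : ℝ, T ≤ r → 0 ≤ r ^ (-(1 / 4) : ℝ) ∧ E * r ^ (-(1 / 4) : ℝ) ≤ E := fun r hr =>
        ⟨rpow_nonneg (by linarith) _, mul_le_of_le_one_right hE.le
          (rpow_le_one_of_one_le_of_nonpos (by linarith) (by norm_num))⟩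
      have h6 := mul_nonneg hE.le (h5 t ht).1
      linarith [(h5 t ht).2, (h5 T le_rfl).2]
    set d := exp (-(Y j T - Y i T + 8 * E + 2 * E)) with hd
    have hd0 : 0 < d := exp_pos _
    have h1 := hle (T + |N| / d) (by linarith [show 0 ≤ |N| / d by positivity])
    rw [le_div_iff₀ (by positivity), mul_add, mul_div_cancel₀ _ hd0.ne'] at h1
    nlinarith [le_abs_self N]

lemma Track.exists_asymp (S : Sol p α u) (hp : 2 < p) (hα : 0 < α)
    (W : Track p u T M C c K σ z z' H) (hK : 2 ≤ K) :
    (∀ i, i + 1 < K → σ i * σ (i + 1) = -1) ∧ ∃ L : ℕ → ℝ, (∀ k : ℕ, k + 1 < K →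
      exp (-L k) = 2 * α / κ p * (((k : ℝ) + 1) * (K - ((k : ℝ) + 1)) / 2)) ∧
      ∃ N > 0, ∃ l, ∃ A > 0, ∀ᶠ t in atTop, dd p u t ≤ N / t ^ 2 ∧ ∀ k < K,
        |z t k - (k - (K - 1) / 2) * log t - ∑ j ∈ range k, L j - l| ≤ A * t ^ (-(1 / 4) : ℝ) := by
  obtain ⟨Y, Y', N, hN, E, hE, T₁, hT₁, h⟩ := W.exists_modulation S hp hα hK
  have hT1 : 1 ≤ T₁ := by linarith [W.two_le]
  have hκ := κ_pos hp
  set β := κ p / (2 * α) with hβ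
  have hβ0 : 0 < β := by positivity
  have halt := alternating_of_drift (K := K) (σ := σ) (z := z) hT1 hE hβ0
    (W.fit T le_rfl).cfg.sgn (fun t ht => (W.fit t (hT₁.trans ht)).lt)
    (fun t ht => (h t ht).2)
  set γ : ℕ → ℝ := fun k => ((k : ℝ) + 1) * (K - ((k : ℝ) + 1)) / 2 with hγ
  have hL : ∀ k : ℕ, k + 1 < K → exp (- -log (2 * α / κ p * γ k))
      = 2 * α / κ p * γ k := fun k hk => by
    have : (k : ℝ) + 1 < K := by exact_mod_cast hk
    rw [neg_neg, exp_log]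
    have : 0 < (K : ℝ) - (k + 1) := by linarith
    positivity
  set L : ℕ → ℝ := fun k => -log (2 * α / κ p * γ k) with hLdef
  set f : ℕ → ℝ → ℝ := fun k t => Y (k + 1) t - Y k t - log t - L k with hf
  have hβγ : ∀ k, k + 1 < K → ∀ t, T₁ ≤ t → γ k * exp (-f k t) / t
      = β * exp (-(Y (k + 1) t - Y k t)) := fun k hk t ht => by
    have ht0 : 0 < t := by linarith
    have e : exp (-f k t) * exp (-L k) = exp (-(Y (k + 1) t - Y k t)) * t := by
      rw [← exp_add, show -f k t + -L k = -(Y (k + 1) t - Y k t) + log t by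
        simp only [hf]; ring, exp_add, exp_log ht0]
    rw [show exp (-L k) = _ from hL k hk] at e
    rw [div_eq_iff ht0.ne', mul_assoc, ← e, hβ]
    field_simp
  set B := β * (N * (2 * E * exp (2 * E))) with hB
  have hB0 : 0 < B := by positivity
  have hcmp : ∀ k, k + 1 < K → ∀ t, T₁ ≤ t → |γ k * exp (-f k t) / t
      - β * exp (-(z t (k + 1) - z t k))| ≤ B * t ^ (-(1 / 4) : ℝ) / t := fun k hk t ht => by
    have ht0 : 0 < t := by linarith
    obtain ⟨_, hq, h3⟩ := h t ht
    have h1 := (h3 k (by omega)).2.1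
    have h2 := (h3 (k + 1) hk).2.1
    have hw0 : 0 ≤ t ^ (-(1 / 4) : ℝ) := rpow_nonneg ht0.le _
    have hw1 : t ^ (-(1 / 4) : ℝ) ≤ 1 := rpow_le_one_of_one_le_of_nonpos (by linarith) (by norm_num)
    set w := t ^ (-(1 / 4) : ℝ)
    set δ := (Y k t - z t k) - (Y (k + 1) t - z t (k + 1)) with hδ
    have hδw : |δ| ≤ 2 * E * w := (abs_sub _ _).trans (by linarith)
    have hδ1 : |δ| ≤ 2 * E := hδw.trans (mul_le_of_le_one_right (by positivity) hw1)
    have e : exp (-(Y (k + 1) t - Y k t)) = exp (-(z t (k + 1) - z t k)) * exp δ := by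
      rw [← exp_add]; congr 1; rw [hδ]; ring
    rw [hβγ k hk t ht, e, ← mul_sub, abs_mul, abs_of_pos hβ0, ← mul_sub_one, abs_mul,
      abs_of_pos (exp_pos _)]
    calc _ ≤ β * (N / t * (2 * E * w * exp (2 * E))) := by
          refine mul_le_mul_of_nonneg_left (mul_le_mul ((exp_le_qq hk).trans hq)
            ((abs_exp_sub_one_le δ).trans ?_) (abs_nonneg _) (by positivity)) hβ0.le
          gcongr
      _ = _ := by rw [hB]; ring
  obtain ⟨l, A, hA, hlim⟩ := exists_toda_limit (Y := Y) (Y' := Y') (f := f) (L := L)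
    (T := T₁) (E := E + 2 * B) hK hT1 (by positivity) (fun _ _ => rfl)
    (fun t ht k hk => ((h t ht).2.2 k hk).1) fun t ht k hk => by
      have ht0 : 0 < t := by linarith
      have hw0 : 0 ≤ B * t ^ (-(1 / 4) : ℝ) / t := by positivity
      have hgg : ∀ i, i + 1 < K → σ (i + 1) * σ i = -1 := fun i hi => mul_comm (σ i) _ ▸ halt i hi
      have e : σ k * gg K σ (z t) k = (if k + 1 < K then exp (-(z t (k + 1) - z t k)) else 0)
            - if 0 < k then exp (-(z t k - z t (k - 1))) else 0 := by
        rw [gg, mul_sub, mul_ite, mul_ite, mul_zero, ← mul_assoc, ← mul_assoc]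
        have h1 : 0 < k → σ k * σ (k - 1) = -1 := fun h0 => by
          have := hgg (k - 1) (by omega)
          rwa [Nat.sub_add_cancel h0] at this
        split_ifs with a b b
        · rw [h1 a, halt k b]; ring
        · rw [h1 a]; ring
        · rw [halt k b]; ring
        · ring
      have c1 : |(k:ℝ) * (K - k) / 2 * exp (-f (k - 1) t) / t
          - β * if 0 < k then exp (-(z t k - z t (k - 1))) else 0|
          ≤ B * t ^ (-(1 / 4) : ℝ) / t := by
        split_ifs with h0
        · have := hcmp (k - 1) (by omega) t ht
          rw [Nat.sub_add_cancel h0] at this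
          simp only [hγ, Nat.cast_pred h0, sub_add_cancel] at this
          exact this
        · obtain rfl : k = 0 := by omega
          simpa using hw0
      have c2 : |((k:ℝ) + 1) * (K - (k + 1)) / 2 * exp (-f k t) / t
          - β * if k + 1 < K then exp (-(z t (k + 1) - z t k)) else 0|
          ≤ B * t ^ (-(1 / 4) : ℝ) / t := by
        split_ifs with h0
        · exact hcmp k h0 t ht
        · have : (K : ℝ) = k + 1 := by exact_mod_cast (by omega : K = k + 1)
          rw [this]
          simpa using hw0
      have c3 := ((h t ht).2.2 k hk).2.2
      rw [e, mul_sub] at c3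
      rw [sub_div, show (E + 2 * B) * t ^ (-(1 / 4) : ℝ) / t = E * t ^ (-(1 / 4) : ℝ) / t
        + 2 * (B * t ^ (-(1 / 4) : ℝ) / t) by ring]
      rw [abs_le] at *
      constructor <;> linarith [c1.1, c1.2, c2.1, c2.2, c3.1, c3.2]
  refine ⟨halt, L, hL, N, hN, l, A + E, by positivity, ?_⟩
  filter_upwards [hlim, eventually_ge_atTop T₁] with t h1 ht
  refine ⟨(h t ht).1, fun k hk => ?_⟩
  have h2 := h1 k hk
  have h3 := ((h t ht).2.2 k hk).2.1
  rw [add_mul]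
  rw [abs_le] at *
  constructor <;> linarith [h2.1, h2.2, h3.1, h3.2]

end

section

variable {p α T M C c : ℝ} {u : ℝ × ℝ → ℝ} {K : ℕ} {σ : ℕ → ℝ} {z z' : ℝ → ℕ → ℝ} {H : ℝ → ℝ}

/-- The squared distance in the energy space to a sum of solitary waves. -/
noncomputable def er (p : ℝ) (u : ℝ × ℝ → ℝ) (K : ℕ) (σ w : ℕ → ℝ) (t : ℝ) : ℝ :=
  (∫ x, (ux u t x - rrx p K σ w x) ^ 2) + (∫ x, (U u t x - rr p K σ w x) ^ 2) + ∫ x, ut u t x ^ 2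

lemma Sol.er_integrand (S : Sol p α u) (hp : 2 < p) {t : ℝ} (ht : 0 < t) (w : ℕ → ℝ) :
    (fun x => deriv (fun y => u (t, y) - rr p K σ w y) x ^ 2 + (u (t, x) - rr p K σ w x) ^ 2)
      = fun x => (ux u t x - rrx p K σ w x) ^ 2 + (U u t x - rr p K σ w x) ^ 2 := by
  ext x
  rw [show deriv (fun y => u (t, y) - rr p K σ w y) x = _ from
    ((S.dx t ht x).sub (hasDerivAt_rr hp x)).deriv]
  rfl

lemma Sol.er_eq (S : Sol p α u) (hp : 2 < p) {t : ℝ} (ht : 0 < t) (w : ℕ → ℝ) :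
    (∫ x, (deriv (fun y => u (t, y) - rr p K σ w y) x ^ 2 + (u (t, x) - rr p K σ w x) ^ 2))
      + (∫ x, ut u t x ^ 2) = er p u K σ w t := by
  rw [S.er_integrand hp ht, integral_add ((S.tux.l2 ht).sub (l2c_rrx hp)).int
    ((S.tu.l2 ht).sub (l2c_rr hp)).int, er]

lemma Sol.er_eq' (S : Sol p α u) (hp : 2 < p) {t : ℝ} (ht : 0 < t) (w : ℕ → ℝ) :
    (∫ x, (deriv (fun y => u (t, y) - rr p K σ w y) x ^ 2 + (u (t, x) - rr p K σ w x) ^ 2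
      + ut u t x ^ 2)) = er p u K σ w t := by
  rw [← S.er_eq hp ht, integral_add _ (S.tut.l2 ht).int]
  rw [S.er_integrand hp ht]
  exact ((S.tux.l2 ht).sub (l2c_rrx hp)).int.add ((S.tu.l2 ht).sub (l2c_rr hp)).int

lemma Sol.exists_er_le (S : Sol p α u) (hp : 2 < p) (hσ : ∀ k < K, |σ k| = 1) :
    ∃ D, ∀ t, 0 < t → ∀ w, er p u K σ w t ≤ 2 * nrm u t + D := by
  have key : ∀ f : ℝ → ℝ, L2c f → ∀ w : ℕ → ℝ,
      ∫ x, (∑ k ∈ range K, σ k * f (x - w k)) ^ 2 ≤ K * (K * ∫ x, f x ^ 2) :=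
    fun f hf w => by
      refine (L2c.integral_sum_sq_le _ fun k _ => (hf.comp_sub (w k)).const_mul (σ k)).trans_eq ?_
      rw [card_range, sum_congr rfl (g := fun _ => ∫ x, f x ^ 2), sum_const,
        card_range, nsmul_eq_mul]
      intro k hk
      simp only [mul_pow, ← sq_abs (σ k), hσ k (mem_range.1 hk), one_pow, one_mul]
      exact integral_comp_sub (fun x => f x ^ 2) (w k)
  refine ⟨2 * (K * (K * ∫ x, Q1 p x ^ 2)) + 2 * (K * (K * ∫ x, Q p x ^ 2)), fun t ht w => ?_⟩
  have h1 := (S.tux.l2 ht).integral_sub_sq_le (l2c_rrx (K := K) (σ := σ) (z := w) hp)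
  have h2 := (S.tu.l2 ht).integral_sub_sq_le (l2c_rr (K := K) (σ := σ) (z := w) hp)
  have h3 : ∫ x, rrx p K σ w x ^ 2 ≤ _ := key _ (l2c_Q1 hp) w
  have h4 : ∫ x, rr p K σ w x ^ 2 ≤ _ := key _ (l2c_Q hp) w
  have := integral_sq_nonneg (ut u t)
  rw [er, nrm]
  linarith

lemma Track.exists_er_le (S : Sol p α u) (hp : 2 < p) (W : Track p u T M C c K σ z z' H) :
    ∃ A > 0, ∀ t, T ≤ t → ∀ w δ, δ ≤ 1 → (∀ k < K, |z t k - w k| ≤ δ) →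
      er p u K σ w t ≤ A * (dd p u t + δ ^ 2) := by
  obtain ⟨A, hA, h⟩ := exists_rr_sub_le hp K
  refine ⟨1 + 4 * C ^ 2 + 4 * A, by positivity, fun t ht w δ hδ hw => ?_⟩
  have ht0 : 0 < t := by linarith [W.two_le]
  have hf := W.fit t ht
  obtain ⟨h1, h2⟩ := h σ (z t) w hf.cfg.sgn δ hδ hw
  have d0 := dd_nonneg p u t
  have h3 := hf.sub_le
  have h4 := hf.subx_le
  rw [mul_pow, sq_sqrt d0] at h3 h4
  have lr : ∀ y, L2c (rr p K σ y) := fun y => l2c_rr hp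
  have lrx : ∀ y, L2c (rrx p K σ y) := fun y => l2c_rrx hp
  have l1 := ((S.tux.l2 ht0).sub (lrx (z t))).integral_add_sq_le ((lrx (z t)).sub (lrx w))
  have l2 := ((S.tu.l2 ht0).sub (lr (z t))).integral_add_sq_le ((lr (z t)).sub (lr w))
  simp only [sub_add_sub_cancel] at l1 l2
  have h5 : ∫ x, ut u t x ^ 2 ≤ dd p u t := by
    have h6 := integral_sq_nonneg (ww p u t)
    have h7 := integral_sq_nonneg (wwx p u t)
    rw [dd]; linarith
  have h8 : 0 ≤ C ^ 2 * δ ^ 2 := by positivity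
  have h9 : 0 ≤ A * dd p u t := by positivity
  rw [er]
  linarith [sq_nonneg δ]

lemma exists_le_mul_of_eventually {f g : ℝ → ℝ} (hg : ∀ t, 0 < t → 0 < g t)
    (hga : AntitoneOn g (Set.Ioi 0)) (hf : ∀ T, ∃ B, ∀ t, 0 < t → t ≤ T → f t ≤ B)
    (h : ∃ A, ∀ᶠ t in atTop, f t ≤ A * g t) : ∃ C > 0, ∀ t, 0 < t → f t ≤ C * g t := by
  obtain ⟨A, h⟩ := h
  obtain ⟨T, hT⟩ := eventually_atTop.1 (h.and (eventually_gt_atTop 0))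
  have hT0 := (hT T le_rfl).2
  obtain ⟨B, hB⟩ := hf T
  have hgT := hg T hT0
  refine ⟨|A| + |B| / g T + 1, by positivity, fun t ht => ?_⟩
  have hgt := hg t ht
  rcases le_total t T with h1 | h1
  · calc f t ≤ |B| := (hB t ht h1).trans (le_abs_self _)
      _ = |B| / g T * g T := by field_simp
      _ ≤ _ := mul_le_mul (by linarith [abs_nonneg A]) (hga ht hT0 h1) hgT.le (by positivity)
  · refine ((hT t h1).1).trans ?_
    gcongr
    have : 0 ≤ |B| / g T := by positivity
    linarith [le_abs_self A]

lemma Track.exists_er_le_exp (S : Sol p α u) (hp : 2 < p) (W : Track p u T M C c K σ z z' H)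
    (hK : K ≤ 1) : ∃ l, ∃ A, ∃ γ > 0, ∀ᶠ t in atTop,
      er p u K σ (fun _ => l) t ≤ A * exp (-γ * t) := by
  obtain ⟨B, hB, γ, hγ, h⟩ := W.exists_dd_le_exp S hp hK
  have hC := W.C_pos
  set D := C * √B with hD
  have hz : ∃ l, ∀ t, T + 2 ≤ t → ∀ k < K,
      |z t k - l| ≤ 2 * D / γ * exp (-(γ / 2) * t) := by
    obtain rfl | rfl : K = 0 ∨ K = 1 := by omega
    · exact ⟨0, fun _ _ _ hk => absurd hk (by omega)⟩
    obtain ⟨l, hl⟩ := exists_limit (f := fun t => z t 0) (T := T + 2)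
      (g := fun t => 2 * D / γ * exp (-(γ / 2) * t))
      (fun t ht => W.deriv t (by linarith) 0 one_pos)
      (fun t _ => (((hasDerivAt_id t).const_mul (-(γ / 2))).exp).const_mul (2 * D / γ))
      (fun t _ => by positivity) fun t ht => by
        refine (W.deriv_le t (by linarith) 0 one_pos).trans ?_
        have e : √(dd p u t) ≤ √B * exp (-(γ / 2) * t) := by
          refine (sqrt_le_sqrt (h t ht)).trans_eq ?_
          rw [sqrt_mul hB.le, sqrt_eq_rpow (exp _), ← exp_mul]
          ring_nf
        refine (mul_le_mul_of_nonneg_left e hC.le).trans_eq ?_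
        simp only [id]
        rw [hD]
        field_simp
    exact ⟨l, fun t ht k hk => by obtain rfl : k = 0 := by omega
                                  exact hl t ht⟩
  obtain ⟨l, hl⟩ := hz
  obtain ⟨A, hA, hA'⟩ := W.exists_er_le S hp
  refine ⟨l, A * (B + (2 * D / γ) ^ 2), γ, hγ, ?_⟩
  have hlim : Tendsto (fun t : ℝ => 2 * D / γ * exp (-(γ / 2) * t)) atTop (𝓝 0) := by
    have := (tendsto_exp_atBot.comp (tendsto_id.const_mul_atTop_of_neg
      (show -(γ / 2) < 0 by linarith))).const_mul (2 * D / γ)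
    simpa using this
  filter_upwards [eventually_ge_atTop (T + 2), hlim.eventually_le_const one_pos] with t ht h1
  refine (hA' t (by linarith) _ _ h1 (hl t ht)).trans ?_
  rw [mul_assoc, add_mul]
  gcongr
  · exact h t ht
  · rw [mul_pow, sq (exp _), ← exp_add]
    ring_nf
    rfl

end

section

variable {p α : ℝ} {u : ℝ × ℝ → ℝ} {K : ℕ} {σ : ℕ → ℝ}

lemma tendsto_integral_sq (hp : 2 < p) {w : ℝ → ℕ → ℝ} {q : ℝ → ℝ} {a : ℝ → ℝ → ℝ}
    (hc : ∀ᶠ t in atTop, Cfg K σ (w t) (q t)) (hq : Tendsto q atTop (𝓝 0))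
    (ha : ∀ᶠ t in atTop, L2c (a t))
    (h : Tendsto (fun t => ∫ x, (a t x - rr p K σ (w t) x) ^ 2) atTop (𝓝 0)) :
    Tendsto (fun t => ∫ x, a t x ^ 2) atTop (𝓝 (K * ∫ x, Q p x ^ 2)) := by
  obtain ⟨N, hN, hN'⟩ := exists_integral_mul_sub_le hp K (f := Q p) one_pos (continuous_Q hp)
    fun x => by rw [one_mul, abs_of_pos (Q_pos hp x)]
  have key : ∀ b : ℝ → ℝ → ℝ, (∀ᶠ t in atTop, L2c (b t)) →
      Tendsto (fun t => ∫ x, (b t x - rr p K σ (w t) x) ^ 2) atTop (𝓝 0) →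
      Tendsto (fun t => ∫ x, b t x * rr p K σ (w t) x) atTop (𝓝 (K * ∫ x, Q p x ^ 2)) := by
    intro b hb hb'
    have h1 : ∀ k ∈ range K, Tendsto (fun t => σ k * ∫ x, b t x * Q p (x - w t k)) atTop
        (𝓝 (∫ x, Q p x ^ 2)) := fun k hk => by
      obtain ⟨t₀, ht₀⟩ := hc.exists
      have hs : σ k * (σ k * ∫ x, Q p x * Q p x) = ∫ x, Q p x ^ 2 := by
        rw [← mul_assoc, ← sq, ← sq_abs, ht₀.sgn k (mem_range.1 hk), one_pow, one_mul]
        simp only [sq]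
      rw [← hs]
      refine Tendsto.const_mul _ (tendsto_iff_norm_sub_tendsto_zero.2 ?_)
      have h2 : Tendsto (fun t => N * (q t ^ (1 / 4 : ℝ)
          + √(∫ x, (b t x - rr p K σ (w t) x) ^ 2))) atTop (𝓝 0) := by
        have := ((hq.rpow_const (p := 1 / 4) (Or.inr (by norm_num))).add hb'.sqrt).const_mul N
        simpa using this
      refine squeeze_zero' (Eventually.of_forall fun t => norm_nonneg _) ?_ h2
      filter_upwards [hc, hb] with t h3 h4
      exact hN' σ (w t) (q t) h3 (b t) h4 k (mem_range.1 hk)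
    have h5 := tendsto_finsetSum _ h1
    rw [sum_const, card_range, nsmul_eq_mul] at h5
    refine h5.congr' ?_
    filter_upwards [hb] with t h6
    simp only [rr, mul_sum]
    rw [integral_finsetSum]
    · refine sum_congr rfl fun k _ => ?_
      rw [← integral_const_mul]
      congr 1; ext x; ring
    · exact fun k _ => h6.mul_int (((l2c_Q hp).comp_sub (w t k)).const_mul (σ k))
  have lr : ∀ t, L2c (rr p K σ (w t)) := fun t => l2c_rr hp
  have h1 := (h.add ((key a ha h).const_mul 2)).sub (key (fun t => rr p K σ (w t))
    (Eventually.of_forall lr) (by simp))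
  rw [show 0 + 2 * (K * ∫ x, Q p x ^ 2) - K * ∫ x, Q p x ^ 2 = K * ∫ x, Q p x ^ 2 by ring] at h1
  refine h1.congr' ?_
  filter_upwards [ha] with t h2
  rw [← integral_const_mul, ← integral_add (h2.sub (lr t)).int ((h2.mul_int (lr t)).const_mul 2),
    ← integral_sub _ ((lr t).mul_int (lr t))]
  · congr 1; ext x; ring
  · exact (h2.sub (lr t)).int.add ((h2.mul_int (lr t)).const_mul 2)

lemma Sol.tendsto_mass (S : Sol p α u) (hp : 2 < p) {w : ℝ → ℕ → ℝ} {q g : ℝ → ℝ}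
    (hc : ∀ᶠ t in atTop, Cfg K σ (w t) (q t)) (hq : Tendsto q atTop (𝓝 0))
    (hg : Tendsto g atTop (𝓝 0)) (h : ∀ t, 0 < t → er p u K σ (w t) t ≤ g t) :
    Tendsto (fun t => ∫ x, U u t x ^ 2) atTop (𝓝 (K * ∫ x, Q p x ^ 2)) := by
  refine tendsto_integral_sq hp hc hq ?_ ?_
  · filter_upwards [eventually_gt_atTop 0] with t ht using S.tu.l2 ht
  refine squeeze_zero' (Eventually.of_forall fun t => integral_sq_nonneg _) ?_ hg
  filter_upwards [eventually_gt_atTop 0] with t ht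
  have := h t ht
  have h1 := integral_sq_nonneg fun x => ux u t x - rrx p K σ (w t) x
  have h2 := integral_sq_nonneg (ut u t)
  rw [er] at this
  linarith

lemma tendsto_mul_exp_neg {γ : ℝ} (hγ : 0 < γ) (C : ℝ) :
    Tendsto (fun t => C * exp (-γ * t)) atTop (𝓝 0) := by
  simpa using (tendsto_exp_atBot.comp (tendsto_id.const_mul_atTop_of_neg
    (neg_lt_zero.2 hγ))).const_mul C

lemma Sol.tendsto_mass_of_vanishing (S : Sol p α u) (hp : 2 < p) (h : Vanishing u) :
    Tendsto (fun t => ∫ x, U u t x ^ 2) atTop (𝓝 ((0 : ℕ) * ∫ x, Q p x ^ 2)) := by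
  obtain ⟨C, _, γ, hγ, h⟩ := h
  refine S.tendsto_mass (σ := 0) (w := 0) (q := 0) hp (Eventually.of_forall fun t =>
    ⟨fun k hk => absurd hk (by omega), fun k hk => absurd hk (by omega), le_rfl, zero_le_one⟩)
    tendsto_const_nhds (tendsto_mul_exp_neg hγ C) fun t ht => ?_
  rw [← S.er_eq' hp ht]
  simpa [rr, ux] using h t ht.le

lemma Sol.tendsto_mass_of_singleSoliton (S : Sol p α u) (hp : 2 < p) (h : SingleSoliton p u) :
    Tendsto (fun t => ∫ x, U u t x ^ 2) atTop (𝓝 ((1 : ℕ) * ∫ x, Q p x ^ 2)) := by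
  obtain ⟨σ, hσ, l, C, _, γ, hγ, h⟩ := h
  refine S.tendsto_mass (σ := fun _ => σ) (w := fun _ _ => l) (q := 0) hp
    (Eventually.of_forall fun t => ⟨fun k _ => by rcases hσ with rfl | rfl <;> simp,
      fun j hj k hk hjk => (hjk (by omega)).elim, le_rfl, zero_le_one⟩)
    tendsto_const_nhds (tendsto_mul_exp_neg hγ C) fun t ht => ?_
  rw [← S.er_eq' hp ht]
  simpa [rr] using h t ht.le

lemma Sol.tendsto_mass_of_multiSoliton (S : Sol p α u) (hp : 2 < p) (h : MultiSoliton p α u) :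
    ∃ K : ℕ, 2 ≤ K ∧ Tendsto (fun t => ∫ x, U u t x ^ 2) atTop (𝓝 (K * ∫ x, Q p x ^ 2)) := by
  obtain ⟨K, hK, σ, hσ, l, z, C, _, h, τ, _, _, hz⟩ := h
  have hm : 1 < min (p - 1) (5 / 4) := lt_min (by linarith) (by norm_num)
  obtain ⟨θ, hθ, hθ'⟩ := exists_between hm
  obtain ⟨D, hD⟩ := hz θ hθ hθ'
  set R := 2 * |D| + 2 * ∑ k, |τ k| with hR
  have hlim : Tendsto (fun t : ℝ => exp R / t) atTop (𝓝 0) :=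
    tendsto_const_nhds.div_atTop tendsto_id
  refine ⟨K, hK, S.tendsto_mass (σ := fun k => σ * (-1) ^ (k + 1)) (w := fun t k => z k t)
    (q := fun t => exp R / t) (g := fun t => C ^ 2 / t ^ 2) hp ?_ hlim ?_ fun t ht => ?_⟩
  · filter_upwards [eventually_ge_atTop 1, hlim.eventually_le_const one_pos] with t ht h1
    have ht0 : 0 < t := by linarith
    refine ⟨fun k _ => by rcases hσ with rfl | rfl <;> simp [abs_pow], ?_, by positivity, h1⟩
    have hb : ∀ k < K, |z k t - ((k : ℝ) + 1 - ((K : ℝ) + 1) / 2) * log t - l|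
        ≤ |D| + ∑ k, |τ k| := fun k hk => by
      have h2 := hD k hk t ht
      have h3 : D * t ^ (-θ + 1) ≤ |D| := (mul_le_mul_of_nonneg_right (le_abs_self D)
        (by positivity)).trans (mul_le_of_le_one_right (abs_nonneg D)
          (rpow_le_one_of_one_le_of_nonpos ht (by linarith)))
      have h4 := single_le_sum (fun i _ => abs_nonneg (τ i)) (mem_univ (⟨k, hk⟩ : Fin K))
      have h5 := abs_add_le (z k t - ((k : ℝ) + 1 - ((K : ℝ) + 1) / 2) * log t
        - τ ⟨k, hk⟩ - l) (τ ⟨k, hk⟩)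
      rw [show z k t - ((k : ℝ) + 1 - ((K : ℝ) + 1) / 2) * log t - τ ⟨k, hk⟩ - l
        + τ ⟨k, hk⟩ = z k t - ((k : ℝ) + 1 - ((K : ℝ) + 1) / 2) * log t - l by ring] at h5
      linarith
    intro j hj k hk hjk
    have h2 : 1 ≤ |(j : ℝ) - k| := by
      exact_mod_cast Int.one_le_abs (sub_ne_zero.2 (Nat.cast_injective.ne hjk : (j : ℤ) ≠ k))
    have h3 := log_nonneg ht
    have h4 : |((j : ℝ) - k) * log t| ≤ |z j t - z k t| + R := by
      have := abs_sub (z j t - z k t) ((z j t - ((j : ℝ) + 1 - ((K : ℝ) + 1) / 2) * log t - l)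
        - (z k t - ((k : ℝ) + 1 - ((K : ℝ) + 1) / 2) * log t - l))
      rw [show z j t - z k t - ((z j t - ((j : ℝ) + 1 - ((K : ℝ) + 1) / 2) * log t - l)
        - (z k t - ((k : ℝ) + 1 - ((K : ℝ) + 1) / 2) * log t - l))
        = ((j : ℝ) - k) * log t by ring] at this
      linarith [abs_sub (z j t - ((j : ℝ) + 1 - ((K : ℝ) + 1) / 2) * log t - l)
        (z k t - ((k : ℝ) + 1 - ((K : ℝ) + 1) / 2) * log t - l), hb j hj, hb k hk]
    rw [abs_mul, abs_of_nonneg h3] at h4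
    rw [le_div_iff₀ ht0, ← exp_log ht0, ← exp_add, exp_log ht0, exp_le_exp]
    linarith [le_mul_of_one_le_left h3 h2]
  · exact tendsto_const_nhds.div_atTop (tendsto_pow_atTop two_ne_zero)
  · rw [← S.er_eq hp ht]
    simpa only [rr, mul_sum, mul_assoc] using h t ht

lemma natCast_mul_integral_Q_inj (hp : 2 < p) {m n : ℕ} {f : ℝ → ℝ}
    (hm : Tendsto f atTop (𝓝 (m * ∫ x, Q p x ^ 2)))
    (hn : Tendsto f atTop (𝓝 (n * ∫ x, Q p x ^ 2))) : m = n := by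
  have h : 0 < ∫ x, Q p x ^ 2 := by
    refine integral_pos_of_integrable_nonneg_nonzero (x := 0) ((continuous_Q hp).pow 2)
      (l2c_Q hp).int (fun x => sq_nonneg _) (pow_pos (Q_pos hp 0) 2).ne'
  exact_mod_cast mul_right_cancel₀ h.ne' (tendsto_nhds_unique hm hn)

end

section

variable {p α T M C c : ℝ} {u : ℝ × ℝ → ℝ} {K : ℕ} {σ : ℕ → ℝ} {z z' : ℝ → ℕ → ℝ} {H : ℝ → ℝ}

lemma Sol.exists_er_bound (S : Sol p α u) (hp : 2 < p) (hσ : ∀ k < K, |σ k| = 1)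
    (hN : ∀ T, ∃ B, ∀ t, 0 < t → t ≤ T → nrm u t ≤ B) (T : ℝ) :
    ∃ B, ∀ t, 0 < t → t ≤ T → ∀ w, er p u K σ w t ≤ B := by
  obtain ⟨D, hD⟩ := S.exists_er_le hp hσ
  obtain ⟨B, hB⟩ := hN T
  exact ⟨2 * B + D, fun t ht hT w => (hD t ht w).trans (by linarith [hB t ht hT])⟩

lemma Track.exists_le_exp (S : Sol p α u) (hp : 2 < p) (W : Track p u T M C c K σ z z' H)
    (hN : ∀ T, ∃ B, ∀ t, 0 < t → t ≤ T → nrm u t ≤ B) (hK : K ≤ 1) :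
    ∃ l, ∀ F : ℝ → ℝ, (∀ t, 0 < t → F t = er p u K σ (fun _ => l) t) →
      ∃ C > 0, ∃ γ > 0, ∀ t ≥ 0, F t ≤ C * exp (-γ * t) := by
  obtain ⟨l, A, γ, hγ, h⟩ := W.exists_er_le_exp S hp hK
  obtain ⟨C, hC, h⟩ := exists_le_mul_of_eventually (g := fun t => exp (-γ * t))
    (fun t _ => exp_pos _)
    (fun s _ t _ hst => exp_le_exp.2 (mul_le_mul_of_nonpos_left hst (by linarith)))
    (fun T' => by
      obtain ⟨B, hB⟩ := S.exists_er_bound hp (W.fit T le_rfl).cfg.sgn hN T'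
      exact ⟨B, fun t ht hT => hB t ht hT _⟩) ⟨A, h⟩
  refine ⟨l, fun F hF => ⟨C + |F 0|, by positivity, γ, hγ, fun t ht => ?_⟩⟩
  rcases ht.eq_or_lt with rfl | ht
  · simpa using (le_abs_self (F 0)).trans (le_add_of_nonneg_left hC.le)
  · rw [hF t ht]
    refine (h t ht).trans ?_
    gcongr
    linarith [abs_nonneg (F 0)]

lemma Track.multiSoliton (S : Sol p α u) (hp : 2 < p) (hα : 0 < α)
    (W : Track p u T M C c K σ z z' H)
    (hN : ∀ T, ∃ B, ∀ t, 0 < t → t ≤ T → nrm u t ≤ B) (hK : 2 ≤ K) : MultiSoliton p α u := by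
  obtain ⟨halt, L, hL, N, hN0, l, A, hA, h⟩ := W.exists_asymp S hp hα hK
  have hsgn := (W.fit T le_rfl).cfg.sgn
  have hσ0 : σ 0 = 1 ∨ σ 0 = -1 := eq_or_eq_neg_of_abs_eq (hsgn 0 (by omega))
  have hs : ∀ k < K, -σ 0 * (-1) ^ (k + 1) = σ k := fun k hk => by
    induction k with
    | zero => ring
    | succ k ih =>
      have h1 := halt k hk
      have h2 : σ k ^ 2 = 1 := by rw [← sq_abs, hsgn k (by omega), one_pow]
      rw [pow_succ, ← mul_assoc, ih (by omega)]
      linear_combination σ (k + 1) * h2 - σ k * h1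
  have hK0 : (K : ℝ) ≠ 0 := by exact_mod_cast (by omega : K ≠ 0)
  set m := (∑ k ∈ range K, ∑ j ∈ range k, L j) / K with hm
  set τ : ℕ → ℝ := fun k => ∑ j ∈ range k, L j - m with hτ
  obtain ⟨T₂, hT₂⟩ := eventually_atTop.1 (h.and (eventually_ge_atTop T))
  set w : ℕ → ℝ → ℝ := fun k t => if t < T₂ then
    ((k : ℝ) + 1 - ((K : ℝ) + 1) / 2) * log t + τ k + (l + m) else z t k with hw
  obtain ⟨A', hA', her⟩ := W.exists_er_le S hp
  obtain ⟨C₀, hC₀, hC⟩ := exists_le_mul_of_eventually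
    (f := fun t => er p u K σ (fun k => w k t) t) (g := fun t => 1 / t ^ 2)
    (fun t ht => by positivity)
    (fun s (hs : 0 < s) t _ hst => by simp only; gcongr)
    (fun T' => by
      obtain ⟨B, hB⟩ := S.exists_er_bound hp hsgn hN T'
      exact ⟨B, fun t ht hT => hB t ht hT _⟩)
    ⟨A' * N, by
      filter_upwards [eventually_ge_atTop T₂] with t ht
      obtain ⟨⟨h1, -⟩, h2⟩ := hT₂ t ht
      simp only [hw, not_lt.2 ht, if_false]
      refine (her t h2 (z t) 0 zero_le_one fun k _ => by simp).trans ?_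
      rw [mul_assoc, mul_one_div]
      gcongr
      simpa using h1⟩
  refine ⟨K, hK, -σ 0, by rcases hσ0 with h | h <;> simp [h], l + m, w, √C₀,
    sqrt_pos.2 hC₀, fun t ht => ?_, fun k => τ k, ?_, fun j hj => ?_, fun θ _ hθ =>
      ⟨A, fun k hk t ht => ?_⟩⟩
  · have e : ∀ x, -σ 0 * ∑ k ∈ range K, (-1) ^ (k + 1) * Q p (x - w k t)
        = rr p K σ (fun k => w k t) x := fun x => by
      rw [rr, mul_sum]
      exact sum_congr rfl fun k hk => by rw [← mul_assoc, hs k (mem_range.1 hk)]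
    simp only [e]
    rw [S.er_eq hp ht, sq_sqrt hC₀.le]
    exact (hC t ht).trans_eq (mul_one_div _ _)
  · rw [Fin.sum_univ_eq_sum_range, hτ, sum_sub_distrib, sum_const,
      card_range, nsmul_eq_mul, hm, mul_div_cancel₀ _ hK0, sub_self]
  · rw [← hL j hj]
    simp only [hτ, sum_range_succ]
    congr 1; ring
  · have h1 : A * t ^ (-(1 / 4) : ℝ) ≤ A * t ^ (-θ + 1) := by
      have := lt_min_iff.1 hθ
      gcongr
      linarith
    refine le_trans ?_ h1
    rcases lt_or_ge t T₂ with h2 | h2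
    · simp only [hw, h2, if_true]
      rw [show ((k : ℝ) + 1 - ((K : ℝ) + 1) / 2) * log t + τ k + (l + m)
        - ((k : ℝ) + 1 - ((K : ℝ) + 1) / 2) * log t - τ k - (l + m) = 0 by ring, abs_zero]
      positivity
    · simp only [hw, not_lt.2 h2, if_false]
      refine le_of_eq_of_le ?_ ((hT₂ t h2).1.2 k hk)
      congr 1
      simp only [hτ]
      ring

lemma Sol.trichotomy (S : Sol p α u) (hp : 2 < p) (hα : 0 < α)
    (hN : ∀ T, ∃ B, ∀ t, 0 < t → t ≤ T → nrm u t ≤ B) :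
    Vanishing u ∨ SingleSoliton p u ∨ MultiSoliton p α u := by
  obtain ⟨T, M, C, c, K, σ, z, z', H, W⟩ := S.exists_track hp hα
  obtain hK | hK : K ≤ 1 ∨ 2 ≤ K := by omega
  · obtain ⟨l, h⟩ := W.exists_le_exp S hp hN hK
    obtain rfl | rfl : K = 0 ∨ K = 1 := by omega
    · exact Or.inl (h _ fun t ht => by rw [← S.er_eq' hp ht]; simp [rr, ux])
    · refine Or.inr (Or.inl ⟨σ 0, eq_or_eq_neg_of_abs_eq ((W.fit T le_rfl).cfg.sgn 0 one_pos), l,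
        h _ fun t ht => by rw [← S.er_eq' hp ht]; simp [rr]⟩)
  · exact Or.inr (Or.inr (W.multiSoliton S hp hα hN hK))

end

end NLKG

theorem soliton_resolution_damped_NLKG (p α : ℝ) (hp : 2 < p) (hα : 0 < α) (u : ℝ × ℝ → ℝ)
    (hreg : ContDiffOn ℝ 2 u (Set.Ici (0 : ℝ) ×ˢ Set.univ))
    (hpde : ∀ t ≥ (0 : ℝ), ∀ x : ℝ, utt u t x + 2 * α * ut u t x - uxx u t x + u (t, x)
        - |u (t, x)| ^ (p - 1) * u (t, x) = 0)
    (hint : ∀ t ≥ (0 : ℝ), Integrable (fun x : ℝ => u (t, x) ^ 2) ∧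
      Integrable (fun x : ℝ => ut u t x ^ 2) ∧
      Integrable (fun x : ℝ => ux u t x ^ 2) ∧
      Integrable (fun x : ℝ => utt u t x ^ 2) ∧
      Integrable (fun x : ℝ => utx u t x ^ 2) ∧
      Integrable (fun x : ℝ => uxx u t x ^ 2))
    (hbdd : ∀ T ≥ (0 : ℝ), ∃ B : ℝ, ∀ t : ℝ, 0 ≤ t → t ≤ T → (∫ x : ℝ, u (t, x) ^ 2) ≤ B ∧
      (∫ x : ℝ, ut u t x ^ 2) ≤ B ∧
      (∫ x : ℝ, ux u t x ^ 2) ≤ B ∧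
      (∫ x : ℝ, utt u t x ^ 2) ≤ B ∧
      (∫ x : ℝ, utx u t x ^ 2) ≤ B ∧
      (∫ x : ℝ, uxx u t x ^ 2) ≤ B)
    (hdecay : ∀ t ≥ (0 : ℝ), Tendsto (fun x : ℝ => u (t, x)) atTop (nhds 0) ∧
      Tendsto (fun x : ℝ => u (t, x)) atBot (nhds 0) ∧
      Tendsto (fun x : ℝ => ut u t x) atTop (nhds 0) ∧
      Tendsto (fun x : ℝ => ut u t x) atBot (nhds 0) ∧
      Tendsto (fun x : ℝ => ux u t x) atTop (nhds 0) ∧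
      Tendsto (fun x : ℝ => ux u t x) atBot (nhds 0)) :
    (Vanishing u ∨ SingleSoliton p u ∨ MultiSoliton p α u) ∧
    ¬(Vanishing u ∧ SingleSoliton p u) ∧
    ¬(Vanishing u ∧ MultiSoliton p α u) ∧
    ¬(SingleSoliton p u ∧ MultiSoliton p α u) := by
  have S := NLKG.sol_of_regular hreg hpde hint hbdd
  have hN : ∀ T, ∃ B, ∀ t, 0 < t → t ≤ T → NLKG.nrm u t ≤ B := fun T => by
    obtain ⟨B, hB⟩ := hbdd (max T 0) (le_max_right _ _)
    refine ⟨B + B + B, fun t ht hT => ?_⟩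
    obtain ⟨h1, h2, h3, -⟩ := hB t ht.le (hT.trans (le_max_left _ _))
    exact add_le_add (add_le_add h2 h3) h1
  refine ⟨S.trichotomy hp hα hN, fun ⟨h1, h2⟩ => ?_, fun ⟨h1, h2⟩ => ?_, fun ⟨h1, h2⟩ => ?_⟩
  · exact absurd (NLKG.natCast_mul_integral_Q_inj hp (S.tendsto_mass_of_vanishing hp h1)
      (S.tendsto_mass_of_singleSoliton hp h2)) zero_ne_one
  · obtain ⟨K, hK, h⟩ := S.tendsto_mass_of_multiSoliton hp h2
    have := NLKG.natCast_mul_integral_Q_inj hp (S.tendsto_mass_of_vanishing hp h1) h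
    omega
  · obtain ⟨K, hK, h⟩ := S.tendsto_mass_of_multiSoliton hp h2
    have := NLKG.natCast_mul_integral_Q_inj hp (S.tendsto_mass_of_singleSoliton hp h1) h
    omega
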